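/- Let q = p^r with p prime and r ≥ 1, and let t be an integer with t² ≤ 4q. Then there exists an elliptic curve E over 𝔽_q with exactly q + 1 + t rational points (counting the point at infinity) if and only if t satisfies at least one of the following conditions: (i) gcd(p, t) = 1; (ii) r is even and t² = 4q; (iii) r is even, p ≢ 1 (mod 3), and t² = q; (iv) r is odd, p = 2 or p = 3, and t² = pq; (v) r is odd and t = 0; (vi) r is even, p ≢ 1 (mod 4), and t = 0. -/

import Mathlib

set_option linter.unusedSectionVars false

section

open Polynomial

namespace WeierstrassCurve.Affine.Point

variable {K : Type*} [Field K] [DecidableEq K] {W : WeierstrassCurve.Affine K}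

/-- The `x`-coordinate of a point, with value `0` at infinity. -/
def xc {K : Type*} [Field K] {W : WeierstrassCurve.Affine K} : W.Point → K
  | zero => 0
  | some x _ _ => x

/-- The `y`-coordinate of a point, with value `0` at infinity. -/
def yc {K : Type*} [Field K] {W : WeierstrassCurve.Affine K} : W.Point → K
  | zero => 0
  | some _ y _ => y

@[simp] lemma xc_some {x y : K} (h : W.Nonsingular x y) : xc (some x y h) = x := rfl

@[simp] lemma yc_some {x y : K} (h : W.Nonsingular x y) : yc (some x y h) = y := rfl

@[simp] lemma xc_zero : xc (0 : W.Point) = 0 := rfl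

lemma exists_eq_some {P : W.Point} (hP : P ≠ 0) : ∃ x y h, P = some x y h := by
  cases P with
  | zero => exact absurd rfl hP
  | some x y h => exact ⟨x, y, h, rfl⟩

lemma nonsingular_coords {P : W.Point} (hP : P ≠ 0) : W.Nonsingular (xc P) (yc P) := by
  obtain ⟨x, y, h, rfl⟩ := exists_eq_some hP
  exact h

lemma equation_coords {P : W.Point} (hP : P ≠ 0) :
    yc P ^ 2 + W.a₁ * xc P * yc P + W.a₃ * yc P =
      xc P ^ 3 + W.a₂ * xc P ^ 2 + W.a₄ * xc P + W.a₆ :=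
  (W.equation_iff _ _).1 (nonsingular_coords hP).1

lemma ext_coords {P Q : W.Point} (hP : P ≠ 0) (hQ : Q ≠ 0) (hx : xc P = xc Q)
    (hy : yc P = yc Q) : P = Q := by
  obtain ⟨x, y, h, rfl⟩ := exists_eq_some hP
  obtain ⟨x', y', h', rfl⟩ := exists_eq_some hQ
  simp only [xc_some, yc_some] at hx hy
  subst hx hy
  rfl

@[simp] lemma xc_neg (P : W.Point) : xc (-P) = xc P := by
  cases P <;> rfl

lemma yc_neg {P : W.Point} (hP : P ≠ 0) : yc (-P) = -yc P - W.a₁ * xc P - W.a₃ := by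
  obtain ⟨x, y, h, rfl⟩ := exists_eq_some hP
  rfl

lemma eq_or_eq_neg_of_xc_eq {P Q : W.Point} (hP : P ≠ 0) (hQ : Q ≠ 0) (hx : xc P = xc Q) :
    P = Q ∨ P = -Q := by
  obtain ⟨x, y, h, rfl⟩ := exists_eq_some hP
  obtain ⟨x', y', h', rfl⟩ := exists_eq_some hQ
  exact X_eq_iff.1 hx

lemma add_coords {P Q : W.Point} (hP : P ≠ 0) (hQ : Q ≠ 0) (hx : xc P ≠ xc Q) :
    P + Q ≠ 0 ∧
    xc (P + Q) = ((yc P - yc Q) / (xc P - xc Q)) ^ 2 + W.a₁ * ((yc P - yc Q) / (xc P - xc Q))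
      - W.a₂ - xc P - xc Q ∧
    yc (P + Q) = -((yc P - yc Q) / (xc P - xc Q) * (xc (P + Q) - xc P) + yc P)
      - W.a₁ * xc (P + Q) - W.a₃ := by
  obtain ⟨x, y, h, rfl⟩ := exists_eq_some hP
  obtain ⟨x', y', h', rfl⟩ := exists_eq_some hQ
  replace hx : x ≠ x' := hx
  rw [add_of_X_ne hx]
  refine ⟨some_ne_zero _, ?_, ?_⟩
  · simp [addX, slope_of_X_ne hx]
  · simp [addY, negAddY, negY, slope_of_X_ne hx]

lemma add_ne_zero_of_xc_ne {P Q : W.Point} (hP : P ≠ 0) (hQ : Q ≠ 0) (hx : xc P ≠ xc Q) :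
    P + Q ≠ 0 := (add_coords hP hQ hx).1

lemma sub_ne_zero_of_xc_ne {P Q : W.Point} (hP : P ≠ 0) (hQ : Q ≠ 0) (hx : xc P ≠ xc Q) :
    P - Q ≠ 0 := by
  rw [sub_eq_add_neg]
  exact add_ne_zero_of_xc_ne hP (neg_ne_zero.2 hQ) (by simpa using hx)

lemma xc_add_mul {P Q : W.Point} (hP : P ≠ 0) (hQ : Q ≠ 0) (hx : xc P ≠ xc Q) :
    xc (P + Q) * (xc P - xc Q) ^ 2 = (yc P - yc Q) ^ 2 +
      W.a₁ * (yc P - yc Q) * (xc P - xc Q) - (W.a₂ + xc P + xc Q) * (xc P - xc Q) ^ 2 := by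
  have h0 : xc P - xc Q ≠ 0 := sub_ne_zero.2 hx
  rw [(add_coords hP hQ hx).2.1]
  field_simp
  ring

lemma xc_sub_mul {P Q : W.Point} (hP : P ≠ 0) (hQ : Q ≠ 0) (hx : xc P ≠ xc Q) :
    xc (P - Q) * (xc P - xc Q) ^ 2 = (yc P + yc Q + W.a₁ * xc Q + W.a₃) ^ 2 +
      W.a₁ * (yc P + yc Q + W.a₁ * xc Q + W.a₃) * (xc P - xc Q)
        - (W.a₂ + xc P + xc Q) * (xc P - xc Q) ^ 2 := by
  have h := xc_add_mul hP (neg_ne_zero.2 hQ) (by simpa using hx)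
  rw [← sub_eq_add_neg, yc_neg hQ, xc_neg] at h
  rw [h]
  ring

/-- The sum `x(P + Q) + x(P - Q)` in terms of `x(P)` and `x(Q)`. -/
lemma xc_add_add_xc_sub {P Q : W.Point} (hP : P ≠ 0) (hQ : Q ≠ 0) (hx : xc P ≠ xc Q) :
    (xc (P + Q) + xc (P - Q)) * (xc P - xc Q) ^ 2 =
      2 * (xc P + xc Q) * (xc P * xc Q) + W.b₂ * (xc P * xc Q) + W.b₄ * (xc P + xc Q) + W.b₆ := by
  rw [add_mul, xc_add_mul hP hQ hx, xc_sub_mul hP hQ hx]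
  have e1 := equation_coords hP
  have e2 := equation_coords hQ
  simp only [b₂, b₄, b₆]
  linear_combination 2 * e1 + 2 * e2

/-- The product `x(P + Q) x(P - Q)` in terms of `x(P)` and `x(Q)`. -/
lemma xc_add_mul_xc_sub {P Q : W.Point} (hP : P ≠ 0) (hQ : Q ≠ 0) (hx : xc P ≠ xc Q) :
    (xc (P + Q) * xc (P - Q)) * (xc P - xc Q) ^ 2 =
      (xc P * xc Q) ^ 2 - W.b₄ * (xc P * xc Q) - W.b₆ * (xc P + xc Q) - W.b₈ := by
  have h0 : (xc P - xc Q) ^ 2 ≠ 0 := pow_ne_zero _ (sub_ne_zero.2 hx)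
  have h1 := xc_add_mul hP hQ hx
  have h2 := xc_sub_mul hP hQ hx
  have e1 := equation_coords hP
  have e2 := equation_coords hQ
  apply mul_right_cancel₀ h0
  have : xc (P + Q) * xc (P - Q) * (xc P - xc Q) ^ 2 * (xc P - xc Q) ^ 2 =
    (xc (P + Q) * (xc P - xc Q) ^ 2) * (xc (P - Q) * (xc P - xc Q) ^ 2) := by ring
  rw [this, h1, h2]
  simp only [b₄, b₆, b₈]
  generalize xc P = x at *
  generalize xc Q = X at *
  generalize yc P = y at *
  generalize yc Q = Y at *
  linear_combination (y^2 + W.a₃ * y + (-2) * Y^2 + (-2) * W.a₁ * X * Y + (-2) * W.a₃ * Y + (-1) * W.a₁ * W.a₃ * X + W.a₁ * x * y + W.a₁^2 * X * x + W.a₁ * W.a₃ * x + (-1) * W.a₂ * x^2 + 4 * W.a₂ * X * x + (-2) * W.a₂ * X^2 + (-1) * x^3 + 2 * X * x^2 + 2 * X^2 * x + (-2) * X^3 + (-1) * W.a₁^2 * X^2 + W.a₄ * x + W.a₆) * e1 + (Y^2 + W.a₁ * X * Y + W.a₃ * Y + W.a₁ * W.a₃ * X + W.a₁^2 * X * x +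 (-1) * W.a₁ * W.a₃ * x + (-4) * W.a₂ * x^2 + 4 * W.a₂ * X * x + (-1) * W.a₂ * X^2 + (-4) * x^3 + 2 * X * x^2 + 2 * X^2 * x + (-1) * X^3 + (-1) * W.a₁^2 * x^2 + (-2) * W.a₄ * x + (-1) * W.a₆ + W.a₄ * X) * e2

/-- The square of `2 y + a₁ x + a₃` in terms of `x`. -/
lemma eta_sq {P : W.Point} (hP : P ≠ 0) : (2 * yc P + W.a₁ * xc P + W.a₃) ^ 2 =
    4 * xc P ^ 3 + W.b₂ * xc P ^ 2 + 2 * W.b₄ * xc P + W.b₆ := by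
  have e1 := equation_coords hP
  simp only [b₂, b₄, b₆]
  linear_combination 4 * e1

lemma two_nsmul_ne_zero_iff {P : W.Point} (hP : P ≠ 0) :
    2 • P ≠ 0 ↔ 4 * xc P ^ 3 + W.b₂ * xc P ^ 2 + 2 * W.b₄ * xc P + W.b₆ ≠ 0 := by
  rw [← eta_sq hP, not_iff_not, two_nsmul, add_eq_zero_iff_eq_neg]
  constructor
  · intro h
    have := yc_neg hP
    rw [← h] at this
    rw [show 2 * yc P + W.a₁ * xc P + W.a₃ = 0 by linear_combination this]
    simp
  · intro h
    refine ext_coords hP (neg_ne_zero.2 hP) (xc_neg P).symm ?_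
    have := pow_eq_zero_iff (two_ne_zero) |>.1 h
    rw [yc_neg hP]
    linear_combination this

lemma xc_two_nsmul {P : W.Point} (hP : P ≠ 0) (h2 : 2 • P ≠ 0) :
    xc (2 • P) * (4 * xc P ^ 3 + W.b₂ * xc P ^ 2 + 2 * W.b₄ * xc P + W.b₆) =
      xc P ^ 4 - W.b₄ * xc P ^ 2 - 2 * W.b₆ * xc P - W.b₈ := by
  have h3 := (two_nsmul_ne_zero_iff hP).1 h2
  rw [← eta_sq hP] at h3 ⊢
  obtain ⟨x, y, h, rfl⟩ := exists_eq_some hP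
  simp only [xc_some, yc_some] at *
  have hη : 2 * y + W.a₁ * x + W.a₃ ≠ 0 := fun h => h3 (by rw [h]; simp)
  have hne : y ≠ W.negY x y := by
    intro h
    apply hη
    rw [negY] at h
    linear_combination h
  have hη' : y - (-y - W.a₁ * x - W.a₃) ≠ 0 := by
    intro h
    apply hη
    linear_combination h
  rw [two_nsmul, add_self_of_Y_ne hne]
  have e1 := (W.equation_iff _ _).1 h.1
  simp only [xc_some, addX, slope_of_Y_ne rfl hne, negY]
  have key : y - (-y - W.a₁ * x - W.a₃) = 2 * y + W.a₁ * x + W.a₃ := by ring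
  have aux : ∀ l h : K, h ≠ 0 → ((l / h) ^ 2 + W.a₁ * (l / h) - W.a₂ - x - x) * h ^ 2 =
      l ^ 2 + W.a₁ * l * h - (W.a₂ + 2 * x) * h ^ 2 := by
    intro l h hh
    field_simp
    ring
  rw [key, aux _ _ hη]
  simp only [b₄, b₆, b₈]
  linear_combination ((-1) * W.a₁^2 + (-4) * W.a₂ + (-8) * x) * e1

end WeierstrassCurve.Affine.Point

end

section

open Polynomial Filter

/-- A tuple of polynomials of degree at most `d` defining a morphism of degree `d` from the
projective line: no common zeros, including at infinity. -/
structure PrimTuple {K ι : Type*} [Field K] (d : ℕ) (L : ι → K[X]) : Prop where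
  natDegree_le : ∀ i, (L i).natDegree ≤ d
  eval_ne : ∀ z, ∃ i, (L i).eval z ≠ 0
  coeff_ne : ∃ i, (L i).coeff d ≠ 0

namespace PrimTuple

variable {K ι : Type*} [Field K] [IsAlgClosed K] {d e : ℕ} {L N : ι → K[X]}

lemma span_eq_top (h : PrimTuple d L) : Ideal.span (Set.range L) = ⊤ := by
  obtain ⟨g, hg⟩ := (IsPrincipalIdealRing.principal (Ideal.span (Set.range L))).principal
  have hdvd : ∀ i, g ∣ L i := by
    intro i
    have : L i ∈ Ideal.span (Set.range L) := Ideal.subset_span ⟨i, rfl⟩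
    rw [hg] at this
    exact Ideal.mem_span_singleton.1 this
  have hu : IsUnit g := by
    by_contra hu
    have : g.degree ≠ 0 := by
      intro h0
      exact hu (Polynomial.isUnit_iff_degree_eq_zero.2 h0)
    obtain ⟨z, hz⟩ := IsAlgClosed.exists_root g this
    obtain ⟨i, hi⟩ := h.eval_ne z
    exact hi (eval_eq_zero_of_dvd_of_eval_eq_zero (hdvd i) hz)
  rw [hg]
  exact Ideal.span_singleton_eq_top.2 hu

lemma exists_mul [Finite ι] (h : PrimTuple d L) (hN : ∀ i j, N i * L j = N j * L i) :
    ∃ g, ∀ i, N i = g * L i := by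
  have := Fintype.ofFinite ι
  have h1 : (1 : K[X]) ∈ Ideal.span (Set.range L) := by rw [h.span_eq_top]; trivial
  obtain ⟨c, hc⟩ := (Ideal.mem_span_range_iff_exists_fun).1 h1
  refine ⟨∑ j, c j * N j, fun i => ?_⟩
  calc N i = N i * ∑ j, c j * L j := by rw [hc, mul_one]
    _ = _ := by
      rw [Finset.mul_sum, Finset.sum_mul]
      refine Finset.sum_congr rfl fun j _ => ?_
      linear_combination c j * hN i j

lemma exists_ne_zero (h : PrimTuple d L) : ∃ i, L i ≠ 0 := by
  obtain ⟨i, hi⟩ := h.coeff_ne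
  exact ⟨i, fun h0 => hi (by simp [h0])⟩

lemma degree_le {g : K[X]} (h : PrimTuple d L) (hg : g ≠ 0)
    (hN : ∀ i, (g * L i).natDegree ≤ e) : g.natDegree + d ≤ e := by
  obtain ⟨i, hi⟩ := h.coeff_ne
  have h0 : L i ≠ 0 := fun h0 => hi (by simp [h0])
  have := hN i
  rw [natDegree_mul hg h0] at this
  have := le_natDegree_of_ne_zero hi
  omega

lemma unique [Finite ι] (h : PrimTuple d L) (h' : PrimTuple e N)
    (hN : ∀ i j, N i * L j = N j * L i) : d = e := by
  obtain ⟨g, hg⟩ := h.exists_mul hN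
  obtain ⟨g', hg'⟩ := h'.exists_mul (N := L) fun i j => by
    linear_combination hN j i
  have hg0 : g ≠ 0 := by
    rintro rfl
    obtain ⟨i, hi⟩ := h'.exists_ne_zero
    exact hi (by simp [hg])
  have hg0' : g' ≠ 0 := by
    rintro rfl
    obtain ⟨i, hi⟩ := h.exists_ne_zero
    exact hi (by simp [hg'])
  have h1 := h.degree_le hg0 (e := e) fun i => by rw [← hg]; exact h'.natDegree_le i
  have h2 := h'.degree_le hg0' (e := d) fun i => by rw [← hg']; exact h.natDegree_le i
  omega

end PrimTuple

/-- Homogeneous evaluation of a polynomial of degree at most `d` at `(u, v)`. -/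
def hev {R S : Type*} [Semiring R] [CommRing S] (f : R →+* S) (A : R[X]) (d : ℕ) (u v : S) : S :=
  ∑ i ∈ Finset.range (d + 1), f (A.coeff i) * (u ^ i * v ^ (d - i))

section hev

variable {K : Type*} [Field K]

lemma hev_eq_mul {A : K[X]} {d : ℕ} (hA : A.natDegree ≤ d) {u v : K} (hv : v ≠ 0) :
    hev (RingHom.id K) A d u v = v ^ d * A.eval (u / v) := by
  rw [hev, eval_eq_sum_range' (Nat.lt_succ_of_le hA), Finset.mul_sum]
  refine Finset.sum_congr rfl fun i hi => ?_
  have : i ≤ d := Nat.lt_succ_iff.1 (Finset.mem_range.1 hi)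
  obtain ⟨j, rfl⟩ := Nat.exists_eq_add_of_le this
  simp only [RingHom.id_apply, Nat.add_sub_cancel_left, div_pow, pow_add]
  field_simp

lemma hev_zero {A : K[X]} {d : ℕ} (u : K) :
    hev (RingHom.id K) A d u 0 = A.coeff d * u ^ d := by
  rw [hev, Finset.sum_range_succ, Finset.sum_eq_zero]
  · simp
  · intro i hi
    have : d - i ≠ 0 := by
      have := Finset.mem_range.1 hi
      omega
    simp [this]

lemma hev_ne {d : ℕ} {A B : K[X]} (h : PrimTuple d ![A, B]) {u v : K} (huv : u ≠ 0 ∨ v ≠ 0) :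
    hev (RingHom.id K) A d u v ≠ 0 ∨ hev (RingHom.id K) B d u v ≠ 0 := by
  have hA : A.natDegree ≤ d := h.natDegree_le 0
  have hB : B.natDegree ≤ d := h.natDegree_le 1
  by_cases hv : v = 0
  · subst hv
    have hu : u ≠ 0 := by simpa using huv
    rw [hev_zero, hev_zero]
    obtain ⟨i, hi⟩ := h.coeff_ne
    fin_cases i
    · left; exact mul_ne_zero hi (pow_ne_zero _ hu)
    · right; exact mul_ne_zero hi (pow_ne_zero _ hu)
  · rw [hev_eq_mul hA hv, hev_eq_mul hB hv]
    obtain ⟨i, hi⟩ := h.eval_ne (u / v)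
    fin_cases i
    · left; exact mul_ne_zero (pow_ne_zero _ hv) hi
    · right; exact mul_ne_zero (pow_ne_zero _ hv) hi

lemma eval_hev (A : K[X]) (d : ℕ) (U V : K[X]) (z : K) :
    (hev C A d U V).eval z = hev (RingHom.id K) A d (U.eval z) (V.eval z) := by
  simp [hev, eval_finsetSum]

lemma natDegree_hev_le (A : K[X]) (d : ℕ) {e : ℕ} {U V : K[X]} (hU : U.natDegree ≤ e)
    (hV : V.natDegree ≤ e) : (hev C A d U V).natDegree ≤ d * e := by
  refine natDegree_sum_le_of_forall_le _ _ fun i hi => ?_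
  have : i ≤ d := Nat.lt_succ_iff.1 (Finset.mem_range.1 hi)
  obtain ⟨j, rfl⟩ := Nat.exists_eq_add_of_le this
  refine (natDegree_C_mul_le _ _).trans ?_
  rw [add_mul, Nat.add_sub_cancel_left]
  exact natDegree_mul_le_of_le (natDegree_pow_le_of_le _ hU) (natDegree_pow_le_of_le _ hV)

lemma coeff_hev (A : K[X]) (d : ℕ) {e : ℕ} {U V : K[X]} (hU : U.natDegree ≤ e)
    (hV : V.natDegree ≤ e) : (hev C A d U V).coeff (d * e) =
      hev (RingHom.id K) A d (U.coeff e) (V.coeff e) := by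
  rw [hev, hev, finsetSum_coeff]
  refine Finset.sum_congr rfl fun i hi => ?_
  have : i ≤ d := Nat.lt_succ_iff.1 (Finset.mem_range.1 hi)
  obtain ⟨j, rfl⟩ := Nat.exists_eq_add_of_le this
  rw [coeff_C_mul, add_mul, Nat.add_sub_cancel_left,
    coeff_mul_add_eq_of_natDegree_le (natDegree_pow_le_of_le _ hU) (natDegree_pow_le_of_le _ hV),
    coeff_pow_of_natDegree_le hU, coeff_pow_of_natDegree_le hV]
  rfl

lemma PrimTuple.comp {d e : ℕ} {A B U V : K[X]} (h : PrimTuple d ![A, B])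
    (h' : PrimTuple e ![U, V]) :
    PrimTuple (d * e) ![hev C A d U V, hev C B d U V] := by
  have hU : U.natDegree ≤ e := h'.natDegree_le 0
  have hV : V.natDegree ≤ e := h'.natDegree_le 1
  refine ⟨?_, ?_, ?_⟩
  · intro i
    fin_cases i <;> exact natDegree_hev_le _ _ hU hV
  · intro z
    have huv : U.eval z ≠ 0 ∨ V.eval z ≠ 0 := by
      obtain ⟨i, hi⟩ := h'.eval_ne z
      fin_cases i
      · exact Or.inl hi
      · exact Or.inr hi
    rcases hev_ne h huv with h1 | h1
    · exact ⟨0, by simpa [eval_hev] using h1⟩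
    · exact ⟨1, by simpa [eval_hev] using h1⟩
  · have huv : U.coeff e ≠ 0 ∨ V.coeff e ≠ 0 := by
      obtain ⟨i, hi⟩ := h'.coeff_ne
      fin_cases i
      · exact Or.inl hi
      · exact Or.inr hi
    rcases hev_ne h huv with h1 | h1
    · exact ⟨0, by simpa [coeff_hev _ _ hU hV] using h1⟩
    · exact ⟨1, by simpa [coeff_hev _ _ hU hV] using h1⟩

end hev

end

section

open Polynomial Filter

namespace WeierstrassCurve.Affine.Point

section generic

variable {K : Type*} [Field K] {W : WeierstrassCurve.Affine K}

lemma finite_xc_eq (c : K) : {P : W.Point | xc P = c}.Finite := by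
  classical
  by_cases h : ∃ P : W.Point, P ≠ 0 ∧ xc P = c
  · obtain ⟨P, hP, hPc⟩ := h
    refine (Set.toFinite {0, P, -P}).subset fun Q hQ => ?_
    by_cases hQ0 : Q = 0
    · simp [hQ0]
    · rcases eq_or_eq_neg_of_xc_eq hQ0 hP ((Set.mem_ofPred.1 hQ).trans hPc.symm) with h | h <;>
        simp [h]
  · push Not at h
    refine (Set.finite_singleton 0).subset fun Q hQ => ?_
    by_contra hQ0
    exact h Q hQ0 hQ

lemma eventually_xc_ne (c : K) : ∀ᶠ P : W.Point in cofinite, xc P ≠ c :=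
  (finite_xc_eq c).eventually_cofinite_notMem

lemma eventually_ne (Q : W.Point) : ∀ᶠ P : W.Point in cofinite, P ≠ Q :=
  (Set.finite_singleton Q).eventually_cofinite_notMem

lemma eventually_eval_ne {f : K[X]} (hf : f ≠ 0) :
    ∀ᶠ P : W.Point in cofinite, f.eval (xc P) ≠ 0 := by
  classical
  have : ∀ᶠ P : W.Point in cofinite, ∀ c ∈ f.roots.toFinset, xc P ≠ c :=
    (f.roots.toFinset.eventually_all).2 fun c _ => eventually_xc_ne c
  filter_upwards [this] with P hP h0
  exact hP _ (by simp [hf, h0]) rfl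

variable [IsAlgClosed K] [W.IsElliptic]

lemma exists_xc_eq (c : K) : ∃ P : W.Point, P ≠ 0 ∧ xc P = c := by
  set f : K[X] := X ^ 2 + C (W.a₁ * c + W.a₃) * X - C (c ^ 3 + W.a₂ * c ^ 2 + W.a₄ * c + W.a₆)
  have hf : f.degree ≠ 0 := by
    have : f.degree = 2 := by
      simp only [f]
      compute_degree!
    simp [this]
  obtain ⟨y, hy⟩ := IsAlgClosed.exists_root f hf
  have he : W.Equation c y := by
    rw [equation_iff]
    simp only [f, IsRoot.def, eval_sub, eval_add, eval_mul, eval_pow, eval_X, eval_C] at hy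
    linear_combination hy
  exact ⟨some c y (equation_iff_nonsingular.1 he), by rintro ⟨⟩, rfl⟩

instance : Infinite W.Point :=
  Infinite.of_surjective (xc : W.Point → K) fun c =>
    let ⟨P, _, h⟩ := exists_xc_eq (W := W) c
    ⟨P, h⟩

lemma eq_zero_of_eventually {f : K[X]} (hf : ∀ᶠ P : W.Point in cofinite, f.eval (xc P) = 0) :
    f = 0 := by
  by_contra h
  obtain ⟨P, hP, hP'⟩ := (hf.and (eventually_eval_ne h)).exists
  exact hP' hP

lemma eq_of_eventually {f g : K[X]}
    (h : ∀ᶠ P : W.Point in cofinite, f.eval (xc P) = g.eval (xc P)) : f = g := by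
  refine sub_eq_zero.1 (eq_zero_of_eventually (W := W) ?_)
  filter_upwards [h] with P hP
  simp [hP]

end generic

/-- A map between Weierstrass curves acts, at all but finitely many points, on `x`-coordinates as
the rational function `A / B` of degree `d`. -/
structure HasX {K : Type*} [Field K] {W₁ W₂ : WeierstrassCurve.Affine K} (φ : W₁.Point → W₂.Point)
    (d : ℕ) (A B : K[X]) : Prop where
  prim : PrimTuple d ![A, B]
  ev : ∀ᶠ P in cofinite, φ P ≠ 0 ∧ B.eval (xc P) ≠ 0 ∧ xc (φ P) * B.eval (xc P) = A.eval (xc P)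

namespace HasX

variable {K : Type*} [Field K] {W₁ W₂ W₃ : WeierstrassCurve.Affine K}
  {φ : W₁.Point → W₂.Point} {ψ : W₂.Point → W₃.Point} {d e : ℕ} {A B U V : K[X]}

lemma natDegree_left_le (h : HasX φ d A B) : A.natDegree ≤ d := h.prim.natDegree_le 0

lemma natDegree_right_le (h : HasX φ d A B) : B.natDegree ≤ d := h.prim.natDegree_le 1

lemma sub_C_mul_ne_zero [IsAlgClosed K] (h : HasX φ d A B) (hd : d ≠ 0) (c : K) :
    A - C c * B ≠ 0 := by
  intro h0
  have hA : A = C c * B := sub_eq_zero.1 h0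
  have hB : B.coeff d ≠ 0 := by
    obtain ⟨i, hi⟩ := h.prim.coeff_ne
    fin_cases i
    · intro h1
      simp [hA, h1] at hi
    · exact hi
  have : B.degree ≠ 0 := by
    intro hdeg
    have := le_natDegree_of_ne_zero hB
    have h2 := natDegree_eq_zero_iff_degree_le_zero.2 hdeg.le
    omega
  obtain ⟨z, hz⟩ := IsAlgClosed.exists_root B this
  obtain ⟨i, hi⟩ := h.prim.eval_ne z
  rw [IsRoot.def] at hz
  fin_cases i <;> simp [hA, hz] at hi

lemma tendsto [IsAlgClosed K] (h : HasX φ d A B) (hd : d ≠ 0) :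
    Tendsto φ cofinite cofinite := by
  refine Tendsto.cofinite_of_finite_preimage_singleton fun Q => ?_
  have h1 := (h.ev.and (eventually_eval_ne (W := W₁) (h.sub_C_mul_ne_zero hd (xc Q))))
  refine (Filter.eventually_cofinite.1 h1).subset fun P hP hP' => ?_
  have hP : φ P = Q := by simpa using hP
  obtain ⟨⟨h1, h2, h3⟩, h4⟩ := hP'
  apply h4
  rw [hP] at h3
  simp [h3]

lemma comp [IsAlgClosed K] (h' : HasX ψ e U V) (h : HasX φ d A B) (hd : d ≠ 0) :
    HasX (ψ ∘ φ) (e * d) (hev C U e A B) (hev C V e A B) := by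
  refine ⟨h'.prim.comp h.prim, ?_⟩
  filter_upwards [h.ev, (h.tendsto hd).eventually h'.ev] with P ⟨h1, h2, h3⟩ ⟨h4, h5, h6⟩
  have hx : A.eval (xc P) / B.eval (xc P) = xc (φ P) := by rw [← h3]; field_simp
  rw [eval_hev, eval_hev, hev_eq_mul h'.natDegree_left_le h2, hev_eq_mul h'.natDegree_right_le h2,
    hx]
  refine ⟨h4, mul_ne_zero (pow_ne_zero _ h2) h5, ?_⟩
  rw [← h6, Function.comp]
  ring

lemma mul_eq_mul [IsAlgClosed K] [W₁.IsElliptic] {φ' : W₁.Point → W₂.Point} (h : HasX φ d A B)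
    (h' : HasX φ' e U V) (hx : ∀ᶠ P in cofinite, xc (φ P) = xc (φ' P)) : A * V = U * B := by
  refine eq_of_eventually (W := W₁) ?_
  filter_upwards [h.ev, h'.ev, hx] with P ⟨h1, h2, h3⟩ ⟨h4, h5, h6⟩ h7
  rw [eval_mul, eval_mul, ← h3, ← h6, h7]
  ring

lemma unique' [IsAlgClosed K] [W₁.IsElliptic] {φ' : W₁.Point → W₂.Point} (h : HasX φ d A B)
    (h' : HasX φ' e U V) (hx : ∀ᶠ P in cofinite, xc (φ P) = xc (φ' P)) : d = e := by
  have := h.mul_eq_mul h' hx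
  refine h.prim.unique h'.prim fun i j => ?_
  fin_cases i <;> fin_cases j <;> simp <;> first | ring1 | linear_combination this |
    linear_combination -this

lemma unique [IsAlgClosed K] [W₁.IsElliptic] (h : HasX φ d A B) (h' : HasX φ e U V) : d = e :=
  h.unique' h' (Eventually.of_forall fun _ => rfl)

lemma congr {φ' : W₁.Point → W₂.Point} (h : HasX φ d A B)
    (hx : ∀ᶠ P in cofinite, φ' P ≠ 0 ∧ xc (φ' P) = xc (φ P)) : HasX φ' d A B := by
  refine ⟨h.prim, ?_⟩
  filter_upwards [h.ev, hx] with P h1 h2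
  rw [h2.2]
  exact ⟨h2.1, h1.2⟩

end HasX

section id

variable {K : Type*} [Field K] {W : WeierstrassCurve.Affine K}

lemma hasX_id : HasX (id : W.Point → W.Point) 1 X 1 := by
  refine ⟨⟨?_, ?_, ?_⟩, ?_⟩
  · intro i
    fin_cases i <;> simp
  · exact fun z => ⟨1, by simp⟩
  · exact ⟨0, by simp⟩
  · filter_upwards [eventually_ne 0] with P hP
    simpa using hP

end id

end WeierstrassCurve.Affine.Point

end

section

open Polynomial Filter

namespace WeierstrassCurve

variable {K : Type*} [Field K]

/-- The polynomial `4 X³ + b₂ X² + 2 b₄ X + b₆`. -/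
noncomputable def psi (W : WeierstrassCurve K) : K[X] :=
  C 4 * X ^ 3 + C W.b₂ * X ^ 2 + C (2 * W.b₄) * X + C W.b₆

/-- The numerator `X⁴ - b₄ X² - 2 b₆ X - b₈` of the duplication formula. -/
noncomputable def dupl (W : WeierstrassCurve K) : K[X] :=
  X ^ 4 - C W.b₄ * X ^ 2 - C (2 * W.b₆) * X - C W.b₈

@[simp] lemma eval_psi (W : WeierstrassCurve K) (x : K) :
    W.psi.eval x = 4 * x ^ 3 + W.b₂ * x ^ 2 + 2 * W.b₄ * x + W.b₆ := by
  simp [psi]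

@[simp] lemma eval_dupl (W : WeierstrassCurve K) (x : K) :
    W.dupl.eval x = x ^ 4 - W.b₄ * x ^ 2 - 2 * W.b₆ * x - W.b₈ := by
  simp [dupl]

lemma natDegree_psi_le (W : WeierstrassCurve K) : W.psi.natDegree ≤ 3 := by
  unfold psi; compute_degree

lemma natDegree_dupl (W : WeierstrassCurve K) : W.dupl.natDegree = 4 := by
  unfold dupl; compute_degree!

lemma psi_ne_zero (W : WeierstrassCurve K) [W.IsElliptic] : W.psi ≠ 0 := by
  intro h
  have h3 : W.psi.coeff 3 = 4 := by simp [psi]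
  have h2 : W.psi.coeff 2 = W.b₂ := by simp [psi]
  have h1 : W.psi.coeff 1 = 2 * W.b₄ := by simp [psi, coeff_C]
  have h0 : W.psi.coeff 0 = W.b₆ := by simp [psi]
  rw [h, coeff_zero] at h0 h1 h2 h3
  have : (2 : K) = 0 := by
    have : (2 : K) * 2 = 0 := by linear_combination -h3
    simpa using this
  refine W.isUnit_Δ.ne_zero ?_
  rw [Δ, ← h2, ← h0]
  linear_combination -4 * W.b₄ ^ 3 * this

lemma primTuple_dupl_psi (W : WeierstrassCurve K) [W.IsElliptic] :
    PrimTuple 4 ![W.dupl, W.psi] := by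
  refine ⟨?_, ?_, ?_⟩
  · intro i
    fin_cases i
    · exact W.natDegree_dupl.le
    · exact W.natDegree_psi_le.trans (by norm_num)
  · intro z
    by_contra! h
    have h0 := h 0
    have h1 := h 1
    refine addSubMap_ne_zero (W := W) (x := ![z ^ 2, 2 * z, 1]) (fun h => ?_) (funext fun i => ?_)
    · simpa using congrFun h 2
    · simp only [Matrix.cons_val_zero, Matrix.cons_val_one, eval_dupl, eval_psi] at h0 h1
      fin_cases i
      · simp [addSubMap]
        linear_combination h0
      · simp [addSubMap]
        linear_combination h1
      · simp [addSubMap]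
        ring
  · refine ⟨0, ?_⟩
    have := W.natDegree_dupl
    simp [dupl]

namespace Affine.Point

variable [DecidableEq K] [IsAlgClosed K] {W W₁ W₂ : WeierstrassCurve.Affine K}

lemma hasX_two [W.IsElliptic] :
    HasX (fun P : W.Point => 2 • P) 4 (dupl W) (psi W) := by
  refine ⟨primTuple_dupl_psi W, ?_⟩
  filter_upwards [eventually_ne 0, eventually_eval_ne (W := W) (psi_ne_zero W)] with P h0 h1
  have h2 := (two_nsmul_ne_zero_iff h0).2 (by simpa using h1)
  exact ⟨h2, h1, by simpa using xc_two_nsmul h0 h2⟩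

lemma HasX.neg {φ : W₁.Point → W₂.Point} {d : ℕ} {A B : K[X]} (h : HasX φ d A B) :
    HasX (fun P => -φ P) d A B := by
  refine h.congr ?_
  filter_upwards [h.ev] with P hP
  simpa using hP.1

lemma HasX.parallelogram_le [W₁.IsElliptic] {φ ψ : W₁.Point → W₂.Point} {d₁ d₂ e₁ e₂ : ℕ}
    {A₁ B₁ A₂ B₂ C₁ D₁ C₂ D₂ : K[X]}
    (h₁ : HasX φ d₁ A₁ B₁) (h₂ : HasX ψ d₂ A₂ B₂) (h₃ : HasX (fun P => φ P + ψ P) e₁ C₁ D₁)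
    (h₄ : HasX (fun P => φ P - ψ P) e₂ C₂ D₂) : e₁ + e₂ ≤ 2 * (d₁ + d₂) := by
  have hL : PrimTuple (e₁ + e₂) ![D₁ * D₂, C₁ * D₂ + C₂ * D₁, C₁ * C₂] := by
    have hC₁ := h₃.natDegree_left_le
    have hD₁ := h₃.natDegree_right_le
    have hC₂ := h₄.natDegree_left_le
    have hD₂ := h₄.natDegree_right_le
    have key : ∀ c d c' d' : K, c ≠ 0 ∨ d ≠ 0 → c' ≠ 0 ∨ d' ≠ 0 →
        d * d' ≠ 0 ∨ c * d' + c' * d ≠ 0 ∨ c * c' ≠ 0 := by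
      intro c d c' d' h h'
      by_contra! h0
      obtain ⟨h0, h1, h2⟩ := h0
      rcases mul_eq_zero.1 h0 with rfl | rfl <;> rcases mul_eq_zero.1 h2 with rfl | rfl <;>
        simp_all
    refine ⟨?_, ?_, ?_⟩
    · intro i
      fin_cases i
      · exact natDegree_mul_le_of_le hD₁ hD₂
      · refine natDegree_add_le_of_degree_le (natDegree_mul_le_of_le hC₁ hD₂) ?_
        rw [add_comm e₁]
        exact natDegree_mul_le_of_le hC₂ hD₁
      · exact natDegree_mul_le_of_le hC₁ hC₂
    · intro z
      have a1 : C₁.eval z ≠ 0 ∨ D₁.eval z ≠ 0 := by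
        obtain ⟨i, hi⟩ := h₃.prim.eval_ne z
        fin_cases i <;> simp_all
      have a2 : C₂.eval z ≠ 0 ∨ D₂.eval z ≠ 0 := by
        obtain ⟨i, hi⟩ := h₄.prim.eval_ne z
        fin_cases i <;> simp_all
      rcases key _ _ _ _ a1 a2 with h | h | h
      · exact ⟨0, by simpa using h⟩
      · exact ⟨1, by simpa using h⟩
      · exact ⟨2, by simpa using h⟩
    · have a1 : C₁.coeff e₁ ≠ 0 ∨ D₁.coeff e₁ ≠ 0 := by
        obtain ⟨i, hi⟩ := h₃.prim.coeff_ne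
        fin_cases i <;> simp_all
      have a2 : C₂.coeff e₂ ≠ 0 ∨ D₂.coeff e₂ ≠ 0 := by
        obtain ⟨i, hi⟩ := h₄.prim.coeff_ne
        fin_cases i <;> simp_all
      rcases key _ _ _ _ a1 a2 with h | h | h
      · exact ⟨0, by simpa [coeff_mul_add_eq_of_natDegree_le hD₁ hD₂] using h⟩
      · refine ⟨1, ?_⟩
        have := coeff_mul_add_eq_of_natDegree_le hC₂ hD₁
        rw [add_comm e₂] at this
        simpa [coeff_mul_add_eq_of_natDegree_le hC₁ hD₂, this] using h
      · exact ⟨2, by simpa [coeff_mul_add_eq_of_natDegree_le hC₁ hC₂] using h⟩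
  set N : Fin 3 → K[X] := ![(A₁ * B₂ - A₂ * B₁) ^ 2,
    C 2 * (A₁ * B₂ + A₂ * B₁) * (A₁ * A₂) + C W₂.b₂ * (A₁ * A₂) * (B₁ * B₂) +
      C W₂.b₄ * (A₁ * B₂ + A₂ * B₁) * (B₁ * B₂) + C W₂.b₆ * (B₁ * B₂) ^ 2,
    (A₁ * A₂) ^ 2 - C W₂.b₄ * (A₁ * A₂) * (B₁ * B₂) -
      C W₂.b₆ * (A₁ * B₂ + A₂ * B₁) * (B₁ * B₂) - C W₂.b₈ * (B₁ * B₂) ^ 2] with hNdef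
  have hNdeg : ∀ i, (N i).natDegree ≤ 2 * (d₁ + d₂) := by
    have m1 : (A₁ * B₂).natDegree ≤ d₁ + d₂ :=
      natDegree_mul_le_of_le h₁.natDegree_left_le h₂.natDegree_right_le
    have m2 : (A₂ * B₁).natDegree ≤ d₁ + d₂ := by
      rw [mul_comm]
      exact natDegree_mul_le_of_le h₁.natDegree_right_le h₂.natDegree_left_le
    have m3 : (A₁ * A₂).natDegree ≤ d₁ + d₂ :=
      natDegree_mul_le_of_le h₁.natDegree_left_le h₂.natDegree_left_le
    have m4 : (B₁ * B₂).natDegree ≤ d₁ + d₂ :=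
      natDegree_mul_le_of_le h₁.natDegree_right_le h₂.natDegree_right_le
    have m5 := natDegree_add_le_of_degree_le m1 m2
    have m6 : (A₁ * B₂ - A₂ * B₁).natDegree ≤ d₁ + d₂ := natDegree_sub_le_of_le m1 m2 |>.trans (by simp)
    have mm : ∀ (c : K) (u v : K[X]), u.natDegree ≤ d₁ + d₂ → v.natDegree ≤ d₁ + d₂ →
        (C c * u * v).natDegree ≤ 2 * (d₁ + d₂) := by
      intro c u v hu hv
      rw [mul_assoc, two_mul]
      exact (natDegree_C_mul_le _ _).trans (natDegree_mul_le_of_le hu hv)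
    have ms : ∀ (u : K[X]), u.natDegree ≤ d₁ + d₂ → (u ^ 2).natDegree ≤ 2 * (d₁ + d₂) :=
      fun u hu => natDegree_pow_le_of_le _ hu
    have mc : ∀ (c : K) (u : K[X]), u.natDegree ≤ d₁ + d₂ → (C c * u ^ 2).natDegree ≤ 2 * (d₁ + d₂) :=
      fun c u hu => (natDegree_C_mul_le _ _).trans (ms u hu)
    have msub : ∀ (n : ℕ) (u v : K[X]), u.natDegree ≤ n → v.natDegree ≤ n →
        (u - v).natDegree ≤ n := fun n u v hu hv =>
      (natDegree_sub_le_of_le hu hv).trans (by simp)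
    intro i
    fin_cases i
    · exact ms _ m6
    · exact natDegree_add_le_of_degree_le (natDegree_add_le_of_degree_le
        (natDegree_add_le_of_degree_le (mm _ _ _ m5 m3) (mm _ _ _ m3 m4)) (mm _ _ _ m5 m4)) (mc _ _ m4)
    · exact msub _ _ _ (msub _ _ _ (msub _ _ _ (ms _ m3) (mm _ _ _ m3 m4)) (mm _ _ _ m5 m4))
        (mc _ _ m4)
  have hfac : ∀ᶠ P : W₁.Point in cofinite, ∃ g : K, g ≠ 0 ∧ (N 0).eval (xc P) ≠ 0 ∧ ∀ i, (N i).eval (xc P) =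
      g * (![D₁ * D₂, C₁ * D₂ + C₂ * D₁, C₁ * C₂] i).eval (xc P) := by
    filter_upwards [h₁.ev, h₂.ev, h₃.ev, h₄.ev] with P ⟨a1, a2, a3⟩ ⟨b1, b2, b3⟩ ⟨c1, c2, c3⟩
      ⟨d1, d2, d3⟩
    have hne : xc (φ P) ≠ xc (ψ P) := by
      intro h
      rcases eq_or_eq_neg_of_xc_eq a1 b1 h with h | h
      · exact d1 (by rw [h, sub_self])
      · exact c1 (by rw [h, neg_add_cancel])
    have s1 := xc_add_add_xc_sub a1 b1 hne
    have s2 := xc_add_mul_xc_sub a1 b1 hne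
    have hdiff := sub_ne_zero.2 hne
    refine ⟨((xc (φ P) - xc (ψ P)) * (B₁.eval (xc P) * B₂.eval (xc P))) ^ 2 /
      (D₁.eval (xc P) * D₂.eval (xc P)), ?_, ?_, ?_⟩
    · exact div_ne_zero (pow_ne_zero _ (mul_ne_zero hdiff (mul_ne_zero a2 b2))) (mul_ne_zero c2 d2)
    · simp only [hNdef, Matrix.cons_val_zero, eval_pow, eval_sub, eval_mul, ← a3, ← b3]
      refine pow_ne_zero _ ?_
      have := mul_ne_zero hdiff (mul_ne_zero a2 b2)
      intro h
      apply this
      linear_combination h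
    · intro i
      rw [div_mul_eq_mul_div, eq_div_iff (mul_ne_zero c2 d2)]
      fin_cases i
      · simp only [hNdef, Fin.zero_eta, Matrix.cons_val_zero, eval_pow, eval_sub, eval_mul, ← a3, ← b3]
        ring
      · simp only [hNdef, Fin.mk_one, Matrix.cons_val_one, Matrix.cons_val_zero, eval_add, eval_pow, eval_mul, ← a3, ← b3, ← c3, ← d3, eval_C]
        linear_combination -(B₁.eval (xc P) * B₂.eval (xc P)) ^ 2 * (D₁.eval (xc P) * D₂.eval (xc P)) * s1
      · simp only [hNdef, Fin.reduceFinMk, Matrix.cons_val, eval_add, eval_pow, eval_sub, eval_mul, ← a3, ← b3, ← c3, ← d3, eval_C]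
        linear_combination -(B₁.eval (xc P) * B₂.eval (xc P)) ^ 2 * (D₁.eval (xc P) * D₂.eval (xc P)) * s2
  obtain ⟨g, hg⟩ := hL.exists_mul (N := N) fun i j => by
    refine eq_of_eventually (W := W₁) ?_
    filter_upwards [hfac] with P ⟨g, _, _, hg⟩
    rw [eval_mul, eval_mul, hg i, hg j]
    ring
  have hg0 : g ≠ 0 := by
    rintro rfl
    obtain ⟨P, _, _, h, _⟩ := hfac.exists
    exact h (by simp [hg])
  have := hL.degree_le hg0 (e := 2 * (d₁ + d₂)) fun i => by rw [← hg]; exact hNdeg i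
  omega

end Affine.Point
end WeierstrassCurve

end

section

open Polynomial Filter

namespace WeierstrassCurve.Affine.Point

variable {K : Type*} [Field K] [DecidableEq K] [IsAlgClosed K]
  {W W₁ W₂ W₃ : WeierstrassCurve.Affine K}

lemma HasX.eventually_coeff_ne {φ : W₁.Point → W₂.Point} {d : ℕ} {A B : K[X]} (h : HasX φ d A B) :
    ∀ᶠ c in cofinite, A.coeff d - c * B.coeff d ≠ 0 := by
  have : (C (A.coeff d) - X * C (B.coeff d)) ≠ (0 : K[X]) := by
    intro h0
    have h1 : A.coeff d = 0 := by simpa using congrArg (coeff · 0) h0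
    have h2 : B.coeff d = 0 := by simpa [h1] using congrArg (coeff · 1) h0
    obtain ⟨i, hi⟩ := h.prim.coeff_ne
    fin_cases i <;> simp_all
  have hfin := (Polynomial.finite_setOfPred_isRoot this)
  refine hfin.eventually_cofinite_notMem.mono fun c hc h0 => hc ?_
  simp only [Set.mem_ofPred, IsRoot.def, eval_sub, eval_mul, eval_C, eval_X]
  exact h0

lemma HasX.eventually_exists {φ : W₁.Point →+ W₂.Point} {d : ℕ} {A B : K[X]} (h : HasX φ d A B)
    (hd : d ≠ 0) [W₁.IsElliptic] : ∀ᶠ c in cofinite, (∃ z, (A - C c * B).eval z = 0) ∧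
      (∀ P : W₁.Point, P ≠ 0 → φ P ≠ 0 → ((A - C c * B).eval (xc P) = 0 ↔ xc (φ P) = c)) ∧
      (∀ P : W₁.Point, P ≠ 0 → (A - C c * B).eval (xc P) = 0 → φ P ≠ 0) := by
  have hT := Filter.eventually_cofinite.1 h.ev
  have e1 := h.eventually_coeff_ne
  have e2 := (hT.image fun P => xc (φ P)).eventually_cofinite_notMem
  have e3 := (hT.image fun P => A.eval (xc P) / B.eval (xc P)).eventually_cofinite_notMem
  filter_upwards [e1, e2, e3] with c h1 h2 h3
  have h2' : ∀ P, xc (φ P) = c → φ P ≠ 0 ∧ eval P.xc B ≠ 0 ∧ xc (φ P) * eval P.xc B = eval P.xc A := by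
    intro P hP
    by_contra hP'
    exact h2 ⟨P, hP', hP⟩
  have h3' : ∀ P : W₁.Point, (A - C c * B).eval (xc P) = 0 →
      φ P ≠ 0 ∧ eval P.xc B ≠ 0 ∧ xc (φ P) * eval P.xc B = eval P.xc A := by
    intro P hP
    by_contra hP'
    simp only [eval_sub, eval_mul, eval_C] at hP
    refine h3 ⟨P, hP', ?_⟩
    have hB : B.eval (xc P) ≠ 0 := by
      intro hB
      obtain ⟨i, hi⟩ := h.prim.eval_ne (xc P)
      have hA : A.eval (xc P) = 0 := by simpa [hB] using hP
      fin_cases i <;> simp_all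
    exact (div_eq_iff hB).2 (by linear_combination hP)
  refine ⟨?_, fun P h0 h0' => ⟨fun hP => ?_, fun hP => ?_⟩, fun P _ hP => (h3' P hP).1⟩
  · refine IsAlgClosed.exists_root (A - C c * B) fun hdeg => ?_
    have := le_natDegree_of_ne_zero (p := A - C c * B) (n := d) (by simpa using h1)
    have h2 := natDegree_eq_zero_iff_degree_le_zero.2 hdeg.le
    omega
  · obtain ⟨_, hB, hx⟩ := h3' P hP
    simp only [eval_sub, eval_mul, eval_C] at hP
    exact mul_right_cancel₀ hB (by linear_combination hx + hP)
  · obtain ⟨_, hB, hx⟩ := h2' P hP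
    rw [hP] at hx
    simp [← hx]

lemma eventually_of_xc {p : K → Prop} (h : ∀ᶠ c in cofinite, p c) :
    ∀ᶠ P : W.Point in cofinite, p (xc P) := by
  have : Tendsto (xc : W.Point → K) cofinite cofinite :=
    Tendsto.cofinite_of_finite_preimage_singleton fun c => finite_xc_eq c
  exact this.eventually h

lemma HasX.surjective {φ : W₁.Point →+ W₂.Point} {d : ℕ} {A B : K[X]} (h : HasX φ d A B)
    (hd : d ≠ 0) [W₁.IsElliptic] [W₂.IsElliptic] : Function.Surjective φ := by
  have key : ∀ᶠ Q : W₂.Point in cofinite, Q ∈ φ.range := by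
    filter_upwards [eventually_of_xc (h.eventually_exists hd), eventually_ne 0] with Q
      ⟨⟨z, hz⟩, h1, h2⟩ hQ
    obtain ⟨P, hP, rfl⟩ := exists_xc_eq (W := W₁) z
    have h3 := h2 P hP hz
    rcases eq_or_eq_neg_of_xc_eq h3 hQ ((h1 P hP h3).1 hz) with h4 | h4
    · exact ⟨P, h4⟩
    · exact ⟨-P, by rw [map_neg, h4, neg_neg]⟩
  intro Q
  have h2 : Tendsto (fun R : W₂.Point => Q - R) cofinite cofinite :=
    Function.Injective.tendsto_cofinite fun a b hab => by simpa using hab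
  obtain ⟨R, hR, hR'⟩ := (key.and (h2.eventually key)).exists
  have := φ.range.add_mem hR hR'
  rwa [add_sub_cancel] at this

lemma HasX.card_ker {φ : W₁.Point →+ W₂.Point} {d : ℕ} {A B : K[X]} (h : HasX φ d A B)
    (hd : d ≠ 0) [W₁.IsElliptic] [W₂.IsElliptic] :
    ∀ᶠ c in cofinite, Nat.card φ.ker = (A - C c * B).roots.toFinset.card := by
  have e4 : ∀ᶠ c in cofinite, W₂.psi.eval c ≠ 0 :=
    (Polynomial.finite_setOfPred_isRoot (psi_ne_zero W₂)).eventually_cofinite_notMem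
  filter_upwards [h.eventually_exists hd, e4] with c ⟨⟨z, hz⟩, h1, h2⟩ h3
  obtain ⟨P₀, hP₀, rfl⟩ := exists_xc_eq (W := W₁) z
  set Q := φ P₀ with hQdef
  have hQ := h2 P₀ hP₀ hz
  have hQc := (h1 P₀ hP₀ hQ).1 hz
  have h2Q : Q ≠ -Q := by
    rw [← hQc, eval_psi] at h3
    have := (two_nsmul_ne_zero_iff hQ).2 h3
    rwa [two_nsmul, Ne, add_eq_zero_iff_eq_neg] at this
  have hk : ∀ k : φ.ker, φ (P₀ + k) = Q := fun k => by
    rw [map_add, (AddMonoidHom.mem_ker).1 k.2, add_zero]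
  have hk0 : ∀ k : φ.ker, P₀ + (k : W₁.Point) ≠ 0 := fun k h0 => hQ ((hk k).symm.trans (by rw [h0, φ.map_zero]))
  rw [← Nat.card_eq_finsetCard]
  · refine Nat.card_congr (Equiv.ofBijective (fun k : φ.ker => ⟨xc (P₀ + (k : W₁.Point)), ?_⟩) ⟨?_, ?_⟩)
    · rw [Multiset.mem_toFinset, mem_roots (h.sub_C_mul_ne_zero hd c), IsRoot.def, h1 _ (hk0 k), hk, hQc]
      rw [hk]; exact hQ
    · intro k k' hkk
      simp only [Subtype.mk.injEq] at hkk
      rcases eq_or_eq_neg_of_xc_eq (hk0 k) (hk0 k') hkk with h4 | h4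
      · exact Subtype.ext (add_left_cancel h4)
      · refine absurd ?_ h2Q
        exact (hk k).symm.trans (by rw [h4, map_neg, hk])
    · rintro ⟨z, hz⟩
      rw [Multiset.mem_toFinset, mem_roots (h.sub_C_mul_ne_zero hd c), IsRoot.def] at hz
      obtain ⟨P, hP, rfl⟩ := exists_xc_eq (W := W₁) z
      have h5 := h2 P hP hz
      have h6 := (h1 P hP h5).1 hz
      have key : ∀ P', xc P' = xc P → φ P' = Q → ∃ k : φ.ker, xc (P₀ + (k : W₁.Point)) = xc P := by
        intro P' h7 h8
        exact ⟨⟨P' - P₀, by rw [AddMonoidHom.mem_ker, map_sub, h8, sub_self]⟩, by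
          simp [h7]⟩
      obtain ⟨k, hk⟩ : ∃ k : φ.ker, xc (P₀ + (k : W₁.Point)) = xc P := by
        rcases eq_or_eq_neg_of_xc_eq h5 hQ (h6.trans hQc.symm) with h7 | h7
        · exact key P rfl h7
        · exact key (-P) (xc_neg P) (by rw [map_neg, h7, neg_neg])
      exact ⟨k, Subtype.ext hk⟩

lemma HasX.finite_ker {φ : W₁.Point →+ W₂.Point} {d : ℕ} {A B : K[X]} (h : HasX φ d A B)
    : Finite φ.ker := by
  refine Set.Finite.to_subtype ?_
  exact Set.Finite.preimage' (f := φ) (s := {0}) (Set.finite_singleton _) fun b hb => by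
    have := (Filter.eventually_cofinite.1 h.ev)
    refine this.subset fun P hP hP' => ?_
    rw [Set.mem_preimage, Set.mem_singleton_iff, Set.mem_singleton_iff.1 hb] at hP
    exact hP'.1 hP

lemma HasX.card_ker_eq {φ : W₁.Point →+ W₂.Point} {d : ℕ} {A B : K[X]} (h : HasX φ d A B)
    (hd : d ≠ 0) [W₁.IsElliptic] [W₂.IsElliptic]
    (hs : derivative A * B - A * derivative B ≠ 0) : Nat.card φ.ker = d := by
  have e1 := h.eventually_coeff_ne
  have e2 := ((Polynomial.finite_setOfPred_isRoot hs).image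
    fun z => A.eval z / B.eval z).eventually_cofinite_notMem
  obtain ⟨c, h1, h2, h3⟩ := (e1.and (e2.and (h.card_ker hd))).exists
  have hdeg : (A - C c * B).natDegree = d := by
    refine le_antisymm ?_ (le_natDegree_of_ne_zero (by simpa using h1))
    refine (natDegree_sub_le_of_le h.natDegree_left_le
      ((natDegree_C_mul_le _ _).trans h.natDegree_right_le)).trans (by simp)
  rw [h3, Multiset.toFinset_card_of_nodup, ← hdeg]
  · exact IsAlgClosed.card_roots_eq_natDegree
  · rw [Multiset.nodup_iff_count_le_one]
    intro z
    by_contra! hz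
    rw [count_roots] at hz
    have h0 := h.sub_C_mul_ne_zero hd c
    obtain ⟨r1, r2⟩ := (one_lt_rootMultiplicity_iff_isRoot h0).1 hz
    simp only [IsRoot.def, eval_sub, eval_mul, eval_C, derivative_sub, derivative_mul, derivative_C,
      zero_mul, zero_add] at r1 r2
    have hB : B.eval z ≠ 0 := by
      intro hB
      obtain ⟨i, hi⟩ := h.prim.eval_ne z
      have hA : A.eval z = 0 := by simpa [hB] using r1
      fin_cases i <;> simp_all
    refine h2 ⟨z, ?_, (div_eq_iff hB).2 (by linear_combination r1)⟩
    simp only [Set.mem_ofPred, IsRoot.def, eval_sub, eval_mul]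
    linear_combination eval z B * r2 - eval z (derivative B) * r1

end WeierstrassCurve.Affine.Point

end

section

open Polynomial Filter

/-- A multiplicative quadratic form on a ring, with values in `ℤ`. -/
structure DegForm {R : Type*} [Ring R] (d : R → ℤ) : Prop where
  one : d 1 = 1
  mul : ∀ a b, d (a * b) = d a * d b
  para : ∀ a b, d (a + b) + d (a - b) = 2 * (d a + d b)
  eq_zero : ∀ a, d a = 0 → a = 0

namespace DegForm

variable {R : Type*} [Ring R] {d : R → ℤ}

lemma zero (h : DegForm d) : d 0 = 0 := by
  have := h.para 0 0
  simp only [add_zero, sub_zero] at this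
  omega

lemma cube (h : DegForm d) (x y z : R) :
    d (x + y + z) = d (x + z) + d (y + z) + d (x + y) - d x - d y - d z := by
  have h1 := h.para (x + z) y
  have h2 := h.para (y + z) x
  have h3 := h.para z (x - y)
  have h4 := h.para x y
  rw [show x + z + y = x + y + z by abel] at h1
  rw [show y + z + x = x + y + z by abel] at h2
  rw [show z + (x - y) = x + z - y by abel, show z - (x - y) = y + z - x by abel] at h3
  linarith

/-- The bilinear form attached to a multiplicative quadratic form. -/
def bil (h : DegForm d) : R →+ R →+ ℤ :=
  AddMonoidHom.mk' (fun x => AddMonoidHom.mk' (fun y => d (x + y) - d x - d y) fun y z => by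
      have := h.cube y z x
      rw [show x + (y + z) = y + z + x by abel, this, add_comm y x, add_comm z x]
      ring) fun x y => by
    ext z
    simp only [AddMonoidHom.mk'_apply, AddMonoidHom.add_apply]
    rw [h.cube x y z]
    ring

lemma bil_apply (h : DegForm d) (x y : R) : h.bil x y = d (x + y) - d x - d y := rfl

lemma add (h : DegForm d) (x y : R) : d (x + y) = d x + d y + h.bil x y := by
  rw [bil_apply]; ring

lemma bil_self (h : DegForm d) (x : R) : h.bil x x = 2 * d x := by
  have := h.para x x
  rw [sub_self, h.zero] at this
  rw [bil_apply]
  linarith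

lemma bil_comm (h : DegForm d) (x y : R) : h.bil x y = h.bil y x := by
  rw [bil_apply, bil_apply, add_comm x y]; ring

lemma bil_mul_right (h : DegForm d) (x y a : R) : h.bil (x * a) (y * a) = h.bil x y * d a := by
  rw [bil_apply, bil_apply, ← add_mul, h.mul, h.mul, h.mul]; ring

lemma bil_zsmul_left (h : DegForm d) (n : ℤ) (x y : R) : h.bil (n • x) y = n * h.bil x y := by
  rw [map_zsmul]
  simp

lemma bil_zsmul_right (h : DegForm d) (n : ℤ) (x y : R) : h.bil x (n • y) = n * h.bil x y := by
  rw [map_zsmul]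
  simp

lemma zsmul (h : DegForm d) (n : ℤ) (x : R) : d (n • x) = n ^ 2 * d x := by
  have h1 := h.bil_self (n • x)
  rw [bil_zsmul_left, bil_zsmul_right, bil_self] at h1
  linarith

/-- The trace attached to a multiplicative quadratic form. -/
def tr (h : DegForm d) (a : R) : ℤ := h.bil a 1

lemma bil_one (h : DegForm d) (a : R) : h.bil a 1 = h.tr a := rfl

lemma bil_sq_one (h : DegForm d) (a : R) : h.bil (a * a) 1 = h.tr a ^ 2 - 2 * d a := by
  have h1 := h.mul (a + 1) (a + 1)
  have h2 : (a + 1) * (a + 1) = (a * a + (2 : ℤ) • a) + 1 := by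
    rw [two_smul]; noncomm_ring
  have h3 : h.bil (a * a) a = h.tr a * d a := by
    have := h.bil_mul_right a 1 a
    rwa [one_mul] at this
  rw [h2, h.add, h.add, h.add a 1, h.mul, h.one, h.zsmul, map_add, AddMonoidHom.add_apply,
    bil_zsmul_right, bil_zsmul_left, h3, bil_one, bil_one] at h1
  rw [bil_one]
  linarith

/-- The quadratic equation satisfied by an element. -/
lemma sq_eq (h : DegForm d) (a : R) : a * a = h.tr a • a - d a • 1 := by
  refine sub_eq_zero.1 (h.eq_zero _ ?_)
  have h1 : a * a - (h.tr a • a - d a • (1 : R)) = (a * a + (-h.tr a) • a) + d a • 1 := by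
    rw [neg_smul]; abel
  have h3 : h.bil (a * a) a = h.tr a * d a := by
    have := h.bil_mul_right a 1 a
    rwa [one_mul] at this
  rw [h1, h.add, h.add, h.mul, h.zsmul, h.zsmul, h.one, map_add, AddMonoidHom.add_apply,
    bil_zsmul_right, bil_zsmul_right, bil_zsmul_right, bil_zsmul_left, h3, bil_sq_one, bil_one]
  ring

lemma add_zsmul_one (h : DegForm d) (a b : ℤ) (x : R) :
    d (a • 1 + b • x) = a ^ 2 + a * b * h.tr x + b ^ 2 * d x := by
  rw [h.add, h.zsmul, h.zsmul, h.one, bil_zsmul_left, bil_zsmul_right, bil_comm, bil_one]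
  ring

lemma one_sub (h : DegForm d) (x : R) : d (1 - x) = 1 - h.tr x + d x := by
  have := h.add_zsmul_one 1 (-1) x
  rw [one_smul, neg_smul, one_smul, ← sub_eq_add_neg] at this
  rw [this]; ring

end DegForm

namespace WeierstrassCurve.Affine.Point

variable {K : Type*} [Field K] [DecidableEq K]
  {W W₁ W₂ W₃ : WeierstrassCurve.Affine K}

/-- A homomorphism between groups of points is zero, or given by a rational function of degree `d`
on `x`-coordinates. -/
def HasDeg (φ : W₁.Point →+ W₂.Point) (d : ℕ) : Prop :=
  (φ = 0 ∧ d = 0) ∨ (d ≠ 0 ∧ ∃ A B, HasX φ d A B)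

variable [IsAlgClosed K] {φ ψ : W₁.Point →+ W₂.Point} {d e d₁ d₂ e₁ e₂ : ℕ}

lemma HasX.hasDeg (hd : d ≠ 0) {A B : K[X]} (h : HasX φ d A B) : HasDeg φ d := Or.inr ⟨hd, A, B, h⟩

lemma hasDeg_zero : HasDeg (0 : W₁.Point →+ W₂.Point) 0 := Or.inl ⟨rfl, rfl⟩

namespace HasDeg

lemma exists_hasX (h : HasDeg φ d) (hd : d ≠ 0) : ∃ A B, HasX φ d A B := by
  rcases h with h | h
  · exact absurd h.2 hd
  · exact h.2

lemma eq_zero (h : HasDeg φ 0) : φ = 0 := by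
  rcases h with h | h
  · exact h.1
  · exact absurd rfl h.1

lemma deg_ne_zero (h : HasDeg φ d) (hφ : φ ≠ 0) : d ≠ 0 := by
  rintro rfl
  exact hφ h.eq_zero

lemma neg (h : HasDeg φ d) : HasDeg (-φ) d := by
  rcases h with ⟨rfl, rfl⟩ | ⟨hd, A, B, h⟩
  · exact Or.inl ⟨_root_.neg_zero, rfl⟩
  · exact Or.inr ⟨hd, A, B, h.neg⟩

lemma id : HasDeg (AddMonoidHom.id W.Point) 1 :=
  HasX.hasDeg (φ := AddMonoidHom.id W.Point) one_ne_zero hasX_id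

lemma comp {ψ : W₂.Point →+ W₃.Point} (h' : HasDeg ψ e) (h : HasDeg φ d) :
    HasDeg (ψ.comp φ) (e * d) := by
  rcases h with ⟨rfl, rfl⟩ | ⟨hd, A, B, h⟩
  · exact Or.inl ⟨by simp, by simp⟩
  rcases h' with ⟨rfl, rfl⟩ | ⟨hd', A', B', h'⟩
  · exact Or.inl ⟨by simp, by simp⟩
  · exact Or.inr ⟨mul_ne_zero hd' hd, _, _, h'.comp h hd⟩

lemma two [W₂.IsElliptic] (h : HasDeg φ d) : HasDeg (φ + φ) (4 * d) := by
  rcases h with ⟨rfl, rfl⟩ | ⟨hd, A, B, h⟩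
  · exact Or.inl ⟨by simp, rfl⟩
  · refine Or.inr ⟨mul_ne_zero four_ne_zero hd, _, _,
      ((hasX_two (W := W₂)).comp h hd).congr ?_⟩
    filter_upwards [(hasX_two.comp h hd).ev] with P hP
    have : (φ + φ) P = ((fun P : W₂.Point => 2 • P) ∘ φ) P := by
      simp [two_nsmul]
    rw [this]
    exact ⟨hP.1, rfl⟩

lemma unique [W₁.IsElliptic] (h : HasDeg φ d) (h' : HasDeg φ e) : d = e := by
  by_cases hφ : φ = 0
  · have key : ∀ n, HasDeg φ n → n = 0 := by
      rintro n (⟨_, h⟩ | ⟨_, A, B, h⟩)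
      · exact h
      · obtain ⟨P, hP⟩ := h.ev.exists
        exact absurd (by rw [hφ]; rfl) hP.1
    rw [key d h, key e h']
  · obtain ⟨A, B, h⟩ := h.exists_hasX (h.deg_ne_zero hφ)
    obtain ⟨A, B, h'⟩ := h'.exists_hasX (h'.deg_ne_zero hφ)
    exact h.unique h'

lemma parallelogram_le [W₁.IsElliptic] [W₂.IsElliptic]
    (h₁ : HasDeg φ d₁) (h₂ : HasDeg ψ d₂) (h₃ : HasDeg (φ + ψ) e₁)
    (h₄ : HasDeg (φ - ψ) e₂) : e₁ + e₂ ≤ 2 * (d₁ + d₂) := by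
  by_cases hφ : φ = 0
  · subst hφ
    rw [zero_add] at h₃
    rw [zero_sub] at h₄
    have := h₁.unique hasDeg_zero
    have := h₂.unique h₃
    have := h₂.neg.unique h₄
    omega
  by_cases hψ : ψ = 0
  · subst hψ
    rw [add_zero] at h₃
    rw [sub_zero] at h₄
    have := h₂.unique hasDeg_zero
    have := h₁.unique h₃
    have := h₁.unique h₄
    omega
  by_cases hs : φ + ψ = 0
  · obtain rfl : ψ = -φ := (neg_eq_of_add_eq_zero_right hs).symm
    rw [hs] at h₃
    rw [sub_neg_eq_add] at h₄
    have := h₃.unique hasDeg_zero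
    have := h₁.two.unique h₄
    have := h₁.neg.unique h₂
    omega
  by_cases hs' : φ - ψ = 0
  · obtain rfl : φ = ψ := sub_eq_zero.1 hs'
    rw [hs'] at h₄
    have := h₄.unique hasDeg_zero
    have := h₁.two.unique h₃
    have := h₁.unique h₂
    omega
  obtain ⟨_, _, k₁⟩ := h₁.exists_hasX (h₁.deg_ne_zero hφ)
  obtain ⟨_, _, k₂⟩ := h₂.exists_hasX (h₂.deg_ne_zero hψ)
  obtain ⟨_, _, k₃⟩ := h₃.exists_hasX (h₃.deg_ne_zero hs)
  obtain ⟨_, _, k₄⟩ := h₄.exists_hasX (h₄.deg_ne_zero hs')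
  exact HasX.parallelogram_le k₁ k₂ k₃ k₄

lemma parallelogram [W₁.IsElliptic] [W₂.IsElliptic]
    (h₁ : HasDeg φ d₁) (h₂ : HasDeg ψ d₂) (h₃ : HasDeg (φ + ψ) e₁)
    (h₄ : HasDeg (φ - ψ) e₂) : e₁ + e₂ = 2 * (d₁ + d₂) := by
  have a1 := parallelogram_le h₁ h₂ h₃ h₄
  have a2 := parallelogram_le h₃ h₄ (e₁ := 4 * d₁) (e₂ := 4 * d₂)
    (by rw [show φ + ψ + (φ - ψ) = φ + φ by abel]; exact h₁.two)
    (by rw [show φ + ψ - (φ - ψ) = ψ + ψ by abel]; exact h₂.two)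
  omega

lemma surjective [W₁.IsElliptic] [W₂.IsElliptic] (h : HasDeg φ d) (hd : d ≠ 0) :
    Function.Surjective φ := by
  obtain ⟨_, _, h⟩ := h.exists_hasX hd
  exact h.surjective hd

end HasDeg

/-- Degrees of endomorphisms form a multiplicative quadratic form. -/
lemma degForm_of_hasDeg [W.IsElliptic] {R : Type*} [Ring R] (ι : R →+* AddMonoid.End W.Point)
    (hι : Function.Injective ι) (d : R → ℕ) (hd : ∀ a, HasDeg (ι a) (d a)) :
    DegForm fun a => (d a : ℤ) where
  one := by
    have := (hd 1).unique (by rw [map_one]; exact HasDeg.id)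
    simp [this]
  mul a b := by
    have := (hd (a * b)).unique (by rw [map_mul]; exact (hd a).comp (hd b))
    simp [this]
  para a b := by
    have := HasDeg.parallelogram (hd a) (hd b) (e₁ := d (a + b)) (e₂ := d (a - b))
      (by have := hd (a + b); rwa [map_add] at this) (by have := hd (a - b); rwa [map_sub] at this)
    exact_mod_cast this
  eq_zero a ha := by
    have ha : d a = 0 := by exact_mod_cast ha
    refine hι ?_
    have := hd a
    rw [ha] at this
    exact this.eq_zero.trans ι.map_zero.symm

end WeierstrassCurve.Affine.Point

end

section

open Polynomial Filter

namespace WeierstrassCurve.Affine.Point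

/-- The admissible change of variables `(x, y) ↦ (u²x + r, u³y + u²sx + t)` carries the Weierstrass
equation `W'` to `W`. -/
structure Chg {K : Type*} [Field K] (W' W : WeierstrassCurve.Affine K) (u r s t : K) : Prop where
  ne : u ≠ 0
  h₁ : u * W'.a₁ = W.a₁ + 2 * s
  h₂ : u ^ 2 * W'.a₂ = W.a₂ - s * W.a₁ + 3 * r - s ^ 2
  h₃ : u ^ 3 * W'.a₃ = W.a₃ + r * W.a₁ + 2 * t
  h₄ : u ^ 4 * W'.a₄ = W.a₄ - s * W.a₃ + 2 * r * W.a₂ - (t + r * s) * W.a₁ + 3 * r ^ 2 - 2 * s * t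
  h₆ : u ^ 6 * W'.a₆ = W.a₆ + r * W.a₄ + r ^ 2 * W.a₂ + r ^ 3 - t * W.a₃ - t ^ 2 - r * t * W.a₁

namespace Chg

variable {K : Type*} [Field K] {W W' : WeierstrassCurve.Affine K} {u r s t : K}

lemma of_variableChange (C : VariableChange K) (W : WeierstrassCurve.Affine K) :
    Chg (C • W : WeierstrassCurve K) W C.u C.r C.s C.t := by
  have hu : (C.u : K) ≠ 0 := C.u.ne_zero
  refine ⟨hu, ?_, ?_, ?_, ?_, ?_⟩ <;>
    simp only [variableChange_a₁, variableChange_a₂, variableChange_a₃, variableChange_a₄,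
      variableChange_a₆, Units.val_inv_eq_inv_val] <;> field_simp

lemma neg (h : Chg W' W u r s t) : Chg W' W (-u) r (-s - W.a₁) (-t - W.a₁ * r - W.a₃) where
  ne := neg_ne_zero.2 h.ne
  h₁ := by linear_combination -h.h₁
  h₂ := by linear_combination h.h₂
  h₃ := by linear_combination -h.h₃
  h₄ := by linear_combination h.h₄
  h₆ := by linear_combination h.h₆

lemma equation (h : Chg W' W u r s t) {x y : K} (hxy : W'.Equation x y) :
    W.Equation (u ^ 2 * x + r) (u ^ 3 * y + u ^ 2 * s * x + t) := by
  rw [equation_iff] at hxy ⊢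
  linear_combination u ^ 6 * hxy - (u ^ 5 * x * y) * h.h₁ + (u ^ 4 * x ^ 2) * h.h₂ -
    u ^ 3 * y * h.h₃ + u ^ 2 * x * h.h₄ + h.h₆

lemma equation_symm (h : Chg W' W u r s t) {x y : K}
    (hxy : W.Equation (u ^ 2 * x + r) (u ^ 3 * y + u ^ 2 * s * x + t)) : W'.Equation x y := by
  rw [equation_iff] at hxy ⊢
  have hu := pow_ne_zero 6 h.ne
  refine mul_left_cancel₀ hu ?_
  linear_combination hxy - (-(u ^ 5 * x * y) * h.h₁ + (u ^ 4 * x ^ 2) * h.h₂ -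
    u ^ 3 * y * h.h₃ + u ^ 2 * x * h.h₄ + h.h₆)

/-- The map on points induced by a change of variables. -/
def toFun [W.IsElliptic] (h : Chg W' W u r s t) : W'.Point → W.Point
  | 0 => 0
  | some x y hxy => some (u ^ 2 * x + r) (u ^ 3 * y + u ^ 2 * s * x + t)
      (equation_iff_nonsingular.1 (h.equation hxy.1))

variable [DecidableEq K] [W.IsElliptic]

lemma slope (h : Chg W' W u r s t) {x₁ x₂ y₁ y₂ : K} (hxy : ¬(x₁ = x₂ ∧ y₁ = W'.negY x₂ y₂))
    (h₁ : W'.Equation x₁ y₁) (h₂ : W'.Equation x₂ y₂) :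
    W.slope (u ^ 2 * x₁ + r) (u ^ 2 * x₂ + r) (u ^ 3 * y₁ + u ^ 2 * s * x₁ + t)
      (u ^ 3 * y₂ + u ^ 2 * s * x₂ + t) = u * W'.slope x₁ x₂ y₁ y₂ + s := by
  have hu := h.ne
  by_cases hx : x₁ = x₂
  · subst hx
    have hy : y₁ ≠ W'.negY x₁ y₂ := fun hy => hxy ⟨rfl, hy⟩
    obtain rfl : y₁ = y₂ := Y_eq_of_Y_ne h₁ h₂ rfl hy
    have e : (u ^ 3 * y₁ + u ^ 2 * s * x₁ + t) - W.negY (u ^ 2 * x₁ + r)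
        (u ^ 3 * y₁ + u ^ 2 * s * x₁ + t) = u ^ 3 * (y₁ - W'.negY x₁ y₁) := by
      simp only [negY]
      linear_combination -u ^ 2 * x₁ * h.h₁ - h.h₃
    have hne : y₁ - W'.negY x₁ y₁ ≠ 0 := sub_ne_zero.2 hy
    rw [slope_of_Y_ne rfl, slope_of_Y_ne rfl hy, e]
    · rw [div_eq_iff (mul_ne_zero (pow_ne_zero _ hu) hne), add_mul,
        show ∀ q w : K, u * (q / w) * (u ^ 3 * w) = u ^ 4 * (q / w * w) by intros; ring,
        div_mul_cancel₀ _ hne]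
      simp only [negY]
      linear_combination (u ^ 3 * y₁ - s * u ^ 2 * x₁) * h.h₁ - 2 * u ^ 2 * x₁ * h.h₂ - h.h₄ - s * h.h₃
    · rw [← sub_ne_zero, e]
      exact mul_ne_zero (pow_ne_zero _ hu) hne
  · have hx' : u ^ 2 * x₁ + r ≠ u ^ 2 * x₂ + r := by
      intro h
      exact hx (mul_left_cancel₀ (pow_ne_zero 2 hu) (add_right_cancel h))
    have := sub_ne_zero.2 hx
    rw [slope_of_X_ne hx', slope_of_X_ne hx,
      show u ^ 2 * x₁ + r - (u ^ 2 * x₂ + r) = u ^ 2 * (x₁ - x₂) by ring]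
    field_simp
    ring

/-- The isomorphism on points induced by a change of variables. -/
def hom (h : Chg W' W u r s t) : W'.Point →+ W.Point where
  toFun := h.toFun
  map_zero' := rfl
  map_add' P Q := by
    rcases P with _ | ⟨x₁, y₁, h₁⟩
    · exact (congrArg h.toFun (zero_add Q)).trans (zero_add _).symm
    rcases Q with _ | ⟨x₂, y₂, h₂⟩
    · exact (congrArg h.toFun (add_zero _)).trans (add_zero _).symm
    have e : ∀ x y, W.negY (u ^ 2 * x + r) (u ^ 3 * y + u ^ 2 * s * x + t) =
        u ^ 3 * W'.negY x y + u ^ 2 * s * x + t := by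
      intro x y
      simp only [negY]
      linear_combination u ^ 2 * x * h.h₁ + h.h₃
    by_cases hxy : x₁ = x₂ ∧ y₁ = W'.negY x₂ y₂
    · rw [add_of_Y_eq hxy.1 hxy.2]
      refine Eq.symm (add_of_Y_eq ?_ ?_)
      · rw [hxy.1]
      · rw [e, hxy.1, hxy.2]
    · have hxy' : ¬(u ^ 2 * x₁ + r = u ^ 2 * x₂ + r ∧ u ^ 3 * y₁ + u ^ 2 * s * x₁ + t =
          W.negY (u ^ 2 * x₂ + r) (u ^ 3 * y₂ + u ^ 2 * s * x₂ + t)) := by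
        rintro ⟨hx, hy⟩
        have hx := mul_left_cancel₀ (pow_ne_zero 2 h.ne) (add_right_cancel hx)
        rw [e, hx] at hy
        exact hxy ⟨hx, mul_left_cancel₀ (pow_ne_zero 3 h.ne)
          (add_right_cancel (add_right_cancel hy))⟩
      rw [add_some hxy]
      simp only [toFun]
      rw [add_some hxy']
      simp only [some.injEq, h.slope hxy h₁.1 h₂.1, addX, addY, negAddY, negY]
      constructor
      · linear_combination W'.slope x₁ x₂ y₁ y₂ * u * h.h₁ - h.h₂
      · set l := W'.slope x₁ x₂ y₁ y₂
        linear_combination (-u^2*(l^2 + W'.a₁*l - W'.a₂ - x₁ - x₂) - (u*l+s+u*l+s+W.a₁ - s-u*l)*l*u+l*u*s - l * u * s) * h.h₁ - h.h₃ + (u * l + W.a₁ + s) * h.h₂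

lemma hom_some (h : Chg W' W u r s t) {x y : K} (hxy : W'.Nonsingular x y) :
    h.hom (some x y hxy) = some (u ^ 2 * x + r) (u ^ 3 * y + u ^ 2 * s * x + t)
      (equation_iff_nonsingular.1 (h.equation hxy.1)) := rfl

lemma hom_ne_zero (h : Chg W' W u r s t) {P : W'.Point} (hP : P ≠ 0) : h.hom P ≠ 0 := by
  obtain ⟨x, y, hxy, rfl⟩ := exists_eq_some hP
  rw [hom_some]
  rintro ⟨⟩

lemma xc_hom (h : Chg W' W u r s t) {P : W'.Point} (hP : P ≠ 0) :
    xc (h.hom P) = u ^ 2 * xc P + r := by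
  obtain ⟨x, y, hxy, rfl⟩ := exists_eq_some hP
  rfl

lemma yc_hom (h : Chg W' W u r s t) {P : W'.Point} (hP : P ≠ 0) :
    yc (h.hom P) = u ^ 3 * yc P + u ^ 2 * s * xc P + t := by
  obtain ⟨x, y, hxy, rfl⟩ := exists_eq_some hP
  rfl

lemma hom_injective (h : Chg W' W u r s t) : Function.Injective h.hom := by
  rw [injective_iff_map_eq_zero]
  intro P hP
  by_contra h0
  exact h.hom_ne_zero h0 hP

lemma hom_surjective [W'.IsElliptic] (h : Chg W' W u r s t) : Function.Surjective h.hom := by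
  intro P
  by_cases hP : P = 0
  · exact ⟨0, by rw [hP]; rfl⟩
  obtain ⟨x, y, hxy, rfl⟩ := exists_eq_some hP
  have hu := h.ne
  have e1 : u ^ 2 * ((x - r) / u ^ 2) + r = x := by field_simp; ring
  have e2 : u ^ 3 * ((y - s * (x - r) - t) / u ^ 3) + u ^ 2 * s * ((x - r) / u ^ 2) + t = y := by
    field_simp; ring
  have := hxy.1
  rw [← e1, ← e2] at this
  rw [e1] at this
  refine ⟨some ((x - r) / u ^ 2) ((y - s * (x - r) - t) / u ^ 3)
    (equation_iff_nonsingular.1 (h.equation_symm (by rw [e1]; exact this))), ?_⟩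
  rw [hom_some]
  simp [e1, e2]

lemma hom_neg (h : Chg W' W u r s t) : h.neg.hom = -h.hom := by
  ext P
  by_cases hP : P = 0
  · rw [hP, _root_.map_zero, _root_.map_zero]
  · have h1 := h.hom_ne_zero hP
    rw [AddMonoidHom.neg_apply]
    refine ext_coords (h.neg.hom_ne_zero hP) (neg_ne_zero.2 h1) ?_ ?_
    · rw [xc_neg, xc_hom _ hP, xc_hom _ hP]; ring
    · rw [yc_neg h1, xc_hom _ hP, yc_hom _ hP, yc_hom _ hP]; ring

end Chg

end WeierstrassCurve.Affine.Point

end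

section

open Polynomial Filter

lemma AddSubgroup.eq_top_of_eventually {G : Type*} [AddCommGroup G] [Infinite G] {H : AddSubgroup G}
    (h : ∀ᶠ Q in cofinite, Q ∈ H) : H = ⊤ := by
  refine eq_top_iff.2 fun Q _ => ?_
  have h2 : Tendsto (fun R : G => Q - R) cofinite cofinite :=
    Function.Injective.tendsto_cofinite fun a b hab => by simpa using hab
  obtain ⟨R, hR, hR'⟩ := (h.and (h2.eventually h)).exists
  have := H.add_mem hR hR'
  rwa [add_sub_cancel] at this

lemma AddSubgroup.eq_top_or_eq_top_of_eventually {G : Type*} [AddCommGroup G] [Infinite G]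
    {H₁ H₂ : AddSubgroup G} (h : ∀ᶠ Q in cofinite, Q ∈ H₁ ∨ Q ∈ H₂) : H₁ = ⊤ ∨ H₂ = ⊤ := by
  by_cases h1 : H₂ ≤ H₁
  · exact Or.inl (eq_top_of_eventually (h.mono fun Q hQ => hQ.elim id fun h => h1 h))
  · obtain ⟨a, ha2, ha1⟩ := SetLike.not_le_iff_exists.1 h1
    refine Or.inr (eq_top_of_eventually ?_)
    have h2 : Tendsto (fun R : G => R + a) cofinite cofinite :=
      (add_left_injective a).tendsto_cofinite
    filter_upwards [h, h2.eventually h] with Q hQ hQa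
    rcases hQ with hQ | hQ
    · rcases hQa with hQa | hQa
      · exact absurd ((H₁.add_mem_cancel_left hQ).1 hQa) ha1
      · exact (H₂.add_mem_cancel_right ha2).1 hQa
    · exact hQ

namespace WeierstrassCurve.Affine.Point

variable {K : Type*} [Field K] {W W₁ W₂ : WeierstrassCurve.Affine K} {u r s t : K}

lemma Chg.comp_scale (h : Chg W₁ W 1 0 s t) (h' : Chg W W₂ u r 0 0) :
    Chg W₁ W₂ u r (u * s) (u ^ 3 * t) where
  ne := h'.ne
  h₁ := by linear_combination u * h.h₁ + h'.h₁
  h₂ := by linear_combination u ^ 2 * h.h₂ + h'.h₂ - u * s * h'.h₁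
  h₃ := by linear_combination u ^ 3 * h.h₃ + h'.h₃
  h₄ := by linear_combination u ^ 4 * h.h₄ + h'.h₄ - u * s * h'.h₃ - u ^ 3 * t * h'.h₁
  h₆ := by linear_combination u ^ 6 * h.h₆ + h'.h₆ - u ^ 3 * t * h'.h₃

variable [IsAlgClosed K]

lemma exists_root_quadratic (b c : K) : ∃ z : K, z ^ 2 + b * z + c = 0 := by
  have hf : (X ^ 2 + C b * X + C c).degree ≠ 0 := by
    have : (X ^ 2 + C b * X + C c).degree = 2 := by compute_degree!
    simp [this]
  obtain ⟨y, hy⟩ := IsAlgClosed.exists_root _ hf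
  exact ⟨y, by simpa using hy⟩

lemma exists_chg_of_b_eq [W₁.IsElliptic] (h2 : W₁.b₂ = W₂.b₂) (h4 : W₁.b₄ = W₂.b₄)
    (h6 : W₁.b₆ = W₂.b₆) (h8 : W₁.b₈ = W₂.b₈) : ∃ s t, Chg W₁ W₂ 1 0 s t := by
  have hΔ := W₁.isUnit_Δ.ne_zero
  rw [Δ] at hΔ
  simp only [b₂, b₄, b₆, b₈] at h2 h4 h6 h8 hΔ
  by_cases hc : (2 : K) = 0
  · have hsub : ∀ a b : K, a ^ 2 = b ^ 2 → a = b := by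
      intro a b hab
      have : (a - b) ^ 2 = 0 := by linear_combination hab - b * (a - b) * hc
      exact sub_eq_zero.1 (pow_eq_zero_iff two_ne_zero |>.1 this)
    have e1 : W₁.a₁ = W₂.a₁ := hsub _ _ (by linear_combination h2 - 2 * (W₁.a₂ - W₂.a₂) * hc)
    have e3 : W₁.a₃ = W₂.a₃ := hsub _ _ (by linear_combination h6 - 2 * (W₁.a₆ - W₂.a₆) * hc)
    rw [← e1, ← e3] at h8
    by_cases ha : W₁.a₁ = 0
    · have ha3 : W₁.a₃ ≠ 0 := by
        intro h3
        rw [ha, h3] at hΔ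
        apply hΔ
        ring_nf
        linear_combination (-(W₁.a₂ ^ 2 * -W₁.a₄ ^ 2 * 8) - W₁.a₄ ^ 3 * 32 - W₁.a₆ ^ 2 * 216
          + W₁.a₂ * W₁.a₄ * W₁.a₆ * 144 - 32 * W₁.a₂ ^ 3 * W₁.a₆) * hc
      obtain ⟨s, hs⟩ : ∃ s, s * W₁.a₃ = W₂.a₄ - W₁.a₄ := ⟨(W₂.a₄ - W₁.a₄) / W₁.a₃, by field_simp⟩
      obtain ⟨t, ht⟩ := exists_root_quadratic W₁.a₃ (W₁.a₆ - W₂.a₆)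
      refine ⟨s, t, one_ne_zero, ?_, ?_, ?_, ?_, ?_⟩
      · rw [← e1]; linear_combination -s * hc
      · rw [← e1, ha]
        rw [ha] at h8
        have : W₁.a₃ ^ 2 * (W₁.a₂ - W₂.a₂ + s ^ 2) = 0 := by
          linear_combination h8 + (s * W₁.a₃ + (W₂.a₄ - W₁.a₄)) * hs +
            (W₁.a₄ * W₁.a₄ + 2 * W₂.a₂ * W₂.a₆ - 2 * W₁.a₂ * W₁.a₆ - W₁.a₄ * W₂.a₄) * hc
        have := (mul_eq_zero.1 this).resolve_left (pow_ne_zero _ ha3)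
        linear_combination this
      · rw [← e3]; linear_combination -t * hc
      · rw [← e1, ← e3, ha]; linear_combination hs + (s * t) * hc
      · rw [← e1, ← e3, ha]; linear_combination ht
    · obtain ⟨s, hs⟩ := exists_root_quadratic W₁.a₁ (W₁.a₂ - W₂.a₂)
      obtain ⟨t, ht⟩ : ∃ t, t * W₁.a₁ = W₂.a₄ - W₁.a₄ - s * W₁.a₃ :=
        ⟨(W₂.a₄ - W₁.a₄ - s * W₁.a₃) / W₁.a₁, by field_simp⟩
      refine ⟨s, t, one_ne_zero, ?_, ?_, ?_, ?_, ?_⟩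
      · rw [← e1]; linear_combination -s * hc
      · rw [← e1]; linear_combination hs
      · rw [← e3]; linear_combination -t * hc
      · rw [← e1, ← e3]; linear_combination ht + s * t * hc
      · rw [← e1, ← e3]
        have : W₁.a₁ ^ 2 * (W₁.a₆ - W₂.a₆ + t * W₁.a₃ + t ^ 2) = 0 := by
          linear_combination h8 + (t * W₁.a₁ + (W₂.a₄ - W₁.a₄ - s * W₁.a₃) + W₁.a₁ * W₁.a₃) * ht - W₁.a₃ ^ 2 * hs + ((-2) * W₁.a₂ * W₁.a₆ + W₁.a₄^2 + 2 * W₂.a₂ * W₂.a₆ + (-1) * W₁.a₄ * W₂.a₄ + (-1) * W₁.a₃ * W₂.a₄ * s + W₁.a₃ * W₁.a₄ * s + W₁.a₃^2 * s^2) * hc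
        have := (mul_eq_zero.1 this).resolve_left (pow_ne_zero _ ha)
        linear_combination this
  · refine ⟨(W₁.a₁ - W₂.a₁) / 2, (W₁.a₃ - W₂.a₃) / 2, one_ne_zero, ?_, ?_, ?_, ?_, ?_⟩
    · field_simp; ring
    · field_simp; linear_combination h2
    · field_simp; ring
    · field_simp; linear_combination h4
    · field_simp; linear_combination h6

variable [DecidableEq K] [W₁.IsElliptic] [W₂.IsElliptic]

lemma exists_chg_of_xc_eq (ψ : W₁.Point →+ W₂.Point) (hψ : HasX ψ 1 X 1) :
    ∃ s t, Chg W₁ W₂ 1 0 s t := by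
  have hD : W₁.dupl * W₂.psi = W₂.dupl * W₁.psi := by
    refine eq_of_eventually (W := W₁) ?_
    filter_upwards [hψ.ev, (hψ.tendsto one_ne_zero).eventually hasX_two.ev, hasX_two.ev,
      (hasX_two.tendsto four_ne_zero).eventually hψ.ev] with P h1 h2 h3 h4
    obtain ⟨-, -, h1⟩ := h1
    obtain ⟨-, -, h2⟩ := h2
    obtain ⟨-, -, h3⟩ := h3
    obtain ⟨-, -, h4⟩ := h4
    rw [eval_one, eval_X, mul_one] at h1 h4
    rw [map_nsmul] at h4
    rw [h1] at h2
    rw [eval_mul, eval_mul, ← h2, ← h3, h4]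
    ring
  obtain ⟨g, hg⟩ := (primTuple_dupl_psi W₁).exists_mul (N := ![W₂.dupl, W₂.psi]) (by
    intro i j
    fin_cases i <;> fin_cases j <;> simp [mul_comm, hD])
  have h0 : W₂.dupl = g * W₁.dupl := hg 0
  have h1 : W₂.psi = g * W₁.psi := hg 1
  have hg1 : g = 1 := by
    have hm : ∀ W : WeierstrassCurve K, W.dupl.Monic := fun W => by
      rw [Monic, leadingCoeff, natDegree_dupl]
      simp [dupl]
    have hgm : g.Monic := (hm W₁).of_mul_monic_right (h0 ▸ hm W₂)
    refine hgm.natDegree_eq_zero.1 ?_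
    have := congr_arg natDegree h0
    rw [hgm.natDegree_mul (hm W₁), natDegree_dupl, natDegree_dupl] at this
    omega
  rw [hg1, one_mul] at h0 h1
  have c1 := congr_arg (coeff · 2) h1
  have c2 := congr_arg (coeff · 0) h1
  have c3 := congr_arg (coeff · 2) h0
  have c4 := congr_arg (coeff · 0) h0
  simp [psi, dupl, coeff_X, coeff_C] at c1 c2 c3 c4
  exact exists_chg_of_b_eq c1.symm c3.symm c2.symm c4.symm

lemma hom_eq_or_eq_neg {φ ψ : W₁.Point →+ W₂.Point}
    (h : ∀ᶠ P in cofinite, φ P ≠ 0 ∧ ψ P ≠ 0 ∧ xc (φ P) = xc (ψ P)) : φ = ψ ∨ φ = -ψ := by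
  have := AddSubgroup.eq_top_or_eq_top_of_eventually (H₁ := (φ - ψ).ker) (H₂ := (φ + ψ).ker) (by
    filter_upwards [h] with P ⟨h1, h2, h3⟩
    rcases eq_or_eq_neg_of_xc_eq h1 h2 h3 with h | h
    · exact Or.inl (by simp [AddMonoidHom.mem_ker, h])
    · exact Or.inr (by simp [AddMonoidHom.mem_ker, h]))
  rcases this with h | h
  · exact Or.inl (sub_eq_zero.1 (AddMonoidHom.ker_eq_top_iff.1 h))
  · exact Or.inr (eq_neg_of_add_eq_zero_left (AddMonoidHom.ker_eq_top_iff.1 h))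

/-- A homomorphism acting on `x`-coordinates by an affine map is a change of variables. -/
lemma exists_chg_hom_eq (ψ : W₁.Point →+ W₂.Point) {a b : K} (ha : a ≠ 0)
    (hψ : ∀ᶠ P in cofinite, ψ P ≠ 0 ∧ xc (ψ P) = a * xc P + b) :
    ∃ u r s t, ∃ h : Chg W₁ W₂ u r s t, ψ = h.hom := by
  obtain ⟨u, hu⟩ := IsAlgClosed.exists_pow_nat_eq a two_pos
  have hu0 : u ≠ 0 := by rintro rfl; simp at hu; exact ha hu.symm
  set D : VariableChange K := ⟨Units.mk0 u hu0, b, 0, 0⟩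
  have hD : Chg (D • W₂) W₂ u b 0 0 := Chg.of_variableChange D W₂
  let e := AddEquiv.ofBijective hD.hom ⟨hD.hom_injective, hD.hom_surjective⟩
  have he : ∀ P, hD.hom (e.symm P) = P := e.apply_symm_apply
  have hX : HasX ((e.symm : W₂.Point →+ (D • W₂).toAffine.Point).comp ψ) 1 X 1 := by
    refine ⟨(hasX_id (W := W₁)).prim, ?_⟩
    filter_upwards [hψ] with P ⟨h1, h2⟩
    have h3 : e.symm (ψ P) ≠ 0 := by simpa using h1
    refine ⟨h3, by simp, ?_⟩
    have := hD.xc_hom h3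
    rw [he, h2, hu] at this
    simpa using mul_left_cancel₀ ha (add_right_cancel this).symm
  obtain ⟨s, t, hst⟩ := exists_chg_of_xc_eq _ hX
  have hc := hst.comp_scale hD
  have := hom_eq_or_eq_neg (φ := ψ) (ψ := hc.hom) (by
    filter_upwards [hψ, eventually_ne 0] with P ⟨h1, h2⟩ h3
    exact ⟨h1, hc.hom_ne_zero h3, by rw [hc.xc_hom h3, hu, h2]⟩)
  rcases this with h | h
  · exact ⟨_, _, _, _, hc, h⟩
  · exact ⟨_, _, _, _, hc.neg, by rw [hc.hom_neg, h]⟩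

end WeierstrassCurve.Affine.Point

end

section

open Polynomial Filter

namespace WeierstrassCurve.Affine.Point

section mapHom

variable {K L : Type*} [Field K] [Field L] {W : WeierstrassCurve.Affine K} (σ : K →+* L)

/-- The map on points induced by a homomorphism of fields. -/
def mapFun (W : WeierstrassCurve.Affine K) : W.Point → (W.map σ).toAffine.Point
  | 0 => 0
  | some x y h => some (σ x) (σ y) ((W.map_nonsingular σ.injective x y).2 h)

variable [DecidableEq K] [DecidableEq L]

/-- The homomorphism on points induced by a homomorphism of fields. -/
def mapHom (W : WeierstrassCurve.Affine K) : W.Point →+ (W.map σ).toAffine.Point where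
  toFun := mapFun σ W
  map_zero' := rfl
  map_add' P Q := by
    rcases P with _ | ⟨x₁, y₁, h₁⟩
    · exact (congrArg (mapFun σ W) (zero_add Q)).trans (zero_add _).symm
    rcases Q with _ | ⟨x₂, y₂, h₂⟩
    · exact (congrArg (mapFun σ W) (add_zero _)).trans (add_zero _).symm
    by_cases hxy : x₁ = x₂ ∧ y₁ = W.negY x₂ y₂
    · rw [add_of_Y_eq hxy.1 hxy.2]
      refine Eq.symm (add_of_Y_eq ?_ ?_)
      · rw [hxy.1]
      · rw [map_negY, hxy.2]
    · have hxy' : ¬(σ x₁ = σ x₂ ∧ σ y₁ = (W.map σ).toAffine.negY (σ x₂) (σ y₂)) := by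
        rw [map_negY]
        exact fun h => hxy ⟨σ.injective h.1, σ.injective h.2⟩
      rw [add_some hxy]
      simp only [mapFun]
      rw [add_some hxy']
      simp only [map_slope, map_addX, map_addY]

lemma mapHom_some {x y : K} (h : W.Nonsingular x y) :
    mapHom σ W (some x y h) = some (σ x) (σ y) ((W.map_nonsingular σ.injective x y).2 h) := rfl

lemma mapHom_injective : Function.Injective (mapHom σ W) := by
  rw [injective_iff_map_eq_zero]
  rintro P hP
  by_contra h
  obtain ⟨x, y, h, rfl⟩ := exists_eq_some h
  rw [mapHom_some] at hP
  exact some_ne_zero _ hP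

@[simp] lemma mapHom_eq_zero {P : W.Point} : mapHom σ W P = 0 ↔ P = 0 :=
  map_eq_zero_iff _ (mapHom_injective σ)

@[simp] lemma xc_mapHom (P : W.Point) : xc (mapHom σ W P) = σ (xc P) := by
  by_cases h : P = 0
  · simp [h]
  obtain ⟨x, y, h, rfl⟩ := exists_eq_some h
  rw [mapHom_some, xc_some, xc_some]

@[simp] lemma yc_mapHom {P : W.Point} (hP : P ≠ 0) : yc (mapHom σ W P) = σ (yc P) := by
  obtain ⟨x, y, h, rfl⟩ := exists_eq_some hP
  rw [mapHom_some, yc_some, yc_some]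

end mapHom

namespace Chg

variable {K : Type*} [Field K] {W W' W'' : WeierstrassCurve.Affine K} {u r s t u' r' s' t' : K}

lemma comp (h : Chg W' W u r s t) (h' : Chg W'' W' u' r' s' t') :
    Chg W'' W (u * u') (u ^ 2 * r' + r) (u * s' + s) (u ^ 3 * t' + u ^ 2 * s * r' + t) where
  ne := mul_ne_zero h.ne h'.ne
  h₁ := by linear_combination u * h'.h₁ + h.h₁
  h₂ := by linear_combination u ^ 2 * h'.h₂ + h.h₂ - u * s' * h.h₁
  h₃ := by linear_combination u ^ 3 * h'.h₃ + h.h₃ + u ^ 2 * r' * h.h₁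
  h₄ := by
    linear_combination u ^ 4 * h'.h₄ + h.h₄ + 2 * u ^ 2 * r' * h.h₂ - u * s' * h.h₃ -
      (u ^ 3 * t' + u ^ 3 * r' * s') * h.h₁
  h₆ := by
    linear_combination u ^ 6 * h'.h₆ + h.h₆ + u ^ 2 * r' * h.h₄ + u ^ 4 * r' ^ 2 * h.h₂ -
      u ^ 3 * t' * h.h₃ - u ^ 5 * r' * t' * h.h₁

lemma map {L : Type*} [Field L] (σ : K →+* L) (h : Chg W' W u r s t) :
    Chg (W'.map σ).toAffine (W.map σ).toAffine (σ u) (σ r) (σ s) (σ t) where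
  ne := by simpa using h.ne
  h₁ := by
    have := congr_arg σ h.h₁
    simp only [_root_.map_add, _root_.map_mul, map_ofNat] at this
    exact this
  h₂ := by
    have := congr_arg σ h.h₂
    simp only [_root_.map_add, _root_.map_mul, _root_.map_sub, _root_.map_pow, map_ofNat] at this
    exact this
  h₃ := by
    have := congr_arg σ h.h₃
    simp only [_root_.map_add, _root_.map_mul, _root_.map_pow, map_ofNat] at this
    exact this
  h₄ := by
    have := congr_arg σ h.h₄
    simp only [_root_.map_add, _root_.map_mul, _root_.map_sub, _root_.map_pow, map_ofNat] at this
    exact this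
  h₆ := by
    have := congr_arg σ h.h₆
    simp only [_root_.map_add, _root_.map_mul, _root_.map_sub, _root_.map_pow] at this
    exact this

lemma eq_of (h : Chg W' W u r s t) (h' : Chg W'' W u r s t) : W' = W'' := by
  have hu := h.ne
  ext
  · exact mul_left_cancel₀ hu (h.h₁.trans h'.h₁.symm)
  · exact mul_left_cancel₀ (pow_ne_zero _ hu) (h.h₂.trans h'.h₂.symm)
  · exact mul_left_cancel₀ (pow_ne_zero _ hu) (h.h₃.trans h'.h₃.symm)
  · exact mul_left_cancel₀ (pow_ne_zero _ hu) (h.h₄.trans h'.h₄.symm)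
  · exact mul_left_cancel₀ (pow_ne_zero _ hu) (h.h₆.trans h'.h₆.symm)

lemma of_eq (h : W' = W) : Chg W' W 1 0 0 0 := by
  subst h; constructor <;> simp

variable [DecidableEq K] [IsAlgClosed K] [W.IsElliptic]

lemma hasDeg_hom [W'.IsElliptic] (h : Chg W' W u r s t) : HasDeg h.hom 1 := by
  refine HasX.hasDeg (A := C (u ^ 2) * X + C r) (B := 1) one_ne_zero ⟨⟨?_, ?_, ?_⟩, ?_⟩
  · intro i
    fin_cases i
    · simp only [Fin.zero_eta, Matrix.cons_val_zero]
      compute_degree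
    · simp
  · exact fun z => ⟨1, by simp⟩
  · exact ⟨0, by simpa [coeff_C, -_root_.map_pow] using h.ne⟩
  · filter_upwards [eventually_ne 0] with P hP
    exact ⟨h.hom_ne_zero hP, by simp, by simp [h.xc_hom hP]⟩

/-- A change of variables as an isomorphism of groups of points. -/
noncomputable def equiv [W'.IsElliptic] (h : Chg W' W u r s t) : W'.Point ≃+ W.Point :=
  AddEquiv.ofBijective h.hom ⟨h.hom_injective, h.hom_surjective⟩

lemma hasDeg_equiv_symm [W'.IsElliptic] (h : Chg W' W u r s t) :
    HasDeg (h.equiv.symm : W.Point →+ W'.Point) 1 := by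
  have hu := h.ne
  refine HasX.hasDeg (A := X - C r) (B := C (u ^ 2)) one_ne_zero ⟨⟨?_, ?_, ?_⟩, ?_⟩
  · intro i
    fin_cases i
    · simp only [Fin.zero_eta, Matrix.cons_val_zero]
      compute_degree
    · simp
  · exact fun z => ⟨1, by simpa using hu⟩
  · exact ⟨0, by simp⟩
  · filter_upwards [eventually_ne 0] with P hP
    have h1 : h.equiv.symm P ≠ 0 := by simpa using hP
    refine ⟨h1, by simpa using hu, ?_⟩
    have := h.xc_hom h1
    rw [show h.hom (h.equiv.symm P) = P from h.equiv.apply_symm_apply P] at this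
    simp [this]
    ring

end Chg

end WeierstrassCurve.Affine.Point

end

section

open Polynomial Filter

namespace WeierstrassCurve.Affine.Point

variable {k : Type*} [Field k]

/-- The polynomial in `x` giving `yⁿ + ȳⁿ`, where `y` and `ȳ` are the two roots of the Weierstrass
equation at `x`. -/
noncomputable def traceY (W : WeierstrassCurve.Affine k) : ℕ → k[X]
  | 0 => 2
  | 1 => -(C W.a₁ * X + C W.a₃)
  | n + 2 => -(C W.a₁ * X + C W.a₃) * traceY W (n + 1) +
      (X ^ 3 + C W.a₂ * X ^ 2 + C W.a₄ * X + C W.a₆) * traceY W n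

lemma eval_traceY [DecidableEq k] {W : WeierstrassCurve.Affine k} {P : W.Point} (hP : P ≠ 0) (n : ℕ) :
    (traceY W n).eval (xc P) = yc P ^ n + yc (-P) ^ n := by
  have e := equation_coords hP
  induction n using Nat.twoStepInduction with
  | zero => simp [traceY]; norm_num
  | one => simp [traceY, yc_neg hP]; ring
  | more n h0 h1 =>
    simp only [traceY, eval_add, eval_mul, eval_neg, eval_C, eval_X, eval_pow, h0, h1, yc_neg hP]
    ring_nf at e ⊢
    linear_combination -(yc P ^ n + (-yc P - xc P * W.a₁ - W.a₃) ^ n) * e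

lemma natDegree_traceY_le (W : WeierstrassCurve.Affine k) (n : ℕ) :
    2 * (traceY W n).natDegree ≤ 3 * n := by
  induction n using Nat.twoStepInduction with
  | zero => simp [traceY]
  | one =>
    have : (traceY W 1).natDegree ≤ 1 := by unfold traceY; compute_degree
    omega
  | more n h0 h1 =>
    have h2 : (-(C W.a₁ * X + C W.a₃) : k[X]).natDegree ≤ 1 := by compute_degree
    have h3 : (X ^ 3 + C W.a₂ * X ^ 2 + C W.a₄ * X + C W.a₆ : k[X]).natDegree ≤ 3 := by
      compute_degree
    have h4 := natDegree_add_le_of_le (natDegree_mul_le_of_le h2 (le_refl (traceY W (n+1)).natDegree))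
      (natDegree_mul_le_of_le h3 (le_refl (traceY W n).natDegree))
    change (traceY W (n + 2)).natDegree ≤ _ at h4
    omega

/-- The numerator of `x(P - π P)`, where `π` is the `q`-power Frobenius. -/
noncomputable def oneSubNum (W : WeierstrassCurve.Affine k) (q : ℕ) : k[X] :=
  X ^ (2 * q + 1) + (X ^ (q + 2) + C (2 * W.a₂) * X ^ (q + 1) + C W.a₄ * X ^ q + C W.a₄ * X
    + C (2 * W.a₆) + traceY W (q + 1))

lemma natDegree_oneSubNum (W : WeierstrassCurve.Affine k) {q : ℕ} (hq : 2 ≤ q) :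
    (oneSubNum W q).natDegree = 2 * q + 1 := by
  have h : (X ^ (q + 2) + C (2 * W.a₂) * X ^ (q + 1) + C W.a₄ * X ^ q + C W.a₄ * X
    + C (2 * W.a₆) + traceY W (q + 1)).natDegree ≤ 2 * q := by
    have h0 := natDegree_traceY_le W (q + 1)
    refine natDegree_add_le_of_degree_le ?_ (by omega)
    compute_degree
    all_goals omega
  unfold oneSubNum
  rw [natDegree_add_eq_left_of_natDegree_lt, natDegree_X_pow]
  rw [natDegree_X_pow]
  omega

variable [DecidableEq k] {W : WeierstrassCurve.Affine k}

/-- An endomorphism raising coordinates to the `q`-th power. -/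
def IsFrob (π : W.Point →+ W.Point) (q : ℕ) : Prop :=
  ∀ P, P ≠ 0 → π P ≠ 0 ∧ xc (π P) = xc P ^ q ∧ yc (π P) = yc P ^ q

lemma IsFrob.xc_sub {π : W.Point →+ W.Point} {q : ℕ} (h : IsFrob π q) {P : W.Point} (hP : P ≠ 0)
    (hx : xc P ≠ xc P ^ q) :
    xc (P - π P) * (xc P - xc P ^ q) ^ 2 = (oneSubNum W q).eval (xc P) := by
  obtain ⟨h1, h2, h3⟩ := h P hP
  obtain ⟨h1', h2', h3'⟩ := h (-P) (neg_ne_zero.2 hP)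
  have e := xc_sub_mul hP h1 (by rwa [h2])
  have e1 := equation_coords hP
  have e2 := equation_coords h1
  rw [_root_.map_neg, yc_neg h1] at h3'
  rw [← h2, e, oneSubNum]
  simp only [eval_add, eval_mul, eval_C, eval_X, eval_pow, eval_traceY hP, pow_succ (yc P),
    pow_succ (yc (-P)), ← h3', ← h3]
  have p1 : xc P ^ (2 * q + 1) = xc (π P) ^ 2 * xc P := by rw [h2]; ring
  have p2 : xc P ^ (q + 2) = xc (π P) * xc P ^ 2 := by rw [h2]; ring
  have p3 : xc P ^ (q + 1) = xc (π P) * xc P := by rw [h2]; ring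
  rw [p1, p2, p3, ← h2, yc_neg hP]
  linear_combination e1 + e2

/-- A map given by a fraction whose numerator has degree one more than its denominator is separable. -/
lemma exists_hasX_of_natDegree [IsAlgClosed k] [W.IsElliptic] {φ : W.Point → W.Point} {N D : k[X]}
    (hD : D ≠ 0) (hd : N.natDegree = D.natDegree + 1)
    (h : ∀ᶠ P in cofinite, φ P ≠ 0 ∧ xc (φ P) * D.eval (xc P) = N.eval (xc P)) :
    ∃ d A B, d ≠ 0 ∧ HasX φ d A B ∧ derivative A * B - A * derivative B ≠ 0 := by
  have hN : N ≠ 0 := by rintro rfl; simp at hd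
  obtain ⟨A, hA⟩ := EuclideanDomain.gcd_dvd_left N D
  obtain ⟨B, hB⟩ := EuclideanDomain.gcd_dvd_right N D
  set g := EuclideanDomain.gcd N D
  have hg : g ≠ 0 := by rintro h; rw [h, zero_mul] at hA; exact hN hA
  have hA0 : A ≠ 0 := by rintro rfl; exact hN (by simpa using hA)
  have hB0 : B ≠ 0 := by rintro rfl; exact hD (by simpa using hB)
  have hcop : IsCoprime A B := by
    obtain ⟨a, b, hab⟩ : ∃ a b, a * N + b * D = g :=
      by
      refine ⟨EuclideanDomain.gcdA N D, EuclideanDomain.gcdB N D, ?_⟩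
      rw [mul_comm, mul_comm _ D]
      exact (EuclideanDomain.gcd_eq_gcd_ab N D).symm
    refine ⟨a, b, mul_left_cancel₀ hg ?_⟩
    linear_combination hab - a * hA - b * hB
  have hdeg : A.natDegree = B.natDegree + 1 := by
    rw [hA, hB, natDegree_mul hg hA0, natDegree_mul hg hB0] at hd
    omega
  refine ⟨A.natDegree, A, B, by omega, ⟨⟨?_, ?_, ?_⟩, ?_⟩, ?_⟩
  · intro i
    fin_cases i
    · simp
    · simp; omega
  · intro z
    by_contra! h
    obtain ⟨a, b, hab⟩ := hcop
    have h0 := h 0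
    have h1 := h 1
    have := congr_arg (eval z) hab
    simp at h0 h1
    simp [h0, h1] at this
  · exact ⟨0, by simpa using hA0⟩
  · filter_upwards [h, eventually_eval_ne (W := W) hD] with P ⟨h1, h2⟩ h3
    rw [hA, hB, eval_mul, eval_mul] at h2
    rw [hB, eval_mul] at h3
    refine ⟨h1, right_ne_zero_of_mul h3, mul_left_cancel₀ (left_ne_zero_of_mul h3) ?_⟩
    linear_combination h2
  · intro h0
    have h1 := congr_arg (coeff · (A.natDegree - 1 + B.natDegree)) h0
    simp only [coeff_sub, coeff_zero] at h1
    have hA' : (derivative A).natDegree ≤ A.natDegree - 1 := natDegree_derivative_le A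
    by_cases hB1 : B.natDegree = 0
    · have : derivative B = 0 := derivative_of_natDegree_zero hB1
      rw [this, mul_zero, coeff_zero, coeff_mul_add_eq_of_natDegree_le hA' le_rfl, coeff_derivative,
        show A.natDegree - 1 + 1 = A.natDegree by omega, show A.natDegree - 1 = 0 by omega] at h1
      simp [hA0, hB0] at h1
    · have hB' : (derivative B).natDegree ≤ B.natDegree - 1 := natDegree_derivative_le B
      rw [coeff_mul_add_eq_of_natDegree_le hA' le_rfl, show A.natDegree - 1 + B.natDegree =
        A.natDegree + (B.natDegree - 1) by omega, coeff_mul_add_eq_of_natDegree_le le_rfl hB',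
        coeff_derivative, coeff_derivative, show A.natDegree - 1 + 1 = A.natDegree by omega,
        show B.natDegree - 1 + 1 = B.natDegree by omega] at h1
      have h2 : ((A.natDegree - 1 : ℕ) : k) + 1 = A.natDegree := by
        rw [hdeg]; simp
      have h3 : ((B.natDegree - 1 : ℕ) : k) + 1 = B.natDegree := by
        rw [← Nat.cast_add_one, Nat.sub_add_cancel (by omega)]
      rw [h2, h3, hdeg] at h1
      push_cast at h1
      have h4 : A.leadingCoeff * B.leadingCoeff = 0 := by
        rw [leadingCoeff, leadingCoeff, hdeg]
        linear_combination h1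
      simp [hA0, hB0] at h4

lemma IsFrob.exists_hasX_one_sub [IsAlgClosed k] [W.IsElliptic] {π : W.Point →+ W.Point} {q : ℕ}
    (hq : 2 ≤ q) (h : IsFrob π q) :
    ∃ (d : ℕ) (A B : k[X]), d ≠ 0 ∧ HasX (AddMonoidHom.id W.Point - π) d A B ∧
      derivative A * B - A * derivative B ≠ 0 := by
  have hdeg : (X - X ^ q : k[X]).natDegree = q := by
    rw [natDegree_sub_eq_right_of_natDegree_lt, natDegree_X_pow]
    rw [natDegree_X, natDegree_X_pow]
    omega
  have h0 : (X - X ^ q : k[X]) ≠ 0 := by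
    intro h0; rw [h0, natDegree_zero] at hdeg; omega
  refine exists_hasX_of_natDegree (φ := (AddMonoidHom.id _ - π : W.Point →+ W.Point)) (N := oneSubNum W q) (D := (X - X ^ q) ^ 2) (pow_ne_zero _ h0) ?_ ?_
  · rw [natDegree_oneSubNum W hq, natDegree_pow, hdeg]
  · filter_upwards [eventually_ne 0, eventually_eval_ne (W := W) h0] with P hP hx
    have hx : xc P ≠ xc P ^ q := by simpa [sub_eq_zero] using hx
    obtain ⟨h1, h2, -⟩ := h P hP
    exact ⟨sub_ne_zero_of_xc_ne hP h1 (by rwa [h2]), by simpa using h.xc_sub hP hx⟩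

end WeierstrassCurve.Affine.Point

end

section

open Polynomial Filter

lemma FiniteField.exists_algebraMap_eq_of_pow_card_eq {F k : Type*} [Field F] [Fintype F] [Field k]
    [Algebra F k] {x : k} (hx : x ^ Fintype.card F = x) : ∃ y : F, algebraMap F k y = x := by
  classical
  by_contra! h
  have h1 := Fintype.one_lt_card (α := F)
  have hdeg : (X ^ Fintype.card F - X : k[X]).natDegree = Fintype.card F :=
    FiniteField.X_pow_card_sub_X_natDegree_eq k h1
  have h2 := Polynomial.card_le_degree_of_subset_roots (p := (X ^ Fintype.card F - X : k[X]))
    (Z := insert x (Finset.univ.image (algebraMap F k))) (by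
      intro z hz
      rw [Finset.mem_val] at hz
      rw [mem_roots (FiniteField.X_pow_card_sub_X_ne_zero k h1)]
      rcases Finset.mem_insert.1 hz with rfl | hz
      · simp [hx]
      · obtain ⟨y, -, rfl⟩ := Finset.mem_image.1 hz
        simp [← _root_.map_pow, FiniteField.pow_card])
  rw [hdeg, Finset.card_insert_of_notMem (by simpa using h),
    Finset.card_image_of_injective _ (algebraMap F k).injective, Finset.card_univ] at h2
  omega

lemma IsAlgClosed.exists_eq_mul_pow_add {k : Type*} [Field k] [IsAlgClosed k] {q : ℕ} (hq : 2 ≤ q)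
    {a : k} (ha : a ≠ 0) (b : k) : ∃ z, z = a * z ^ q + b := by
  have hd : (C a * X ^ q + (C b - X)).natDegree = q := by
    rw [natDegree_add_eq_left_of_natDegree_lt, natDegree_C_mul_X_pow _ _ ha]
    rw [natDegree_C_mul_X_pow _ _ ha]
    have : (C b - X).natDegree ≤ 1 := by compute_degree
    omega
  obtain ⟨z, hz⟩ := IsAlgClosed.exists_root (C a * X ^ q + (C b - X))
    (fun h => by have := natDegree_eq_of_degree_eq_some (n := 0) h; omega)
  refine ⟨z, ?_⟩
  simp at hz
  linear_combination -hz

namespace WeierstrassCurve.Affine.Point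

variable {F k : Type*} [Field F] [Fintype F] [Field k] [Algebra F k] [DecidableEq F] [DecidableEq k]

lemma IsFrob.card_ker {W₀ : WeierstrassCurve F}
    {π : (W₀.map (algebraMap F k)).toAffine.Point →+ (W₀.map (algebraMap F k)).toAffine.Point}
    (h : IsFrob π (Fintype.card F)) :
    Nat.card W₀.toAffine.Point = Nat.card (AddMonoidHom.id _ - π).ker := by
  have hr : (mapHom (algebraMap F k) W₀.toAffine).range = (AddMonoidHom.id _ - π).ker := by
    ext P
    rw [AddMonoidHom.mem_range, AddMonoidHom.mem_ker, AddMonoidHom.sub_apply, AddMonoidHom.id_apply,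
      sub_eq_zero]
    by_cases hP : P = 0
    · rw [hP]
      exact ⟨fun _ => π.map_zero.symm, fun _ => ⟨0, (mapHom (algebraMap F k) W₀.toAffine).map_zero⟩⟩
    obtain ⟨h1, h2, h3⟩ := h P hP
    constructor
    · rintro ⟨Q, rfl⟩
      have hQ : Q ≠ 0 := by rintro rfl; simp at hP
      refine ext_coords hP h1 ?_ ?_
      · rw [h2, xc_mapHom, ← _root_.map_pow, FiniteField.pow_card]
      · rw [h3, yc_mapHom _ hQ, ← _root_.map_pow, FiniteField.pow_card]
    · intro hPP
      rw [← hPP] at h2 h3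
      obtain ⟨x, hx⟩ := FiniteField.exists_algebraMap_eq_of_pow_card_eq h2.symm
      obtain ⟨y, hy⟩ := FiniteField.exists_algebraMap_eq_of_pow_card_eq h3.symm
      have hn := nonsingular_coords hP
      rw [← hx, ← hy] at hn
      have hn := (W₀.toAffine.map_nonsingular (algebraMap F k).injective x y).1 hn
      refine ⟨some x y hn, ext_coords (by rw [mapHom_some]; exact some_ne_zero _) hP ?_ ?_⟩
      · rw [xc_mapHom, xc_some, hx]
      · rw [yc_mapHom _ (some_ne_zero _), yc_some, hy]
  rw [← hr]
  exact Nat.card_congr (AddMonoidHom.ofInjective (mapHom_injective _)).toEquiv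

variable [IsAlgClosed k]

/-- Change of variables after Frobenius. -/
noncomputable def frobHom (σ : k →+* k) {W : WeierstrassCurve.Affine k} [W.IsElliptic] {u r s t : k}
    (h : Chg (W.map σ).toAffine W u r s t) : W.Point →+ W.Point := h.hom.comp (mapHom σ W)

lemma isFrob_frobHom {σ : k →+* k} {q : ℕ} (hσ : ∀ x, σ x = x ^ q) {W : WeierstrassCurve.Affine k}
    [W.IsElliptic] (h : Chg (W.map σ).toAffine W 1 0 0 0) : IsFrob (frobHom σ h) q := by
  intro P hP
  have hP' : mapHom σ W P ≠ 0 := by simpa using hP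
  refine ⟨h.hom_ne_zero hP', ?_, ?_⟩
  · change xc (h.hom _) = _
    rw [h.xc_hom hP', xc_mapHom, hσ]
    ring
  · change yc (h.hom _) = _
    rw [h.yc_hom hP', yc_mapHom _ hP, hσ]
    ring

/-- A curve with an endomorphism that is Frobenius up to a change of variables has a model over
`F` whose number of points is the degree of `1 - α`. -/
theorem exists_card_eq {σ : k →+* k} (hσ : ∀ x, σ x = x ^ Fintype.card F)
    {W : WeierstrassCurve.Affine k} [W.IsElliptic] {u r s t : k}
    (h : Chg (W.map σ).toAffine W u r s t) {n : ℕ}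
    (hn : HasDeg (AddMonoidHom.id _ - frobHom σ h) n) :
    ∃ W₀ : WeierstrassCurve F, W₀.Δ ≠ 0 ∧ Nat.card W₀.toAffine.Point = n := by
  set q := Fintype.card F
  have hq : 2 ≤ q := Fintype.one_lt_card
  have hu := h.ne
  obtain ⟨U, hU0, hU⟩ : ∃ U : k, U ≠ 0 ∧ U = u * U ^ q := by
    obtain ⟨U, hU⟩ := IsAlgClosed.exists_pow_nat_eq u⁻¹ (n := q - 1) (by omega)
    refine ⟨U, ?_, ?_⟩
    · rintro rfl
      rw [zero_pow (by omega)] at hU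
      exact inv_ne_zero hu hU.symm
    · obtain ⟨m, hm⟩ : ∃ m, q = m + 1 := ⟨q - 1, by omega⟩
      rw [hm] at hU ⊢
      rw [add_tsub_cancel_right] at hU
      rw [pow_succ, hU]
      field_simp
  obtain ⟨R, hR⟩ := IsAlgClosed.exists_eq_mul_pow_add hq (pow_ne_zero 2 hu) r
  obtain ⟨S, hS⟩ := IsAlgClosed.exists_eq_mul_pow_add hq hu s
  obtain ⟨T, hT⟩ := IsAlgClosed.exists_eq_mul_pow_add hq (pow_ne_zero 3 hu) (u ^ 2 * s * R ^ q + t)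
  set D : VariableChange k := ⟨Units.mk0 U hU0, R, S, T⟩
  have hD : Chg (D • W) W U R S T := Chg.of_variableChange D W
  have hDσ := h.comp (hD.map σ)
  have hDeq : Chg ((D • W).map σ).toAffine W U R S T := by
    convert hDσ using 1
    · rw [hσ, ← hU]
    · rw [hσ, ← hR]
    · rw [hσ, ← hS]
    · rw [hσ, hσ, add_assoc, ← hT]
  have hW : (D • W).map σ = D • W := hDeq.eq_of hD
  have h1 : Chg ((D • W).map σ).toAffine (D • W) 1 0 0 0 := Chg.of_eq hW
  obtain ⟨W₀, hW₀⟩ : ∃ W₀ : WeierstrassCurve F, W₀.map (algebraMap F k) = D • W := by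
    rw [WeierstrassCurve.ext_iff] at hW
    simp only [map_a₁, map_a₂, map_a₃, map_a₄, map_a₆, hσ] at hW
    obtain ⟨e1, e2, e3, e4, e6⟩ := hW
    obtain ⟨b1, h1⟩ := FiniteField.exists_algebraMap_eq_of_pow_card_eq e1
    obtain ⟨b2, h2⟩ := FiniteField.exists_algebraMap_eq_of_pow_card_eq e2
    obtain ⟨b3, h3⟩ := FiniteField.exists_algebraMap_eq_of_pow_card_eq e3
    obtain ⟨b4, h4⟩ := FiniteField.exists_algebraMap_eq_of_pow_card_eq e4
    obtain ⟨b6, h6⟩ := FiniteField.exists_algebraMap_eq_of_pow_card_eq e6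
    exact ⟨⟨b1, b2, b3, b4, b6⟩, by ext <;> assumption⟩
  have hfr := isFrob_frobHom hσ h1
  have key : ∀ P, hD.hom (frobHom σ h1 P) = frobHom σ h (hD.hom P) := by
    intro P
    by_cases hP : P = 0
    · simp [hP]
    obtain ⟨f1, f2, f3⟩ := hfr P hP
    have hP' := hD.hom_ne_zero hP
    have hP'' : mapHom σ W (hD.hom P) ≠ 0 := by simpa using hP'
    refine ext_coords (hD.hom_ne_zero f1) (h.hom_ne_zero hP'') ?_ ?_
    · change _ = xc (h.hom _)
      rw [hD.xc_hom f1, f2, h.xc_hom hP'', xc_mapHom, hD.xc_hom hP]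
      simp only [_root_.map_add, _root_.map_mul, _root_.map_pow]
      simp only [hσ]
      linear_combination hR + (U + u * U ^ q) * xc P ^ q * hU
    · change _ = yc (h.hom _)
      rw [hD.yc_hom f1, f2, f3, h.yc_hom hP'', yc_mapHom _ hP', xc_mapHom, hD.xc_hom hP, hD.yc_hom hP]
      simp only [_root_.map_add, _root_.map_mul, _root_.map_pow]
      simp only [hσ]
      linear_combination hT + (U ^ 2 + U * (u * U ^ q) + (u * U ^ q) ^ 2) * yc P ^ q * hU +
        (U + u * U ^ q) * S * xc P ^ q * hU + u ^ 2 * (U ^ q) ^ 2 * xc P ^ q * hS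
  have hfr2 : ∀ W' : WeierstrassCurve k, W' = D • W → ∃ π : W'.toAffine.Point →+ W'.toAffine.Point,
      IsFrob π q ∧ HasDeg (AddMonoidHom.id _ - π) n := by
    rintro _ rfl
    refine ⟨_, hfr, ?_⟩
    have := (hD.hasDeg_equiv_symm.comp hn).comp hD.hasDeg_hom
    rw [one_mul, mul_one] at this
    convert this using 1
    ext P
    apply hD.hom_injective
    change _ = hD.equiv (hD.equiv.symm _)
    rw [AddEquiv.apply_symm_apply]
    simp [key]
  obtain ⟨π, hπ, hπn⟩ := hfr2 _ hW₀
  have hell : (W₀.map (algebraMap F k)).IsElliptic := by rw [hW₀]; infer_instance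
  refine ⟨W₀, ?_, ?_⟩
  · intro h0
    have := (W₀.map (algebraMap F k)).isUnit_Δ.ne_zero
    rw [map_Δ, h0, _root_.map_zero] at this
    exact this rfl
  · obtain ⟨d, A, B, hd, hX, hs⟩ := hπ.exists_hasX_one_sub hq
    rw [hπ.card_ker, hX.card_ker_eq hd hs, hπn.unique (hX.hasDeg hd)]

end WeierstrassCurve.Affine.Point

end

section

open Polynomial Filter

namespace WeierstrassCurve.Affine.Point

variable {k : Type*} [Field k] [DecidableEq k] [IsAlgClosed k] {W₁ W₂ : WeierstrassCurve.Affine k}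
  [W₁.IsElliptic] [W₂.IsElliptic]

/-- A homomorphism acting on `x`-coordinates by a Möbius transformation fixes infinity. -/
lemma eq_zero_of_moebius (ψ : W₁.Point →+ W₂.Point) {a b c d : k} (h : HasX ψ 1 (C a * X + C b) (C c * X + C d)) :
    c = 0 := by
  by_contra hc
  have h0 : (C c * W₁.dupl + C d * W₁.psi) = 0 := by
    refine eq_zero_of_eventually (W := W₁) ?_
    have hD2 : W₂.dupl ≠ 0 := fun h => by have := W₂.natDegree_dupl; simp [h] at this
    filter_upwards [h.ev, (h.tendsto one_ne_zero).eventually (eventually_eval_ne hD2),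
      eventually_ne 0] with Q ⟨h1, h2, h3⟩ h4 hQ0
    set u := xc Q
    set u' := xc (ψ Q)
    have hp : (C (c ^ 2) * ((X * C u) ^ 2 - C W₁.b₄ * (X * C u) - C W₁.b₆ * (X + C u) - C W₁.b₈) +
          C (c * d) * (2 * (X + C u) * (X * C u) + C W₁.b₂ * (X * C u) + C W₁.b₄ * (X + C u) +
            C W₁.b₆) + C (d ^ 2) * (X - C u) ^ 2) *
        (((C a * X + C b) * C u') ^ 2 - C W₂.b₄ * ((C a * X + C b) * (C c * X + C d) * C u') -
          C W₂.b₆ * ((C a * X + C b) * (C c * X + C d) + (C c * X + C d) ^ 2 * C u') -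
          C W₂.b₈ * (C c * X + C d) ^ 2) * C ((c * u + d) ^ 2) =
        (C (a ^ 2) * ((X * C u) ^ 2 - C W₁.b₄ * (X * C u) - C W₁.b₆ * (X + C u) - C W₁.b₈) +
          C (a * b) * (2 * (X + C u) * (X * C u) + C W₁.b₂ * (X * C u) + C W₁.b₄ * (X + C u) +
            C W₁.b₆) + C (b ^ 2) * (X - C u) ^ 2) * C ((a * d - b * c) ^ 2) * (X - C u) ^ 2 := by
      refine eq_of_eventually (W := W₁) ?_
      have t1 : Tendsto (fun R => R + Q) cofinite cofinite :=
        (add_left_injective Q).tendsto_cofinite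
      have t2 : Tendsto (fun R => R - Q) cofinite cofinite :=
        (sub_left_injective (b := Q)).tendsto_cofinite
      filter_upwards [h.ev, t1.eventually h.ev, t2.eventually h.ev, eventually_ne 0,
        eventually_xc_ne u, (h.tendsto one_ne_zero).eventually (eventually_xc_ne u')]
        with R ⟨e1, e2, e3⟩ ⟨f1, f2, f3⟩ ⟨g1, g2, g3⟩ hR0 hx hx'
      have s1 := xc_add_add_xc_sub hR0 hQ0 hx
      have m1 := xc_add_mul_xc_sub hR0 hQ0 hx
      have m2 := xc_add_mul_xc_sub e1 h1 hx'
      rw [_root_.map_add] at f3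
      rw [_root_.map_sub] at g3
      simp only [eval_add, eval_mul, eval_sub, eval_C, eval_X, eval_pow, eval_ofNat] at *
      change _ * (_ - u) ^ 2 = _ at s1
      change _ * (_ - u) ^ 2 = _ at m1
      change _ * (_ - u') ^ 2 = _ at m2
      set r := xc R
      set r' := xc (ψ R)
      set xp := xc (R + Q)
      set xm := xc (R - Q)
      set Xp := xc (ψ R + ψ Q)
      set Xm := xc (ψ R - ψ Q)
      change _ = _ at h3
      rw [← s1, ← m1]
      have i1 : (a * r + b) * u' = r' * u' * (c * r + d) := by rw [← e3]; ring
      have i2 : r' * (c * r + d) * (c * u + d) - u' * (c * u + d) * (c * r + d) =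
        (a * d - b * c) * (r - u) := by rw [e3, h3]; ring
      have i3 : Xp * (c * xp + d) * (Xm * (c * xm + d)) = (a * xp + b) * (a * xm + b) := by
        rw [f3, g3]
      rw [i1, ← e3]
      have i4 : (r' * u' * (c * r + d)) ^ 2 - W₂.b₄ * (r' * (c * r + d) * (c * r + d) * u') -
          W₂.b₆ * (r' * (c * r + d) * (c * r + d) + (c * r + d) ^ 2 * u') -
          W₂.b₈ * (c * r + d) ^ 2 = Xp * Xm * (r' - u') ^ 2 * (c * r + d) ^ 2 := by
        rw [m2]; ring
      rw [i4]
      linear_combination (r - u) ^ 2 * (c * r + d) ^ 2 * (c * u + d) ^ 2 * (r' - u') ^ 2 * i3 +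
        (r - u) ^ 2 * ((a * xp + b) * (a * xm + b)) *
          ((r' - u') * (c * r + d) * (c * u + d) + (a * d - b * c) * (r - u)) * i2
    have := congr_arg (eval u) hp
    simp only [eval_add, eval_mul, eval_sub, eval_C, eval_X, eval_pow, eval_ofNat] at this h2 h3
    change u' * _ = _ at h3
    rw [eval_dupl] at h4
    rw [← h3] at this
    have h5 : c * (c * u + d) ^ 4 * (u' ^ 4 - W₂.b₄ * u' ^ 2 - 2 * W₂.b₆ * u' - W₂.b₈) *
        (eval u (C c * W₁.dupl + C d * W₁.psi)) = 0 := by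
      simp only [eval_add, eval_mul, eval_C, eval_dupl, eval_psi]
      linear_combination this
    exact (mul_eq_zero.1 h5).resolve_left
      (mul_ne_zero (mul_ne_zero hc (pow_ne_zero _ h2)) h4)
  have := congr_arg (coeff · 4) h0
  simp [dupl, psi, hc] at this

lemma HasX.exists_chg_hom_eq {ψ : W₁.Point →+ W₂.Point} {A B : k[X]} (h : HasX ψ 1 A B) :
    ∃ u r s t, ∃ h : Chg W₁ W₂ u r s t, ψ = h.hom := by
  have hA := eq_X_add_C_of_natDegree_le_one h.natDegree_left_le
  have hB := eq_X_add_C_of_natDegree_le_one h.natDegree_right_le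
  rw [hA, hB] at h
  have hc := eq_zero_of_moebius ψ h
  have hd : B.coeff 0 ≠ 0 := by
    obtain ⟨P, -, h2, -⟩ := h.ev.exists
    simpa [hc] using h2
  have ha : A.coeff 1 ≠ 0 := by
    obtain ⟨i, hi⟩ := h.prim.coeff_ne
    fin_cases i <;> simp [coeff_C, hc] at hi
    exact hi
  refine Affine.Point.exists_chg_hom_eq ψ (a := A.coeff 1 / B.coeff 0) (b := A.coeff 0 / B.coeff 0)
    (div_ne_zero ha hd) ?_
  filter_upwards [h.ev] with P ⟨h1, h2, h3⟩
  refine ⟨h1, ?_⟩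
  simp [hc] at h3
  field_simp
  exact h3

variable {p : ℕ} [Fact p.Prime] [CharP k p]

/-- An injective homomorphism whose degree is a power of the characteristic is a Frobenius map up to
a change of variables. -/
lemma HasX.exists_chg_of_injective {φ : W₁.Point →+ W₂.Point} {n : ℕ} {A B : k[X]}
    (h : HasX φ (p ^ n) A B) (hφ : Function.Injective φ) {σ : k →+* k}
    (hσ : ∀ x, σ x = x ^ p ^ n) :
    ∃ u r s t, ∃ h : Chg (W₁.map σ).toAffine W₂ u r s t, φ = h.hom.comp (mapHom σ W₁) := by
  have hd : p ^ n ≠ 0 := pow_ne_zero _ (Fact.out : p.Prime).ne_zero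
  have key : ∀ᶠ c in cofinite, ∃ l m, A - C c * B = C l * X ^ p ^ n + C m := by
    filter_upwards [h.eventually_coeff_ne, h.card_ker hd] with c h1 h2
    have hker : φ.ker = ⊥ := (AddMonoidHom.ker_eq_bot_iff φ).2 hφ
    rw [hker, Nat.card_unique, eq_comm, Finset.card_eq_one] at h2
    obtain ⟨z, hz⟩ := h2
    have hdeg : (A - C c * B).natDegree = p ^ n := by
      refine le_antisymm ?_ (le_natDegree_of_ne_zero (by simpa using h1))
      refine (natDegree_sub_le_of_le h.natDegree_left_le
        ((natDegree_C_mul_le _ _).trans h.natDegree_right_le)).trans (by simp)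
    have hs := (IsAlgClosed.splits (A - C c * B)).eq_prod_roots
    have hr : (A - C c * B).roots = Multiset.replicate (p ^ n) z := by
      rw [Multiset.eq_replicate]
      refine ⟨by rw [← hdeg]; exact IsAlgClosed.card_roots_eq_natDegree, fun b hb => ?_⟩
      have := Multiset.mem_toFinset.2 hb
      rw [hz] at this
      simpa using this
    rw [hr, Multiset.map_replicate, Multiset.prod_replicate, sub_pow_char_pow] at hs
    refine ⟨(A - C c * B).leadingCoeff, -(A - C c * B).leadingCoeff * z ^ p ^ n, hs.trans ?_⟩
    simp only [C_mul, C_neg, C_pow]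
    ring
  obtain ⟨c, l, m, hc⟩ := key.exists
  obtain ⟨c', ⟨l', m', hc'⟩, hcc⟩ := (key.and (Set.finite_singleton c).eventually_cofinite_notMem).exists
  have hcc : c' - c ≠ 0 := sub_ne_zero.2 (by simpa using hcc)
  obtain ⟨γ, δ, hB⟩ : ∃ γ δ, B = C γ * X ^ p ^ n + C δ := by
    refine ⟨(l - l') / (c' - c), (m - m') / (c' - c), ?_⟩
    have h1 : C (c' - c) * B = C (l - l') * X ^ p ^ n + C (m - m') := by
      simp only [C_sub]; linear_combination hc - hc'
    refine mul_left_cancel₀ (C_ne_zero.2 hcc) (h1.trans ?_)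
    rw [mul_add, ← mul_assoc, ← C_mul, ← C_mul, mul_div_cancel₀ _ hcc, mul_div_cancel₀ _ hcc]
  obtain ⟨α, β, hA⟩ : ∃ α β, A = C α * X ^ p ^ n + C β := by
    refine ⟨l + c * γ, m + c * δ, ?_⟩
    rw [hB] at hc
    simp only [C_add, C_mul]
    linear_combination hc
  have hσs : Function.Surjective σ := fun y => by
    obtain ⟨z, hz⟩ := IsAlgClosed.exists_pow_nat_eq y (Nat.pos_of_ne_zero hd)
    exact ⟨z, by rw [hσ, hz]⟩
  have hsurj : Function.Surjective (mapHom σ W₁) := by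
    intro P
    by_cases hP : P = 0
    · exact ⟨0, by simp [hP]⟩
    obtain ⟨x, y, hxy, rfl⟩ := exists_eq_some hP
    obtain ⟨x, rfl⟩ := hσs x
    obtain ⟨y, rfl⟩ := hσs y
    exact ⟨some x y ((W₁.map_nonsingular σ.injective x y).1 hxy), rfl⟩
  let e := AddEquiv.ofBijective (mapHom σ W₁) ⟨mapHom_injective σ, hsurj⟩
  have he : ∀ P, mapHom σ W₁ (e.symm P) = P := e.apply_symm_apply
  have hX : HasX (φ.comp (e.symm : (W₁.map σ).toAffine.Point →+ W₁.Point)) 1 (C α * X + C β)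
      (C γ * X + C δ) := by
    refine ⟨⟨?_, ?_, ?_⟩, ?_⟩
    · intro i
      fin_cases i
      · simp only [Fin.zero_eta, Matrix.cons_val_zero]; compute_degree
      · simp only [Fin.mk_one, Matrix.cons_val_one, Matrix.cons_val_zero]; compute_degree
    · intro z
      obtain ⟨w, rfl⟩ := hσs z
      obtain ⟨i, hi⟩ := h.prim.eval_ne w
      refine ⟨i, ?_⟩
      fin_cases i
      · simpa [hA, hσ] using hi
      · simpa [hB, hσ] using hi
    · obtain ⟨i, hi⟩ := h.prim.coeff_ne
      refine ⟨i, ?_⟩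
      fin_cases i
      · simpa [hA, coeff_C, (Fact.out : p.Prime).ne_zero] using hi
      · simpa [hB, coeff_C, (Fact.out : p.Prime).ne_zero] using hi
    · filter_upwards [e.symm.injective.tendsto_cofinite.eventually h.ev] with P ⟨h1, h2, h3⟩
      have hx : xc P = xc (e.symm P) ^ p ^ n := by
        conv_lhs => rw [← he P]
        rw [xc_mapHom, hσ]
      simp only [hA, hB, eval_add, eval_mul, eval_C, eval_X, eval_pow, ← hx] at h2 h3 ⊢
      exact ⟨h1, h2, h3⟩
  obtain ⟨u, r, s, t, hh, hψ⟩ := hX.exists_chg_hom_eq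
  refine ⟨u, r, s, t, hh, ?_⟩
  rw [← hψ]
  ext P
  exact congr_arg φ (e.symm_apply_apply P).symm

end WeierstrassCurve.Affine.Point

end

section

open Polynomial Filter

namespace WeierstrassCurve.Affine.Point

variable {K : Type*} [Field K] [DecidableEq K] {W : WeierstrassCurve.Affine K}

/-- `f` generically agrees with a rational function on the curve. -/
def IsRat (f : W.Point → K) : Prop :=
  ∃ a b c : K[X], c ≠ 0 ∧
    ∀ᶠ P in cofinite, f P * c.eval (xc P) = a.eval (xc P) + b.eval (xc P) * yc P

namespace IsRat

variable {f g : W.Point → K}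

lemma congr (hf : IsRat f) (h : ∀ᶠ P in cofinite, f P = g P) : IsRat g := by
  obtain ⟨a, b, c, hc, hf⟩ := hf
  refine ⟨a, b, c, hc, ?_⟩
  filter_upwards [hf, h] with P h1 h2
  rw [← h2, h1]

lemma const (c : K) : IsRat fun _ : W.Point => c :=
  ⟨C c, 0, 1, one_ne_zero, Eventually.of_forall fun P => by simp⟩

lemma xc : IsRat (xc : W.Point → K) :=
  ⟨X, 0, 1, one_ne_zero, Eventually.of_forall fun P => by simp⟩

lemma yc : IsRat (yc : W.Point → K) :=
  ⟨0, 1, 1, one_ne_zero, Eventually.of_forall fun P => by simp⟩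

lemma add (hf : IsRat f) (hg : IsRat g) : IsRat fun P => f P + g P := by
  obtain ⟨a, b, c, hc, hf⟩ := hf
  obtain ⟨a', b', c', hc', hg⟩ := hg
  refine ⟨a * c' + a' * c, b * c' + b' * c, c * c', mul_ne_zero hc hc', ?_⟩
  filter_upwards [hf, hg] with P h1 h2
  simp only [eval_add, eval_mul]
  linear_combination c'.eval (Point.xc P) * h1 + c.eval (Point.xc P) * h2

lemma mul (hf : IsRat f) (hg : IsRat g) : IsRat fun P => f P * g P := by
  obtain ⟨a, b, c, hc, hf⟩ := hf
  obtain ⟨a', b', c', hc', hg⟩ := hg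
  refine ⟨a * a' + b * b' * (X ^ 3 + C W.a₂ * X ^ 2 + C W.a₄ * X + C W.a₆),
    a * b' + a' * b - b * b' * (C W.a₁ * X + C W.a₃), c * c', mul_ne_zero hc hc', ?_⟩
  filter_upwards [hf, hg, eventually_ne 0] with P h1 h2 h3
  have h4 := equation_coords h3
  simp only [eval_add, eval_mul, eval_sub, eval_pow, eval_X, eval_C]
  linear_combination g P * c'.eval (Point.xc P) * h1 +
    (a.eval (Point.xc P) + b.eval (Point.xc P) * Point.yc P) * h2 +
    b.eval (Point.xc P) * b'.eval (Point.xc P) * h4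

lemma neg (hf : IsRat f) : IsRat fun P => -f P :=
  ((const (-1)).mul hf).congr (Eventually.of_forall fun P => by simp)

lemma sub (hf : IsRat f) (hg : IsRat g) : IsRat fun P => f P - g P :=
  (hf.add hg.neg).congr (Eventually.of_forall fun P => by ring)

lemma pow (hf : IsRat f) (n : ℕ) : IsRat fun P => f P ^ n := by
  induction n with
  | zero => simpa using const 1
  | succ n ih => simpa only [pow_succ] using ih.mul hf

lemma eval (hf : IsRat f) (a : K[X]) : IsRat fun P => a.eval (f P) := by
  induction a using Polynomial.induction_on' with
  | add p q hp hq => simpa only [eval_add] using hp.add hq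
  | monomial n c => simpa only [eval_monomial] using (const c).mul (hf.pow n)

lemma norm_ne_zero (W : WeierstrassCurve.Affine K) {a b : K[X]} (h : a ≠ 0 ∨ b ≠ 0) :
    a ^ 2 - a * b * (C W.a₁ * X + C W.a₃) -
      b ^ 2 * (X ^ 3 + C W.a₂ * X ^ 2 + C W.a₄ * X + C W.a₆) ≠ 0 := by
  intro h0
  have := CoordinateRing.degree_norm_smul_basis (W' := W) a b
  rw [CoordinateRing.norm_smul_basis, h0, degree_zero, eq_comm, max_eq_bot] at this
  obtain ⟨h1, h2⟩ := this
  rw [two_nsmul] at h1 h2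
  have ha : a = 0 := by
    rw [← degree_eq_bot]; revert h1
    cases a.degree with
    | bot => simp
    | coe n => intro h; exact absurd h (by rw [← WithBot.coe_add]; exact WithBot.coe_ne_bot)
  have hb : b = 0 := by
    rw [← degree_eq_bot]; revert h2
    cases b.degree with
    | bot => simp
    | coe n => intro h; exact absurd h WithBot.coe_ne_bot
  exact h.elim (· ha) (· hb)

lemma conj {a b : K[X]} {P : W.Point} (hP : P ≠ 0) :
    (a ^ 2 - a * b * (C W.a₁ * X + C W.a₃) -
      b ^ 2 * (X ^ 3 + C W.a₂ * X ^ 2 + C W.a₄ * X + C W.a₆)).eval (Point.xc P) =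
    (a.eval (Point.xc P) + b.eval (Point.xc P) * Point.yc P) *
    (a.eval (Point.xc P) + b.eval (Point.xc P) * (-Point.yc P - W.a₁ * Point.xc P - W.a₃)) := by
  have h4 := equation_coords hP
  simp only [eval_add, eval_mul, eval_sub, eval_pow, eval_X, eval_C]
  linear_combination b.eval (Point.xc P) ^ 2 * h4

lemma eventually_eq_zero_or (hf : IsRat f) :
    (∀ᶠ P in cofinite, f P = 0) ∨ ∀ᶠ P in cofinite, f P ≠ 0 := by
  obtain ⟨a, b, c, hc, hf⟩ := hf
  by_cases h : a ≠ 0 ∨ b ≠ 0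
  · right
    filter_upwards [hf, eventually_ne 0, eventually_eval_ne (norm_ne_zero W h)] with P h1 h2 h3 h4
    rw [conj h2, ← h1, h4] at h3
    simp at h3
  · left
    push Not at h
    filter_upwards [hf, eventually_eval_ne hc] with P h1 h2
    simpa [h.1, h.2, h2] using h1

lemma inv (hf : IsRat f) : IsRat fun P => (f P)⁻¹ := by
  rcases hf.eventually_eq_zero_or with h | h
  · exact (const 0).congr (h.mono fun P hP => by simp [hP])
  obtain ⟨a, b, c, hc, hf⟩ := hf
  by_cases hab : a ≠ 0 ∨ b ≠ 0
  · refine ⟨c * (a - b * (C W.a₁ * X + C W.a₃)), -(c * b), _, norm_ne_zero W hab, ?_⟩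
    filter_upwards [h, hf, eventually_ne 0] with P h1 h2 h3
    rw [conj h3, ← h2]
    field_simp
    simp only [eval_add, eval_mul, eval_sub, eval_neg, eval_X, eval_C]
    ring
  · push Not at hab
    refine (const 0).congr ?_
    filter_upwards [hf, eventually_eval_ne hc] with P h1 h2
    have : f P = 0 := by simpa [hab.1, hab.2, h2] using h1
    simp [this]

lemma div (hf : IsRat f) (hg : IsRat g) : IsRat fun P => f P / g P := by
  simpa only [div_eq_mul_inv] using hf.mul hg.inv

lemma comp {W' : WeierstrassCurve.Affine K} {φ : W'.Point → W.Point} (hf : IsRat f)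
    (hx : IsRat fun P => Point.xc (φ P)) (hy : IsRat fun P => Point.yc (φ P))
    (hφ : Tendsto φ cofinite cofinite) : IsRat fun P => f (φ P) := by
  obtain ⟨a, b, c, hc, hf⟩ := hf
  refine (((hx.eval a).add ((hx.eval b).mul hy)).div (hx.eval c)).congr ?_
  filter_upwards [hφ.eventually hf, hφ.eventually (eventually_eval_ne hc)] with P h1 h2
  rw [← h1, mul_div_cancel_right₀ _ h2]

end IsRat

end WeierstrassCurve.Affine.Point

end

section

open Polynomial Filter

namespace WeierstrassCurve.Affine.Point

variable {K : Type*} [Field K] [DecidableEq K] {W W₁ W₂ W₃ : WeierstrassCurve.Affine K}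

lemma two_nsmul_coords {P : W.Point} (hP : P ≠ 0) (h2 : 2 • P ≠ 0) {ℓ : K}
    (hℓ : ℓ = (3 * xc P ^ 2 + 2 * W.a₂ * xc P + W.a₄ - W.a₁ * yc P) /
      (2 * yc P + W.a₁ * xc P + W.a₃)) :
    xc (2 • P) = ℓ ^ 2 + W.a₁ * ℓ - W.a₂ - xc P - xc P ∧
    yc (2 • P) = -(ℓ * (xc (2 • P) - xc P) + yc P) - W.a₁ * xc (2 • P) - W.a₃ := by
  have h2' := h2
  rw [two_nsmul_ne_zero_iff hP, ← eta_sq hP] at h2'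
  obtain ⟨x, y, h, rfl⟩ := exists_eq_some hP
  have hy : y ≠ W.negY x y := by
    intro h
    refine h2' (pow_eq_zero_iff two_ne_zero |>.2 ?_)
    rw [negY] at h
    simp only [xc_some, yc_some]
    linear_combination h
  rw [two_nsmul, add_self_of_Y_ne hy]
  have hs : W.slope x x y y = ℓ := by
    rw [slope_of_Y_ne rfl hy, hℓ, negY]
    simp only [xc_some, yc_some]
    congr 1
    ring
  simp only [xc_some, yc_some, addX, addY, negAddY, negY, hs, and_self]

/-- `φ` is generically given by rational functions. -/
structure IsGood (φ : W₁.Point →+ W₂.Point) : Prop where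
  xc : IsRat fun P => xc (φ P)
  yc : IsRat fun P => yc (φ P)
  ev : φ = 0 ∨ ∀ᶠ P in cofinite, φ P ≠ 0

namespace IsGood

variable {φ ψ : W₁.Point →+ W₂.Point}

lemma zero : IsGood (0 : W₁.Point →+ W₂.Point) :=
  ⟨by simpa using IsRat.const 0, by simpa using! IsRat.const 0, Or.inl rfl⟩

lemma id : IsGood (AddMonoidHom.id W.Point) :=
  ⟨IsRat.xc, IsRat.yc, Or.inr (eventually_ne 0)⟩

lemma neg (h : IsGood φ) : IsGood (-φ) := by
  refine ⟨by simpa using h.xc, ?_, ?_⟩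
  · rcases h.ev with rfl | h0
    · simpa using! IsRat.const 0
    refine (((h.yc.neg).sub ((IsRat.const W₂.a₁).mul h.xc)).sub (IsRat.const W₂.a₃)).congr ?_
    filter_upwards [h0] with P hP
    rw [AddMonoidHom.neg_apply, yc_neg hP]
  · rcases h.ev with rfl | h0
    · simp
    · right; simpa using h0

lemma tendsto [Infinite W₁.Point] (h : IsGood φ) (h0 : φ ≠ 0) : Tendsto φ cofinite cofinite := by
  have hne := h.ev.resolve_left h0
  refine Tendsto.cofinite_of_finite_preimage_singleton fun T => ?_
  have key : ∀ᶠ P in cofinite, φ P ≠ T := by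
    by_cases hT : T = 0
    · rwa [hT]
    rcases (h.xc.sub (IsRat.const (Point.xc T))).eventually_eq_zero_or with hx | hx
    · rcases (h.yc.sub (IsRat.const (Point.yc T))).eventually_eq_zero_or with hy | hy
      · exfalso
        have hT : ∀ᶠ P in cofinite, φ P = T := by
          filter_upwards [hne, hx, hy] with P h1 h2 h3
          exact ext_coords h1 hT (sub_eq_zero.1 h2) (sub_eq_zero.1 h3)
        refine h0 (AddMonoidHom.ext fun Q => ?_)
        obtain ⟨P, h1, h2⟩ := (hT.and ((add_left_injective Q).tendsto_cofinite.eventually hT)).exists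
        rw [_root_.map_add, h1] at h2
        simpa using h2
      · filter_upwards [hy] with P h1 h2
        simp [h2] at h1
    · filter_upwards [hx] with P h1 h2
      simp [h2] at h1
  simpa [Filter.eventually_cofinite] using! key

lemma comp [Infinite W₁.Point] {χ : W₂.Point →+ W₃.Point} (hχ : IsGood χ) (h : IsGood φ) :
    IsGood (χ.comp φ) := by
  by_cases h0 : φ = 0
  · subst h0
    simpa using zero
  by_cases h0' : χ = 0
  · subst h0'
    simpa using zero
  have ht := h.tendsto h0
  exact ⟨hχ.xc.comp h.xc h.yc ht, hχ.yc.comp h.xc h.yc ht,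
    Or.inr (ht.eventually (hχ.ev.resolve_left h0'))⟩

variable [IsAlgClosed K] [W₁.IsElliptic] [W₂.IsElliptic]

lemma two (W : WeierstrassCurve.Affine K) [W.IsElliptic] : IsGood (2 • AddMonoidHom.id W.Point) := by
  have h2 : ∀ᶠ P : W.Point in cofinite, P ≠ 0 ∧ 2 • P ≠ 0 := by
    filter_upwards [eventually_ne 0, eventually_eval_ne W.psi_ne_zero] with P h1 h2
    exact ⟨h1, by rwa [two_nsmul_ne_zero_iff h1, ← eval_psi]⟩
  have hℓ : IsRat fun P : W.Point => (3 * Point.xc P ^ 2 + 2 * W.a₂ * Point.xc P + W.a₄ -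
      W.a₁ * Point.yc P) / (2 * Point.yc P + W.a₁ * Point.xc P + W.a₃) :=
    (((((IsRat.const 3).mul (IsRat.xc.pow 2)).add ((IsRat.const (2 * W.a₂)).mul IsRat.xc)).add
      (IsRat.const W.a₄)).sub ((IsRat.const W.a₁).mul IsRat.yc)).div
      ((((IsRat.const 2).mul IsRat.yc).add ((IsRat.const W.a₁).mul IsRat.xc)).add (IsRat.const W.a₃))
  have hx : IsRat fun P : W.Point => Point.xc (2 • P) := by
    refine (((((hℓ.pow 2).add ((IsRat.const W.a₁).mul hℓ)).sub (IsRat.const W.a₂)).sub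
      IsRat.xc).sub IsRat.xc).congr (h2.mono fun P hP => ?_)
    exact (two_nsmul_coords hP.1 hP.2 rfl).1.symm
  refine ⟨by simpa using hx, ?_, Or.inr (by simpa using h2.mono fun P hP => hP.2)⟩
  refine (((((hℓ.mul (hx.sub IsRat.xc)).add IsRat.yc).neg).sub ((IsRat.const W.a₁).mul hx)).sub
    (IsRat.const W.a₃)).congr (h2.mono fun P hP => ?_)
  exact (two_nsmul_coords hP.1 hP.2 rfl).2.symm

lemma add (h : IsGood φ) (h' : IsGood ψ) : IsGood (φ + ψ) := by
  by_cases h0 : φ = 0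
  · simpa [h0] using h'
  by_cases h0' : ψ = 0
  · simpa [h0'] using h
  have hφ := h.ev.resolve_left h0
  have hψ := h'.ev.resolve_left h0'
  rcases (h.xc.sub h'.xc).eventually_eq_zero_or with hx | hx
  · rcases hom_eq_or_eq_neg (φ := φ) (ψ := ψ) (by
      filter_upwards [hφ, hψ, hx] with P h1 h2 h3
      exact ⟨h1, h2, sub_eq_zero.1 h3⟩) with rfl | rfl
    · convert (two W₂).comp h using 1
      ext P
      simp [two_nsmul]
    · simpa using zero
  have hev : ∀ᶠ P in cofinite, φ P ≠ 0 ∧ ψ P ≠ 0 ∧ Point.xc (φ P) ≠ Point.xc (ψ P) := by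
    filter_upwards [hφ, hψ, hx] with P h1 h2 h3
    exact ⟨h1, h2, sub_ne_zero.1 h3⟩
  have hℓ := (h.yc.sub h'.yc).div (h.xc.sub h'.xc)
  have hxs : IsRat fun P => Point.xc (φ P + ψ P) := by
    refine (((((hℓ.pow 2).add ((IsRat.const W₂.a₁).mul hℓ)).sub (IsRat.const W₂.a₂)).sub
      h.xc).sub h'.xc).congr (hev.mono fun P hP => ?_)
    exact (add_coords hP.1 hP.2.1 hP.2.2).2.1.symm
  refine ⟨hxs, ?_, Or.inr (hev.mono fun P hP => (add_coords hP.1 hP.2.1 hP.2.2).1)⟩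
  refine (((((hℓ.mul (hxs.sub h.xc)).add h.yc).neg).sub ((IsRat.const W₂.a₁).mul hxs)).sub
    (IsRat.const W₂.a₃)).congr (hev.mono fun P hP => ?_)
  exact (add_coords hP.1 hP.2.1 hP.2.2).2.2.symm

lemma exists_hasDeg (h : IsGood φ) : ∃ d, HasDeg φ d := by
  by_cases h0 : φ = 0
  · exact ⟨0, h0 ▸ hasDeg_zero⟩
  have ht := h.tendsto h0
  obtain ⟨a, b, c, hc, hx⟩ := h.xc
  have hb : b = 0 := by
    refine eq_zero_of_eventually (W := W₁) ?_
    filter_upwards [hx, neg_injective.tendsto_cofinite.eventually hx, eventually_ne 0,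
      eventually_eval_ne W₁.psi_ne_zero] with P h1 h2 h3 h4
    rw [eval_psi, ← eta_sq h3] at h4
    rw [_root_.map_neg, xc_neg, xc_neg, yc_neg h3] at h2
    refine (mul_eq_zero.1 (?_ : _ * (2 * Point.yc P + W₁.a₁ * Point.xc P + W₁.a₃) = 0)).resolve_right
      (pow_ne_zero_iff two_ne_zero |>.1 h4)
    linear_combination h2 - h1
  have hx' : ∀ᶠ P in cofinite, Point.xc (φ P) * c.eval (Point.xc P) = a.eval (Point.xc P) := by
    filter_upwards [hx] with P h1
    rw [h1, hb]; simp
  obtain ⟨A, hA⟩ := EuclideanDomain.gcd_dvd_left a c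
  obtain ⟨B, hB⟩ := EuclideanDomain.gcd_dvd_right a c
  have hg : EuclideanDomain.gcd a c ≠ 0 := fun h => hc (by rw [hB, h, zero_mul])
  have hcop : EuclideanDomain.gcdA a c * A + EuclideanDomain.gcdB a c * B = 1 := by
    refine mul_left_cancel₀ hg ?_
    linear_combination -EuclideanDomain.gcd_eq_gcd_ab a c - EuclideanDomain.gcdA a c * hA -
      EuclideanDomain.gcdB a c * hB
  have hX : HasX φ (max A.natDegree B.natDegree) A B := by
    refine ⟨⟨fun i => by fin_cases i <;> simp, fun z => ?_, ?_⟩, ?_⟩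
    · by_contra! h
      have h0 := h 0
      have h1 := h 1
      have := congr_arg (Polynomial.eval z) hcop
      simp at h0 h1
      simp [h0, h1] at this
    · by_cases hA0 : A = 0
      · refine ⟨1, ?_⟩
        have : B ≠ 0 := by rintro rfl; simp at hB; exact hc hB
        simpa [hA0]
      by_cases hB0 : B = 0
      · exact absurd hB (by simpa [hB0] using hc)
      rcases max_choice A.natDegree B.natDegree with h | h <;> rw [h]
      · exact ⟨0, by simpa using hA0⟩
      · exact ⟨1, by simpa using hB0⟩
    · filter_upwards [hx', h.ev.resolve_left h0, eventually_eval_ne (W := W₁) hc] with P h1 h2 h3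
      rw [hB, eval_mul] at h3
      refine ⟨h2, right_ne_zero_of_mul h3, mul_left_cancel₀ (left_ne_zero_of_mul h3) ?_⟩
      have hA' := congr_arg (Polynomial.eval (Point.xc P)) hA
      have hB' := congr_arg (Polynomial.eval (Point.xc P)) hB
      rw [eval_mul] at hA' hB'
      linear_combination h1 - Point.xc (φ P) * hB' + hA'
  refine ⟨_, hX.hasDeg fun hd => ?_⟩
  have hA0 := eq_C_of_natDegree_eq_zero (Nat.le_zero.1 (hd ▸ le_max_left A.natDegree B.natDegree))
  have hB0 := eq_C_of_natDegree_eq_zero (Nat.le_zero.1 (hd ▸ le_max_right A.natDegree B.natDegree))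
  obtain ⟨P, ⟨-, h1, h2⟩, h3⟩ :=
    (hX.ev.and (ht.eventually (eventually_xc_ne (A.coeff 0 / B.coeff 0)))).exists
  rw [hA0, hB0, eval_C, eval_C] at h2
  rw [hB0, eval_C] at h1
  exact h3 (by rw [eq_div_iff h1, h2])

end IsGood

lemma Chg.isGood_hom [W₂.IsElliptic] {u r s t : K} (h : Chg W₁ W₂ u r s t) : IsGood h.hom := by
  refine ⟨?_, ?_, Or.inr ((eventually_ne 0).mono fun P => h.hom_ne_zero)⟩
  · exact (((IsRat.const (u ^ 2)).mul IsRat.xc).add (IsRat.const r)).congr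
      ((eventually_ne 0).mono fun P hP => (h.xc_hom hP).symm)
  · exact ((((IsRat.const (u ^ 3)).mul IsRat.yc).add ((IsRat.const (u ^ 2 * s)).mul IsRat.xc)).add
      (IsRat.const t)).congr ((eventually_ne 0).mono fun P hP => (h.yc_hom hP).symm)

lemma Chg.isGood_equiv_symm [W₁.IsElliptic] [W₂.IsElliptic] {u r s t : K} (h : Chg W₁ W₂ u r s t) :
    IsGood (h.equiv.symm : W₂.Point →+ W₁.Point) := by
  have hne : ∀ᶠ P : W₂.Point in cofinite, h.equiv.symm P ≠ 0 := by
    filter_upwards [eventually_ne 0] with P hP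
    simpa using hP
  have hu := h.ne
  have he : ∀ P, h.hom (h.equiv.symm P) = P := h.equiv.apply_symm_apply
  have hx : IsRat fun P : W₂.Point => Point.xc (h.equiv.symm P) := by
    refine ((IsRat.xc.sub (IsRat.const r)).div (IsRat.const (u ^ 2))).congr ?_
    filter_upwards [hne] with P hP
    have := h.xc_hom hP
    rw [he] at this
    rw [this]
    field_simp
    ring
  refine ⟨hx, ?_, Or.inr hne⟩
  refine (((IsRat.yc.sub ((IsRat.const (u ^ 2 * s)).mul hx)).sub (IsRat.const t)).div
    (IsRat.const (u ^ 3))).congr ?_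
  filter_upwards [hne] with P hP
  have := h.yc_hom hP
  rw [he] at this
  rw [this]
  change _ = Point.yc (h.equiv.symm P)
  field_simp
  ring

lemma isGood_mapHom {q : ℕ} {σ : K →+* K} (hσ : ∀ x, σ x = x ^ q) (W : WeierstrassCurve.Affine K) :
    IsGood (mapHom σ W) := by
  refine ⟨(IsRat.xc.pow q).congr (Eventually.of_forall fun P => by simp [hσ]),
    (IsRat.yc.pow q).congr ?_, Or.inr ?_⟩
  · filter_upwards [eventually_ne 0] with P hP
    rw [yc_mapHom σ hP, hσ]
  · filter_upwards [eventually_ne 0] with P hP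
    simpa using hP

end WeierstrassCurve.Affine.Point

end

section

open Polynomial Filter

namespace WeierstrassCurve.Affine.Point

variable {k : Type*} [Field k] [DecidableEq k] [IsAlgClosed k] {W : WeierstrassCurve.Affine k}
  [W.IsElliptic]

/-- The ring of endomorphisms generically given by rational functions. -/
def goodEnd (W : WeierstrassCurve.Affine k) [W.IsElliptic] : Subring (AddMonoid.End W.Point) where
  carrier := {φ | IsGood (φ : W.Point →+ W.Point)}
  mul_mem' h h' := IsGood.comp h h'
  one_mem' := IsGood.id
  add_mem' h h' := IsGood.add h h'
  zero_mem' := IsGood.zero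
  neg_mem' h := IsGood.neg h

/-- The degree of an endomorphism. -/
noncomputable def goodDeg (a : goodEnd W) : ℕ := (IsGood.exists_hasDeg a.2).choose

lemma hasDeg_goodDeg (a : goodEnd W) : HasDeg (a : AddMonoid.End W.Point) (goodDeg a) :=
  (IsGood.exists_hasDeg a.2).choose_spec

lemma degForm_goodDeg (W : WeierstrassCurve.Affine k) [W.IsElliptic] :
    DegForm fun a : goodEnd W => (goodDeg a : ℤ) :=
  degForm_of_hasDeg (goodEnd W).subtype Subtype.coe_injective goodDeg hasDeg_goodDeg

lemma goodEnd_apply_apply (φ : goodEnd W) (P : W.Point) :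
    (φ : AddMonoid.End W.Point) ((φ : AddMonoid.End W.Point) P) =
      (degForm_goodDeg W).tr φ • (φ : AddMonoid.End W.Point) P - goodDeg φ • P := by
  have h1 := congr_arg (fun a : goodEnd W => (a : AddMonoid.End W.Point) P)
    ((degForm_goodDeg W).sq_eq φ)
  have h2 : (φ : AddMonoid.End W.Point) ((φ : AddMonoid.End W.Point) P) =
    (degForm_goodDeg W).tr φ • (φ : AddMonoid.End W.Point) P - (goodDeg φ : ℤ) • P := h1
  rwa [natCast_zsmul] at h2

variable {p : ℕ} [Fact p.Prime] [CharP k p]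

lemma injective_of_goodDeg_eq (hp : ∀ P : W.Point, p • P = 0 → P = 0) {φ : goodEnd W} {n : ℕ}
    (h : goodDeg φ = p ^ n) : Function.Injective (φ : AddMonoid.End W.Point) := by
  have hp' : ∀ n, ∀ P : W.Point, p ^ n • P = 0 → P = 0 := by
    intro n
    induction n with
    | zero => simp
    | succ n ih => intro P hP; rw [pow_succ, mul_nsmul] at hP; exact hp P (by
        refine ih _ ?_
        rwa [← mul_nsmul', mul_comm, mul_nsmul'] )
  refine (injective_iff_map_eq_zero _).2 fun P hP => hp' n P ?_
  have h1 := goodEnd_apply_apply φ P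
  rw [hP, _root_.map_zero, smul_zero, zero_sub, h, eq_comm, neg_eq_zero] at h1
  exact h1

/-- On a supersingular curve, an endomorphism of degree `p ^ (2 * m)` is multiplication by `p ^ m`
up to an automorphism. -/
lemma exists_mul_eq_pow (hp : ∀ P : W.Point, p • P = 0 → P = 0) {φ : goodEnd W} {m : ℕ}
    (h : goodDeg φ = p ^ (2 * m)) : ∃ δ : goodEnd W, goodDeg δ = 1 ∧ δ * φ = ((p : ℤ) ^ m) • 1 := by
  have hp0 : p ≠ 0 := (Fact.out : p.Prime).ne_zero
  have hD := degForm_goodDeg W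
  have h' : goodDeg (((p : ℤ) ^ m) • (1 : goodEnd W)) = p ^ (2 * m) := by
    have := hD.zsmul ((p : ℤ) ^ m) 1
    rw [hD.one, mul_one] at this
    zify
    rw [this]; ring
  have key : ∀ ψ : goodEnd W, goodDeg ψ = p ^ (2 * m) → ∃ u r s t,
      ∃ h : Chg (W.map (iterateFrobenius k p (2 * m))).toAffine W u r s t,
        (ψ : AddMonoid.End W.Point) = h.hom.comp (mapHom (iterateFrobenius k p (2 * m)) W) := by
    intro ψ hψ
    obtain ⟨-, A, B, hAB⟩ := (hasDeg_goodDeg ψ).resolve_left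
      (fun h => pow_ne_zero (2 * m) hp0 (hψ ▸ h.2))
    rw [hψ] at hAB
    exact hAB.exists_chg_of_injective (injective_of_goodDeg_eq hp hψ)
      fun x => iterateFrobenius_def p (2 * m) x
  obtain ⟨u, r, s, t, c, hc⟩ := key φ h
  obtain ⟨u', r', s', t', c', hc'⟩ := key _ h'
  have hg : IsGood (c'.hom.comp (c.equiv.symm : W.Point →+ _)) := c'.isGood_hom.comp c.isGood_equiv_symm
  have hmul : (⟨_, hg⟩ : goodEnd W) * φ = ((p : ℤ) ^ m) • 1 := by
    refine Subtype.ext (AddMonoidHom.ext fun P => ?_)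
    rw [hc']
    change c'.hom (c.equiv.symm ((φ : AddMonoid.End W.Point) P)) = _
    rw [hc]
    exact congr_arg c'.hom (c.equiv.symm_apply_apply _)
  refine ⟨_, ?_, hmul⟩
  have h2 := congr_arg goodDeg hmul
  have h3 := hD.mul ⟨_, hg⟩ φ
  have h4 : (p ^ (2 * m) : ℕ) ≠ 0 := pow_ne_zero _ hp0
  zify at h2 h4 ⊢
  rw [h3, h', h] at h2
  exact mul_right_cancel₀ (by exact_mod_cast h4) (h2.trans (one_mul _).symm)

lemma tr_eq_of_goodDeg_eq (hp : ∀ P : W.Point, p • P = 0 → P = 0) {φ : goodEnd W} {m : ℕ}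
    (h : goodDeg φ = p ^ (2 * m)) : ∃ δ : goodEnd W, goodDeg δ = 1 ∧
      (degForm_goodDeg W).tr δ ^ 2 ≤ 4 ∧
      (degForm_goodDeg W).tr φ = p ^ m * (degForm_goodDeg W).tr δ := by
  obtain ⟨δ, h1, h2⟩ := exists_mul_eq_pow hp h
  have hD := degForm_goodDeg W
  set s := (degForm_goodDeg W).tr δ with hs
  refine ⟨δ, h1, ?_, ?_⟩
  · have := hD.add_zsmul_one (-s) 2 δ
    rw [h1] at this
    have h3 : (0 : ℤ) ≤ goodDeg (-s • 1 + (2 : ℤ) • δ) := by positivity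
    rw [this, ← hs] at h3
    push_cast at h3
    nlinarith
  · have h3 := hD.sq_eq δ
    rw [h1, ← hs] at h3
    have h4 : (s • 1 - δ) * δ = 1 := by
      rw [sub_mul, h3]; simp
    have h5 : φ = ((p : ℤ) ^ m) • (s • 1 - δ) := by
      have : (s • 1 - δ) * (δ * φ) = φ := by rw [← mul_assoc, h4, one_mul]
      rw [← this, h2, mul_smul_comm, mul_one]
    rw [h5, DegForm.tr, hD.bil_zsmul_left, map_sub, AddMonoidHom.sub_apply, hD.bil_zsmul_left,
      hD.bil_self, hD.one, hD.bil_one, ← hs]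
    ring

lemma pow_dvd_tr_sq (hp : ∀ P : W.Point, p • P = 0 → P = 0) {φ : goodEnd W} {m : ℕ}
    (h : goodDeg φ = p ^ m) : ∃ s : ℤ, s ^ 2 ≤ 4 ∧ (degForm_goodDeg W).tr φ ^ 2 = p ^ m * (s + 2) := by
  have hD := degForm_goodDeg W
  have h1 : goodDeg (φ * φ) = p ^ (2 * m) := by
    have := hD.mul φ φ
    rw [h] at this
    zify
    rw [this]
    push_cast
    ring
  obtain ⟨δ, -, h2, h3⟩ := tr_eq_of_goodDeg_eq hp h1
  refine ⟨_, h2, ?_⟩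
  have := hD.bil_sq_one φ
  rw [hD.bil_one, h3, h] at this
  push_cast at this
  linear_combination -this

end WeierstrassCurve.Affine.Point

end

section

open Polynomial Filter

lemma Nat.Prime.exists_sq_add_mul_add_sq {p : ℕ} (hp : p.Prime) (h3 : p ≡ 1 [MOD 3]) :
    ∃ a b : ℤ, a ^ 2 + a * b + b ^ 2 = p := by
  have := Fact.mk hp
  obtain ⟨g, hg⟩ : ∃ g : ZMod p, g ^ 2 + g + 1 = 0 := by
    have : Fact (Nat.Prime 3) := ⟨Nat.prime_three⟩
    have hdvd : 3 ∣ Fintype.card (ZMod p)ˣ := by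
      rw [ZMod.card_units]
      exact (Nat.modEq_iff_dvd' hp.one_lt.le).1 h3.symm
    obtain ⟨g, hg⟩ := exists_prime_orderOf_dvd_card 3 hdvd
    refine ⟨g, ?_⟩
    have h1 : (g : ZMod p) ^ 3 = 1 := by
      rw [← Units.val_pow_eq_pow_val, ← hg, pow_orderOf_eq_one, Units.val_one]
    have h2 : (g : ZMod p) - 1 ≠ 0 := by
      rw [sub_ne_zero]
      intro h
      rw [Units.val_eq_one] at h
      rw [h, orderOf_one] at hg
      omega
    refine mul_left_cancel₀ h2 ?_
    linear_combination h1
  set m := Nat.sqrt p with hm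
  have hlt : p < (m + 1) * (m + 1) := Nat.lt_succ_sqrt p
  have hle : m * m < p := by
    refine lt_of_le_of_ne (Nat.sqrt_le p) fun h => ?_
    exact (Nat.irreducible_iff_nat_prime p).2 hp |>.not_isSquare ⟨m, h.symm⟩
  obtain ⟨⟨x, y⟩, ⟨x', y'⟩, hne, heq⟩ := Fintype.exists_ne_map_eq_of_card_lt
    (fun z : Fin (m + 1) × Fin (m + 1) => ((z.1 : ℕ) : ZMod p) - g * ((z.2 : ℕ) : ZMod p))
    (by simpa [ZMod.card] using hlt)
  obtain ⟨a, ha⟩ : ∃ a : ℤ, a = ((x : ℕ) : ℤ) - ((x' : ℕ) : ℤ) := ⟨_, rfl⟩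
  obtain ⟨b, hb⟩ : ∃ b : ℤ, b = ((y : ℕ) : ℤ) - ((y' : ℕ) : ℤ) := ⟨_, rfl⟩
  have hab : ¬(a = 0 ∧ b = 0) := by
    rintro ⟨rfl, rfl⟩
    exact hne (Prod.ext (Fin.ext (by simp only; omega)) (Fin.ext (by simp only; omega)))
  have hdvd : (p : ℤ) ∣ a ^ 2 + a * b + b ^ 2 := by
    rw [← ZMod.intCast_zmod_eq_zero_iff_dvd]
    have h1 : (a : ZMod p) = g * b := by
      rw [ha, hb]; push_cast
      simp only at heq
      linear_combination heq
    push_cast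
    rw [h1]
    linear_combination (b : ZMod p) ^ 2 * hg
  have hax : |a| ≤ m := by have := x.2; have := x'.2; rw [abs_le]; omega
  have hbx : |b| ≤ m := by have := y.2; have := y'.2; rw [abs_le]; omega
  have hle' : (m : ℤ) * m < p := by exact_mod_cast hle
  have h1 : a ^ 2 ≤ m * m := by rw [← sq]; exact sq_le_sq' (abs_le.1 hax).1 (abs_le.1 hax).2
  have h2 : b ^ 2 ≤ m * m := by rw [← sq]; exact sq_le_sq' (abs_le.1 hbx).1 (abs_le.1 hbx).2
  obtain ⟨c, hc⟩ := hdvd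
  have hp0 : (0 : ℤ) < p := by exact_mod_cast hp.pos
  have hpos : 0 < a ^ 2 + a * b + b ^ 2 := by
    rcases not_and_or.1 hab with h | h
    · have := sq_pos_of_ne_zero h
      nlinarith [sq_nonneg (a + 2 * b)]
    · have := sq_pos_of_ne_zero h
      nlinarith [sq_nonneg (2 * a + b)]
  have hc0 : 0 < c := by rw [hc] at hpos; exact pos_of_mul_pos_right hpos hp0.le
  have hc3 : c < 3 := by
    by_contra! h
    nlinarith [sq_nonneg (a - b)]
  obtain rfl | rfl : c = 1 ∨ c = 2 := by omega
  · exact ⟨a, b, by linarith⟩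
  · exfalso
    have hp2 : p ≠ 2 := by rintro rfl; exact absurd h3 (by decide)
    have hodd : (p : ℤ) % 2 = 1 := by
      have := hp.eq_two_or_odd.resolve_left hp2
      omega
    obtain ⟨a', ha' | ha'⟩ := Int.even_or_odd' a <;>
    obtain ⟨b', hb' | hb'⟩ := Int.even_or_odd' b <;> subst ha' hb' <;> ring_nf at hc <;> omega

namespace WeierstrassCurve.Affine.Point

section

variable {k : Type*} [Field k] [DecidableEq k] [IsAlgClosed k] {W : WeierstrassCurve.Affine k}
  [W.IsElliptic] {p : ℕ} [Fact p.Prime] [CharP k p]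

lemma false_of_norm_eq (hp : ∀ P : W.Point, p • P = 0 → P = 0) {δ : goodEnd W}
    (hδ : goodDeg δ = 1) {a b : ℤ} (hp2 : p ≠ 2)
    (hs : IsCoprime (p : ℤ) (4 - (degForm_goodDeg W).tr δ ^ 2))
    (hab : a ^ 2 + a * b * (degForm_goodDeg W).tr δ + b ^ 2 = p) : False := by
  have hD := degForm_goodDeg W
  set s := (degForm_goodDeg W).tr δ with hs'
  have hpp : Prime (p : ℤ) := Nat.prime_iff_prime_int.1 Fact.out
  have h1 : goodDeg (a • 1 + b • δ) = p ^ 1 := by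
    have := hD.add_zsmul_one a b δ
    rw [hδ, ← hs'] at this
    zify
    rw [this]
    push_cast
    linear_combination hab
  obtain ⟨s', -, h2⟩ := pow_dvd_tr_sq hp h1
  have h3 : (degForm_goodDeg W).tr (a • 1 + b • δ) = 2 * a + b * s := by
    rw [DegForm.tr, map_add, AddMonoidHom.add_apply, hD.bil_zsmul_left, hD.bil_zsmul_left,
      hD.bil_self, hD.one, hD.bil_one, ← hs']
    ring
  rw [h3, pow_one] at h2
  obtain ⟨e, he⟩ := hpp.dvd_of_dvd_pow ⟨_, h2⟩
  have h4 : (p : ℤ) ∣ (4 - s ^ 2) * b ^ 2 := by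
    refine ⟨4 - p * e ^ 2, ?_⟩
    linear_combination 4 * hab - (2 * a + b * s + p * e) * he
  obtain ⟨f, rfl⟩ := hpp.dvd_of_dvd_pow (hs.dvd_of_dvd_mul_left h4)
  have h5 : (p : ℤ) * p ∣ 4 * p := by
    refine ⟨e ^ 2 + (4 - s ^ 2) * f ^ 2, ?_⟩
    linear_combination -4 * hab + (2 * a + p * f * s + p * e) * he
  rw [mul_dvd_mul_iff_right hpp.ne_zero] at h5
  have h6 : p ∣ 2 ^ 2 := by exact_mod_cast h5
  exact hp2 ((Nat.prime_dvd_prime_iff_eq Fact.out Nat.prime_two).1 ((Fact.out : p.Prime).dvd_of_dvd_pow h6))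

lemma supersingular_trace (hp : ∀ P : W.Point, p • P = 0 → P = 0) {φ : goodEnd W} {r : ℕ}
    (h : goodDeg φ = p ^ r) {t : ℤ} (ht : (degForm_goodDeg W).tr φ = -t) :
        (Even r ∧ t ^ 2 = 4 * (p : ℤ) ^ r) ∨
        (Even r ∧ ¬ p ≡ 1 [MOD 3] ∧ t ^ 2 = (p : ℤ) ^ r) ∨
        (Odd r ∧ (p = 2 ∨ p = 3) ∧ t ^ 2 = (p : ℤ) * (p : ℤ) ^ r) ∨
        (Odd r ∧ t = 0) ∨
        (Even r ∧ ¬ p ≡ 1 [MOD 4] ∧ t = 0) := by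
  have hpp : Prime (p : ℤ) := Nat.prime_iff_prime_int.1 Fact.out
  have hp2 := (Fact.out : p.Prime).two_le
  rcases Nat.even_or_odd' r with ⟨m, rfl | rfl⟩
  · obtain ⟨δ, h1, h2, h3⟩ := tr_eq_of_goodDeg_eq hp h
    rw [ht] at h3
    obtain ⟨s, hs⟩ : ∃ s, s = (degForm_goodDeg W).tr δ := ⟨_, rfl⟩
    have he : Even (2 * m) := even_two_mul m
    have hts : t ^ 2 = s ^ 2 * (p : ℤ) ^ (2 * m) := by
      rw [← hs] at h3
      rw [pow_mul, sq (p : ℤ), mul_pow]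
      linear_combination (p ^ m * s - t) * h3
    have hs2 : s ≤ 2 := by rw [← hs] at h2; nlinarith
    have hs2' : -2 ≤ s := by rw [← hs] at h2; nlinarith
    have hmod : s ^ 2 = 1 → ¬ p ≡ 1 [MOD 3] := by
      intro hs1 h3
      have hp2 : p ≠ 2 := by rintro rfl; exact absurd h3 (by decide)
      have hp3 : p ≠ 3 := by rintro rfl; exact absurd h3 (by decide)
      obtain ⟨a, b, hab⟩ := (Fact.out : p.Prime).exists_sq_add_mul_add_sq h3
      refine false_of_norm_eq hp h1 hp2 (a := a) (b := s * b) ?_ ?_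
      · rw [← hs, hs1]
        have : Nat.Coprime p 3 := (Nat.coprime_primes Fact.out Nat.prime_three).2 hp3
        exact Nat.isCoprime_iff_coprime.2 this
      · rw [← hs]
        linear_combination hab + (a * b + b ^ 2) * hs1
    have : s = -2 ∨ s = -1 ∨ s = 0 ∨ s = 1 ∨ s = 2 := by omega
    rcases this with rfl | rfl | rfl | rfl | rfl
    · exact Or.inl ⟨he, by linarith⟩
    · exact Or.inr (Or.inl ⟨he, hmod (by norm_num), by linarith⟩)
    · refine Or.inr (Or.inr (Or.inr (Or.inr ⟨he, fun h4 => ?_, by simpa using hts⟩)))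
      have hp2 : p ≠ 2 := by rintro rfl; exact absurd h4 (by decide)
      obtain ⟨a, b, hab⟩ := Nat.Prime.sq_add_sq (p := p) (by
        have : p % 4 = 1 := h4
        omega)
      refine false_of_norm_eq hp h1 hp2 (a := a) (b := b) ?_ ?_
      · rw [← hs]
        have : Nat.Coprime p (2 ^ 2) :=
          Nat.Coprime.pow_right 2 ((Nat.coprime_primes Fact.out Nat.prime_two).2 hp2)
        exact Nat.isCoprime_iff_coprime.2 this
      · rw [← hs]
        zify at hab
        linear_combination hab
    · exact Or.inr (Or.inl ⟨he, hmod (by norm_num), by linarith⟩)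
    · exact Or.inl ⟨he, by linarith⟩
  · have ho : Odd (2 * m + 1) := odd_two_mul_add_one m
    obtain ⟨s, h1, h2⟩ := pow_dvd_tr_sq hp h
    rw [ht, neg_sq] at h2
    have h3 : ((p : ℤ) ^ m) ^ 2 ∣ t ^ 2 := by
      refine ⟨p * (s + 2), ?_⟩
      rw [h2]; ring
    obtain ⟨v, rfl⟩ := (Int.pow_dvd_pow_iff two_ne_zero).1 h3
    have hpm : ((p : ℤ) ^ m) ^ 2 ≠ 0 := pow_ne_zero _ (pow_ne_zero _ hpp.ne_zero)
    have h4 : v ^ 2 = p * (s + 2) := by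
      refine mul_left_cancel₀ hpm ?_
      linear_combination h2
    obtain ⟨w, rfl⟩ := hpp.dvd_of_dvd_pow ⟨_, h4⟩
    have h5 : (p : ℤ) * w ^ 2 = s + 2 := by
      refine mul_left_cancel₀ hpp.ne_zero ?_
      linear_combination h4
    by_cases hw : w = 0
    · exact Or.inr (Or.inr (Or.inr (Or.inl ⟨ho, by simp [hw]⟩)))
    have hw1 : 1 ≤ w ^ 2 := sq_pos_of_ne_zero hw
    have hs2 : s ≤ 2 := by nlinarith
    have hp4 : (p : ℤ) ≤ 4 := by nlinarith
    have hp2' : (2 : ℤ) ≤ p := by exact_mod_cast hp2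
    have hw2 : w ^ 2 < 2 ^ 2 := by nlinarith
    have hw3 := abs_lt_of_sq_lt_sq hw2 (by norm_num)
    have hw4 : w ^ 2 = 1 := by
      obtain ⟨h6, h7⟩ := abs_lt.1 hw3
      obtain rfl | rfl : w = 1 ∨ w = -1 := by omega
      all_goals norm_num
    refine Or.inr (Or.inr (Or.inl ⟨ho, ?_, ?_⟩))
    · have : p ≤ 4 := by exact_mod_cast hp4
      interval_cases p
      · exact Or.inl rfl
      · exact Or.inr rfl
      · exact absurd (Fact.out : Nat.Prime 4) (by decide)
    · linear_combination ((p : ℤ) ^ m) ^ 2 * p ^ 2 * hw4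

end

theorem card_condition {p r : ℕ} (hp : p.Prime) (hr : 1 ≤ r) {F : Type*} [Field F] [Fintype F]
    (hF : Fintype.card F = p ^ r) {t : ℤ} (W₀ : WeierstrassCurve F) (hΔ : W₀.Δ ≠ 0)
    (hcard : (Nat.card W₀.toAffine.Point : ℤ) = (p : ℤ) ^ r + 1 + t) :
      (Int.gcd p t = 1 ∨
        (Even r ∧ t ^ 2 = 4 * (p : ℤ) ^ r) ∨
        (Even r ∧ ¬ p ≡ 1 [MOD 3] ∧ t ^ 2 = (p : ℤ) ^ r) ∨
        (Odd r ∧ (p = 2 ∨ p = 3) ∧ t ^ 2 = (p : ℤ) * (p : ℤ) ^ r) ∨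
        (Odd r ∧ t = 0) ∨
        (Even r ∧ ¬ p ≡ 1 [MOD 4] ∧ t = 0)) := by
  classical
  by_cases hg : Int.gcd p t = 1
  · exact Or.inl hg
  right
  have := Fact.mk hp
  have hpt : (p : ℤ) ∣ t := by
    by_contra h
    exact hg (Int.isCoprime_iff_gcd_eq_one.1
      ((Nat.prime_iff_prime_int.1 hp).coprime_iff_not_dvd.2 h))
  have : CharP F p := charP_of_card_eq_prime_pow hF
  let k := AlgebraicClosure F
  have : CharP k p := charP_of_injective_algebraMap (algebraMap F k).injective p
  have : W₀.IsElliptic := ⟨isUnit_iff_ne_zero.2 hΔ⟩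
  let W : WeierstrassCurve.Affine k := (W₀.map (algebraMap F k)).toAffine
  let σ : k →+* k := iterateFrobenius k p r
  have hσ : ∀ x, σ x = x ^ Fintype.card F := fun x => by
    rw [hF]; exact iterateFrobenius_def p r x
  have hW : (W.map σ).toAffine = W := by
    have : ∀ x : F, σ (algebraMap F k x) = algebraMap F k x := fun x => by
      rw [hσ, ← _root_.map_pow, FiniteField.pow_card]
    ext <;> exact this _
  let h : Chg (W.map σ).toAffine W 1 0 0 0 := Chg.of_eq hW
  have hfrob := isFrob_frobHom hσ h
  have hq : 2 ≤ Fintype.card F := Fintype.one_lt_card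
  let π : goodEnd W := ⟨frobHom σ h, h.isGood_hom.comp (isGood_mapHom hσ W)⟩
  have hD := degForm_goodDeg W
  have hπ : goodDeg π = p ^ r := by
    refine (hasDeg_goodDeg π).unique (HasX.hasDeg (pow_ne_zero _ hp.ne_zero)
      (A := X ^ p ^ r) (B := 1) ⟨⟨?_, ?_, ?_⟩, ?_⟩)
    · intro i; fin_cases i <;> simp
    · exact fun z => ⟨1, by simp⟩
    · exact ⟨0, by simp⟩
    · filter_upwards [eventually_ne 0] with P hP
      obtain ⟨h1, h2, -⟩ := hfrob P hP
      rw [hF] at h2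
      exact ⟨h1, by simp, by simpa using! h2⟩
  have h1π : (Nat.card W₀.toAffine.Point : ℤ) = goodDeg (1 - π) := by
    obtain ⟨d, A, B, hd, hX, hs⟩ := hfrob.exists_hasX_one_sub hq
    rw [hfrob.card_ker, hX.card_ker_eq hd hs]
    exact_mod_cast (hX.hasDeg hd).unique (hasDeg_goodDeg (1 - π))
  have htr : (degForm_goodDeg W).tr π = -t := by
    have := hD.one_sub π
    rw [← h1π, hcard, hπ] at this
    push_cast at this
    linarith
  refine supersingular_trace (φ := π) (fun P hP => ?_) hπ htr
  have h2 := goodEnd_apply_apply π P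
  obtain ⟨e, he⟩ := hpt
  have hpP : (p : ℤ) • P = 0 := by rwa [natCast_zsmul]
  have hinj : Function.Injective (π : AddMonoid.End W.Point) :=
    h.hom_injective.comp (mapHom_injective σ)
  rw [htr, he, hπ, ← _root_.map_zsmul, ← mul_neg, mul_comm, mul_smul, hpP, smul_zero,
    _root_.map_zero, show r = r - 1 + 1 by omega, pow_succ, mul_nsmul', hP, smul_zero, sub_zero] at h2
  rw [← _root_.map_zero (π : AddMonoid.End W.Point)] at h2
  have h3 := hinj h2
  rw [← _root_.map_zero (π : AddMonoid.End W.Point)] at h3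
  exact hinj h3

end WeierstrassCurve.Affine.Point

end

section

open Polynomial Filter Topology
open scoped PeriodPair

namespace PeriodPair

variable (L : PeriodPair)

/-- The Weierstrass cubic attached to a lattice. -/
noncomputable def cubic (x : ℂ) : ℂ := 4 * x ^ 3 - L.g₂ * x - L.g₃

lemma derivWeierstrassP_sq' {z : ℂ} (hz : z ∉ L.lattice) : ℘'[L] z ^ 2 = L.cubic (℘[L] z) :=
  L.derivWeierstrassP_sq z hz

lemma isPreconnected_compl_of_countable {s : Set ℂ} (hs : s.Countable) : IsPreconnected sᶜ :=
  (hs.isConnected_compl_of_one_lt_rank (by simp)).isPreconnected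

lemma countable_lattice : (L.lattice : Set ℂ).Countable :=
  countable_of_Lindelof_of_discrete (X := L.lattice)

lemma isOpen_compl_lattice : IsOpen (L.lattice : Set ℂ)ᶜ := L.isClosed_lattice.isOpen_compl

lemma eventually_notMem_lattice (z : ℂ) : ∀ᶠ w in 𝓝[≠] z, w ∉ L.lattice := by
  filter_upwards [self_mem_nhdsWithin,
    mem_nhdsWithin_of_mem_nhds (L.compl_lattice_sdiff_singleton_mem_nhds z)] with w hw hw'
  simp_all

lemma analyticAt_weierstrassP {z : ℂ} (hz : z ∉ L.lattice) : AnalyticAt ℂ ℘[L] z :=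
  L.analyticOnNhd_weierstrassP _ hz

lemma analyticAt_derivWeierstrassP {z : ℂ} (hz : z ∉ L.lattice) : AnalyticAt ℂ ℘'[L] z :=
  L.analyticOnNhd_derivWeierstrassP _ hz

lemma hasDerivAt_weierstrassP {z : ℂ} (hz : z ∉ L.lattice) : HasDerivAt ℘[L] (℘'[L] z) z := by
  rw [← L.deriv_weierstrassP]
  exact (L.analyticAt_weierstrassP hz).differentiableAt.hasDerivAt

lemma tendsto_weierstrassP {l : ℂ} (hl : l ∈ L.lattice) :
    Tendsto ℘[L] (𝓝[≠] l) (Bornology.cobounded ℂ) := by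
  rw [tendsto_cobounded_iff_meromorphicOrderAt_neg (L.meromorphic_weierstrassP l),
    L.order_weierstrassP l hl]
  exact compare_gt_iff_gt.mp rfl

lemma eventually_weierstrassP_ne (c z : ℂ) : ∀ᶠ w in 𝓝[≠] z, ℘[L] w ≠ c := by
  have h0 {l : ℂ} (hl : l ∈ L.lattice) : ∀ᶠ w in 𝓝[≠] l, ℘[L] w ≠ c :=
    (L.tendsto_weierstrassP hl).eventually (Bornology.eventually_ne_cobounded c)
  by_cases hz : z ∈ L.lattice
  · exact h0 hz
  · have := (L.analyticAt_weierstrassP hz).eventually_eq_or_eventually_ne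
      (analyticAt_const (v := c))
    refine this.resolve_left fun h => ?_
    have h1 := L.analyticOnNhd_weierstrassP.eqOn_of_preconnected_of_eventuallyEq
      (analyticOnNhd_const (v := c)) (isPreconnected_compl_of_countable L.countable_lattice) hz h
    obtain ⟨w, hw, hw'⟩ := ((h0 L.lattice.zero_mem).and (L.eventually_notMem_lattice 0)).exists
    exact hw (h1 hw')

lemma cubic_ne_of_notMem {s : Finset ℂ} (z : ℂ) : ∀ᶠ w in 𝓝[≠] z, ℘[L] w ∉ s := by
  have := (eventually_all_finset s (l := 𝓝[≠] z) (p := fun c w => ℘[L] w ≠ c)).2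
    fun c _ => L.eventually_weierstrassP_ne c z
  filter_upwards [this] with w hw hs
  exact hw _ hs rfl

lemma eventually_eval_weierstrassP_ne {f : ℂ[X]} (hf : f ≠ 0) (z : ℂ) :
    ∀ᶠ w in 𝓝[≠] z, f.eval (℘[L] w) ≠ 0 := by
  filter_upwards [L.cubic_ne_of_notMem (s := f.roots.toFinset) z] with w hw h
  exact hw (by simpa [hf] using! h)

lemma eventually_cubic_ne (z : ℂ) : ∀ᶠ w in 𝓝[≠] z, L.cubic (℘[L] w) ≠ 0 := by
  have hf : (4 * X ^ 3 - C L.g₂ * X - C L.g₃ : ℂ[X]) ≠ 0 := by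
    intro h
    have := congrArg (fun f => f.coeff 3) h
    simp at this
  filter_upwards [L.eventually_eval_weierstrassP_ne hf z] with w hw
  simpa [cubic] using hw

lemma eventually_derivWeierstrassP_ne (z : ℂ) : ∀ᶠ w in 𝓝[≠] z, ℘'[L] w ≠ 0 := by
  filter_upwards [L.eventually_cubic_ne z, L.eventually_notMem_lattice z] with w hw hw' h
  rw [← L.derivWeierstrassP_sq' hw', h] at hw
  simp at hw

lemma hasDerivAt_derivWeierstrassP {z : ℂ} (hz : z ∉ L.lattice) :
    HasDerivAt ℘'[L] (6 * ℘[L] z ^ 2 - L.g₂ / 2) z := by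
  have han := L.analyticAt_derivWeierstrassP hz
  have key : ∀ᶠ w in 𝓝[≠] z, deriv ℘'[L] w = 6 * ℘[L] w ^ 2 - L.g₂ / 2 := by
    filter_upwards [L.eventually_notMem_lattice z, L.eventually_derivWeierstrassP_ne z]
      with w hw hw'
    have h1 := (L.analyticAt_derivWeierstrassP hw).differentiableAt.hasDerivAt
    have h2 := L.hasDerivAt_weierstrassP hw
    have h3 := (h1.mul h1)
    have h4 := ((((h2.pow 3).const_mul 4).sub (h2.const_mul L.g₂)).sub_const L.g₃)
    have h5 : (℘'[L] * ℘'[L]) =ᶠ[𝓝 w] fun x => 4 * (℘[L] ^ 3) x - L.g₂ * ℘[L] x - L.g₃ := by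
      filter_upwards [L.isOpen_compl_lattice.mem_nhds hw] with u hu
      simpa [sq] using L.derivWeierstrassP_sq u hu
    have h6 := h3.unique (h4.congr_of_eventuallyEq h5)
    apply mul_left_cancel₀ (mul_ne_zero two_ne_zero hw')
    simp only [Nat.cast_ofNat, Nat.add_one_sub_one] at h6
    linear_combination h6
  have h1 : Tendsto (deriv ℘'[L]) (𝓝[≠] z) (𝓝 (deriv ℘'[L] z)) :=
    han.deriv.continuousAt.tendsto.mono_left nhdsWithin_le_nhds
  have h2 : Tendsto (fun w => 6 * ℘[L] w ^ 2 - L.g₂ / 2) (𝓝[≠] z)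
      (𝓝 (6 * ℘[L] z ^ 2 - L.g₂ / 2)) := by
    have := (L.analyticAt_weierstrassP hz).continuousAt
    exact ContinuousAt.tendsto (f := fun w => 6 * ℘[L] w ^ 2 - L.g₂ / 2)
      (by fun_prop) |>.mono_left nhdsWithin_le_nhds
  rw [← tendsto_nhds_unique_of_eventuallyEq h1 h2 key]
  exact han.differentiableAt.hasDerivAt

/-- The curve `y² = x³ - (g₂/4) x - g₃/4`. -/
noncomputable def curve : WeierstrassCurve ℂ := ⟨0, 0, 0, -L.g₂ / 4, -L.g₃ / 4⟩

lemma nonsingular {z : ℂ} (hz : z ∉ L.lattice) :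
    L.curve.toAffine.Nonsingular (℘[L] z) (℘'[L] z / 2) := by
  rw [WeierstrassCurve.Affine.nonsingular_iff, WeierstrassCurve.Affine.equation_iff]
  refine ⟨by simp only [curve]; linear_combination L.derivWeierstrassP_sq z hz / 4, ?_⟩
  by_contra! h
  simp only [curve] at h
  obtain ⟨h1, h2⟩ := h
  have hd : ℘'[L] z = 0 := by linear_combination h2
  have hdd : 6 * ℘[L] z ^ 2 - L.g₂ / 2 = 0 := by linear_combination -2 * h1
  set c := ℘[L] z with hc
  have han := (L.analyticAt_weierstrassP hz).sub (analyticAt_const (v := c))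
  obtain ⟨n, g, hg, hg0, hfg⟩ := han.exists_eventuallyEq_pow_smul_nonzero_iff.2 (by
    intro h
    obtain ⟨w, hw, hw'⟩ := ((L.eventually_weierstrassP_ne c z).and
      (h.filter_mono nhdsWithin_le_nhds)).exists
    exact hw (sub_eq_zero.1 hw'))
  have hn : n ≠ 0 := by
    rintro rfl
    have := hfg.self_of_nhds
    simp [← hc] at this
    exact hg0 this.symm
  obtain ⟨m, rfl⟩ := Nat.exists_eq_succ_of_ne_zero hn
  have key : ∀ᶠ w in 𝓝[≠] z, ((m + 1) * g w + (w - z) * deriv g w) ^ 2 =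
      (w - z) ^ 2 * g w ^ 2 * (4 * ((w - z) ^ (m + 1) * g w) + 12 * c) := by
    filter_upwards [L.eventually_notMem_lattice z, self_mem_nhdsWithin,
      hfg.filter_mono nhdsWithin_le_nhds, hfg.eventually_nhds.filter_mono nhdsWithin_le_nhds,
      hg.eventually_analyticAt.filter_mono nhdsWithin_le_nhds] with w hw hwz hf1 hf2 hg1
    have hwz' : w - z ≠ 0 := sub_ne_zero.2 hwz
    have e1 := (L.hasDerivAt_weierstrassP hw).sub_const c
    have e2 := ((((hasDerivAt_id w).sub_const z).pow (m + 1)).mul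
      hg1.differentiableAt.hasDerivAt).congr_of_eventuallyEq hf2
    have e3 := e1.unique e2
    have e4 := L.derivWeierstrassP_sq w hw
    simp only [Pi.sub_apply, smul_eq_mul, Nat.succ_eq_add_one] at hf1
    simp at e3
    have hp : ℘[L] w = c + (w - z) ^ (m + 1) * g w := by linear_combination hf1
    have h0 : 4 * c ^ 3 - L.g₂ * c - L.g₃ = 0 := by
      rw [hc, ← L.derivWeierstrassP_sq z hz, hd]; simp
    apply mul_left_cancel₀ (pow_ne_zero (2 * m) hwz')
    rw [e3, hp] at e4
    linear_combination e4 + h0 + 2 * ((w - z) ^ (m + 1) * g w) * hdd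
  have t1 : Tendsto (fun w => ((m + 1) * g w + (w - z) * deriv g w) ^ 2) (𝓝[≠] z)
      (𝓝 (((m + 1) * g z + (z - z) * deriv g z) ^ 2)) := by
    have := hg.continuousAt
    have := hg.deriv.continuousAt
    exact ContinuousAt.tendsto (f := fun w => ((m + 1) * g w + (w - z) * deriv g w) ^ 2)
      (by fun_prop) |>.mono_left nhdsWithin_le_nhds
  have t2 : Tendsto (fun w => (w - z) ^ 2 * g w ^ 2 * (4 * ((w - z) ^ (m + 1) * g w) + 12 * c))
      (𝓝[≠] z) (𝓝 ((z - z) ^ 2 * g z ^ 2 * (4 * ((z - z) ^ (m + 1) * g z) + 12 * c))) := by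
    have := hg.continuousAt
    exact ContinuousAt.tendsto
      (f := fun w => (w - z) ^ 2 * g w ^ 2 * (4 * ((w - z) ^ (m + 1) * g w) + 12 * c))
      (by fun_prop) |>.mono_left nhdsWithin_le_nhds
  have := tendsto_nhds_unique_of_eventuallyEq t1 t2 key
  have hm : (m : ℂ) + 1 ≠ 0 := by exact_mod_cast Nat.succ_ne_zero m
  simp [hm, hg0] at this

end PeriodPair

end

section

open Polynomial Filter Topology
open scoped PeriodPair

/-- A function whose derivative vanishes on a punctured neighbourhood of `0` and which has a limit
at `0` is eventually equal to that limit. -/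
lemma Complex.eventually_eq_of_hasDerivAt_zero {f : ℂ → ℂ} {c : ℂ}
    (hf : ∀ᶠ z in 𝓝[≠] 0, HasDerivAt f 0 z) (hc : Tendsto f (𝓝[≠] 0) (𝓝 c)) :
    ∀ᶠ z in 𝓝[≠] 0, f z = c := by
  rw [eventually_nhdsWithin_iff, Metric.eventually_nhds_iff_ball] at hf
  obtain ⟨ε, hε, hf⟩ := hf
  rw [eventually_nhdsWithin_iff, Metric.eventually_nhds_iff_ball]
  refine ⟨ε, hε, fun z hz hz0 => ?_⟩
  replace hz0 : z ≠ 0 := hz0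
  have hnz : 0 < normSq z := normSq_pos.2 hz0
  set U : Set ℂ := Metric.ball 0 ε ∩ {w | 0 < (w * (starRingEnd ℂ) z).re} with hU
  have hlin : ∀ w, (w * (starRingEnd ℂ) z).re = z.re * w.re + z.im * w.im := fun w => by
    simp; ring
  have hconv : Convex ℝ U := by
    refine (convex_ball 0 ε).inter ?_
    simp only [hlin]
    intro a ha b hb s t hs ht hst
    simp only [Set.mem_ofPred] at *
    have : z.re * (s • a + t • b).re + z.im * (s • a + t • b).im =
      s * (z.re * a.re + z.im * a.im) + t * (z.re * b.re + z.im * b.im) := by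
        simp; ring
    rw [this]
    rcases hs.eq_or_lt with rfl | hs
    · simp at hst
      subst hst
      simpa
    · positivity
  have hopen : IsOpen U := by
    refine Metric.isOpen_ball.inter (isOpen_lt continuous_const ?_)
    fun_prop
  have hd : ∀ w ∈ U, HasDerivAt f 0 w := by
    rintro w ⟨hw, hw'⟩
    refine hf w hw ?_
    rintro rfl
    simp at hw'
  have hconst : ∀ w ∈ U, f w = f z := by
    intro w hw
    refine hopen.is_const_of_deriv_eq_zero hconv.isPreconnected
      (fun x hx => (hd x hx).differentiableAt.differentiableWithinAt)
      (fun x hx => (hd x hx).deriv) hw ⟨hz, ?_⟩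
    simp only [Set.mem_ofPred, mul_conj]
    simpa using hz0
  have ht : Tendsto (fun t : ℝ => (t : ℂ) * z) (𝓝[>] 0) (𝓝[≠] 0) := by
    refine tendsto_nhdsWithin_iff.2 ⟨?_, ?_⟩
    · have : Continuous fun t : ℝ => (t : ℂ) * z := by fun_prop
      simpa using (this.tendsto 0).mono_left nhdsWithin_le_nhds
    · filter_upwards [self_mem_nhdsWithin] with t ht
      have : t ≠ 0 := ne_of_gt ht
      simp [this, hz0]
  have hev : ∀ᶠ t : ℝ in 𝓝[>] 0, f ((t : ℂ) * z) = f z := by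
    filter_upwards [self_mem_nhdsWithin, (ht.mono_right nhdsWithin_le_nhds).eventually
      (Metric.ball_mem_nhds 0 hε)] with t ht htb
    refine hconst _ ⟨htb, ?_⟩
    replace ht : 0 < t := ht
    simp only [Set.mem_ofPred]
    rw [mul_assoc, mul_conj, ← ofReal_mul, ofReal_re]
    positivity
  exact tendsto_nhds_unique (tendsto_const_nhds.congr' (hev.mono fun _ h => h.symm)) (hc.comp ht)

namespace PeriodPair

variable (L : PeriodPair)

lemma tendsto_chord {l : Filter ℂ} {x y u v : ℂ → ℂ} {a b c d : ℂ}
    (hx : Tendsto x l (Bornology.cobounded ℂ)) (hu : Tendsto u l (𝓝 c)) (hv : Tendsto v l (𝓝 d))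
    (h1 : ∀ᶠ z in l, y z ^ 2 = x z ^ 3 + a * x z + b)
    (h2 : ∀ᶠ z in l, v z ^ 2 = u z ^ 3 + a * u z + b) :
    Tendsto (fun z => ((y z - v z) / (x z - u z)) ^ 2 - x z - u z) l (𝓝 c) := by
  have hxu : Tendsto (fun z => x z - u z) l (Bornology.cobounded ℂ) := by
    rw [← tendsto_norm_atTop_iff_cobounded] at hx ⊢
    refine tendsto_atTop_mono' l (f₁ := fun z => ‖x z‖ - ‖u z‖)
      (Eventually.of_forall fun z => norm_sub_norm_le _ _) ?_
    simpa [sub_eq_add_neg] using! hx.atTop_add hu.norm.neg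
  have he : Tendsto (fun z => (x z - u z)⁻¹) l (𝓝 0) := tendsto_inv₀_cobounded.comp hxu
  set e := fun z => (x z - u z)⁻¹ with hedef
  have hne : ∀ᶠ z in l, x z - u z ≠ 0 := hxu.eventually (Bornology.eventually_ne_cobounded 0)
  have hye : Tendsto (fun z => y z * e z ^ 2) l (𝓝 0) := by
    have hsq : Tendsto (fun z => (1 + u z * e z) ^ 3 * e z + a * (1 + u z * e z) * e z ^ 3 +
        b * e z ^ 4) l (𝓝 ((1 + c * 0) ^ 3 * 0 + a * (1 + c * 0) * 0 ^ 3 + b * 0 ^ 4)) :=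
      ((((tendsto_const_nhds.add (hu.mul he)).pow 3).mul he).add
        ((tendsto_const_nhds.mul (tendsto_const_nhds.add (hu.mul he))).mul (he.pow 3))).add
          (tendsto_const_nhds.mul (he.pow 4))
    have hsq' : Tendsto (fun z => (y z * e z ^ 2) ^ 2) l (𝓝 0) := by
      rw [show (0 : ℂ) = (1 + c * 0) ^ 3 * 0 + a * (1 + c * 0) * 0 ^ 3 + b * 0 ^ 4 by ring]
      refine hsq.congr' ?_
      filter_upwards [h1, hne] with z hz hz0
      have : x z * e z = 1 + u z * e z := by
        simp only [hedef]; field_simp; ring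
      rw [mul_pow, hz, ← this]
      ring
    rw [tendsto_zero_iff_norm_tendsto_zero] at hsq' ⊢
    have := hsq'.sqrt
    simp only [norm_pow, Real.sqrt_zero, Real.sqrt_sq (norm_nonneg _)] at this
    exact this
  have hlim : Tendsto (fun z => u z + ((3 * u z ^ 2 + a) * ((1 + u z * e z) * e z) +
      (a * u z + 2 * b - u z ^ 3) * e z ^ 2 - 2 * v z * (y z * e z ^ 2))) l
      (𝓝 (c + ((3 * c ^ 2 + a) * ((1 + c * 0) * 0) + (a * c + 2 * b - c ^ 3) * 0 ^ 2
        - 2 * d * 0))) :=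
    hu.add (((((tendsto_const_nhds.mul (hu.pow 2)).add tendsto_const_nhds).mul
      ((tendsto_const_nhds.add (hu.mul he)).mul he)).add
      ((((tendsto_const_nhds.mul hu).add tendsto_const_nhds).sub (hu.pow 3)).mul (he.pow 2))).sub
      ((tendsto_const_nhds.mul hv).mul hye))
  have hc : c + ((3 * c ^ 2 + a) * ((1 + c * 0) * 0) + (a * c + 2 * b - c ^ 3) * 0 ^ 2
      - 2 * d * 0) = c := by ring
  rw [hc] at hlim
  refine hlim.congr' ?_
  filter_upwards [h1, h2, hne] with z hz1 hz2 hz0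
  have : x z * e z = 1 + u z * e z := by
    simp only [hedef]; field_simp; ring
  rw [← this]
  simp only [hedef]
  field_simp
  linear_combination -hz1 - hz2

/-- The addition formula for `℘`. -/
lemma weierstrassP_add {u v : ℂ} (hu : u ∉ L.lattice) (hv : v ∉ L.lattice)
    (huv : u + v ∉ L.lattice) :
    ℘[L] (u + v) * (℘[L] u - ℘[L] v) ^ 2 = (℘[L] u * ℘[L] v - L.g₂ / 4) * (℘[L] u + ℘[L] v) -
      L.g₃ / 2 - ℘'[L] u * ℘'[L] v / 2 := by
  obtain ⟨s, rfl⟩ : ∃ s, v = s - u := ⟨u + v, by ring⟩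
  rw [add_sub_cancel] at huv ⊢
  have hs0 : ∀ᶠ z in 𝓝[≠] (0 : ℂ), s - z ∉ L.lattice := by
    have hcont : ContinuousAt (fun z => s - z) 0 := by fun_prop
    have h1 : (L.lattice : Set ℂ)ᶜ ∈ 𝓝 (s - 0) :=
      L.isOpen_compl_lattice.mem_nhds (by simpa using! huv)
    exact (hcont.tendsto.eventually h1).filter_mono nhdsWithin_le_nhds
  have hana : AnalyticAt ℂ ℘[L] (s - 0) := L.analyticAt_weierstrassP (by simpa using huv)
  have hanb : AnalyticAt ℂ ℘'[L] (s - 0) := L.analyticAt_derivWeierstrassP (by simpa using huv)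
  have hta : Tendsto (fun z => ℘[L] (s - z)) (𝓝[≠] 0) (𝓝 (℘[L] s)) := by
    have h : ContinuousAt (fun z => ℘[L] (s - z)) 0 :=
      ContinuousAt.comp (f := fun z => s - z) (g := ℘[L]) hana.continuousAt (by fun_prop)
    simpa using h.tendsto.mono_left nhdsWithin_le_nhds
  have htb : Tendsto (fun z => ℘'[L] (s - z) / 2) (𝓝[≠] 0) (𝓝 (℘'[L] s / 2)) := by
    have h : ContinuousAt (fun z => ℘'[L] (s - z)) 0 :=
      ContinuousAt.comp (f := fun z => s - z) (g := ℘'[L]) hanb.continuousAt (by fun_prop)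
    simpa using! (h.tendsto.mono_left nhdsWithin_le_nhds).div_const 2
  have ht0 := L.tendsto_weierstrassP L.lattice.zero_mem
  have hne : ∀ᶠ z in 𝓝[≠] (0 : ℂ), ℘[L] z ≠ ℘[L] (s - z) := by
    obtain ⟨M, hM⟩ := (hta.norm.isBoundedUnder_le)
    have h2 := (tendsto_norm_atTop_iff_cobounded.2 ht0).eventually_gt_atTop M
    filter_upwards [h2, eventually_map.1 hM] with z hz hz' h
    rw [h] at hz
    exact absurd hz' (not_le.2 hz)
  have hlim := tendsto_chord (a := -L.g₂ / 4) (b := -L.g₃ / 4) ht0 hta htb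
    (y := fun z => ℘'[L] z / 2) (by
      filter_upwards [L.eventually_notMem_lattice 0] with z hz
      linear_combination L.derivWeierstrassP_sq z hz / 4) (by
      filter_upwards [hs0] with z hz
      linear_combination L.derivWeierstrassP_sq _ hz / 4)
  have hder : ∀ᶠ z in 𝓝[≠] (0 : ℂ), HasDerivAt (fun z => ((℘'[L] z / 2 - ℘'[L] (s - z) / 2) /
      (℘[L] z - ℘[L] (s - z))) ^ 2 - ℘[L] z - ℘[L] (s - z)) 0 z := by
    filter_upwards [L.eventually_notMem_lattice 0, hs0, hne] with z hz hsz hzne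
    have hD : ℘[L] z - ℘[L] (s - z) ≠ 0 := sub_ne_zero.2 hzne
    have hid : HasDerivAt (fun z => s - z) (-1) z := by simpa using (hasDerivAt_id z).const_sub s
    have d1 := L.hasDerivAt_weierstrassP hz
    have d2 : HasDerivAt (fun z => ℘[L] (s - z)) _ z := (L.hasDerivAt_weierstrassP hsz).comp z hid
    have d3 := L.hasDerivAt_derivWeierstrassP hz
    have d4 : HasDerivAt (fun z => ℘'[L] (s - z)) _ z :=
      (L.hasDerivAt_derivWeierstrassP hsz).comp z hid
    have e1 := L.derivWeierstrassP_sq z hz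
    have e2 := L.derivWeierstrassP_sq _ hsz
    refine (((((d3.div_const 2).sub (d4.div_const 2)).div (d1.sub d2) hD).pow 2).sub d1).sub d2
      |>.congr_deriv ?_
    simp
    field_simp
    linear_combination -2 * (℘'[L] z - ℘'[L] (s - z)) * (e1 - e2)
  have hev := Complex.eventually_eq_of_hasDerivAt_zero hder hlim
  set V : Set ℂ := ((L.lattice : Set ℂ) ∪ (fun z => s - z) '' (L.lattice : Set ℂ))ᶜ with hV
  have hVmem {z : ℂ} : z ∈ V ↔ z ∉ L.lattice ∧ s - z ∉ L.lattice := by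
    simp only [hV, Set.mem_compl_iff, Set.mem_union, Set.mem_image, SetLike.mem_coe, not_or]
    refine and_congr_right fun _ => not_congr ⟨?_, fun h => ⟨s - z, h, by ring⟩⟩
    rintro ⟨w, hw, rfl⟩
    simpa using hw
  have hVc : IsPreconnected V := isPreconnected_compl_of_countable
    (L.countable_lattice.union (L.countable_lattice.image _))
  have hN : AnalyticOnNhd ℂ (fun z => ℘[L] s * (℘[L] z - ℘[L] (s - z)) ^ 2 -
      ((℘[L] z * ℘[L] (s - z) - L.g₂ / 4) * (℘[L] z + ℘[L] (s - z)) -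
      L.g₃ / 2 - ℘'[L] z * ℘'[L] (s - z) / 2)) V := by
    intro z hz
    obtain ⟨hz1, hz2⟩ := hVmem.1 hz
    have hid : AnalyticAt ℂ (fun z => s - z) z := by fun_prop
    have := L.analyticAt_weierstrassP hz1
    have := L.analyticAt_derivWeierstrassP hz1
    have : AnalyticAt ℂ (fun z => ℘[L] (s - z)) z :=
      AnalyticAt.fun_comp (L.analyticAt_weierstrassP hz2) hid
    have : AnalyticAt ℂ (fun z => ℘'[L] (s - z)) z :=
      AnalyticAt.fun_comp (L.analyticAt_derivWeierstrassP hz2) hid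
    fun_prop
  have hzero : ∀ᶠ z in 𝓝[≠] (0 : ℂ), ℘[L] s * (℘[L] z - ℘[L] (s - z)) ^ 2 -
      ((℘[L] z * ℘[L] (s - z) - L.g₂ / 4) * (℘[L] z + ℘[L] (s - z)) -
      L.g₃ / 2 - ℘'[L] z * ℘'[L] (s - z) / 2) = 0 := by
    filter_upwards [L.eventually_notMem_lattice 0, hs0, hne, hev] with z hz hsz hzne h
    have hD : ℘[L] z - ℘[L] (s - z) ≠ 0 := sub_ne_zero.2 hzne
    have e1 := L.derivWeierstrassP_sq z hz
    have e2 := L.derivWeierstrassP_sq _ hsz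
    rw [← h]
    field_simp
    linear_combination 4 * e1 + 4 * e2
  obtain ⟨z₀, ⟨⟨hz1, hz2⟩, hz3⟩⟩ := (((L.eventually_notMem_lattice 0).and hs0).and
    (eventually_eventually_nhdsWithin.2 hzero |>.and self_mem_nhdsWithin)).exists
  have hz0 : z₀ ≠ 0 := hz3.2
  have h0 : ∀ᶠ z in 𝓝 z₀, ℘[L] s * (℘[L] z - ℘[L] (s - z)) ^ 2 -
      ((℘[L] z * ℘[L] (s - z) - L.g₂ / 4) * (℘[L] z + ℘[L] (s - z)) -
      L.g₃ / 2 - ℘'[L] z * ℘'[L] (s - z) / 2) = 0 := by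
    have := hz3.1
    rwa [isOpen_compl_singleton.nhdsWithin_eq (show z₀ ∈ ({0}ᶜ : Set ℂ) from hz0)] at this
  have := hN.eqOn_zero_of_preconnected_of_eventuallyEq_zero hVc (hVmem.2 ⟨hz1, hz2⟩) h0
    (hVmem.2 ⟨hu, hv⟩)
  simp only [Pi.zero_apply] at this
  linear_combination this

/-- The addition formula for the derivative of `℘`. -/
lemma derivWeierstrassP_add {u v : ℂ} (hu : u ∉ L.lattice) (hv : v ∉ L.lattice)
    (huv : u + v ∉ L.lattice) (hne : ℘[L] u ≠ ℘[L] v) :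
    ℘'[L] (u + v) / 2 = -((℘'[L] u / 2 - ℘'[L] v / 2) / (℘[L] u - ℘[L] v) *
      (℘[L] (u + v) - ℘[L] u) + ℘'[L] u / 2) := by
  have hD : ℘[L] u - ℘[L] v ≠ 0 := sub_ne_zero.2 hne
  have d1 := L.hasDerivAt_weierstrassP hv
  have d2 := L.hasDerivAt_derivWeierstrassP hv
  have hid : HasDerivAt (fun z => u + z) 1 v := by simpa using (hasDerivAt_id v).const_add u
  have d3 : HasDerivAt (fun z => ℘[L] (u + z)) _ v := (L.hasDerivAt_weierstrassP huv).comp v hid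
  have hcont : ContinuousAt (fun z => u + z) v := by fun_prop
  have h1 := (d3.mul ((d1.const_sub (℘[L] u)).pow 2))
  have h2 := (((((d1.const_mul (℘[L] u)).sub_const (L.g₂ / 4)).mul (d1.const_add (℘[L] u))).sub_const
    (L.g₃ / 2)).sub ((d2.const_mul (℘'[L] u)).div_const 2)).congr_of_eventuallyEq (f₁ :=
      (fun z => ℘[L] (u + z)) * (fun z => ℘[L] u - ℘[L] z) ^ 2) (by
    filter_upwards [L.isOpen_compl_lattice.mem_nhds hv,
      hcont.tendsto.eventually (L.isOpen_compl_lattice.mem_nhds huv)] with z hz hz'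
    simpa using! L.weierstrassP_add hu hz hz')
  have h3 := h1.unique h2
  have h4 := L.weierstrassP_add hu hv huv
  have e1 := L.derivWeierstrassP_sq u hu
  have e2 := L.derivWeierstrassP_sq v hv
  simp at h3
  have hgoal : ℘'[L] (u + v) * (℘[L] u - ℘[L] v) ^ 3 =
      -((℘'[L] u - ℘'[L] v) * (℘[L] u - ℘[L] v) ^ 2 *
      (℘[L] (u + v) - ℘[L] u) + ℘'[L] u * (℘[L] u - ℘[L] v) ^ 3) := by
    linear_combination (℘[L] u - ℘[L] v) * h3 + (℘'[L] u + ℘'[L] v) * h4 -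
      ℘'[L] v / 2 * e1 - ℘'[L] u / 2 * e2
  field_simp
  apply mul_left_cancel₀ (pow_ne_zero 2 hD)
  linear_combination hgoal

end PeriodPair

end

section

open Polynomial Filter Topology
open scoped PeriodPair

namespace PeriodPair

variable (L : PeriodPair)

open WeierstrassCurve.Affine WeierstrassCurve.Affine.Point

/-- A meromorphic elliptic function without poles is constant. -/
lemma exists_eventually_eq_const {g : ℂ → ℂ} (hper : ∀ z, ∀ l ∈ L.lattice, g (z + l) = g z)
    (hm : ∀ z, MeromorphicAt g z) (ho : ∀ z, 0 ≤ meromorphicOrderAt g z) :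
    ∃ c, ∀ z, ∀ᶠ w in 𝓝[≠] z, g w = c := by
  have hlim : ∀ z, ∃ c, Tendsto g (𝓝[≠] z) (𝓝 c) := fun z =>
    (tendsto_nhds_iff_meromorphicOrderAt_nonneg (hm z)).2 (ho z)
  set F : ℂ → ℂ := fun z => limUnder (𝓝[≠] z) g with hF
  have hFt : ∀ z, Tendsto g (𝓝[≠] z) (𝓝 (F z)) := fun z => tendsto_nhds_limUnder (hlim z)
  have hFg : ∀ z, ∀ᶠ w in 𝓝[≠] z, F w = g w := by
    intro z
    filter_upwards [(hm z).eventually_analyticAt] with w hw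
    exact tendsto_nhds_unique (hFt w) (hw.continuousAt.tendsto.mono_left nhdsWithin_le_nhds)
  have hFd : Differentiable ℂ F := by
    intro z
    have h1 : MeromorphicAt F z := (hm z).congr ((hFg z).mono fun _ h => h.symm)
    refine (h1.analyticAt ?_).differentiableAt
    rw [continuousAt_iff_punctured_nhds]
    exact (hFt z).congr' ((hFg z).mono fun _ h => h.symm)
  have hFper : ∀ z, ∀ l ∈ L.lattice, F (z + l) = F z := by
    intro z l hl
    refine tendsto_nhds_unique (f := g) (l := 𝓝[≠] (z + l)) (hFt _) ?_
    have ht : Tendsto (fun w => w - l) (𝓝[≠] (z + l)) (𝓝[≠] z) := by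
      refine tendsto_nhdsWithin_iff.2 ⟨?_, ?_⟩
      · have : ContinuousAt (fun w => w - l) (z + l) := by fun_prop
        simpa using this.tendsto.mono_left nhdsWithin_le_nhds
      · filter_upwards [self_mem_nhdsWithin] with w hw h
        exact hw (by simp only [Set.mem_singleton_iff] at h ⊢; rw [← h]; ring)
    refine ((hFt z).comp ht).congr fun w => ?_
    rw [Function.comp, ← hper (w - l) l hl, sub_add_cancel]
  refine ⟨F 0, fun z => (hFg z).mono fun w hw => hw ▸ ?_⟩
  exact hFd.apply_eq_apply_of_bounded (IsZLattice.isCompact_range_of_periodic L.lattice _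
    hFd.continuous hFper).isBounded w 0

lemma weierstrassP_add_mem (z : ℂ) {l : ℂ} (hl : l ∈ L.lattice) : ℘[L] (z + l) = ℘[L] z :=
  L.weierstrassP_add_coe z ⟨l, hl⟩

lemma derivWeierstrassP_add_mem (z : ℂ) {l : ℂ} (hl : l ∈ L.lattice) :
    ℘'[L] (z + l) = ℘'[L] z :=
  L.derivWeierstrassP_add_coe z ⟨l, hl⟩

lemma exists_weierstrassP_eq (c : ℂ) : ∃ z ∉ L.lattice, ℘[L] z = c := by
  by_contra! h
  have hm : ∀ z, MeromorphicAt (fun z => (℘[L] z - c)⁻¹) z := fun z =>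
    ((L.meromorphic_weierstrassP z).sub (MeromorphicAt.const c z)).inv
  have hl : ∀ l ∈ L.lattice, Tendsto (fun z => (℘[L] z - c)⁻¹) (𝓝[≠] l) (𝓝 0) := by
    intro l hl
    refine tendsto_inv₀_cobounded.comp ?_
    have := L.tendsto_weierstrassP hl
    rw [← tendsto_norm_atTop_iff_cobounded] at this ⊢
    refine tendsto_atTop_mono (f := fun z => ‖℘[L] z‖ - ‖c‖) (fun z => norm_sub_norm_le _ _) ?_
    exact tendsto_atTop_add_const_right _ _ this
  obtain ⟨d, hd⟩ := L.exists_eventually_eq_const (g := fun z => (℘[L] z - c)⁻¹)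
    (fun z l hl => by rw [L.weierstrassP_add_mem z hl]) hm (fun z => by
      rw [← tendsto_nhds_iff_meromorphicOrderAt_nonneg (hm z)]
      by_cases hz : z ∈ L.lattice
      · exact ⟨0, hl z hz⟩
      · have := (L.analyticAt_weierstrassP hz).continuousAt
        have h2 : ContinuousAt (fun z => (℘[L] z - c)⁻¹) z :=
          (this.sub continuousAt_const).inv₀ (sub_ne_zero.2 (h z hz))
        exact ⟨_, h2.tendsto.mono_left nhdsWithin_le_nhds⟩)
  have hd0 : d = 0 := tendsto_nhds_unique
    (tendsto_const_nhds.congr' ((hd 0).mono fun _ h => h.symm)) (hl 0 L.lattice.zero_mem)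
  obtain ⟨w, hw, hw'⟩ := ((hd 0).and (L.eventually_notMem_lattice 0)).exists
  rw [hd0, inv_eq_zero, sub_eq_zero] at hw
  exact h w hw' hw

lemma curve_Δ_ne_zero : L.curve.Δ ≠ 0 := by
  intro h
  have hΔ : L.g₂ ^ 3 = 27 * L.g₃ ^ 2 := by
    simp only [WeierstrassCurve.Δ, WeierstrassCurve.b₂, WeierstrassCurve.b₄, WeierstrassCurve.b₆,
      WeierstrassCurve.b₈, curve] at h
    linear_combination h
  obtain ⟨e, he1, he2⟩ : ∃ e, 4 * e ^ 3 - L.g₂ * e - L.g₃ = 0 ∧ 12 * e ^ 2 = L.g₂ := by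
    by_cases h2 : L.g₂ = 0
    · refine ⟨0, ?_, by simp [h2]⟩
      have : L.g₃ = 0 := by simpa [h2] using hΔ
      simp [this]
    · refine ⟨-3 * L.g₃ / (2 * L.g₂), ?_, ?_⟩
      · field_simp
        linear_combination 4 * L.g₃ * hΔ
      · field_simp
        linear_combination -4 * hΔ
  obtain ⟨w, hw, rfl⟩ := L.exists_weierstrassP_eq e
  have h1 := L.derivWeierstrassP_sq w hw
  rw [he1] at h1
  have hd : ℘'[L] w = 0 := by simpa using h1
  have := L.nonsingular hw
  rw [nonsingular_iff] at this
  simp only [curve, hd] at this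
  rcases this.2 with h | h
  · apply h
    linear_combination -he2 / 4
  · simp at h

instance : L.curve.toAffine.IsElliptic := ⟨IsUnit.mk0 _ L.curve_Δ_ne_zero⟩

open Classical in
/-- The uniformisation `z ↦ (℘ z, ℘' z / 2)`. -/
noncomputable def toPoint (z : ℂ) : L.curve.toAffine.Point :=
  if h : z ∈ L.lattice then 0 else .some _ _ (L.nonsingular h)

variable {L}

lemma toPoint_of_mem {z : ℂ} (h : z ∈ L.lattice) : L.toPoint z = 0 := dif_pos h

lemma toPoint_of_notMem {z : ℂ} (h : z ∉ L.lattice) :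
    L.toPoint z = .some _ _ (L.nonsingular h) := dif_neg h

lemma toPoint_eq_zero {z : ℂ} : L.toPoint z = 0 ↔ z ∈ L.lattice := by
  refine ⟨fun h => ?_, toPoint_of_mem⟩
  by_contra hz
  rw [toPoint_of_notMem hz] at h
  exact some_ne_zero _ h

lemma xc_toPoint {z : ℂ} (h : z ∉ L.lattice) : xc (L.toPoint z) = ℘[L] z := by
  rw [toPoint_of_notMem h, xc_some]

lemma yc_toPoint {z : ℂ} (h : z ∉ L.lattice) : yc (L.toPoint z) = ℘'[L] z / 2 := by
  rw [toPoint_of_notMem h, yc_some]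

lemma toPoint_neg (z : ℂ) : L.toPoint (-z) = -L.toPoint z := by
  by_cases h : z ∈ L.lattice
  · rw [toPoint_of_mem h, toPoint_of_mem (neg_mem h), _root_.neg_zero]
  · have h' : -z ∉ L.lattice := by simpa using h
    have h0 : L.toPoint z ≠ 0 := mt toPoint_eq_zero.1 h
    refine ext_coords (mt toPoint_eq_zero.1 h') (neg_ne_zero.2 h0) ?_ ?_
    · rw [xc_neg, xc_toPoint h, xc_toPoint h', weierstrassP_neg]
    · rw [yc_neg h0, yc_toPoint h, yc_toPoint h', derivWeierstrassP_neg]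
      simp [curve]
      ring

lemma toPoint_add_mem (z : ℂ) {l : ℂ} (hl : l ∈ L.lattice) :
    L.toPoint (z + l) = L.toPoint z := by
  by_cases h : z ∈ L.lattice
  · rw [toPoint_of_mem h, toPoint_of_mem (add_mem h hl)]
  · have h' : z + l ∉ L.lattice := fun h' => h (by simpa using sub_mem h' hl)
    refine ext_coords (mt toPoint_eq_zero.1 h') (mt toPoint_eq_zero.1 h) ?_ ?_
    · rw [xc_toPoint h, xc_toPoint h', L.weierstrassP_add_mem _ hl]
    · rw [yc_toPoint h, yc_toPoint h', L.derivWeierstrassP_add_mem _ hl]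

lemma toPoint_add_of_ne {u v : ℂ} (hu : u ∉ L.lattice) (hv : v ∉ L.lattice)
    (huv : u + v ∉ L.lattice) (hne : ℘[L] u ≠ ℘[L] v) :
    L.toPoint (u + v) = L.toPoint u + L.toPoint v := by
  have hu0 := mt toPoint_eq_zero.1 hu
  have hv0 := mt toPoint_eq_zero.1 hv
  have hx : xc (L.toPoint u) ≠ xc (L.toPoint v) := by rwa [xc_toPoint hu, xc_toPoint hv]
  obtain ⟨h0, h1, h2⟩ := add_coords hu0 hv0 hx
  have hD : ℘[L] u - ℘[L] v ≠ 0 := sub_ne_zero.2 hne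
  have e1 := L.derivWeierstrassP_sq u hu
  have e2 := L.derivWeierstrassP_sq v hv
  have hX : xc (L.toPoint (u + v)) = xc (L.toPoint u + L.toPoint v) := by
    apply mul_right_cancel₀ (pow_ne_zero 2 (sub_ne_zero.2 hx))
    rw [xc_add_mul hu0 hv0 hx, xc_toPoint huv, xc_toPoint hu, xc_toPoint hv, yc_toPoint hu,
      yc_toPoint hv, L.weierstrassP_add hu hv huv]
    simp only [curve]
    linear_combination (-e1 - e2) / 4
  refine ext_coords (mt toPoint_eq_zero.1 huv) h0 hX ?_
  rw [h2, ← hX, yc_toPoint huv, xc_toPoint huv, xc_toPoint hu, xc_toPoint hv, yc_toPoint hu,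
    yc_toPoint hv, L.derivWeierstrassP_add hu hv huv hne]
  simp [curve]

lemma toPoint_add (u v : ℂ) : L.toPoint (u + v) = L.toPoint u + L.toPoint v := by
  by_cases hu : u ∈ L.lattice
  · rw [toPoint_of_mem hu, add_comm, toPoint_add_mem v hu, zero_add]
  by_cases hv : v ∈ L.lattice
  · rw [toPoint_of_mem hv, toPoint_add_mem u hv, add_zero]
  by_cases huv : u + v ∈ L.lattice
  · have : u = -v + (u + v) := by ring
    rw [toPoint_of_mem huv, this, toPoint_add_mem _ huv, toPoint_neg]
    simp
  by_cases hne : ℘[L] u = ℘[L] v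
  · have hsub : ∀ a : ℂ, Tendsto (fun w => a - w) (𝓝[≠] 0) (𝓝[≠] a) := by
      intro a
      refine tendsto_nhdsWithin_iff.2 ⟨?_, ?_⟩
      · have : ContinuousAt (fun w => a - w) 0 := by fun_prop
        simpa using this.tendsto.mono_left nhdsWithin_le_nhds
      · filter_upwards [self_mem_nhdsWithin] with w hw
        simpa using! hw
    have hbd : ∀ a ∉ L.lattice, ∀ᶠ w in 𝓝[≠] 0, ℘[L] (a - w) ≠ ℘[L] w := by
      intro a ha
      have h1 := (((L.analyticAt_weierstrassP ha).continuousAt.tendsto.mono_left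
        nhdsWithin_le_nhds).comp (hsub a)).norm
      obtain ⟨M, hM⟩ := h1.isBoundedUnder_le
      have h2 := (tendsto_norm_atTop_iff_cobounded.2
        (L.tendsto_weierstrassP L.lattice.zero_mem)).eventually_gt_atTop M
      filter_upwards [h2, eventually_map.1 hM] with z hz hz' h
      rw [← h] at hz
      exact absurd hz' (not_le.2 hz)
    obtain ⟨w, ⟨⟨hw1, hw2⟩, hw3⟩, ⟨hw4, hw5⟩, hw6⟩ := ((((L.eventually_notMem_lattice 0).and
      ((hsub (u + v)).eventually (L.eventually_notMem_lattice _))).and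
      ((hsub u).eventually (L.eventually_notMem_lattice _))).and
      (((hbd _ huv).and (hbd _ hu)).and
      ((hsub u).eventually (L.eventually_weierstrassP_ne (℘[L] v) u)))).exists
    have a1 := toPoint_add_of_ne hw2 hw1 (by simpa using huv) hw4
    have a2 := toPoint_add_of_ne hw3 hv (by rwa [show u - w + v = u + v - w by ring]) hw6
    have a3 := toPoint_add_of_ne hw3 hw1 (by simpa using hu) hw5
    rw [sub_add_cancel] at a1 a3
    rw [a1, a3, show u + v - w = u - w + v by ring, a2]
    abel
  · exact toPoint_add_of_ne hu hv huv hne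

variable (L) in
/-- The uniformisation as a group homomorphism. -/
noncomputable def toPointHom : ℂ →+ L.curve.toAffine.Point :=
  AddMonoidHom.mk' L.toPoint toPoint_add

lemma toPointHom_apply (z : ℂ) : L.toPointHom z = L.toPoint z := rfl

lemma mem_ker_toPointHom {z : ℂ} : z ∈ L.toPointHom.ker ↔ z ∈ L.lattice := toPoint_eq_zero

lemma toPointHom_surjective : Function.Surjective L.toPointHom := by
  intro P
  by_cases hP : P = 0
  · exact ⟨0, by rw [hP, _root_.map_zero]⟩
  · obtain ⟨z, hz, hx⟩ := L.exists_weierstrassP_eq (xc P)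
    have := eq_or_eq_neg_of_xc_eq (P := L.toPoint z) (mt toPoint_eq_zero.1 hz) hP
      (by rw [xc_toPoint hz, hx])
    rcases this with h | h
    · exact ⟨z, h⟩
    · exact ⟨-z, by rw [_root_.map_neg, toPointHom_apply, h, neg_neg]⟩

end PeriodPair

end

section

open Polynomial Filter Topology
open scoped PeriodPair

lemma even_meromorphicOrderAt_zero {g : ℂ → ℂ} (hm : MeromorphicAt g 0)
    (heven : ∀ z, g (-z) = g z) {n : ℤ} (hn : meromorphicOrderAt g 0 = n) : Even n := by
  obtain ⟨k, hk, hk0, hg⟩ := (meromorphicOrderAt_eq_int_iff hm).1 hn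
  by_contra hodd
  rw [Int.not_even_iff_odd] at hodd
  have ht : Tendsto (fun z : ℂ => -z) (𝓝[≠] 0) (𝓝[≠] 0) := by
    refine tendsto_nhdsWithin_iff.2 ⟨?_, ?_⟩
    · have : ContinuousAt (fun z : ℂ => -z) 0 := by fun_prop
      simpa using this.tendsto.mono_left nhdsWithin_le_nhds
    · filter_upwards [self_mem_nhdsWithin] with w hw
      simpa using! hw
  have hkt := hk.continuousAt.tendsto.mono_left (nhdsWithin_le_nhds (s := {0}ᶜ))
  have h1 : ∀ᶠ z in 𝓝[≠] (0 : ℂ), k (-z) = -k z := by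
    filter_upwards [hg, ht.eventually hg, self_mem_nhdsWithin] with z h1 h2 hz
    rw [heven, h1, sub_zero, sub_zero, hodd.neg_zpow, smul_eq_mul, smul_eq_mul] at h2
    have : z ^ n ≠ 0 := zpow_ne_zero _ hz
    have h3 : z ^ n * (k z + k (-z)) = 0 := by rw [mul_add, h2]; ring
    linear_combination (mul_eq_zero.1 h3).resolve_left this
  have h2 := tendsto_nhds_unique ((hkt.comp ht).congr' h1) hkt.neg
  have h3 : k 0 = -k 0 := tendsto_nhds_unique (hkt.comp ht) (hkt.neg.congr' (h1.mono fun _ h => h.symm))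
  exact hk0 (self_eq_neg.1 h3)

namespace PeriodPair

variable (L : PeriodPair)

open WeierstrassCurve.Affine WeierstrassCurve.Affine.Point

/-- Even elliptic functions with poles only at lattice points are polynomials in `℘`. -/
lemma exists_polynomial (N : ℕ) {g : ℂ → ℂ} (hper : ∀ z, ∀ l ∈ L.lattice, g (z + l) = g z)
    (heven : ∀ z, g (-z) = g z) (hm : ∀ z, MeromorphicAt g z)
    (ho : ∀ z ∉ L.lattice, 0 ≤ meromorphicOrderAt g z)
    (hN : ((-(2 * N : ℤ) : ℤ) : WithTop ℤ) ≤ meromorphicOrderAt g 0) :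
    ∃ Q : ℂ[X], ∀ z, ∀ᶠ w in 𝓝[≠] z, g w = Q.eval (℘[L] w) := by
  induction N generalizing g with
  | zero =>
    obtain ⟨c, hc⟩ := L.exists_eventually_eq_const hper hm fun z => by
      by_cases hz : z ∈ L.lattice
      · have : g = g ∘ (· + -z) := by
          ext w
          rw [Function.comp, hper w _ (neg_mem hz)]
        rw [this, meromorphicOrderAt_comp_add_const_eq_meromorphicOrderAt, add_neg_cancel]
        simpa using hN
      · exact ho z hz
    exact ⟨C c, fun z => (hc z).mono fun w hw => by simpa using hw⟩
  | succ N ih =>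
    have hid : ∀ n : ℕ, MeromorphicAt (fun z : ℂ => z ^ n) 0 := fun n => by fun_prop
    have hido : ∀ n : ℕ, meromorphicOrderAt (fun z : ℂ => z ^ n) 0 = ((n : ℤ) : WithTop ℤ) := by
      intro n
      have h1 := meromorphicOrderAt_pow (f := fun z : ℂ => z - 0) (x := 0) (by fun_prop) (n := n)
      rw [meromorphicOrderAt_id_sub_const, mul_one] at h1
      refine Eq.trans ?_ h1
      congr 1
      ext z
      simp
    have hP := L.meromorphic_weierstrassP 0
    have hPo : meromorphicOrderAt ((fun z : ℂ => z ^ 2) * ℘[L]) 0 = 0 := by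
      rw [meromorphicOrderAt_mul (hid 2) hP, hido, L.order_weierstrassP 0 L.lattice.zero_mem]
      rfl
    obtain ⟨c0, hc0, ht0⟩ :=
      (tendsto_ne_zero_iff_meromorphicOrderAt_eq_zero ((hid 2).mul hP)).2 hPo
    have hgo : 0 ≤ meromorphicOrderAt ((fun z : ℂ => z ^ (2 * N + 2)) * g) 0 := by
      rw [meromorphicOrderAt_mul (hid _) (hm 0), hido]
      cases h : meromorphicOrderAt g 0 with
      | top => simp
      | coe m =>
        rw [h] at hN
        have : -(2 * ((N + 1 : ℕ) : ℤ)) ≤ m := WithTop.coe_le_coe.1 hN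
        have h2 : (0 : ℤ) ≤ ((2 * N + 2 : ℕ) : ℤ) + m := by push_cast at this ⊢; omega
        exact WithTop.coe_le_coe.2 h2
    obtain ⟨c, ht⟩ := (tendsto_nhds_iff_meromorphicOrderAt_nonneg ((hid _).mul (hm 0))).2 hgo
    set a := c / c0 ^ (N + 1) with ha
    set g' : ℂ → ℂ := fun z => g z - a * ℘[L] z ^ (N + 1) with hg'
    have hm' : ∀ z, MeromorphicAt g' z := fun z =>
      (hm z).sub ((MeromorphicAt.const a z).mul ((L.meromorphic_weierstrassP z).pow _))
    have heven' : ∀ z, g' (-z) = g' z := fun z => by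
      simp only [hg', heven, L.weierstrassP_neg]
    have hto : Tendsto ((fun z : ℂ => z ^ (2 * N + 2)) * g') (𝓝[≠] 0) (𝓝 0) := by
      have h1 := ht.sub ((ht0.pow (N + 1)).const_mul a)
      have h2 : c - a * c0 ^ (N + 1) = 0 := by
        rw [ha, div_mul_cancel₀ _ (pow_ne_zero _ hc0), sub_self]
      rw [h2] at h1
      refine h1.congr fun z => ?_
      simp only [hg', Pi.mul_apply]
      ring
    rw [tendsto_zero_iff_meromorphicOrderAt_pos ((hid _).mul (hm' 0)),
      meromorphicOrderAt_mul (hid _) (hm' 0), hido] at hto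
    obtain ⟨Q, hQ⟩ := ih (g := g') (fun z l hl => by
        simp only [hg', hper z l hl, L.weierstrassP_add_mem z hl]) heven' hm' (fun z hz => by
        rw [← tendsto_nhds_iff_meromorphicOrderAt_nonneg (hm' z)]
        obtain ⟨d, hd⟩ := (tendsto_nhds_iff_meromorphicOrderAt_nonneg (hm z)).2 (ho z hz)
        have h1 : Tendsto ℘[L] (𝓝[≠] z) (𝓝 (℘[L] z)) :=
          (L.analyticAt_weierstrassP hz).continuousAt.tendsto.mono_left nhdsWithin_le_nhds
        exact ⟨_, hd.sub ((h1.pow (N + 1)).const_mul a)⟩) (by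
        cases h : meromorphicOrderAt g' 0 with
        | top => exact le_top
        | coe m =>
          rw [h] at hto
          obtain ⟨e, he⟩ := even_meromorphicOrderAt_zero (hm' 0) heven' h
          have h2 : (0 : ℤ) < ((2 * N + 2 : ℕ) : ℤ) + m := WithTop.coe_lt_coe.1 hto
          refine WithTop.coe_le_coe.2 ?_
          push_cast at h2
          omega)
    refine ⟨Q + C a * X ^ (N + 1), fun z => (hQ z).mono fun w hw => ?_⟩
    rw [eval_add, ← hw, eval_mul, eval_C, eval_pow, eval_X]
    simp [hg']

end PeriodPair

end

section

open Polynomial Filter Topology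
open scoped PeriodPair

namespace WeierstrassCurve.Affine.Point

/-- The endomorphism `φ` acts on `x`-coordinates as the reduced fraction `A / B`, and on the
invariant differential as multiplication by `α`. -/
structure IsMult {K : Type*} [Field K] [DecidableEq K] {W : WeierstrassCurve.Affine K}
    (φ : W.Point →+ W.Point) (α : K) (A B : K[X]) : Prop where
  coprime : IsCoprime A B
  eq_zero_iff : ∀ P ≠ 0, φ P = 0 ↔ B.eval (xc P) = 0
  xc_mul : ∀ P ≠ 0, φ P ≠ 0 → xc (φ P) * B.eval (xc P) = A.eval (xc P)
  deriv_sq : (derivative A * B - A * derivative B) ^ 2 * psi W =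
    C α ^ 2 * (B * (4 * A ^ 3 + C W.b₂ * A ^ 2 * B + 2 * C W.b₄ * A * B ^ 2 + C W.b₆ * B ^ 3))

end WeierstrassCurve.Affine.Point

namespace PeriodPair

variable (L : PeriodPair)

open WeierstrassCurve.Affine WeierstrassCurve.Affine.Point

/-- `α` maps the lattice to itself. -/
def Multiplies (α : ℂ) : Prop := ∀ l ∈ L.lattice, α * l ∈ L.lattice

variable {L} {α : ℂ}

/-- The endomorphism of the curve induced by a complex multiplication of the lattice. -/
noncomputable def mulHom (h : L.Multiplies α) : L.curve.toAffine.Point →+ L.curve.toAffine.Point :=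
  L.toPointHom.liftOfSurjective L.toPointHom_surjective
    ⟨L.toPointHom.comp (AddMonoidHom.mulLeft α), fun z hz => by
      rw [mem_ker_toPointHom] at hz
      exact mem_ker_toPointHom.2 (h z hz)⟩

lemma mulHom_toPoint (h : L.Multiplies α) (z : ℂ) : mulHom h (L.toPoint z) = L.toPoint (α * z) :=
  AddMonoidHom.liftOfRightInverse_comp_apply _ _ _ ⟨L.toPointHom.comp (AddMonoidHom.mulLeft α), _⟩ z

lemma finite_torsion (h : L.Multiplies α) (hα : α ≠ 0) :
    {c | ∃ z, α * z ∈ L.lattice ∧ ℘[L] z = c}.Finite := by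
  have hb := ZSpan.fundamentalDomain_isBounded L.basis
  have h1 : ((fun z => α * z) '' ZSpan.fundamentalDomain L.basis ∩ L.lattice).Finite := by
    rw [L.lattice_eq_span_range_basis]
    refine ZSpan.setFinite_inter L.basis ?_
    obtain ⟨M, hM⟩ := hb.exists_norm_le
    refine isBounded_iff_forall_norm_le.2 ⟨‖α‖ * M, ?_⟩
    rintro _ ⟨z, hz, rfl⟩
    rw [norm_mul]
    exact mul_le_mul_of_nonneg_left (hM z hz) (norm_nonneg _)
  refine (h1.image fun w => ℘[L] (α⁻¹ * w)).subset ?_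
  rintro c ⟨z, hz, rfl⟩
  have hl : ((ZSpan.floor L.basis z : _) : ℂ) ∈ L.lattice := by
    rw [L.lattice_eq_span_range_basis]
    exact (ZSpan.floor L.basis z).2
  refine ⟨α * ZSpan.fract L.basis z, ⟨⟨_, ZSpan.fract_mem_fundamentalDomain L.basis z, rfl⟩, ?_⟩, ?_⟩
  · rw [ZSpan.fract, mul_sub]
    exact sub_mem hz (h _ hl)
  · simp only [inv_mul_cancel_left₀ hα]
    rw [ZSpan.fract, sub_eq_add_neg, L.weierstrassP_add_mem _ (neg_mem hl)]

lemma eventually_smul (hα : α ≠ 0) (z : ℂ) {p : ℂ → Prop} (h : ∀ᶠ w in 𝓝[≠] (α * z), p w) :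
    ∀ᶠ w in 𝓝[≠] z, p (α * w) := by
  refine Tendsto.eventually (tendsto_nhdsWithin_iff.2 ⟨?_, ?_⟩) h
  · have : ContinuousAt (fun w : ℂ => α * w) z := by fun_prop
    exact this.tendsto.mono_left nhdsWithin_le_nhds
  · filter_upwards [self_mem_nhdsWithin] with w hw
    simpa [hα] using! hw

lemma eventually_smul_notMem (hα : α ≠ 0) (z : ℂ) : ∀ᶠ w in 𝓝[≠] z, α * w ∉ L.lattice :=
  eventually_smul hα z (L.eventually_notMem_lattice _)

lemma exists_coprime (h : L.Multiplies α) (hα : α ≠ 0) : ∃ A B : ℂ[X], IsCoprime A B ∧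
    ∀ z ∉ L.lattice, α * z ∉ L.lattice → ℘[L] (α * z) * B.eval (℘[L] z) = A.eval (℘[L] z) := by
  set F := (finite_torsion h hα).toFinset with hF
  set D : ℂ[X] := ∏ c ∈ F, (X - C c) ^ 2 with hD
  have hD0 : D ≠ 0 := Finset.prod_ne_zero_iff.2 fun c _ => pow_ne_zero _ (X_sub_C_ne_zero c)
  set p : ℂ → ℂ := ℘[L] ∘ fun z => α * z with hp
  have hp_ord : ∀ z, meromorphicOrderAt p z = meromorphicOrderAt ℘[L] (α * z) := fun z =>
    meromorphicOrderAt_comp_of_deriv_ne_zero (by fun_prop) (by simpa using hα)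
  have hpm : ∀ z, MeromorphicAt p z := fun z =>
    (L.meromorphic_weierstrassP _).comp_analyticAt (by fun_prop)
  have hDm : ∀ (E : ℂ[X]) z, MeromorphicAt (fun w => E.eval (℘[L] w)) z := by
    intro E z
    induction E using Polynomial.induction_on' with
    | add p q hp hq => simpa using! hp.add hq
    | monomial n a =>
      simpa using! (MeromorphicAt.const a z).mul ((L.meromorphic_weierstrassP z).pow n)
  set g : ℂ → ℂ := p * fun w => D.eval (℘[L] w) with hg
  have hgm : ∀ z, MeromorphicAt g z := fun z => (hpm z).mul (hDm D z)
  have hcont : ∀ (E : ℂ[X]) z, z ∉ L.lattice → ContinuousAt (fun w => E.eval (℘[L] w)) z :=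
    fun E z hz => E.continuous.continuousAt.comp (L.analyticAt_weierstrassP hz).continuousAt
  have hE : ∀ (E : ℂ[X]) z, z ∉ L.lattice → 0 ≤ meromorphicOrderAt (fun w => E.eval (℘[L] w)) z :=
    fun E z hz => (tendsto_nhds_iff_meromorphicOrderAt_nonneg (hDm E z)).1
      ⟨_, (hcont E z hz).tendsto.mono_left nhdsWithin_le_nhds⟩
  have hpc : ∀ z, α * z ∉ L.lattice → ContinuousAt p z := fun z hz =>
    ContinuousAt.comp (f := fun z => α * z) (x := z)
      (L.analyticAt_weierstrassP hz).continuousAt (by fun_prop)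
  have ho : ∀ z ∉ L.lattice, 0 ≤ meromorphicOrderAt g z := by
    intro z hz
    by_cases hαz : α * z ∈ L.lattice
    · have hc : ℘[L] z ∈ F := by
        rw [hF, Set.Finite.mem_toFinset]
        exact ⟨z, hαz, rfl⟩
      obtain ⟨E, hDE⟩ := Finset.dvd_prod_of_mem (fun c => (X - C c) ^ 2) hc
      rw [← hD] at hDE
      set q : ℂ → ℂ := fun w => (X - C (℘[L] z)).eval (℘[L] w) with hq
      have hgq : g = p * (q ^ 2 * fun w => E.eval (℘[L] w)) := by
        rw [hg, hDE]
        ext w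
        simp [hq]
      have hq0 : 0 < meromorphicOrderAt q z := by
        rw [← tendsto_zero_iff_meromorphicOrderAt_pos (hDm _ z)]
        have := (hcont (X - C (℘[L] z)) z hz).tendsto.mono_left (nhdsWithin_le_nhds (s := {z}ᶜ))
        simpa [hq] using this
      have h2 : (2 : WithTop ℤ) ≤ meromorphicOrderAt (q ^ 2) z := by
        rw [meromorphicOrderAt_pow (hDm _ z)]
        cases hm : meromorphicOrderAt q z with
        | top => exact le_top
        | coe m =>
          rw [hm] at hq0
          have : (0 : ℤ) < m := WithTop.coe_lt_coe.1 hq0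
          exact WithTop.coe_le_coe.2 (show (2 : ℤ) ≤ (2 : ℕ) * m by push_cast; omega)
      rw [hgq, meromorphicOrderAt_mul (hpm z) (((hDm _ z).pow 2).mul (hDm E z)),
        meromorphicOrderAt_mul ((hDm _ z).pow 2) (hDm E z), hp_ord,
        L.order_weierstrassP _ hαz]
      calc (0 : WithTop ℤ) = -2 + (2 + 0) := rfl
        _ ≤ _ := by gcongr; exact hE E z hz
    · rw [← tendsto_nhds_iff_meromorphicOrderAt_nonneg (hgm z)]
      exact ⟨_, ((hpc z hαz).mul (hcont D z hz)).tendsto.mono_left nhdsWithin_le_nhds⟩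
  obtain ⟨N, hN⟩ : ∃ N : ℕ, ((-(2 * N : ℤ) : ℤ) : WithTop ℤ) ≤ meromorphicOrderAt g 0 := by
    cases hm : meromorphicOrderAt g 0 with
    | top => exact ⟨0, le_top⟩
    | coe m => exact ⟨m.natAbs, WithTop.coe_le_coe.2 (by omega)⟩
  obtain ⟨Q, hQ⟩ := L.exists_polynomial N (g := g) (fun z l hl => by
      simp only [hg, hp, Pi.mul_apply, Function.comp, mul_add, L.weierstrassP_add_mem _ hl,
        L.weierstrassP_add_mem _ (h l hl)]) (fun z => by
      simp only [hg, hp, Pi.mul_apply, Function.comp, mul_neg, L.weierstrassP_neg]) hgm ho hN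
  have hG : GCDMonoid.gcd Q D ≠ 0 := fun h0 => hD0 ((gcd_eq_zero_iff _ _).1 h0).2
  have hc : ∀ E, GCDMonoid.gcd Q D ∣ E → E / GCDMonoid.gcd Q D * GCDMonoid.gcd Q D = E :=
    fun E h => by rw [mul_comm]; exact EuclideanDomain.mul_div_cancel' hG h
  refine ⟨Q / GCDMonoid.gcd Q D, D / GCDMonoid.gcd Q D, isCoprime_div_gcd_div_gcd hD0,
    fun z hz hαz => ?_⟩
  have hev : ∀ᶠ w in 𝓝[≠] z, ℘[L] (α * w) * (D / GCDMonoid.gcd Q D).eval (℘[L] w) =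
      (Q / GCDMonoid.gcd Q D).eval (℘[L] w) := by
    filter_upwards [hQ z, L.eventually_eval_weierstrassP_ne hG z] with w hw hw'
    rw [← mul_left_inj' hw', mul_assoc, ← eval_mul, ← eval_mul,
      hc _ (GCDMonoid.gcd_dvd_left Q D), hc _ (GCDMonoid.gcd_dvd_right Q D)]
    exact hw
  exact tendsto_nhds_unique
    ((((hpc z hαz).mul (hcont _ z hz)).tendsto.mono_left nhdsWithin_le_nhds).congr' hev)
    ((hcont _ z hz).tendsto.mono_left nhdsWithin_le_nhds)

theorem exists_isMult (h : L.Multiplies α) (hα : α ≠ 0) :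
    ∃ A B, IsMult (mulHom h) α A B := by
  obtain ⟨A, B, hAB, hx⟩ := exists_coprime h hα
  have hcont : ∀ (E : ℂ[X]) z, z ∉ L.lattice → ContinuousAt (fun w => E.eval (℘[L] w)) z :=
    fun E z hz => E.continuous.continuousAt.comp (L.analyticAt_weierstrassP hz).continuousAt
  have hne : ∀ z ∉ L.lattice, α * z ∉ L.lattice → B.eval (℘[L] z) ≠ 0 := by
    intro z hz hαz hB
    have := hx z hz hαz
    rw [hB, mul_zero] at this
    obtain ⟨a, b, hab⟩ := hAB
    have h1 := congrArg (Polynomial.eval (℘[L] z)) hab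
    simp [hB, ← this] at h1
  have hzero : ∀ z ∉ L.lattice, α * z ∈ L.lattice → B.eval (℘[L] z) = 0 := by
    intro z hz hαz
    have h1 : Tendsto (fun w => A.eval (℘[L] w) * (℘[L] (α * w))⁻¹) (𝓝[≠] z)
        (𝓝 (A.eval (℘[L] z) * 0)) := by
      refine ((hcont A z hz).tendsto.mono_left nhdsWithin_le_nhds).mul ?_
      refine (tendsto_inv₀_cobounded.comp (L.tendsto_weierstrassP hαz)).comp
        (tendsto_nhdsWithin_iff.2 ⟨?_, ?_⟩)
      · have : ContinuousAt (fun w : ℂ => α * w) z := by fun_prop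
        exact this.tendsto.mono_left nhdsWithin_le_nhds
      · filter_upwards [self_mem_nhdsWithin] with w hw
        simpa [hα] using! hw
    rw [mul_zero] at h1
    refine tendsto_nhds_unique ((hcont B z hz).tendsto.mono_left nhdsWithin_le_nhds)
      (h1.congr' ?_)
    filter_upwards [eventually_smul_notMem hα z, L.eventually_notMem_lattice z,
      eventually_smul hα z (L.eventually_weierstrassP_ne 0 (α * z))] with w h1 h2 h3
    rw [← hx w h2 h1]
    field_simp
  refine ⟨A, B, hAB, ?_, ?_, ?_⟩
  · intro P hP
    obtain ⟨z, rfl⟩ := L.toPointHom_surjective P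
    rw [toPointHom_apply, Ne, toPoint_eq_zero] at hP
    rw [toPointHom_apply, mulHom_toPoint, toPoint_eq_zero, xc_toPoint hP]
    exact ⟨hzero z hP, fun hB => by_contra fun hz => hne z hP hz hB⟩
  · intro P hP hφ
    obtain ⟨z, rfl⟩ := L.toPointHom_surjective P
    rw [toPointHom_apply, Ne, toPoint_eq_zero] at hP
    rw [toPointHom_apply, mulHom_toPoint, Ne, toPoint_eq_zero] at hφ
    rw [toPointHom_apply, mulHom_toPoint, xc_toPoint hP, xc_toPoint hφ]
    exact hx z hP hφ
  · rw [← sub_eq_zero]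
    by_contra hne0
    have hev : ∀ᶠ w in 𝓝[≠] (0 : ℂ), w ∉ L.lattice ∧ α * w ∉ L.lattice :=
      (L.eventually_notMem_lattice 0).and (eventually_smul_notMem hα 0)
    obtain ⟨z, ⟨hz, hαz⟩, hz0⟩ := (hev.and (L.eventually_eval_weierstrassP_ne hne0 0)).exists
    apply hz0
    have hP := L.hasDerivAt_weierstrassP hz
    have hPα : HasDerivAt (fun w => ℘[L] (α * w)) (℘'[L] (α * z) * α) z := by
      have h1 : HasDerivAt (fun w => α * w) α z := by
        simpa using (hasDerivAt_id z).const_mul α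
      exact HasDerivAt.comp z (L.hasDerivAt_weierstrassP hαz) h1
    have hB : HasDerivAt (fun w => B.eval (℘[L] w)) ((derivative B).eval (℘[L] z) * ℘'[L] z) z :=
      (B.hasDerivAt _).comp z hP
    have hA : HasDerivAt (fun w => A.eval (℘[L] w)) ((derivative A).eval (℘[L] z) * ℘'[L] z) z :=
      (A.hasDerivAt _).comp z hP
    have hnhds : ∀ᶠ w in 𝓝 z, ℘[L] (α * w) * B.eval (℘[L] w) = A.eval (℘[L] w) := by
      have h1 : ∀ᶠ w in 𝓝 z, w ∉ L.lattice := L.isOpen_compl_lattice.mem_nhds hz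
      have h2 : ∀ᶠ w in 𝓝 z, α * w ∉ L.lattice := by
        have : ContinuousAt (fun w : ℂ => α * w) z := by fun_prop
        exact this.eventually (L.isOpen_compl_lattice.mem_nhds hαz)
      filter_upwards [h1, h2] with w h1 h2 using hx w h1 h2
    have hd := (hPα.mul hB).unique (hA.congr_of_eventuallyEq hnhds)
    have e1 := hx z hz hαz
    have e2 := L.derivWeierstrassP_sq' hz
    have e3 := L.derivWeierstrassP_sq' hαz
    have hb2 : L.curve.b₂ = 0 := by simp [curve, WeierstrassCurve.b₂]
    have hb4 : 2 * L.curve.b₄ = -L.g₂ := by simp [curve, WeierstrassCurve.b₄]; ring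
    have hb6 : L.curve.b₆ = -L.g₃ := by simp [curve, WeierstrassCurve.b₆]; ring
    have hpsi : (WeierstrassCurve.psi L.curve).eval (℘[L] z) = L.cubic (℘[L] z) := by
      rw [WeierstrassCurve.eval_psi, hb2, hb4, hb6, cubic]; ring
    have hC : (2 : ℂ[X]) * C L.curve.b₄ = -C L.g₂ := by
      rw [← C_neg, ← hb4, C_mul]; rfl
    rw [hb2, hC, hb6]
    simp only [eval_sub, eval_mul, eval_pow, eval_add, eval_C, eval_neg, hpsi, eval_ofNat, C_0,
      C_neg, eval_zero]
    generalize Polynomial.eval (℘[L] z) A = a at *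
    generalize Polynomial.eval (℘[L] z) B = b at *
    generalize Polynomial.eval (℘[L] z) (derivative A) = a' at *
    generalize Polynomial.eval (℘[L] z) (derivative B) = b' at *
    simp only [cubic] at e2 e3 ⊢
    subst e1
    have h1 : (a' * b - ℘[L] (α * z) * b * b') * ℘'[L] z = α * b ^ 2 * ℘'[L] (α * z) := by
      linear_combination -b * hd
    linear_combination ((a' * b - ℘[L] (α * z) * b * b') * ℘'[L] z + α * b ^ 2 * ℘'[L] (α * z)) * h1
      - (a' * b - ℘[L] (α * z) * b * b') ^ 2 * e2 + α ^ 2 * b ^ 4 * e3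

end PeriodPair

end

section

open Polynomial Filter Topology
open scoped PeriodPair

namespace WeierstrassCurve.Affine.Point

variable {K : Type*} [Field K] [DecidableEq K] {W W' : WeierstrassCurve.Affine K} {u r s t : K}

lemma Chg.b₂_eq (h : Chg W' W u r s t) : u ^ 2 * W'.b₂ = W.b₂ + 12 * r := by
  simp only [WeierstrassCurve.b₂]
  linear_combination (u * W'.a₁ + W.a₁ + 2 * s) * h.h₁ + 4 * h.h₂

lemma Chg.b₄_eq (h : Chg W' W u r s t) : u ^ 4 * W'.b₄ = W.b₄ + r * W.b₂ + 6 * r ^ 2 := by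
  simp only [WeierstrassCurve.b₄, WeierstrassCurve.b₂]
  linear_combination 2 * h.h₄ + u ^ 3 * W'.a₃ * h.h₁ + (W.a₁ + 2 * s) * h.h₃

lemma Chg.b₆_eq (h : Chg W' W u r s t) :
    u ^ 6 * W'.b₆ = W.b₆ + 2 * r * W.b₄ + r ^ 2 * W.b₂ + 4 * r ^ 3 := by
  simp only [WeierstrassCurve.b₄, WeierstrassCurve.b₂, WeierstrassCurve.b₆]
  linear_combination 4 * h.h₆ + (u ^ 3 * W'.a₃ + W.a₃ + r * W.a₁ + 2 * t) * h.h₃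

lemma IsMult.conj [IsAlgClosed K] [W.IsElliptic] [W'.IsElliptic] {φ : W.Point →+ W.Point} {α : K}
    {A B : K[X]} (hφ : IsMult φ α A B) (h : Chg W' W u r s t) :
    IsMult ((h.equiv.symm : W.Point →+ W'.Point).comp (φ.comp h.hom)) α
      ((A - C r * B).comp (C (u ^ 2) * X + C r)) (C (u ^ 2) * B.comp (C (u ^ 2) * X + C r)) := by
  have hu := h.ne
  have hsymm : ∀ Q, Q ≠ 0 → xc Q = u ^ 2 * xc (h.equiv.symm Q) + r := by
    intro Q hQ
    obtain ⟨P, rfl⟩ := h.equiv.surjective Q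
    rw [AddEquiv.symm_apply_apply]
    exact h.xc_hom (by rintro rfl; exact hQ (_root_.map_zero _))
  refine ⟨?_, ?_, ?_, ?_⟩
  · have h1 : IsCoprime (A - C r * B) B := by
      have := hφ.coprime.add_mul_left_left (-C r)
      rwa [show A + B * -C r = A - C r * B by ring] at this
    refine (isCoprime_mul_unit_left_right (isUnit_C.2 (IsUnit.mk0 _ (pow_ne_zero 2 hu))) _ _).2 ?_
    exact h1.map (compRingHom _)
  · intro P hP
    have := hφ.eq_zero_iff _ (h.hom_ne_zero hP)
    rw [h.xc_hom hP] at this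
    simp only [AddMonoidHom.comp_apply, AddMonoidHom.coe_coe, EmbeddingLike.map_eq_zero_iff, this]
    simp [hu]
  · intro P hP hne
    simp only [AddMonoidHom.comp_apply, AddMonoidHom.coe_coe, ne_eq,
      EmbeddingLike.map_eq_zero_iff] at hne ⊢
    have := hφ.xc_mul _ (h.hom_ne_zero hP) hne
    rw [h.xc_hom hP, hsymm _ hne] at this
    simp only [eval_mul, eval_comp, eval_add, eval_sub, eval_C, eval_X]
    linear_combination this
  · refine Polynomial.funext fun x => ?_
    have e := congrArg (Polynomial.eval (u ^ 2 * x + r)) hφ.deriv_sq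
    have e2 := h.b₂_eq
    have e4 := h.b₄_eq
    have e6 := h.b₆_eq
    simp only [derivative_comp, derivative_sub, derivative_mul, derivative_C, derivative_add,
      derivative_X, eval_mul, eval_comp, eval_add, eval_sub, eval_C, eval_X, eval_pow, eval_psi,
      eval_ofNat, eval_zero, eval_one] at e ⊢
    generalize Polynomial.eval (u ^ 2 * x + r) A = a at *
    generalize Polynomial.eval (u ^ 2 * x + r) B = b at *
    generalize Polynomial.eval (u ^ 2 * x + r) (derivative A) = a' at *
    generalize Polynomial.eval (u ^ 2 * x + r) (derivative B) = b' at *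
    have f2 : W.b₂ = u ^ 2 * W'.b₂ - 12 * r := by linear_combination -e2
    have f4 : W.b₄ = u ^ 4 * W'.b₄ - r * W.b₂ - 6 * r ^ 2 := by linear_combination -e4
    have f6 : W.b₆ = u ^ 6 * W'.b₆ - (2 * r * W.b₄ + r ^ 2 * W.b₂ + 4 * r ^ 3) := by
      linear_combination -e6
    rw [f6, f4, f2] at e
    linear_combination u ^ 2 * e

/-- The ring homomorphism `ι` is a complex multiplication, normalised on differentials. -/
def IsCM (W : WeierstrassCurve.Affine K) {S : Subring K} (ι : S →+* AddMonoid.End W.Point) : Prop :=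
  ∀ α : S, (α : K) ≠ 0 → ∃ A B, IsMult (ι α) (α : K) A B

lemma IsCM.exists_of_chg [IsAlgClosed K] [W.IsElliptic] [W'.IsElliptic] {S : Subring K}
    {ι : S →+* AddMonoid.End W.Point} (hι : IsCM W ι) (h : Chg W' W u r s t) :
    ∃ ι' : S →+* AddMonoid.End W'.Point, IsCM W' ι' := by
  have hs : ∀ P, h.hom (h.equiv.symm P) = P := fun P => h.equiv.apply_symm_apply P
  have hs' : ∀ P, h.equiv.symm (h.hom P) = P := fun P => h.equiv.symm_apply_apply P
  let c : S → AddMonoid.End W'.Point := fun α =>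
    (h.equiv.symm : W.Point →+ W'.Point).comp ((ι α : W.Point →+ W.Point).comp h.hom)
  have hc : ∀ α P, c α P = h.equiv.symm (ι α (h.hom P)) := fun _ _ => rfl
  refine ⟨⟨⟨⟨c, ?_⟩, ?_⟩, ?_, ?_⟩, fun α hα => ?_⟩
  · refine AddMonoidHom.ext fun P => ?_
    change c 1 P = P
    rw [hc, _root_.map_one]
    exact hs' P
  · refine fun α β => AddMonoidHom.ext fun P => ?_
    change c (α * β) P = c α (c β P)
    rw [hc, hc, hc, hs, _root_.map_mul ι]
    rfl
  · refine AddMonoidHom.ext fun P => ?_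
    change c 0 P = 0
    rw [hc, _root_.map_zero]
    exact _root_.map_zero _
  · refine fun α β => AddMonoidHom.ext fun P => ?_
    change c (α + β) P = c α P + c β P
    rw [hc, hc, hc, _root_.map_add ι]
    exact _root_.map_add h.equiv.symm _ _
  · obtain ⟨A, B, hAB⟩ := hι α hα
    exact ⟨_, _, hAB.conj h⟩

lemma IsCM.exists_of_j_eq [IsAlgClosed K] {W W' : WeierstrassCurve K} [W.IsElliptic]
    [W'.IsElliptic] {S : Subring K} {ι : S →+* AddMonoid.End W.toAffine.Point}
    (hι : IsCM W.toAffine ι) (h : W.j = W'.j) :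
    ∃ ι' : S →+* AddMonoid.End W'.toAffine.Point, IsCM W'.toAffine ι' := by
  obtain ⟨c, rfl⟩ := WeierstrassCurve.exists_variableChange_of_j_eq W W' h
  exact hι.exists_of_chg (Chg.of_variableChange c W)

end WeierstrassCurve.Affine.Point

namespace PeriodPair

open WeierstrassCurve.Affine WeierstrassCurve.Affine.Point

theorem exists_isCM (L : PeriodPair) (S : Subring ℂ) (h : ∀ α ∈ S, L.Multiplies α) :
    ∃ ι : S →+* AddMonoid.End L.curve.toAffine.Point, IsCM L.curve.toAffine ι := by
  let c : S → AddMonoid.End L.curve.toAffine.Point := fun α => mulHom (h α α.2)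
  have hc : ∀ α z, c α (L.toPointHom z) = L.toPointHom (α * z) := fun α z =>
    mulHom_toPoint (h α α.2) z
  refine ⟨⟨⟨⟨c, ?_⟩, ?_⟩, ?_, ?_⟩, fun α hα => exists_isMult (h α α.2) hα⟩
  · refine AddMonoidHom.ext fun P => ?_
    obtain ⟨z, rfl⟩ := L.toPointHom_surjective P
    change c 1 (L.toPointHom z) = L.toPointHom z
    rw [hc]
    simp
  · refine fun α β => AddMonoidHom.ext fun P => ?_
    obtain ⟨z, rfl⟩ := L.toPointHom_surjective P
    change c (α * β) _ = c α (c β _)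
    rw [hc, hc, hc, Subring.coe_mul, mul_assoc]
  · refine AddMonoidHom.ext fun P => ?_
    obtain ⟨z, rfl⟩ := L.toPointHom_surjective P
    change c 0 _ = 0
    rw [hc]
    simp
  · refine fun α β => AddMonoidHom.ext fun P => ?_
    obtain ⟨z, rfl⟩ := L.toPointHom_surjective P
    change c (α + β) _ = c α _ + c β _
    rw [hc, hc, hc, Subring.coe_add, add_mul, _root_.map_add]

end PeriodPair

end

section

open Polynomial Filter

/-- `i : R →+* K` exhibits `R` as a valuation ring of `K` and `ρ : R →+* k` is its reduction map. -/
structure IsReduction {R K k : Type*} [CommRing R] [Field K] [Field k] (i : R →+* K)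
    (ρ : R →+* k) : Prop where
  inj : Function.Injective i
  surj : Function.Surjective ρ
  dich : ∀ z : K, (∃ a, i a = z) ∨ ∃ a, i a * z = 1 ∧ ρ a = 0
  unit : ∀ a, ρ a ≠ 0 → ∃ b, a * b = 1

namespace WeierstrassCurve.Affine.Point

variable {R K k : Type*} [CommRing R] [Field K] [Field k] [DecidableEq K] [DecidableEq k]
  {i : R →+* K} {ρ : R →+* k} {W : WeierstrassCurve R}

section basic

lemma _root_.IsReduction.exists_of_quadratic (hr : IsReduction i ρ) {z : K} {b c : R}
    (h : z ^ 2 + i b * z + i c = 0) : ∃ a, i a = z := by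
  rcases hr.dich z with h1 | ⟨a, ha, h0⟩
  · exact h1
  · exfalso
    have h2 : i (1 + b * a + c * a ^ 2) = i 0 := by
      simp only [_root_.map_add, _root_.map_mul, _root_.map_one, _root_.map_pow, _root_.map_zero]
      linear_combination i a ^ 2 * h - (i a * z + 1 + i a * i b) * ha
    have h3 := congrArg ρ (hr.inj h2)
    simp [h0] at h3

variable (i ρ W) in
/-- The relation that `P` reduces to `h`, between the points of the two fibres of `W`. -/
def RedTo (P : (W.map i).toAffine.Point) (h : (W.map ρ).toAffine.Point) : Prop :=
  (h = 0 ∧ (P = 0 ∨ ∀ a, i a ≠ xc P)) ∨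
    (h ≠ 0 ∧ P ≠ 0 ∧ ∃ x y, i x = xc P ∧ i y = yc P ∧ ρ x = xc h ∧ ρ y = yc h)

variable {P Q T : (W.map i).toAffine.Point} {h g : (W.map ρ).toAffine.Point}

lemma redTo_zero_iff : RedTo i ρ W P 0 ↔ P = 0 ∨ ∀ a, i a ≠ xc P := by simp [RedTo]

lemma redTo_iff (hh : h ≠ 0) : RedTo i ρ W P h ↔
    P ≠ 0 ∧ ∃ x y, i x = xc P ∧ i y = yc P ∧ ρ x = xc h ∧ ρ y = yc h := by simp [RedTo, hh]

lemma RedTo.zero : RedTo i ρ W 0 0 := redTo_zero_iff.2 (.inl rfl)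

lemma RedTo.unique (hr : IsReduction i ρ) (h₁ : RedTo i ρ W P h) (h₂ : RedTo i ρ W P g) :
    h = g := by
  rcases h₁ with ⟨rfl, h₁⟩ | ⟨hh, hP, x, y, hx, hy, hx', hy'⟩ <;>
  rcases h₂ with ⟨rfl, h₂⟩ | ⟨hg, hQ, X, Y, hX, hY, hX', hY'⟩
  · rfl
  · exact absurd hX (h₁.resolve_left hQ X)
  · exact absurd hx (h₂.resolve_left hP x)
  · have e1 := hr.inj (hx.trans hX.symm)
    have e2 := hr.inj (hy.trans hY.symm)
    subst e1 e2
    exact ext_coords hh hg (hx'.symm.trans hX') (hy'.symm.trans hY')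

lemma RedTo.neg (h₁ : RedTo i ρ W P h) : RedTo i ρ W (-P) (-h) := by
  rcases h₁ with ⟨rfl, h₁⟩ | ⟨hh, hP, x, y, hx, hy, hx', hy'⟩
  · left
    simpa using h₁
  · right
    refine ⟨neg_ne_zero.2 hh, neg_ne_zero.2 hP, x, -y - W.a₁ * x - W.a₃, ?_, ?_, ?_, ?_⟩
    · rw [xc_neg, hx]
    · rw [yc_neg hP]
      simp [hx, hy]
    · rw [xc_neg, hx']
    · rw [yc_neg hh]
      simp [hx', hy']

/-- A point whose `x`-coordinate reduces to `x(h)` reduces to `h` or `-h`. -/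
lemma RedTo.of_xc (hr : IsReduction i ρ) (hP : P ≠ 0) (hh : h ≠ 0) {x : R} (hx : i x = xc P)
    (hx' : ρ x = xc h) : RedTo i ρ W P h ∨ RedTo i ρ W P (-h) := by
  have e := equation_coords hP
  have e' := equation_coords hh
  obtain ⟨y, hy⟩ := hr.exists_of_quadratic (z := yc P) (b := W.a₁ * x + W.a₃)
    (c := -(x ^ 3 + W.a₂ * x ^ 2 + W.a₄ * x + W.a₆)) (by
      rw [← hx] at e
      simp only [_root_.map_add, _root_.map_mul, _root_.map_neg, _root_.map_pow]
      simp only [map_a₁, map_a₂, map_a₃, map_a₄, map_a₆] at e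
      linear_combination e)
  have e2 : y ^ 2 + W.a₁ * x * y + W.a₃ * y = x ^ 3 + W.a₂ * x ^ 2 + W.a₄ * x + W.a₆ := by
    apply hr.inj
    rw [← hx, ← hy] at e
    simpa using e
  have e3 := congrArg ρ e2
  rw [← hx'] at e'
  simp only [_root_.map_add, _root_.map_mul, _root_.map_pow] at e3
  simp only [map_a₁, map_a₂, map_a₃, map_a₄, map_a₆] at e'
  have e4 : (ρ y - yc h) * (ρ y - (-yc h - ρ W.a₁ * ρ x - ρ W.a₃)) = 0 := by
    linear_combination e3 - e'
  rcases mul_eq_zero.1 e4 with h1 | h1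
  · exact .inl (.inr ⟨hh, hP, x, y, hx, hy, hx', sub_eq_zero.1 h1⟩)
  · refine .inr (.inr ⟨neg_ne_zero.2 hh, hP, x, y, hx, hy, by rw [xc_neg, hx'], ?_⟩)
    rw [yc_neg hh, sub_eq_zero.1 h1, ← hx']
    rfl

lemma exists_redTo [IsAlgClosed K] [(W.map i).IsElliptic] (hr : IsReduction i ρ)
    (h : (W.map ρ).toAffine.Point) : ∃ P, RedTo i ρ W P h := by
  rcases eq_or_ne h 0 with rfl | hh
  · exact ⟨0, .zero⟩
  · obtain ⟨x, hx⟩ := hr.surj (xc h)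
    obtain ⟨P, hP, hPx⟩ := exists_xc_eq (W := (W.map i).toAffine) (i x)
    rcases RedTo.of_xc hr hP hh hPx.symm hx with h1 | h1
    · exact ⟨P, h1⟩
    · exact ⟨-P, by simpa using h1.neg⟩

lemma RedTo.add_of_xc_ne (hr : IsReduction i ρ) (hh : h ≠ 0) (hg : g ≠ 0) (hx : xc h ≠ xc g)
    (h₁ : RedTo i ρ W P h) (h₂ : RedTo i ρ W Q g) : RedTo i ρ W (P + Q) (h + g) := by
  obtain ⟨hP, x, y, hxP, hyP, hxh, hyh⟩ := (redTo_iff hh).1 h₁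
  obtain ⟨hQ, x', y', hxQ, hyQ, hxg, hyg⟩ := (redTo_iff hg).1 h₂
  obtain ⟨v, hv⟩ := hr.unit (x - x') (by rw [_root_.map_sub, hxh, hxg]; exact sub_ne_zero.2 hx)
  have hvi : (i x - i x') * i v = 1 := by rw [← _root_.map_sub, ← _root_.map_mul, hv, _root_.map_one]
  have hvρ : (ρ x - ρ x') * ρ v = 1 := by rw [← _root_.map_sub, ← _root_.map_mul, hv, _root_.map_one]
  have hxne : xc P ≠ xc Q := by
    rw [← hxP, ← hxQ, ← sub_ne_zero]
    exact left_ne_zero_of_mul_eq_one hvi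
  obtain ⟨a1, a2, a3⟩ := add_coords hP hQ hxne
  obtain ⟨b1, b2, b3⟩ := add_coords hh hg hx
  have s1 : (yc P - yc Q) / (xc P - xc Q) = i ((y - y') * v) := by
    rw [div_eq_iff (sub_ne_zero.2 hxne), ← hxP, ← hxQ, ← hyP, ← hyQ, _root_.map_mul, _root_.map_sub]
    linear_combination (-(i y - i y')) * hvi
  have s2 : (yc h - yc g) / (xc h - xc g) = ρ ((y - y') * v) := by
    rw [div_eq_iff (sub_ne_zero.2 hx), ← hxh, ← hxg, ← hyh, ← hyg, _root_.map_mul, _root_.map_sub]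
    linear_combination (-(ρ y - ρ y')) * hvρ
  rw [s1, ← hxP] at a2 a3
  rw [s2, ← hxh] at b2 b3
  rw [← hxQ] at a2
  rw [← hxg] at b2
  rw [← hyP] at a3
  rw [← hyh] at b3
  refine .inr ⟨b1, a1, ((y - y') * v) ^ 2 + W.a₁ * ((y - y') * v) - W.a₂ - x - x',
    -((y - y') * v * ((((y - y') * v) ^ 2 + W.a₁ * ((y - y') * v) - W.a₂ - x - x') - x) + y)
      - W.a₁ * (((y - y') * v) ^ 2 + W.a₁ * ((y - y') * v) - W.a₂ - x - x') - W.a₃, ?_, ?_, ?_, ?_⟩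
  · rw [a2]; simp
  · rw [a3, a2]; simp
  · rw [b2]; simp
  · rw [b3, b2]; simp

lemma RedTo.add_or_of_zero (hr : IsReduction i ρ) (hg : g ≠ 0) (h₁ : RedTo i ρ W P 0)
    (h₂ : RedTo i ρ W Q g) : RedTo i ρ W (P + Q) g ∨ RedTo i ρ W (P + Q) (-g) := by
  rcases eq_or_ne P 0 with rfl | hP
  · exact .inl (by simpa using h₂)
  have hPi := (redTo_zero_iff.1 h₁).resolve_left hP
  obtain ⟨hQ, x, y, hx, hy, hxg, hyg⟩ := (redTo_iff hg).1 h₂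
  obtain ⟨e, he, he0⟩ := (hr.dich (xc P)).resolve_left (by simpa using hPi)
  have hxne : xc P ≠ xc Q := fun h => hPi x (hx.trans h.symm)
  have hs := xc_add_add_xc_sub hP hQ hxne
  have hp := xc_add_mul_xc_sub hP hQ hxne
  obtain ⟨v, hv⟩ := hr.unit (1 - e * x) (by simp [he0])
  have hvi : (1 - i e * i x) * i v = 1 := by
    rw [← _root_.map_mul, ← _root_.map_one i, ← _root_.map_sub, ← _root_.map_mul, hv]
  have hvρ : ρ v = 1 := by simpa [he0] using congrArg ρ hv
  rw [← hx] at hs hp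
  simp only [map_b₂, map_b₄, map_b₆, map_b₈] at hs hp
  have hs' : xc (P + Q) + xc (P - Q) = i ((2 * (1 + e * x) * x + W.b₂ * (e * x) +
      W.b₄ * (e + e ^ 2 * x) + W.b₆ * e ^ 2) * v ^ 2) := by
    simp only [_root_.map_add, _root_.map_mul, _root_.map_pow, _root_.map_one, map_ofNat]
    have hk : xc P * (i e * (1 - i e * i x)) = 1 - i e * i x := by linear_combination (1 - i e * i x) * he
    have : (xc (P + Q) + xc (P - Q)) * (1 - i e * i x) ^ 2 = 2 * (1 + i e * i x) * i x + i W.b₂ * (i e * i x) +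
      i W.b₄ * (i e + i e ^ 2 * i x) + i W.b₆ * i e ^ 2 := by
      linear_combination i e ^ 2 * hs + ((-1) * xc P * i e * xc (P + Q) + (-1) * xc P * i e * xc (P - Q) +
       2 * (i x * i e * xc (P + Q) + i x * i e * xc (P - Q)) - xc (P + Q) - xc (P - Q)
       + 2 * i x * (i e * xc P + 1) + 2 * i e * i x ^ 2  + i W.b₂ * i e * i x + i W.b₄ * i e) * he
    linear_combination i v ^ 2 * this - (xc (P + Q) + xc (P - Q)) * ((1 - i e * i x) * i v + 1) * hvi
  have hp' : xc (P + Q) * xc (P - Q) = i ((x ^ 2 - W.b₄ * (e * x) - W.b₆ * (e + e ^ 2 * x) -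
      W.b₈ * e ^ 2) * v ^ 2) := by
    simp only [_root_.map_add, _root_.map_mul, _root_.map_pow, _root_.map_sub]
    have : (xc (P + Q) * xc (P - Q)) * (1 - i e * i x) ^ 2 = i x ^ 2 - i W.b₄ * (i e * i x) -
      i W.b₆ * (i e + i e ^ 2 * i x) - i W.b₈ * i e ^ 2 := by
      linear_combination i e ^ 2 * hp + (xc (P + Q) * xc (P - Q) * (2 * i x * i e - 1 - i e * xc P) +
        i x ^ 2 * (i e * xc P + 1) - i W.b₄ * i e * i x - i W.b₆ * i e) * he
    linear_combination i v ^ 2 * this - (xc (P + Q) * xc (P - Q)) * ((1 - i e * i x) * i v + 1) * hvi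
  set s := (2 * (1 + e * x) * x + W.b₂ * (e * x) + W.b₄ * (e + e ^ 2 * x) + W.b₆ * e ^ 2) * v ^ 2
    with hsdef
  set p := (x ^ 2 - W.b₄ * (e * x) - W.b₆ * (e + e ^ 2 * x) - W.b₈ * e ^ 2) * v ^ 2 with hpdef
  have hq : xc (P + Q) ^ 2 + i (-s) * xc (P + Q) + i p = 0 := by
    rw [_root_.map_neg]
    linear_combination xc (P + Q) * hs' - hp'
  obtain ⟨X, hX⟩ := hr.exists_of_quadratic hq
  have hρs : ρ s = 2 * ρ x := by
    rw [hsdef]; simp [he0, hvρ, map_ofNat]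
  have hρp : ρ p = ρ x ^ 2 := by
    rw [hpdef]; simp [he0, hvρ]
  have hXρ : ρ X = ρ x := by
    rw [← hX, ← _root_.map_pow, ← _root_.map_mul, ← _root_.map_add, ← _root_.map_add, ← _root_.map_zero i] at hq
    have := congrArg ρ (hr.inj hq)
    simp only [_root_.map_add, _root_.map_mul, _root_.map_pow, _root_.map_neg, hρs, hρp, _root_.map_zero] at this
    have h2 : (ρ X - ρ x) ^ 2 = 0 := by linear_combination this
    exact sub_eq_zero.1 (pow_eq_zero_iff two_ne_zero |>.1 h2)
  exact RedTo.of_xc hr (add_ne_zero_of_xc_ne hP hQ hxne) hg hX (hXρ.trans hxg)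

lemma RedTo.sub_zero_of_xc (hr : IsReduction i ρ) (hh : h ≠ 0) (h2 : 2 • h ≠ 0)
    (h₁ : RedTo i ρ W P h) (h₂ : RedTo i ρ W Q h) {s : R} (hs : i s = xc (P + Q)) :
    RedTo i ρ W (P - Q) 0 := by
  rw [redTo_zero_iff]
  obtain ⟨hP, x, y, hxP, hyP, hxh, hyh⟩ := (redTo_iff hh).1 h₁
  obtain ⟨hQ, x', y', hxQ, hyQ, hxg, hyg⟩ := (redTo_iff hh).1 h₂
  by_cases hx : xc P = xc Q
  · rcases eq_or_eq_neg_of_xc_eq hP hQ hx with h3 | h3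
    · exact .inl (sub_eq_zero.2 h3)
    · exfalso
      rw [h3] at h₁
      have := RedTo.unique hr h₁ h₂.neg
      exact h2 (by rw [two_nsmul]; nth_rewrite 1 [this]; simp)
  · right
    intro d hd
    have h4 := xc_add_add_xc_sub hP hQ hx
    rw [← hs, ← hd, ← hxP, ← hxQ] at h4
    simp only [map_b₂, map_b₄, map_b₆] at h4
    have h5 : (s + d) * (x - x') ^ 2 = 2 * (x + x') * (x * x') + W.b₂ * (x * x') +
        W.b₄ * (x + x') + W.b₆ := by
      apply hr.inj
      simpa [map_ofNat] using h4
    have h6 := congrArg ρ h5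
    simp only [_root_.map_add, _root_.map_mul, _root_.map_pow, _root_.map_sub, map_ofNat, hxh, hxg] at h6
    rw [two_nsmul_ne_zero_iff hh] at h2
    simp only [map_b₂, map_b₄, map_b₆] at h2
    apply h2
    linear_combination -h6

end basic

section add

variable [IsAlgClosed K] [(W.map i).IsElliptic] [Infinite (W.map ρ).toAffine.Point]
  {P Q T : (W.map i).toAffine.Point} {h g : (W.map ρ).toAffine.Point}

lemma RedTo.add_of_ne_zero (hr : IsReduction i ρ)
    (h2 : ∀ᶠ h : (W.map ρ).toAffine.Point in cofinite, 2 • h ≠ 0) (hh : h ≠ 0) (hg : g ≠ 0)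
    (hhg : h + g ≠ 0) (h₁ : RedTo i ρ W P h) (h₂ : RedTo i ρ W Q g) :
    RedTo i ρ W (P + Q) (h + g) := by
  by_cases hx : xc h = xc g
  · rcases eq_or_eq_neg_of_xc_eq hh hg hx with rfl | h3
    · obtain ⟨r, hr1, hr2, hr3, hr4⟩ := (h2.and ((eventually_ne 0).and
        ((eventually_ne h).and (eventually_ne (-h))))).exists
      obtain ⟨R, hR⟩ := exists_redTo (W := W) hr r
      have hx1 : xc h ≠ xc r := fun h5 => by
        rcases eq_or_eq_neg_of_xc_eq hr2 hh h5.symm with h6 | h6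
        exacts [hr3 h6, hr4 h6]
      have e1 := RedTo.add_of_xc_ne hr hh hr2 hx1 h₁ hR
      have e2 := RedTo.add_of_xc_ne hr hh (neg_ne_zero.2 hr2) (by simpa using hx1) h₂ hR.neg
      have n1 : h + r ≠ 0 := add_ne_zero_of_xc_ne hh hr2 hx1
      have n2 : h + -r ≠ 0 := add_ne_zero_of_xc_ne hh (neg_ne_zero.2 hr2) (by simpa using hx1)
      have e3 := RedTo.add_of_xc_ne hr n1 n2 (fun h5 => by
        rcases eq_or_eq_neg_of_xc_eq n1 n2 h5 with h6 | h6
        · apply hr1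
          rw [two_nsmul, ← eq_neg_iff_add_eq_zero]
          exact add_left_cancel h6
        · apply hhg
          rw [neg_add, neg_neg] at h6
          rw [← eq_neg_iff_add_eq_zero]
          exact add_right_cancel h6) e1 e2
      convert e3 using 1 <;> abel
    · exact absurd (by rw [h3]; simp) hhg
  · exact RedTo.add_of_xc_ne hr hh hg hx h₁ h₂

lemma RedTo.add_of_left_zero (hr : IsReduction i ρ)
    (h2 : ∀ᶠ h : (W.map ρ).toAffine.Point in cofinite, 2 • h ≠ 0) (hg : g ≠ 0)
    (h₁ : RedTo i ρ W P 0) (h₂ : RedTo i ρ W Q g) : RedTo i ρ W (P + Q) g := by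
  rcases RedTo.add_or_of_zero hr hg h₁ h₂ with h3 | h3
  · exact h3
  · obtain ⟨r, hr1, hr2, hr3, hr4⟩ := (h2.and ((eventually_ne 0).and
        ((eventually_ne g).and (eventually_ne (-g))))).exists
    obtain ⟨R, hR⟩ := exists_redTo (W := W) hr r
    have n1 : g + r ≠ 0 := fun h => hr4 (by rw [eq_neg_iff_add_eq_zero, add_comm]; exact h)
    have n2 : -g + r ≠ 0 := fun h => hr3 (by rw [← sub_eq_zero, sub_eq_neg_add]; exact h)
    have e1 := RedTo.add_of_ne_zero hr h2 hg hr2 n1 h₂ hR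
    have e2 := RedTo.add_of_ne_zero hr h2 (neg_ne_zero.2 hg) hr2 n2 h3 hR
    rw [add_assoc] at e2
    rcases RedTo.add_or_of_zero hr n1 h₁ e1 with h5 | h5
    · have h6 := RedTo.unique hr e2 h5
      rw [add_left_inj] at h6
      rwa [h6] at h3
    · have h6 := RedTo.unique hr e2 h5
      exfalso
      apply hr1
      rw [neg_add, add_right_inj] at h6
      rw [two_nsmul]
      nth_rewrite 1 [h6]
      simp

lemma RedTo.zero_of_add (hr : IsReduction i ρ)
    (h2 : ∀ᶠ h : (W.map ρ).toAffine.Point in cofinite, 2 • h ≠ 0) (hh : 2 • h ≠ 0)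
    (h₁ : RedTo i ρ W Q h) (h₂ : RedTo i ρ W (T + Q) h) : RedTo i ρ W T 0 := by
  have hh0 : h ≠ 0 := by rintro rfl; simp at hh
  rw [two_nsmul] at hh
  obtain ⟨-, s, -, hs, -⟩ := (redTo_iff hh).1 (RedTo.add_of_ne_zero hr h2 hh0 hh0 hh h₂ h₁)
  rw [← two_nsmul] at hh
  simpa using RedTo.sub_zero_of_xc hr hh0 hh h₂ h₁ hs

theorem RedTo.add (hr : IsReduction i ρ)
    (h2 : ∀ᶠ h : (W.map ρ).toAffine.Point in cofinite, 2 • h ≠ 0)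
    (h₁ : RedTo i ρ W P h) (h₂ : RedTo i ρ W Q g) : RedTo i ρ W (P + Q) (h + g) := by
  rcases eq_or_ne g 0 with rfl | hg
  · rcases eq_or_ne h 0 with rfl | hh
    · obtain ⟨r, hr1, hr2⟩ := (h2.and (eventually_ne 0)).exists
      obtain ⟨R, hR⟩ := exists_redTo (W := W) hr r
      have e1 := RedTo.add_of_left_zero hr h2 hr2 h₁ (RedTo.add_of_left_zero hr h2 hr2 h₂ hR)
      rw [← add_assoc] at e1
      simpa using RedTo.zero_of_add hr h2 hr1 hR e1
    · rw [add_comm P, add_zero]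
      exact RedTo.add_of_left_zero hr h2 hh h₂ h₁
  rcases eq_or_ne h 0 with rfl | hh
  · rw [zero_add]
    exact RedTo.add_of_left_zero hr h2 hg h₁ h₂
  by_cases hhg : h + g = 0
  · obtain ⟨r, hr1, hr2, hr3⟩ := (h2.and ((eventually_ne 0).and (eventually_ne (-g)))).exists
    obtain ⟨R, hR⟩ := exists_redTo (W := W) hr r
    have n1 : g + r ≠ 0 := fun h => hr3 (by rw [eq_neg_iff_add_eq_zero, add_comm]; exact h)
    have n2 : h + (g + r) = r := by rw [← add_assoc, hhg, zero_add]
    have e1 := RedTo.add_of_ne_zero hr h2 hg hr2 n1 h₂ hR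
    have e2 := RedTo.add_of_ne_zero hr h2 hh n1 (by rwa [n2]) h₁ e1
    rw [n2, ← add_assoc] at e2
    rw [hhg]
    exact RedTo.zero_of_add hr h2 hr1 hR e2
  · exact RedTo.add_of_ne_zero hr h2 hh hg hhg h₁ h₂

end add

end WeierstrassCurve.Affine.Point

end

section

open Polynomial Filter

section normalise

variable {R K k : Type*} [CommRing R] [Field K] [Field k] {i : R →+* K} {ρ : R →+* k}

lemma IsReduction.exists_dvd_all (hr : IsReduction i ρ) (s : Finset K) (hs : s.Nonempty)
    (h0 : (0 : K) ∉ s) : ∃ m ∈ s, ∀ z ∈ s, ∃ a, i a * m = z := by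
  classical
  induction hs using Finset.Nonempty.cons_induction with
  | singleton a => exact ⟨a, by simp, by simpa using ⟨1, by simp⟩⟩
  | cons w s hw hs ih =>
    rw [Finset.mem_cons, not_or] at h0
    obtain ⟨m, hm, h⟩ := ih h0.2
    have hm0 : m ≠ 0 := fun h => h0.2 (h ▸ hm)
    have hw0 : w ≠ 0 := fun h => h0.1 h.symm
    rcases hr.dich (w / m) with ⟨a, ha⟩ | ⟨a, ha, -⟩
    · refine ⟨m, by simp [hm], fun z hz => ?_⟩
      rcases Finset.mem_cons.1 hz with rfl | hz
      · exact ⟨a, by rw [ha]; field_simp⟩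
      · exact h z hz
    · have hmw : i a * w = m := by field_simp at ha; linear_combination ha
      refine ⟨w, by simp, fun z hz => ?_⟩
      rcases Finset.mem_cons.1 hz with rfl | hz
      · exact ⟨1, by simp⟩
      · obtain ⟨b, hb⟩ := h z hz
        exact ⟨b * a, by rw [_root_.map_mul, mul_assoc, hmw, hb]⟩

/-- Clearing denominators and common factors in a pair of polynomials. -/
lemma IsReduction.exists_normalise (hr : IsReduction i ρ) {A B : K[X]} (h : A ≠ 0 ∨ B ≠ 0) :
    ∃ (A' B' : R[X]) (c : K), c ≠ 0 ∧ A'.map i = C c * A ∧ B'.map i = C c * B ∧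
      (A'.map ρ ≠ 0 ∨ B'.map ρ ≠ 0) := by
  classical
  have key : ∀ {D : K[X]}, D ≠ 0 → D.coeffs.Nonempty := fun {D} hD =>
    ⟨D.leadingCoeff, coeff_mem_coeffs (leadingCoeff_ne_zero.2 hD)⟩
  obtain ⟨m, hm, hall⟩ := hr.exists_dvd_all (A.coeffs ∪ B.coeffs)
    (by rcases h with h | h
        · exact (key h).mono Finset.subset_union_left
        · exact (key h).mono Finset.subset_union_right) (by
      simp only [Finset.mem_union, mem_coeffs_iff, mem_support_iff]
      rintro (⟨n, hn, h⟩ | ⟨n, hn, h⟩) <;> exact hn h.symm)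
  have hm0 : m ≠ 0 := by
    rintro rfl
    simp only [Finset.mem_union, mem_coeffs_iff, mem_support_iff] at hm
    rcases hm with (⟨n, hn, h⟩ | ⟨n, hn, h⟩) <;> exact hn h.symm
  have lift : ∀ D : K[X], (∀ z ∈ D.coeffs, ∃ a, i a * m = z) → ∃ D' : R[X], D'.map i = C m⁻¹ * D := by
    intro D hD
    have : C m⁻¹ * D ∈ lifts i := by
      rw [lifts_iff_coeff_lifts]
      intro n
      rw [coeff_C_mul]
      by_cases h0 : D.coeff n = 0
      · exact ⟨0, by simp [h0]⟩
      · obtain ⟨a, ha⟩ := hD _ (coeff_mem_coeffs h0)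
        exact ⟨a, by rw [← ha]; field_simp⟩
    exact (mem_lifts _).1 this
  obtain ⟨A', hA'⟩ := lift A fun z hz => hall z (Finset.mem_union_left _ hz)
  obtain ⟨B', hB'⟩ := lift B fun z hz => hall z (Finset.mem_union_right _ hz)
  have aux : ∀ {D : K[X]} {D' : R[X]}, D'.map i = C m⁻¹ * D → m ∈ D.coeffs → D'.map ρ ≠ 0 := by
    intro D D' h hD h0
    obtain ⟨n, hn, e⟩ := mem_coeffs_iff.1 hD
    have h1 : i (D'.coeff n) = i 1 := by
      rw [← coeff_map, h, coeff_C_mul, ← e, inv_mul_cancel₀ hm0, _root_.map_one]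
    have h2 := congrArg (fun p => coeff p n) h0
    simp [hr.inj h1] at h2
  refine ⟨A', B', m⁻¹, inv_ne_zero hm0, hA', hB', ?_⟩
  rcases Finset.mem_union.1 hm with h | h
  · exact .inl (aux hA' h)
  · exact .inr (aux hB' h)

end normalise

namespace WeierstrassCurve.Affine.Point

variable {R K k : Type*} [CommRing R] [Field K] [Field k] [DecidableEq K] [DecidableEq k]
  {i : R →+* K} {ρ : R →+* k} {W : WeierstrassCurve R}

lemma IsMult.redTo_cases (hr : IsReduction i ρ)
    {φ : (W.map i).toAffine.Point →+ (W.map i).toAffine.Point} {α : K} {A B : K[X]}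
    (hφ : IsMult φ α A B) {A' B' : R[X]} {c : K} (hc : c ≠ 0) (hA : A'.map i = C c * A)
    (hB : B'.map i = C c * B) {P : (W.map i).toAffine.Point} {h y : (W.map ρ).toAffine.Point}
    (hh : h ≠ 0) (hP : RedTo i ρ W P h) (hy : RedTo i ρ W (φ P) y)
    (hne : (A'.map ρ).eval (xc h) ≠ 0 ∨ (B'.map ρ).eval (xc h) ≠ 0) :
    (y = 0 ∧ (B'.map ρ).eval (xc h) = 0) ∨ (y ≠ 0 ∧ (B'.map ρ).eval (xc h) ≠ 0 ∧
      xc y * (B'.map ρ).eval (xc h) = (A'.map ρ).eval (xc h)) := by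
  obtain ⟨hP0, x, -, hx, -, hxh, -⟩ := (redTo_iff hh).1 hP
  have ev : ∀ {D : K[X]} {D' : R[X]}, D'.map i = C c * D → D.eval (xc P) = c⁻¹ * i (D'.eval x) := by
    intro D D' h
    rw [← eval_map_apply, h, hx, eval_mul, eval_C, inv_mul_cancel_left₀ hc]
  have evρ : ∀ D' : R[X], (D'.map ρ).eval (xc h) = ρ (D'.eval x) := fun D' => by
    rw [← hxh, eval_map_apply]
  rw [evρ, evρ] at hne ⊢
  have h0 := hφ.eq_zero_iff P hP0
  have h1 := hφ.xc_mul P hP0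
  rw [ev hB] at h0 h1
  rw [ev hA] at h1
  have h1' : φ P ≠ 0 → xc (φ P) * i (B'.eval x) = i (A'.eval x) := fun hne => by
    have := h1 hne
    field_simp at this
    exact this
  by_cases hy0 : y = 0
  · refine .inl ⟨hy0, ?_⟩
    subst hy0
    by_cases hφP : φ P = 0
    · have := h0.1 hφP
      rw [mul_eq_zero, or_iff_right (inv_ne_zero hc), ← _root_.map_zero i] at this
      rw [hr.inj this, _root_.map_zero]
    · have hn := (redTo_zero_iff.1 hy).resolve_left hφP
      obtain ⟨e, he, he0⟩ := (hr.dich (xc (φ P))).resolve_left (by simpa using hn)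
      have : i (B'.eval x) = i (A'.eval x * e) := by
        rw [_root_.map_mul, ← h1' hφP]
        linear_combination -i (B'.eval x) * he
      rw [hr.inj this, _root_.map_mul, he0, mul_zero]
  · obtain ⟨hφP, z, -, hz, -, hzy, -⟩ := (redTo_iff hy0).1 hy
    have : i (z * B'.eval x) = i (A'.eval x) := by rw [_root_.map_mul, hz, h1' hφP]
    have e : xc y * ρ (B'.eval x) = ρ (A'.eval x) := by rw [← hr.inj this, _root_.map_mul, hzy]
    refine .inr ⟨hy0, fun h5 => ?_, e⟩
    rw [h5, mul_zero] at e
    rcases hne with h6 | h6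
    exacts [h6 e.symm, h6 h5]

lemma eventually_ne_or {A B : k[X]} (h : A ≠ 0 ∨ B ≠ 0) {H : WeierstrassCurve.Affine k} :
    ∀ᶠ P : H.Point in cofinite, A.eval (xc P) ≠ 0 ∨ B.eval (xc P) ≠ 0 := by
  rcases h with h | h
  · filter_upwards [eventually_eval_ne h] with P hP using .inl hP
  · filter_upwards [eventually_eval_ne h] with P hP using .inr hP

lemma eventually_add_left {H : WeierstrassCurve.Affine k} {p : H.Point → Prop}
    (h : ∀ᶠ P in cofinite, p P) (Q : H.Point) : ∀ᶠ P in cofinite, p (Q + P) :=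
  (add_right_injective Q).tendsto_cofinite.eventually h

variable [IsAlgClosed K] [(W.map i).IsElliptic] [Infinite (W.map ρ).toAffine.Point]

/-- A multiplication which preserves the points with nonsingular reduction also preserves the
kernel of reduction. -/
theorem IsMult.redTo_zero (hr : IsReduction i ρ)
    (h2 : ∀ᶠ h : (W.map ρ).toAffine.Point in cofinite, 2 • h ≠ 0)
    {φ : (W.map i).toAffine.Point →+ (W.map i).toAffine.Point} {α : K} {A B : K[X]}
    (hφ : IsMult φ α A B) (hpres : ∀ P h, RedTo i ρ W P h → ∃ h', RedTo i ρ W (φ P) h')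
    {T : (W.map i).toAffine.Point} (hT : RedTo i ρ W T 0) : RedTo i ρ W (φ T) 0 := by
  have hne : A ≠ 0 ∨ B ≠ 0 := by
    by_contra! h
    have := hφ.coprime
    rw [h.1, h.2] at this
    exact not_isCoprime_zero_zero this
  obtain ⟨A', B', c, hc, hA, hB, hAB⟩ := hr.exists_normalise hne
  obtain ⟨D, hD⟩ := hpres T 0 hT
  have key : ∀ Q h y, h ≠ 0 → RedTo i ρ W Q h → RedTo i ρ W (φ Q) y →
      ((A'.map ρ).eval (xc h) ≠ 0 ∨ (B'.map ρ).eval (xc h) ≠ 0) → D + y = y ∨ D + y = -y := by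
    intro Q h y hh hQ hy hne
    have e1 : RedTo i ρ W (T + Q) h := by simpa using RedTo.add hr h2 hT hQ
    have e2 : RedTo i ρ W (φ (T + Q)) (D + y) := by
      rw [_root_.map_add]
      exact RedTo.add hr h2 hD hy
    rcases hφ.redTo_cases hr hc hA hB hh hQ hy hne with h3 | h3 <;>
    rcases hφ.redTo_cases hr hc hA hB hh e1 e2 hne with h4 | h4
    · exact .inl (h4.1.trans h3.1.symm)
    · exact absurd h3.2 h4.2.1
    · exact absurd h4.2 h3.2.1
    · exact eq_or_eq_neg_of_xc_eq h4.1 h3.1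
        (mul_right_cancel₀ h3.2.1 (h4.2.2.trans h3.2.2.symm))
  have hgen := (eventually_ne_or hAB (H := (W.map ρ).toAffine)).and (eventually_ne 0)
  obtain ⟨h, hh1, hh0⟩ := hgen.exists
  obtain ⟨g, ⟨hg1, hg0⟩, hs1, hs0⟩ := (hgen.and (eventually_add_left hgen h)).exists
  obtain ⟨P, hP⟩ := exists_redTo (W := W) hr h
  obtain ⟨Q, hQ⟩ := exists_redTo (W := W) hr g
  obtain ⟨y, hy⟩ := hpres P h hP
  obtain ⟨z, hz⟩ := hpres Q g hQ
  have hyz : RedTo i ρ W (φ (P + Q)) (y + z) := by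
    rw [_root_.map_add]
    exact RedTo.add hr h2 hy hz
  suffices hD0 : D = 0 by rwa [hD0] at hD
  rcases key P h y hh0 hP hy hh1 with h3 | h3
  · simpa using h3
  rcases key Q g z hg0 hQ hz hg1 with h4 | h4
  · simpa using h4
  rcases key _ _ _ hs0 (RedTo.add hr h2 hP hQ) hyz hs1 with h5 | h5
  · simpa using h5
  have e1 : D = -y - y := eq_sub_of_add_eq h3
  have e2 : D = -z - z := eq_sub_of_add_eq h4
  have e3 : D = -(y + z) - (y + z) := eq_sub_of_add_eq h5
  have e4 : D + D = D := by
    calc D + D = (-y - y) + (-z - z) := congrArg₂ _ e1 e2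
      _ = -(y + z) - (y + z) := by abel
      _ = D := e3.symm
  simpa using e4

/-- The endomorphism of the reduction induced by an endomorphism of the generic fibre. -/
theorem exists_induced (hr : IsReduction i ρ)
    (h2 : ∀ᶠ h : (W.map ρ).toAffine.Point in cofinite, 2 • h ≠ 0)
    {φ : (W.map i).toAffine.Point →+ (W.map i).toAffine.Point}
    (hpres : ∀ P h, RedTo i ρ W P h → ∃ h', RedTo i ρ W (φ P) h')
    (h0 : ∀ P, RedTo i ρ W P 0 → RedTo i ρ W (φ P) 0) :
    ∃ ψ : (W.map ρ).toAffine.Point →+ (W.map ρ).toAffine.Point,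
      ∀ P h, RedTo i ρ W P h → RedTo i ρ W (φ P) (ψ h) := by
  choose s hs using fun h => exists_redTo (W := W) hr h
  choose f hf using fun h => hpres (s h) h (hs h)
  have key : ∀ P h, RedTo i ρ W P h → RedTo i ρ W (φ P) (f h) := by
    intro P h hP
    have e1 : RedTo i ρ W (P + -s h) 0 := by simpa using RedTo.add hr h2 hP (hs h).neg
    simpa using RedTo.add hr h2 (h0 _ e1) (hf h)
  refine ⟨AddMonoidHom.mk' f fun a b => ?_, key⟩
  have e1 := key _ _ (RedTo.add hr h2 (hs a) (hs b))
  have e2 := RedTo.add hr h2 (hf a) (hf b)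
  rw [_root_.map_add] at e1
  exact RedTo.unique hr e1 e2

end WeierstrassCurve.Affine.Point

end

section

open Polynomial Filter

lemma exists_zsmul_of_card_torsion_lt {G : Type*} [AddCommGroup G] {ℓ : ℕ} (hℓ : ℓ.Prime)
    (hfin : {P : G | ℓ • P = 0}.Finite) (hcard : {P : G | ℓ • P = 0}.ncard < ℓ ^ 2)
    {P Q : G} (hP : P ≠ 0) (hℓP : ℓ • P = 0) (hℓQ : ℓ • Q = 0) : ∃ c : ℤ, Q = c • P := by
  have : Fact ℓ.Prime := ⟨hℓ⟩
  let T : AddSubgroup G := (nsmulAddMonoidHom ℓ : G →+ G).ker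
  have hT : ∀ x, x ∈ T ↔ ℓ • x = 0 := fun x => by simp [T, AddMonoidHom.mem_ker]
  have hTset : (T : Set G) = {P : G | ℓ • P = 0} := by ext x; simp [hT]
  have : Finite T := by
    have := hfin
    rw [← hTset] at this
    exact this
  let _ : Module (ZMod ℓ) T := AddCommGroup.zmodModule (fun x => by
    ext; simpa using (hT x).1 x.2)
  have hc : Nat.card T < ℓ ^ 2 := by
    rw [← hTset] at hcard
    exact hcard
  rw [← FiniteField.pow_finrank_eq_natCard ℓ T,
    Nat.pow_lt_pow_iff_right hℓ.one_lt] at hc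
  let P' : T := ⟨P, (hT P).2 hℓP⟩
  have hP' : P' ≠ 0 := fun h => hP (congrArg Subtype.val h)
  let Q' : T := ⟨Q, (hT Q).2 hℓQ⟩
  have h1 : Module.finrank (ZMod ℓ) T = 1 := by
    have : Module.finrank (ZMod ℓ) T ≠ 0 := fun h => by
      have := (Module.finrank_eq_zero_iff_of_free (R := ZMod ℓ) (M := T)).1 h
      exact hP' (Subsingleton.elim _ _)
    omega
  obtain ⟨c, hc⟩ := (finrank_eq_one_iff_of_nonzero' P' hP').1 h1 Q'
  refine ⟨(c.val : ℤ), ?_⟩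
  have h2 : c = ((c.val : ℕ) : ZMod ℓ) := by simp
  rw [h2, Nat.cast_smul_eq_nsmul] at hc
  rw [natCast_zsmul]
  exact (congrArg Subtype.val hc).symm

lemma exists_prime_mod_four_eq_three {n : ℕ} (h : n % 4 = 3) :
    ∃ ℓ : ℕ, ℓ.Prime ∧ ℓ % 4 = 3 ∧ ℓ ∣ n := by
  induction n using Nat.strong_induction_on with
  | _ n ih =>
    have h1 : n ≠ 1 := by omega
    obtain ⟨q, hq, m, rfl⟩ := Nat.exists_prime_and_dvd h1
    by_cases h3 : q % 4 = 3
    · exact ⟨q, hq, h3, Dvd.intro _ rfl⟩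
    · have hq4 := Nat.mod_lt q (show 0 < 4 by norm_num)
      have hm4 := Nat.mod_lt m (show 0 < 4 by norm_num)
      have hm : m % 4 = 3 := by
        rw [Nat.mul_mod] at h
        interval_cases hx : q % 4 <;> interval_cases hy : m % 4 <;> simp_all
      have hm0 : 0 < m := by omega
      obtain ⟨ℓ, hℓ, hℓ3, hd⟩ := ih m (by nlinarith [hq.two_le]) hm
      exact ⟨ℓ, hℓ, hℓ3, hd.mul_left q⟩

namespace WeierstrassCurve.Affine.Point

/-- The polynomial expressing `1 / x(nP)` in terms of `1 / x(P)` on the nodal cubic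
`y² + xy = x³`. -/
noncomputable def nodalPoly (k : Type*) [Field k] : ℕ → k[X]
  | 0 => 0
  | 1 => X
  | n + 2 => X * nodalPoly k (n + 1) + 2 * nodalPoly k (n + 1) + 2 * X - nodalPoly k n

variable {k : Type*} [Field k] [DecidableEq k]

lemma natDegree_nodalPoly_le (n : ℕ) : (nodalPoly k n).natDegree ≤ n ∧
    (nodalPoly k (n + 1)).natDegree ≤ n + 1 := by
  induction n with
  | zero => simp [nodalPoly]
  | succ n ih =>
    refine ⟨ih.2, ?_⟩
    rw [nodalPoly]
    have h1 : (X * nodalPoly k (n + 1)).natDegree ≤ n + 2 :=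
      natDegree_mul_le.trans (by have := natDegree_X_le (R := k); omega)
    have h2 : (2 * nodalPoly k (n + 1)).natDegree ≤ n + 2 :=
      natDegree_mul_le.trans (by rw [natDegree_ofNat]; omega)
    have h3 : (2 * X : k[X]).natDegree ≤ n + 2 :=
      natDegree_mul_le.trans (by
        rw [natDegree_ofNat]; have := natDegree_X_le (R := k); omega)
    have h4 := natDegree_add_le_of_degree_le (natDegree_add_le_of_degree_le h1 h2) h3
    exact (natDegree_sub_le_of_le h4 (ih.1.trans (by omega : n ≤ n + 2))).trans (by simp)

lemma coeff_nodalPoly_self (n : ℕ) : (nodalPoly k (n + 1)).coeff (n + 1) = 1 := by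
  induction n with
  | zero => simp [nodalPoly]
  | succ n ih =>
    rw [nodalPoly]
    have h1 := coeff_eq_zero_of_natDegree_lt (p := nodalPoly k (n + 1)) (n := n + 2)
      (by have := (natDegree_nodalPoly_le (k := k) n).2; omega)
    have h2 := coeff_eq_zero_of_natDegree_lt (p := nodalPoly k n) (n := n + 2)
      (by have := (natDegree_nodalPoly_le (k := k) n).1; omega)
    simp [coeff_X_mul, ih, h1, h2, coeff_ofNat_mul, coeff_X]

lemma coeff_nodalPoly (n : ℕ) : ((nodalPoly k n).coeff 0 = 0 ∧ (nodalPoly k n).coeff 1 = n ^ 2) ∧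
    (nodalPoly k (n + 1)).coeff 0 = 0 ∧ (nodalPoly k (n + 1)).coeff 1 = (n + 1 : k) ^ 2 := by
  induction n with
  | zero => simp [nodalPoly]
  | succ n ih =>
    obtain ⟨⟨h0, h1⟩, h2, h3⟩ := ih
    refine ⟨⟨h2, by rw [h3]; push_cast; ring⟩, ?_, ?_⟩
    · rw [nodalPoly]; simp [h0, h2, mul_coeff_zero]
    · rw [nodalPoly]
      simp only [coeff_sub, coeff_add, coeff_X_mul, coeff_ofNat_mul, h1, h2, h3, coeff_X_one]
      push_cast
      ring

variable {W : WeierstrassCurve.Affine k}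

section nodal

variable (h₁ : W.a₁ = 1) (h₂ : W.a₂ = 0) (h₃ : W.a₃ = 0) (h₄ : W.a₄ = 0) (h₆ : W.a₆ = 0)

include h₁ h₂ h₃ h₄ h₆

lemma nodal_b : W.b₂ = 1 ∧ W.b₄ = 0 ∧ W.b₆ = 0 ∧ W.b₈ = 0 := by
  simp [b₂, b₄, b₆, b₈, h₁, h₂, h₃, h₄, h₆]

lemma nodal_xc_ne_zero {P : W.Point} (hP : P ≠ 0) : xc P ≠ 0 := by
  intro h
  have h5 := equation_coords hP
  have h7 := (W.nonsingular_iff _ _).1 (nonsingular_coords hP)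
  simp only [h₁, h₂, h₃, h₄, h₆, h] at h5 h7
  have hy : yc P = 0 := by
    have : yc P ^ 2 = 0 := by linear_combination h5
    exact pow_eq_zero_iff two_ne_zero |>.1 this
  simp [hy] at h7

lemma exists_nodal_xc_eq [IsAlgClosed k] {c : k} (hc : c ≠ 0) : ∃ P : W.Point, P ≠ 0 ∧ xc P = c := by
  obtain ⟨y, hy⟩ := exists_root_quadratic c (-c ^ 3)
  have hns : W.Nonsingular c y := by
    rw [W.nonsingular_iff, W.equation_iff]
    simp only [h₁, h₂, h₃, h₄, h₆]
    refine ⟨by linear_combination hy, ?_⟩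
    by_contra! h
    obtain ⟨h5, h7⟩ := h
    have e1 : y = 3 * c ^ 2 := by linear_combination h5
    have e2 : c * (6 * c + 1) = 0 := by linear_combination h7 - 2 * e1
    have e3 : c ^ 3 * (9 * c + 2) = 0 := by
      rw [e1] at hy
      linear_combination hy
    have e4 := (mul_eq_zero.1 e2).resolve_left hc
    have e5 := (mul_eq_zero.1 e3).resolve_left (pow_ne_zero _ hc)
    exact one_ne_zero (α := k) (by linear_combination 2 * e5 - 3 * e4)
  exact ⟨some c y hns, some_ne_zero _, rfl⟩

lemma infinite_nodal [IsAlgClosed k] : Infinite W.Point := by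
  have : Infinite k := IsAlgClosed.instInfinite
  refine Infinite.of_not_fintype fun hf => ?_
  have h : Set.univ ⊆ insert (0 : k) (Set.range (xc : W.Point → k)) := fun c _ => by
    by_cases hc : c = 0
    · exact .inl hc
    · obtain ⟨P, -, hP⟩ := exists_nodal_xc_eq h₁ h₂ h₃ h₄ h₆ hc
      exact .inr ⟨P, hP⟩
  exact Set.infinite_univ (((Set.finite_range _).insert 0).subset h)

lemma nodal_eventually_two_nsmul_ne : ∀ᶠ P : W.Point in cofinite, 2 • P ≠ 0 := by
  obtain ⟨e2, e4, e6, -⟩ := nodal_b h₁ h₂ h₃ h₄ h₆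
  have hf : (4 * X ^ 3 + X ^ 2 : k[X]) ≠ 0 := fun h => by
    have := congrArg (fun p => coeff p 2) h
    simp [coeff_ofNat_mul, coeff_X_pow] at this
  filter_upwards [eventually_eval_ne hf, eventually_ne 0] with P h hP
  rw [two_nsmul_ne_zero_iff hP, e2, e4, e6]
  simpa using h

lemma nodal_inv_xc_add (P Q : W.Point) : (xc (P + Q))⁻¹ + (xc (P - Q))⁻¹ =
    (xc P)⁻¹ * (xc Q)⁻¹ + 2 * (xc P)⁻¹ + 2 * (xc Q)⁻¹ := by
  obtain ⟨e2, e4, e6, e8⟩ := nodal_b h₁ h₂ h₃ h₄ h₆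
  rcases eq_or_ne P 0 with rfl | hP
  · simp; ring
  rcases eq_or_ne Q 0 with rfl | hQ
  · simp; ring
  have hP' := nodal_xc_ne_zero h₁ h₂ h₃ h₄ h₆ hP
  have hQ' := nodal_xc_ne_zero h₁ h₂ h₃ h₄ h₆ hQ
  have hdbl : (xc (2 • P))⁻¹ = (xc P)⁻¹ ^ 2 + 4 * (xc P)⁻¹ := by
    by_cases h2 : 2 • P = 0
    · have h3 := not_not.1 ((two_nsmul_ne_zero_iff hP).not.1 (not_not.2 h2))
      rw [e2, e4, e6] at h3
      rw [h2, xc_zero, inv_zero]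
      field_simp
      apply mul_left_cancel₀ (pow_ne_zero 2 hP')
      linear_combination -h3
    · have h3 := xc_two_nsmul hP h2
      have h4 := nodal_xc_ne_zero h₁ h₂ h₃ h₄ h₆ h2
      rw [e2, e4, e6, e8] at h3
      field_simp
      apply mul_left_cancel₀ (pow_ne_zero 2 hP')
      linear_combination -h3
  by_cases hx : xc P = xc Q
  · rcases eq_or_eq_neg_of_xc_eq hP hQ hx with h | h
    · rw [← h, ← two_nsmul, sub_self, hdbl, xc_zero, inv_zero]
      ring
    · have hQP : Q = -P := by rw [h, neg_neg]
      rw [hQP, add_neg_cancel, sub_neg_eq_add, ← two_nsmul, hdbl, xc_zero, inv_zero, xc_neg]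
      ring
  · have hs := xc_add_add_xc_sub hP hQ hx
    have hp := xc_add_mul_xc_sub hP hQ hx
    have n1 := nodal_xc_ne_zero h₁ h₂ h₃ h₄ h₆ (add_ne_zero_of_xc_ne hP hQ hx)
    have n2 := nodal_xc_ne_zero h₁ h₂ h₃ h₄ h₆ (sub_ne_zero_of_xc_ne hP hQ hx)
    rw [e2, e4, e6] at hs
    rw [e4, e6, e8] at hp
    have hd : (xc P - xc Q) ^ 2 ≠ 0 := pow_ne_zero _ (sub_ne_zero.2 hx)
    field_simp
    apply mul_left_cancel₀ (mul_ne_zero hd (mul_ne_zero hP' hQ'))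
    linear_combination (xc P * xc Q) ^ 2 * hs -
      xc P * xc Q * (1 + 2 * xc Q + 2 * xc P) * hp

lemma nodal_inv_xc_nsmul (n : ℕ) (P : W.Point) :
    (xc (n • P))⁻¹ = (nodalPoly k n).eval (xc P)⁻¹ ∧
    (xc ((n + 1) • P))⁻¹ = (nodalPoly k (n + 1)).eval (xc P)⁻¹ := by
  induction n with
  | zero => simp [nodalPoly]
  | succ n ih =>
    refine ⟨ih.2, ?_⟩
    have h := nodal_inv_xc_add h₁ h₂ h₃ h₄ h₆ ((n + 1) • P) P
    rw [← succ_nsmul, show (n + 1) • P - P = n • P by rw [succ_nsmul, add_sub_cancel_right],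
      ih.1, ih.2] at h
    rw [nodalPoly]
    simp only [eval_sub, eval_add, eval_mul, eval_X, eval_ofNat]
    linear_combination h

lemma nodal_torsion {ℓ : ℕ} (h0 : ℓ ≠ 0) : {P : W.Point | ℓ • P = 0}.Finite ∧
    {P : W.Point | ℓ • P = 0}.ncard ≤ 2 * ℓ - 1 := by
  obtain ⟨n, rfl⟩ := Nat.exists_eq_succ_of_ne_zero h0
  have hne : nodalPoly k (n + 1) ≠ 0 := fun h => by
    have := coeff_nodalPoly_self (k := k) n
    simp [h] at this
  have hroot : (0 : k) ∈ (nodalPoly k (n + 1)).roots.toFinset := by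
    rw [Multiset.mem_toFinset, mem_roots hne, IsRoot, ← coeff_zero_eq_eval_zero]
    exact (coeff_nodalPoly n).2.1
  have hcard : (nodalPoly k (n + 1)).roots.toFinset.card ≤ n + 1 :=
    (Multiset.toFinset_card_le _).trans ((card_roots' _).trans (natDegree_nodalPoly_le n).2)
  set s := (nodalPoly k (n + 1)).roots.toFinset.erase 0 with hs
  have hscard : s.card ≤ n := by
    rw [hs, Finset.card_erase_of_mem hroot]
    omega
  choose! f hf using fun (c : k) (h : ∃ P : W.Point, P ≠ 0 ∧ (xc P)⁻¹ = c) => h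
  have hsub : {P : W.Point | (n + 1) • P = 0} ⊆
      (({0} ∪ (s.image f ∪ s.image (fun c => -f c)) : Finset W.Point) : Set W.Point) := by
    intro P hP
    rw [Set.mem_ofPred] at hP
    simp only [Finset.coe_union, Finset.coe_image, Finset.coe_singleton]
    by_cases hP0 : P = 0
    · exact .inl hP0
    · right
      have hx := nodal_xc_ne_zero h₁ h₂ h₃ h₄ h₆ hP0
      have hmem : (xc P)⁻¹ ∈ s := by
        rw [hs, Finset.mem_erase, Multiset.mem_toFinset, mem_roots hne, IsRoot,
          ← (nodal_inv_xc_nsmul h₁ h₂ h₃ h₄ h₆ n P).2, hP]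
        simpa using hx
      obtain ⟨g1, g2⟩ := hf _ ⟨P, hP0, rfl⟩
      rcases eq_or_eq_neg_of_xc_eq hP0 g1 (inv_injective g2.symm) with h | h
      · exact .inl ⟨_, hmem, h.symm⟩
      · exact .inr ⟨_, hmem, h.symm⟩
  refine ⟨(Finset.finite_toSet _).subset hsub, ?_⟩
  have h1 := Set.ncard_le_ncard hsub (Finset.finite_toSet _)
  rw [Set.ncard_coe_finset] at h1
  have h2 := Finset.card_union_le {0} (s.image f ∪ s.image (fun c => -f c))
  have h3 := Finset.card_union_le (s.image f) (s.image (fun c => -f c))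
  have h4 := Finset.card_image_le (s := s) (f := f)
  have h5 := Finset.card_image_le (s := s) (f := fun c => -f c)
  rw [Finset.card_singleton] at h2
  change {P : W.Point | (n + 1) • P = 0}.ncard ≤ 2 * (n + 1) - 1
  omega

lemma nodal_exists_torsion [IsAlgClosed k] {ℓ : ℕ} (h1 : 1 < ℓ) (hℓ : (ℓ : k) ≠ 0) :
    ∃ P : W.Point, P ≠ 0 ∧ ℓ • P = 0 := by
  obtain ⟨n, rfl⟩ : ∃ n, ℓ = n + 1 := ⟨ℓ - 1, by omega⟩
  obtain ⟨g, hg⟩ := X_dvd_iff.2 (coeff_nodalPoly (k := k) n).2.1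
  have hg0 : g.coeff 0 ≠ 0 := by
    have := (coeff_nodalPoly (k := k) n).2.2
    rw [hg, coeff_X_mul] at this
    rw [this]
    exact_mod_cast pow_ne_zero 2 hℓ
  have hgn : g.coeff n = 1 := by
    have := coeff_nodalPoly_self (k := k) n
    rwa [hg, coeff_X_mul] at this
  have hdeg : g.degree ≠ 0 := by
    have : (n : WithBot ℕ) ≤ g.degree := le_degree_of_ne_zero (by rw [hgn]; exact one_ne_zero)
    intro h
    rw [h] at this
    have : n ≤ 0 := by exact_mod_cast this
    omega
  obtain ⟨w, hw⟩ := IsAlgClosed.exists_root g hdeg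
  have hw0 : w ≠ 0 := by
    rintro rfl
    exact hg0 (by rw [coeff_zero_eq_eval_zero]; exact hw)
  obtain ⟨P, hP, hx⟩ := exists_nodal_xc_eq h₁ h₂ h₃ h₄ h₆ (inv_ne_zero hw0)
  refine ⟨P, hP, ?_⟩
  by_contra h
  have h2 := (nodal_inv_xc_nsmul h₁ h₂ h₃ h₄ h₆ n P).2
  rw [hx, inv_inv, hg, eval_mul, show eval w g = 0 from hw, mul_zero] at h2
  exact nodal_xc_ne_zero h₁ h₂ h₃ h₄ h₆ h (by simpa using h2)

end nodal

end WeierstrassCurve.Affine.Point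

end

section

open Polynomial Filter

lemma IsReduction.exists_content {R K k : Type*} [CommRing R] [Field K] [Field k] {i : R →+* K}
    {ρ : R →+* k} (hr : IsReduction i ρ) (A : K[X]) :
    ∃ (a : K) (A' : R[X]), A = C a * A'.map i ∧ A'.map ρ ≠ 0 := by
  by_cases hA : A = 0
  · exact ⟨0, 1, by simp [hA], by simp⟩
  · obtain ⟨A', B', c, hc, h1, h2, h3⟩ := hr.exists_normalise (B := 0) (.inl hA)
    refine ⟨c⁻¹, A', ?_, ?_⟩
    · rw [h1, ← mul_assoc, ← C_mul, inv_mul_cancel₀ hc, C_1, one_mul]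
    · refine h3.resolve_right fun h => h ?_
      rw [mul_zero, Polynomial.map_eq_zero_iff hr.inj] at h2
      simp [h2]

namespace WeierstrassCurve.Affine.Point

lemma tendsto_two_nsmul {k : Type*} [Field k] [DecidableEq k] {H : WeierstrassCurve.Affine k}
    (h2 : ∀ᶠ h : H.Point in cofinite, 2 • h ≠ 0) :
    Tendsto (fun h : H.Point => 2 • h) cofinite cofinite := by
  refine Filter.Tendsto.cofinite_of_finite_preimage_singleton fun b => ?_
  have hfin : {h : H.Point | 2 • h = 0}.Finite := by simpa [Filter.eventually_cofinite] using h2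
  by_cases hb : ∃ c : H.Point, 2 • c = b
  · obtain ⟨c, hc⟩ := hb
    refine (hfin.image (fun h => h + c)).subset fun x hx => ⟨x - c, ?_, by simp⟩
    rw [Set.mem_ofPred, nsmul_sub, hc, sub_eq_zero]
    exact hx
  · push Not at hb
    refine Set.finite_empty.subset fun x hx => (hb x hx).elim

variable {R K k : Type*} [CommRing R] [Field K] [Field k] [DecidableEq K] [DecidableEq k]
  {i : R →+* K} {ρ : R →+* k} {W : WeierstrassCurve R}

lemma RedTo.nsmul [IsAlgClosed K] [(W.map i).IsElliptic] [Infinite (W.map ρ).toAffine.Point]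
    (hr : IsReduction i ρ) (h2 : ∀ᶠ h : (W.map ρ).toAffine.Point in cofinite, 2 • h ≠ 0)
    {P : (W.map i).toAffine.Point} {h : (W.map ρ).toAffine.Point} (hP : RedTo i ρ W P h) (n : ℕ) :
    RedTo i ρ W (n • P) (n • h) := by
  induction n with
  | zero => simpa using RedTo.zero
  | succ n ih =>
    rw [succ_nsmul, succ_nsmul]
    exact RedTo.add hr h2 ih hP

lemma RedTo.zsmul [IsAlgClosed K] [(W.map i).IsElliptic] [Infinite (W.map ρ).toAffine.Point]
    (hr : IsReduction i ρ) (h2 : ∀ᶠ h : (W.map ρ).toAffine.Point in cofinite, 2 • h ≠ 0)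
    {P : (W.map i).toAffine.Point} {h : (W.map ρ).toAffine.Point} (hP : RedTo i ρ W P h) (n : ℤ) :
    RedTo i ρ W (n • P) (n • h) := by
  obtain ⟨m, rfl | rfl⟩ := n.eq_nat_or_neg
  · simpa using hP.nsmul hr h2 m
  · simpa using (hP.nsmul hr h2 m).neg

section nodal

variable (h₁ : W.a₁ = 1) (h₂ : W.a₂ = 0) (h₃ : W.a₃ = 0) (h₄ : ρ W.a₄ = 0) (h₆ : W.a₆ = 0)

include h₁ h₂ h₃ h₄ h₆

lemma exists_redTo_of_inv [IsAlgClosed k] (hr : IsReduction i ρ) {P : (W.map i).toAffine.Point}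
    (hP : P ≠ 0) {e : R} (he : i e * xc P = 1) : ∃ h, RedTo i ρ W P h := by
  by_cases h0 : ρ e = 0
  · refine ⟨0, redTo_zero_iff.2 (.inr fun a ha => ?_)⟩
    rw [← ha, ← _root_.map_mul, ← _root_.map_one i] at he
    have := congrArg ρ (hr.inj he)
    simp [h0] at this
  · obtain ⟨v, hv⟩ := hr.unit e h0
    have hx : i v = xc P := by
      have := congrArg i hv
      rw [_root_.map_mul, _root_.map_one] at this
      exact mul_left_cancel₀ (left_ne_zero_of_mul_eq_one he) (this.trans he.symm)
    have hv0 : ρ v ≠ 0 := fun h => by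
      have := congrArg ρ hv
      simp [h] at this
    obtain ⟨h, hh, hxh⟩ := exists_nodal_xc_eq (W := (W.map ρ).toAffine) (by simp [h₁]) (by simp [h₂])
      (by simp [h₃]) (by simp [h₄]) (by simp [h₆]) hv0
    rcases RedTo.of_xc hr hP hh hx hxh.symm with h5 | h5
    exacts [⟨_, h5⟩, ⟨_, h5⟩]

lemma exists_redTo_three_nsmul [IsAlgClosed k] [(W.map i).IsElliptic] (hr : IsReduction i ρ)
    {Q : (W.map i).toAffine.Point} (hQ : Q ≠ 0) (hQ2 : 2 • Q ≠ 0) {a u u' : R} (ha : ρ a = 0)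
    (hu : ρ u ≠ 0) (hu' : ρ u' ≠ 0) (hx : xc Q = i (a * u)) (hx' : xc (2 • Q) = i (a * u')) :
    ∃ h, RedTo i ρ W (3 • Q) h := by
  have : IsDomain R := hr.inj.isDomain i
  by_cases h3 : 3 • Q = 0
  · exact ⟨0, by rw [h3]; exact .zero⟩
  have e2 : W.b₂ = 1 := by simp [b₂, h₁, h₂]
  have e4 : W.b₄ = 2 * W.a₄ := by simp [b₄, h₃]
  have e6 : W.b₆ = 0 := by simp [b₆, h₃, h₆]
  have e8 : W.b₈ = -W.a₄ ^ 2 := by simp [b₈, h₂, h₃, h₆]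
  have hb0 : W.a₄ ≠ 0 := by
    intro h
    have := (W.map i).isUnit_Δ.ne_zero
    rw [map_Δ] at this
    apply this
    simp [Δ, e2, e4, e6, e8, h]
  set b := W.a₄ with hb
  have hx2 := xc_two_nsmul hQ hQ2
  rw [hx, hx'] at hx2
  simp only [map_b₂, map_b₄, map_b₆, map_b₈, e2, e4, e6, e8] at hx2
  have E : (a * u') * (4 * (a * u) ^ 3 + (a * u) ^ 2 + 4 * b * (a * u)) = ((a * u) ^ 2 - b) ^ 2 := by
    apply hr.inj
    simp only [_root_.map_mul, _root_.map_add, _root_.map_sub, _root_.map_pow, _root_.map_neg,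
      _root_.map_one, _root_.map_zero, map_ofNat] at hx2 ⊢
    linear_combination hx2
  have hib : i b ≠ 0 := (map_ne_zero_iff i hr.inj).2 hb0
  rcases hr.dich (i a / i b) with ⟨d, hd⟩ | ⟨e, he, he0⟩
  · exfalso
    have had : a = b * d := hr.inj (by rw [_root_.map_mul, hd]; field_simp)
    have h5 : d ^ 2 * u * u' * (4 * a ^ 2 * u ^ 2 + a * u + 4 * b) = (a * d * u ^ 2 - 1) ^ 2 := by
      apply mul_left_cancel₀ (pow_ne_zero 2 hb0)
      rw [had] at E ⊢
      linear_combination E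
    have h6 := congrArg ρ h5
    simp [ha, h₄] at h6
  · have hia : i a ≠ 0 := by
      intro h
      simp [h] at he
    have ha0 : a ≠ 0 := by
      rintro rfl
      simp at hia
    have hbe : b = e * a := hr.inj (by
      rw [_root_.map_mul]
      field_simp at he
      exact he.symm)
    have h5 : a * u * u' * (4 * a * u ^ 2 + u + 4 * e) = (a * u ^ 2 - e) ^ 2 := by
      apply mul_left_cancel₀ (pow_ne_zero 2 ha0)
      rw [hbe] at E
      linear_combination E
    obtain ⟨w, hwdef⟩ : ∃ w, w = u * u' * (4 * a * u ^ 2 + u + 4 * e) +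
      2 * (a * u ^ 2 - e) * u * (u' - u) + a * u ^ 2 * (u' - u) ^ 2 := ⟨_, rfl⟩
    have h6 : (a * u * u' - e) ^ 2 = a * w := by
      rw [hwdef]
      linear_combination -h5
    obtain ⟨v, hv⟩ := hr.unit w (by simp [hwdef, ha, he0, hu, hu'])
    have hne : xc (2 • Q) ≠ xc Q := by
      intro h
      rcases eq_or_eq_neg_of_xc_eq hQ2 hQ h with h7 | h7
      · rw [two_nsmul] at h7
        exact hQ (by simpa using h7)
      · apply h3
        rw [succ_nsmul, h7, neg_add_cancel]
    have hp := xc_add_mul_xc_sub hQ2 hQ hne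
    rw [← succ_nsmul, show 2 • Q - Q = Q by rw [two_nsmul, add_sub_cancel_right], hx, hx'] at hp
    simp only [map_b₄, map_b₆, map_b₈, e4, e6, e8] at hp
    simp only [_root_.map_mul, _root_.map_neg, _root_.map_pow, _root_.map_zero, map_ofNat] at hp
    have h6' := congrArg i h6
    have hbe' := congrArg i hbe
    have hv' := congrArg i hv
    simp only [_root_.map_mul, _root_.map_sub, _root_.map_pow, _root_.map_one] at h6' hbe' hv'
    rw [hbe'] at hp
    refine exists_redTo_of_inv h₁ h₂ h₃ h₄ h₆ hr h3 (e := u * (u' - u) ^ 2 * v) ?_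
    simp only [_root_.map_mul, _root_.map_sub, _root_.map_pow]
    apply mul_left_cancel₀ (pow_ne_zero 3 hia)
    linear_combination i v * hp + i v * i a ^ 2 * h6' + i a ^ 3 * hv'

/-- On generic points, three times a multiplication lands in the points with nonsingular
reduction. -/
lemma IsMult.eventually_redTo [IsAlgClosed K] [IsAlgClosed k] [(W.map i).IsElliptic]
    (hr : IsReduction i ρ) {φ : (W.map i).toAffine.Point →+ (W.map i).toAffine.Point} {α : K}
    {A B : K[X]} (hφ : IsMult φ α A B) : ∀ᶠ h : (W.map ρ).toAffine.Point in cofinite,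
      ∀ P, RedTo i ρ W P h → ∃ h', RedTo i ρ W (3 • φ P) h' := by
  have : Infinite (W.map ρ).toAffine.Point := infinite_nodal (by simp [h₁]) (by simp [h₂])
      (by simp [h₃]) (by simp [h₄]) (by simp [h₆])
  have h2 : ∀ᶠ h : (W.map ρ).toAffine.Point in cofinite, 2 • h ≠ 0 :=
    nodal_eventually_two_nsmul_ne (by simp [h₁]) (by simp [h₂])
      (by simp [h₃]) (by simp [h₄]) (by simp [h₆])
  obtain ⟨a, A', hA, hA'⟩ := hr.exists_content A
  obtain ⟨b, B', hB, hB'⟩ := hr.exists_content B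
  have hgen := (eventually_ne 0).and ((eventually_eval_ne (W := (W.map ρ).toAffine) hA').and
    (eventually_eval_ne (W := (W.map ρ).toAffine) hB'))
  have key : ∀ h P, (h ≠ 0 ∧ (A'.map ρ).eval (xc h) ≠ 0 ∧ (B'.map ρ).eval (xc h) ≠ 0) →
      RedTo i ρ W P h → ∃ v w : R, ρ v ≠ 0 ∧ ρ w ≠ 0 ∧ (φ P = 0 ↔ b = 0) ∧
        (φ P ≠ 0 → xc (φ P) * b * i w = a * i v) := by
    rintro h P ⟨hh, hAh, hBh⟩ hP
    obtain ⟨hP0, x, -, hx, -, hxh, -⟩ := (redTo_iff hh).1 hP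
    have evρ : ∀ D : R[X], (D.map ρ).eval (xc h) = ρ (D.eval x) := fun D => by
      rw [← hxh, eval_map_apply]
    have evi : ∀ D : R[X], (D.map i).eval (xc P) = i (D.eval x) := fun D => by
      rw [← hx, eval_map_apply]
    rw [evρ] at hAh hBh
    refine ⟨A'.eval x, B'.eval x, hAh, hBh, ?_, fun h0 => ?_⟩
    · rw [hφ.eq_zero_iff P hP0, hB, eval_mul, eval_C, evi, mul_eq_zero, or_iff_left]
      rw [_root_.map_eq_zero_iff i hr.inj]
      exact fun h => hBh (by rw [h, _root_.map_zero])
    · have := hφ.xc_mul P hP0 h0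
      rw [hA, hB, eval_mul, eval_mul, eval_C, eval_C, evi, evi] at this
      linear_combination this
  filter_upwards [hgen, h2, (tendsto_two_nsmul h2).eventually hgen] with h hh hh2 hhd P hP
  have of_red : (∃ h', RedTo i ρ W (φ P) h') → ∃ h', RedTo i ρ W (3 • φ P) h' := fun ⟨h', hh'⟩ =>
    ⟨_, hh'.nsmul hr h2 3⟩
  obtain ⟨v, w, hv, hw, h0, hx⟩ := key h P hh hP
  by_cases hφ0 : φ P = 0
  · exact of_red ⟨0, by rw [hφ0]; exact .zero⟩
  replace hx := hx hφ0
  have hb : b ≠ 0 := fun h => hφ0 (h0.2 h)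
  obtain ⟨v1, hv1⟩ := hr.unit v hv
  obtain ⟨w1, hw1⟩ := hr.unit w hw
  have hv1' := congrArg i hv1
  have hw1' := congrArg i hw1
  simp only [_root_.map_mul, _root_.map_one] at hv1' hw1'
  rcases hr.dich (a / b) with ⟨c, hc⟩ | ⟨e, he, -⟩
  · have hac : a = b * i c := by rw [hc]; field_simp
    have hxc : xc (φ P) = i (c * (v * w1)) := by
      rw [hac] at hx
      simp only [_root_.map_mul]
      apply mul_left_cancel₀ hb
      linear_combination i w1 * hx - b * xc (φ P) * hw1'
    by_cases hρc : ρ c = 0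
    · obtain ⟨v', w', hv', hw', h0', hx'⟩ := key (2 • h) (2 • P) hhd (hP.nsmul hr h2 2)
      obtain ⟨w2, hw2⟩ := hr.unit w' hw'
      have hw2' := congrArg i hw2
      simp only [_root_.map_mul, _root_.map_one] at hw2'
      have hφ2 : 2 • φ P ≠ 0 := by
        rw [← map_nsmul]
        exact fun h => hb (h0'.1 h)
      rw [map_nsmul] at hx'
      have hxc' : xc (2 • φ P) = i (c * (v' * w2)) := by
        have hx' := hx' hφ2
        rw [hac] at hx'
        simp only [_root_.map_mul]
        apply mul_left_cancel₀ hb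
        linear_combination i w2 * hx' - b * xc (2 • φ P) * hw2'
      refine exists_redTo_three_nsmul h₁ h₂ h₃ h₄ h₆ hr hφ0 hφ2 hρc ?_ ?_ hxc hxc'
      · rw [_root_.map_mul]
        refine mul_ne_zero hv fun h => ?_
        have := congrArg ρ hw1
        simp [h] at this
      · rw [_root_.map_mul]
        refine mul_ne_zero hv' fun h => ?_
        have := congrArg ρ hw2
        simp [h] at this
    · obtain ⟨c1, hc1⟩ := hr.unit c hρc
      refine of_red (exists_redTo_of_inv h₁ h₂ h₃ h₄ h₆ hr hφ0 (e := c1 * v1 * w) ?_)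
      rw [hxc, ← _root_.map_mul, ← _root_.map_one i]
      congr 1
      linear_combination v1 * v * w * w1 * hc1 + w * w1 * hv1 + hw1
  · have hae : i e * a = b := by field_simp at he; linear_combination he
    refine of_red (exists_redTo_of_inv h₁ h₂ h₃ h₄ h₆ hr hφ0 (e := e * v1 * w) ?_)
    have ha : a ≠ 0 := fun h => hb (by rw [← hae, h, mul_zero])
    simp only [_root_.map_mul]
    apply mul_left_cancel₀ ha
    linear_combination i v1 * hx + a * hv1' + xc (φ P) * i v1 * i w * hae

/-- A curve with multiplicative reduction has no complex multiplication. -/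
theorem not_isCM_of_nodal [CharZero K] [IsAlgClosed K] [IsAlgClosed k] [(W.map i).IsElliptic]
    (hr : IsReduction i ρ) {p : ℕ} (hp : p.Prime) [CharP k p] {S : Subring K}
    {ι : S →+* AddMonoid.End (W.map i).toAffine.Point} (hι : IsCM (W.map i).toAffine ι) {β : S}
    {D : ℕ} (hD : 0 < D) (hβ : β * β = -(D : S)) : False := by
  have g₁ : (W.map ρ).a₁ = 1 := by simp [h₁]
  have g₂ : (W.map ρ).a₂ = 0 := by simp [h₂]
  have g₃ : (W.map ρ).a₃ = 0 := by simp [h₃]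
  have g₄ : (W.map ρ).a₄ = 0 := by simp [h₄]
  have g₆ : (W.map ρ).a₆ = 0 := by simp [h₆]
  have : Infinite (W.map ρ).toAffine.Point := infinite_nodal g₁ g₂ g₃ g₄ g₆
  have h2 : ∀ᶠ h : (W.map ρ).toAffine.Point in cofinite, 2 • h ≠ 0 :=
    nodal_eventually_two_nsmul_ne g₁ g₂ g₃ g₄ g₆
  have hβ0 : (β : K) ≠ 0 := by
    intro h
    have := congrArg (fun s : S => (s : K)) hβ
    simp [h] at this
    omega
  obtain ⟨A, B, hAB⟩ := hι β hβ0
  have hev := IsMult.eventually_redTo h₁ h₂ h₃ h₄ h₆ hr hAB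
  have hpres : ∀ P h, RedTo i ρ W P h → ∃ h', RedTo i ρ W (ι (3 * β) P) h' := by
    intro P h hP
    have e3 : ∀ P, ι (3 * β) P = 3 • ι β P := fun P => by
      rw [_root_.map_mul, map_ofNat]
      change (3 : AddMonoid.End _) (ι β P) = _
      rw [AddMonoid.End.ofNat_apply]
    obtain ⟨r, hr1, hr2⟩ := (hev.and ((sub_right_injective (b := h)).tendsto_cofinite.eventually
      hev)).exists
    obtain ⟨T, hT⟩ := exists_redTo (W := W) hr r
    obtain ⟨h', hh'⟩ := hr1 T hT
    obtain ⟨h'', hh''⟩ := hr2 (P - T) (by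
      simpa [sub_eq_add_neg] using RedTo.add hr h2 hP hT.neg)
    refine ⟨h'' + h', ?_⟩
    have := RedTo.add hr h2 hh'' hh'
    have e4 : ι β (P - T) + ι β T = ι β P := by
      refine (AddMonoidHom.map_add (ι β) (P - T) T).symm.trans ?_
      rw [sub_add_cancel]
      rfl
    rw [← nsmul_add] at this
    rw [e3]
    exact e4 ▸ this
  have hβ3 : ((3 * β : S) : K) ≠ 0 := by simpa using hβ0
  obtain ⟨A3, B3, hAB3⟩ := hι (3 * β) hβ3
  obtain ⟨ψ, hψ⟩ := exists_induced hr h2 (φ := ι (3 * β)) hpres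
    (fun P hP => hAB3.redTo_zero hr h2 hpres hP)
  have hsq : ∀ h, ψ (ψ h) = (-(9 * D : ℤ)) • h := by
    intro h
    obtain ⟨P, hP⟩ := exists_redTo (W := W) hr h
    have e1 := hψ _ _ (hψ _ _ hP)
    have e2 : ι (3 * β) (ι (3 * β) P) = (-(9 * D : ℤ)) • P := by
      change (ι (3 * β) * ι (3 * β)) P = _
      rw [← _root_.map_mul, show (3 * β) * (3 * β) = ((-(9 * D : ℤ) : ℤ) : S) by
        push_cast; linear_combination 9 * hβ, map_intCast, AddMonoid.End.intCast_apply]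
    replace e1 : RedTo i ρ W ((-(9 * D : ℤ)) • P) (ψ (ψ h)) := e2 ▸ e1
    exact RedTo.unique hr e1 (hP.zsmul hr h2 _)
  have hm : (4 * D * (3 * p) ^ 2 - 1) % 4 = 3 := by
    have : 0 < D * (3 * p) ^ 2 := by have := hp.pos; positivity
    rw [mul_assoc]
    omega
  obtain ⟨ℓ, hℓ, hℓ4, hd⟩ := exists_prime_mod_four_eq_three hm
  have hd' : (ℓ : ℤ) ∣ 4 * D * (3 * p) ^ 2 - 1 := by
    have h1 : 1 ≤ 4 * D * (3 * p) ^ 2 := Nat.succ_le_of_lt (by have := hp.pos; positivity)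
    have := Int.natCast_dvd_natCast.2 hd
    push_cast [h1] at this
    exact this
  have hℓk : (ℓ : k) ≠ 0 := by
    intro h
    obtain ⟨m, hm⟩ := hd'
    have := congrArg (Int.cast : ℤ → k) hm
    push_cast at this
    rw [h, CharP.cast_eq_zero k p] at this
    simp at this
  obtain ⟨P, hP, hℓP⟩ := nodal_exists_torsion (W := (W.map ρ).toAffine) g₁ g₂ g₃ g₄ g₆ hℓ.one_lt hℓk
  obtain ⟨f1, f2⟩ := nodal_torsion (W := (W.map ρ).toAffine) g₁ g₂ g₃ g₄ g₆ hℓ.ne_zero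
  obtain ⟨c, hc⟩ := exists_zsmul_of_card_torsion_lt hℓ f1 (by
    have := hℓ.two_le; nlinarith [Nat.sub_le (2 * ℓ) 1, Nat.sub_add_cancel (by omega : 1 ≤ 2 * ℓ)])
    (Q := ψ P) hP hℓP (by rw [← map_nsmul, hℓP, _root_.map_zero])
  have h5 : (c * c + 9 * D) • P = 0 := by
    have := hsq P
    rw [hc, map_zsmul, hc, smul_smul] at this
    rw [add_smul, this, ← add_smul]
    simp
  have : Fact ℓ.Prime := ⟨hℓ⟩
  have h6 : (ℓ : ℤ) ∣ c * c + 9 * D := by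
    have : addOrderOf P = ℓ := addOrderOf_eq_prime hℓP hP
    rw [← this]
    exact addOrderOf_dvd_iff_zsmul_eq_zero.2 h5
  have h7 : (c * c + 9 * D : ZMod ℓ) = 0 := by
    have := (ZMod.intCast_zmod_eq_zero_iff_dvd _ _).2 h6
    exact_mod_cast this
  have h8 : (4 * D * (3 * p) ^ 2 - 1 : ZMod ℓ) = 0 := by
    have := (ZMod.intCast_zmod_eq_zero_iff_dvd _ _).2 hd'
    exact_mod_cast this
  refine ZMod.mod_four_ne_three_of_sq_eq_neg_one (y := (2 * p * c : ZMod ℓ)) ?_ hℓ4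
  linear_combination 4 * (p : ZMod ℓ) ^ 2 * h7 - h8

end nodal

end WeierstrassCurve.Affine.Point

end

section

open Polynomial Filter

namespace IsReduction

variable {R K k : Type*} [CommRing R] [Field K] [Field k] {i : R →+* K} {ρ : R →+* k}

lemma exists_of_monic (hr : IsReduction i ρ) {F : R[X]} (hF : F.Monic) {z : K}
    (h : F.eval₂ i z = 0) : ∃ a, i a = z := by
  rcases hr.dich z with h1 | ⟨a, ha, h0⟩
  · exact h1
  · exfalso
    have hz : z = (i a)⁻¹ := (inv_eq_of_mul_eq_one_right ha).symm
    have ha0 : i a ≠ 0 := left_ne_zero_of_mul_eq_one ha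
    let : Invertible z := invertibleOfNonzero (right_ne_zero_of_mul_eq_one ha)
    have h1 := (eval₂_reverse_eq_zero_iff i z F).2 h
    rw [invOf_eq_inv, hz, inv_inv, eval₂_at_apply, map_eq_zero_iff i hr.inj] at h1
    have h2 := congrArg ρ h1
    rw [map_zero, ← eval₂_at_apply, h0, eval₂_at_zero, coeff_zero_reverse, hF.leadingCoeff,
      map_one] at h2
    exact one_ne_zero h2

lemma isAlgClosed [IsAlgClosed K] (hr : IsReduction i ρ) : IsAlgClosed k := by
  refine IsAlgClosed.of_exists_root k fun f hf hirr => ?_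
  have := i.domain_nontrivial
  obtain ⟨F, hF, hd, hm⟩ := lifts_and_natDegree_eq_and_monic
    (show f ∈ lifts ρ from (lifts_iff_coeff_lifts _).2 fun n => hr.surj _) hf
  obtain ⟨z, hz⟩ := IsAlgClosed.exists_eval₂_eq_zero_of_injective i hr.inj F (by
    rw [degree_eq_natDegree hm.ne_zero, hd]
    exact_mod_cast hirr.natDegree_pos.ne')
  obtain ⟨a, rfl⟩ := hr.exists_of_monic hm hz
  rw [eval₂_at_apply, map_eq_zero_iff i hr.inj] at hz
  exact ⟨ρ a, by rw [← hF, eval_map, eval₂_at_apply, hz, map_zero]⟩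

lemma of_valuationSubring (V : ValuationSubring K) :
    IsReduction V.subtype (IsLocalRing.residue V) where
  inj := Subtype.val_injective
  surj := IsLocalRing.residue_surjective
  dich z := by
    by_cases hz : z ∈ V
    · exact .inl ⟨⟨z, hz⟩, rfl⟩
    · have hz0 : z ≠ 0 := fun h => hz (h ▸ V.zero_mem)
      refine .inr ⟨⟨z⁻¹, (V.mem_or_inv_mem z).resolve_left hz⟩, inv_mul_cancel₀ hz0, ?_⟩
      rw [IsLocalRing.residue_eq_zero_iff, IsLocalRing.mem_maximalIdeal, mem_nonunits_iff,
        isUnit_iff_exists_inv]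
      rintro ⟨b, hb⟩
      have : z⁻¹ * b = 1 := congrArg Subtype.val hb
      exact hz ((eq_of_inv_mul_eq_one this) ▸ b.2)
  unit a ha := by
    rw [Ne, IsLocalRing.residue_eq_zero_iff, IsLocalRing.mem_maximalIdeal, mem_nonunits_iff,
      not_not] at ha
    exact isUnit_iff_exists_inv.1 ha

lemma exists_valuationSubring [CharZero K] {p : ℕ} (hp : p.Prime) :
    ∃ V : ValuationSubring K, CharP (IsLocalRing.ResidueField V) p := by
  let A : Subring K := (Int.castRingHom K).range
  let x : A := ⟨(p : ℤ), ⟨p, by simp⟩⟩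
  have hI : Ideal.span {x} ≠ ⊤ := by
    rw [Ne, Ideal.span_singleton_eq_top, isUnit_iff_exists_inv]
    rintro ⟨⟨_, m, rfl⟩, hm⟩
    have h1 : ((p : ℤ) : K) * (m : ℤ) = 1 := congrArg Subtype.val hm
    have h2 : (p : ℤ) * m = 1 := by exact_mod_cast h1
    exact hp.one_lt.ne' (by exact_mod_cast Int.eq_one_of_mul_eq_one_right (by positivity) h2)
  obtain ⟨V, -, hV⟩ := Ideal.image_subset_nonunits_valuationSubring _ hI
  refine ⟨V, ?_⟩
  have : Fact p.Prime := ⟨hp⟩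
  refine (CharP.charP_iff_prime_eq_zero hp).2 ?_
  have h1 : (p : K) ∈ V.nonunits := hV ⟨x, Ideal.subset_span rfl, by simp [x]⟩
  rw [← SetLike.mem_coe, ← V.image_maximalIdeal] at h1
  obtain ⟨y, hy, hy'⟩ := h1
  have : y = (p : V) := Subtype.ext (by simpa using hy')
  rw [this] at hy
  have := (IsLocalRing.residue_eq_zero_iff _).2 hy
  simpa using this

end IsReduction

namespace WeierstrassCurve

variable {R K k : Type*} [CommRing R] [Field K] [Field k] {i : R →+* K} {ρ : R →+* k}

lemma j_eq_of_c₄_pow (W : WeierstrassCurve K) [W.IsElliptic] {x : K} (h : W.c₄ ^ 3 = x * W.Δ) :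
    W.j = x := by
  have := W.coe_Δ'
  rw [j, h, ← W.coe_Δ', mul_comm x, ← mul_assoc, Units.inv_mul, one_mul]

lemma isElliptic_of_Δ_ne_zero {W : WeierstrassCurve K} (h : W.Δ ≠ 0) : W.IsElliptic :=
  ⟨h.isUnit⟩

open Affine.Point in
/-- A curve with complex multiplication has an integral model with good reduction. -/
theorem exists_good_model [DecidableEq K] [DecidableEq k] [CharZero K] [IsAlgClosed K]
    (hr : IsReduction i ρ) {p : ℕ} (hp : p.Prime) [CharP k p] (W₀ : WeierstrassCurve K)
    [W₀.IsElliptic] {S : Subring K} {ι : S →+* AddMonoid.End W₀.toAffine.Point}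
    (hι : IsCM W₀.toAffine ι) {β : S} {D : ℕ} (hD : 0 < D) (hβ : β * β = -(D : S)) :
    ∃ W : WeierstrassCurve R, (W.map ρ).IsElliptic ∧ (W.map i).IsElliptic ∧
      ∃ ι' : S →+* AddMonoid.End (W.map i).toAffine.Point, IsCM (W.map i).toAffine ι' := by
  have := hr.isAlgClosed
  have of_j : ∀ (W : WeierstrassCurve R), (W.map i).Δ ≠ 0 → (W.map i).c₄ ^ 3 = W₀.j * (W.map i).Δ →
      (W.map i).IsElliptic ∧
        ∃ ι' : S →+* AddMonoid.End (W.map i).toAffine.Point, IsCM (W.map i).toAffine ι' := by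
    intro W h1 h2
    have := isElliptic_of_Δ_ne_zero h1
    exact ⟨this, hι.exists_of_j_eq (W.map i |>.j_eq_of_c₄_pow h2).symm⟩
  have of_j' : ∀ (W : WeierstrassCurve R), ρ W.Δ ≠ 0 → i (W.c₄ ^ 3) = W₀.j * i W.Δ →
      (W.map ρ).IsElliptic ∧ (W.map i).IsElliptic ∧
        ∃ ι' : S →+* AddMonoid.End (W.map i).toAffine.Point, IsCM (W.map i).toAffine ι' := by
    intro W h1 h2
    refine ⟨isElliptic_of_Δ_ne_zero (by rwa [map_Δ]), of_j W ?_ ?_⟩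
    · rw [map_Δ, Ne, map_eq_zero_iff i hr.inj]
      exact fun h => h1 (by rw [h, _root_.map_zero])
    · rw [map_Δ, map_c₄, ← map_pow, h2]
  generalize W₀.j = j at of_j of_j'
  have integral : ∀ u, (u + 16) ^ 3 = j * u → ∃ a, i a = u := by
    intro u hu
    refine (hr.dich u).resolve_right ?_
    rintro ⟨a, ha, ha0⟩
    obtain ⟨b, hb⟩ := hr.unit (1 + 64 * a) (by simp [ha0])
    have hu0 : u ≠ 0 := by
      rintro rfl
      norm_num at hu
    have ha' : i a ≠ 0 := left_ne_zero_of_mul_eq_one ha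
    have hb' := congrArg i hb
    simp only [map_mul, map_add, map_one, map_ofNat] at hb'
    have hb0 : i b ≠ 0 := right_ne_zero_of_mul_eq_one hb'
    let W : WeierstrassCurve R := ⟨1, 0, 0, a * b, 0⟩
    have hΔ : i W.Δ = i a ^ 2 * i b ^ 3 := by
      have : W.Δ = a ^ 2 * b ^ 2 * (1 - 64 * (a * b)) := by
        simp only [W, Δ, b₂, b₄, b₆, b₈]; ring
      rw [this]
      simp only [map_mul, map_sub, map_one, map_ofNat, map_pow]
      linear_combination -(i a ^ 2 * i b ^ 2) * hb'
    have hc : i W.c₄ = i b * (1 + 16 * i a) := by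
      have : W.c₄ = 1 - 48 * (a * b) := by
        simp only [W, c₄, b₂, b₄]; ring
      rw [this]
      simp only [map_mul, map_sub, map_one, map_ofNat]
      linear_combination - hb'
    obtain ⟨h1, ι', hι'⟩ := of_j W (by rw [map_Δ, hΔ]; positivity) (by
      rw [map_Δ, map_c₄, hΔ, hc]
      linear_combination i a ^ 3 * i b ^ 3 * hu +
        (j * i a ^ 2 * i b ^ 3 - i b ^ 3 * ((i a * u + 16 * i a) ^ 2 +
          (i a * u + 16 * i a) * (1 + 16 * i a) + (1 + 16 * i a) ^ 2)) * ha)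
    exact not_isCM_of_nodal (W := W) rfl rfl rfl (by simp [W, ha0]) rfl hr hp hι' hD hβ
  obtain ⟨u, hu⟩ : ∃ u, (u + 16) ^ 3 = j * u := by
    obtain ⟨u, hu⟩ := IsAlgClosed.exists_root ((X + 16) ^ 3 - C j * X : K[X]) (by
      have : ((X + 16) ^ 3 - C j * X : K[X]) = X ^ 3 + C 48 * X ^ 2 + C (768 - j) * X + C 4096 := by
        simp only [C_sub, map_ofNat]; ring
      rw [this, show (X ^ 3 + C 48 * X ^ 2 + C (768 - j) * X + C 4096 : K[X]).degree = 3 by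
        compute_degree!]
      norm_num)
    refine ⟨u, ?_⟩
    simpa [sub_eq_zero] using hu
  obtain ⟨u, rfl⟩ := integral _ hu
  obtain ⟨J, rfl⟩ : ∃ J, i J = j := by
    obtain ⟨z, hz⟩ := exists_root_quadratic (48 + i u) (768 - j + i u * (48 + i u))
    obtain ⟨z, rfl⟩ := integral z (by linear_combination (z - i u) * hz + hu)
    refine ⟨768 + u * (48 + u) + z ^ 2 + (48 + u) * z, ?_⟩
    simp only [map_mul, map_add, map_ofNat, map_pow]
    linear_combination hz
  have hu' := hu
  rw [← map_mul, ← map_ofNat i, ← map_add, ← map_pow] at hu'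
  replace hu' := hr.inj hu'
  by_cases hp3 : p = 3
  · obtain ⟨a, ha⟩ := IsAlgClosed.exists_pow_nat_eq (i (u + 64)) (n := 4) (by norm_num)
    obtain ⟨a, rfl⟩ := hr.exists_of_monic (F := X ^ 4 - C (u + 64)) (monic_X_pow_sub_C _ (by norm_num))
      (z := a) (by simp [ha])
    have ha4 : a ^ 4 = u + 64 := hr.inj (by rw [map_pow, ha])
    refine ⟨⟨a, 0, 0, 1, 0⟩, of_j' _ ?_ ?_⟩
    · have : Δ (⟨a, 0, 0, 1, 0⟩ : WeierstrassCurve R) = u := by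
        simp only [Δ, b₂, b₄, b₆, b₈]; linear_combination ha4
      rw [this]
      intro h0
      have h1 := congrArg ρ hu'
      simp only [map_mul, map_add, map_pow, h0, mul_zero, zero_add, map_ofNat] at h1
      have h2 : ((4096 : ℕ) : k) = 0 := by push_cast; linear_combination h1
      rw [CharP.cast_eq_zero_iff k p, hp3] at h2
      omega
    · have e1 : Δ (⟨a, 0, 0, 1, 0⟩ : WeierstrassCurve R) = u := by
        simp only [Δ, b₂, b₄, b₆, b₈]; linear_combination ha4
      have e2 : c₄ (⟨a, 0, 0, 1, 0⟩ : WeierstrassCurve R) = u + 16 := by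
        simp only [c₄, b₂, b₄]; linear_combination ha4
      rw [e1, e2, hu', map_mul]
  · obtain ⟨w, hw⟩ := IsAlgClosed.exists_eval₂_eq_zero_of_injective i hr.inj
      (X ^ 12 - C 72 * X ^ 9 + C 1728 * X ^ 6 - C (13824 + J) * X ^ 3 + C (27 * J) : R[X]) (by
        have := i.domain_nontrivial
        rw [show (X ^ 12 - C 72 * X ^ 9 + C 1728 * X ^ 6 - C (13824 + J) * X ^ 3 + C (27 * J) : R[X]).degree = 12 by compute_degree!]
        norm_num)
    obtain ⟨w, rfl⟩ := hr.exists_of_monic (by monicity!) hw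
    have hw' : w ^ 3 * (w ^ 3 - 24) ^ 3 = J * (w ^ 3 - 27) := by
      rw [eval₂_at_apply, map_eq_zero_iff i hr.inj] at hw
      simp at hw
      linear_combination hw
    have e1 : Δ (⟨w, 0, 1, 0, 0⟩ : WeierstrassCurve R) = w ^ 3 - 27 := by
      simp only [Δ, b₂, b₄, b₆, b₈]; ring
    have e2 : c₄ (⟨w, 0, 1, 0, 0⟩ : WeierstrassCurve R) = w * (w ^ 3 - 24) := by
      simp only [c₄, b₂, b₄]; ring
    refine ⟨⟨w, 0, 1, 0, 0⟩, of_j' _ ?_ ?_⟩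
    · rw [e1]
      intro h0
      have h1 := congrArg ρ hw'
      simp only [map_mul, h0, mul_zero] at h1
      simp only [map_sub, map_pow, map_ofNat] at h1 h0
      have h2 : ((729 : ℕ) : k) = 0 := by
        push_cast
        rw [sub_eq_zero] at h0
        rw [h0] at h1
        linear_combination h1
      rw [CharP.cast_eq_zero_iff k p, show 729 = 3 ^ 6 by norm_num] at h2
      exact hp3 ((Nat.prime_dvd_prime_iff_eq hp Nat.prime_three).1 (hp.dvd_of_dvd_pow h2))
    · rw [e1, e2, mul_pow, hw', map_mul]

end WeierstrassCurve

end

section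

open Polynomial Filter

namespace WeierstrassCurve.Affine.Point

/-- A surjective endomorphism given by a fraction on `x`-coordinates has a positive degree. -/
lemma exists_hasX_of_surjective {k : Type*} [Field k] [DecidableEq k] [IsAlgClosed k]
    {W : WeierstrassCurve.Affine k} [W.IsElliptic] {φ : W.Point → W.Point}
    (hφ : Function.Surjective φ) {N D : k[X]} (hD : D ≠ 0)
    (h : ∀ᶠ P in cofinite, φ P ≠ 0 ∧ xc (φ P) * D.eval (xc P) = N.eval (xc P)) :
    ∃ d A B g, d ≠ 0 ∧ g ≠ 0 ∧ N = g * A ∧ D = g * B ∧ HasX φ d A B := by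
  obtain ⟨A, hA⟩ := EuclideanDomain.gcd_dvd_left N D
  obtain ⟨B, hB⟩ := EuclideanDomain.gcd_dvd_right N D
  set g := EuclideanDomain.gcd N D
  have hg : g ≠ 0 := by rintro h; rw [h, zero_mul] at hB; exact hD hB
  have hB0 : B ≠ 0 := by rintro rfl; exact hD (by simpa using hB)
  have hcop : IsCoprime A B := by
    refine ⟨EuclideanDomain.gcdA N D, EuclideanDomain.gcdB N D, mul_left_cancel₀ hg ?_⟩
    have := EuclideanDomain.gcd_eq_gcd_ab N D
    change g = _ at this
    linear_combination -this - EuclideanDomain.gcdA N D * hA - EuclideanDomain.gcdB N D * hB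
  have hX : HasX φ (max A.natDegree B.natDegree) A B := by
    refine ⟨⟨?_, ?_, ?_⟩, ?_⟩
    · intro i
      fin_cases i <;> simp
    · intro z
      by_contra! h
      obtain ⟨a, b, hab⟩ := hcop
      have h0 := h 0
      have h1 := h 1
      have := congr_arg (eval z) hab
      simp at h0 h1
      simp [h0, h1] at this
    · rcases le_or_gt A.natDegree B.natDegree with h1 | h1
      · exact ⟨1, by simpa [max_eq_right h1] using hB0⟩
      · refine ⟨0, ?_⟩
        have : A ≠ 0 := by rintro rfl; simp at h1
        simpa [max_eq_left h1.le] using this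
    · filter_upwards [h, eventually_eval_ne (W := W) hD] with P ⟨h1, h2⟩ h3
      rw [hA, hB, eval_mul, eval_mul] at h2
      rw [hB, eval_mul] at h3
      refine ⟨h1, right_ne_zero_of_mul h3, mul_left_cancel₀ (left_ne_zero_of_mul h3) ?_⟩
      linear_combination h2
  refine ⟨_, A, B, g, fun h0 => ?_, hg, hA, hB, hX⟩
  have hA1 : A.natDegree = 0 := by omega
  have hB1 : B.natDegree = 0 := by omega
  obtain ⟨a, rfl⟩ := natDegree_eq_zero.1 hA1
  obtain ⟨b, rfl⟩ := natDegree_eq_zero.1 hB1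
  have hfin := Filter.eventually_cofinite.1 hX.ev
  refine Set.infinite_univ (α := W.Point) (((hfin.image φ).union (finite_xc_eq (a / b))).subset ?_)
  rintro Q -
  obtain ⟨P, rfl⟩ := hφ Q
  by_cases hP : P ∈ {x | ¬(φ x ≠ 0 ∧ eval (xc x) (C b) ≠ 0 ∧
    xc (φ x) * eval (xc x) (C b) = eval (xc x) (C a))}
  · exact .inl ⟨P, hP, rfl⟩
  · right
    simp only [Set.mem_ofPred, not_not, eval_C] at hP ⊢
    rw [eq_div_iff hP.2.1, hP.2.2]

lemma eventually_two_nsmul_ne {k : Type*} [Field k] [DecidableEq k] [IsAlgClosed k]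
    (W : WeierstrassCurve.Affine k) [W.IsElliptic] : ∀ᶠ P : W.Point in cofinite, 2 • P ≠ 0 :=
  (hasX_two (W := W)).ev.mono fun _ h => h.1

lemma nsmul_surjective {k : Type*} [Field k] [DecidableEq k] [IsAlgClosed k]
    (W : WeierstrassCurve.Affine k) [W.IsElliptic] {n : ℕ} (hn : n ≠ 0) :
    Function.Surjective fun P : W.Point => n • P := by
  have hD := degForm_goodDeg W
  have h1 : goodDeg ((n : ℤ) • (1 : goodEnd W)) ≠ 0 := by
    have := hD.zsmul n 1
    rw [hD.one, mul_one] at this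
    intro h
    rw [h] at this
    have h2 : ((n : ℤ)) ^ 2 = 0 := by exact_mod_cast this.symm
    exact hn (by exact_mod_cast pow_eq_zero_iff two_ne_zero |>.1 h2)
  intro P
  obtain ⟨Q, hQ⟩ := (hasDeg_goodDeg ((n : ℤ) • (1 : goodEnd W))).surjective h1 P
  refine ⟨Q, ?_⟩
  rw [← hQ]
  simp
  rfl

variable {R K k : Type*} [CommRing R] [Field K] [Field k] [DecidableEq K] [DecidableEq k]
  {i : R →+* K} {ρ : R →+* k} {W : WeierstrassCurve R}

lemma exists_redTo_of_isElliptic [IsAlgClosed k] [(W.map ρ).IsElliptic] (hr : IsReduction i ρ)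
    (P : (W.map i).toAffine.Point) : ∃ h, RedTo i ρ W P h := by
  by_cases hP : P = 0
  · exact ⟨0, hP ▸ .zero⟩
  by_cases hx : ∃ x, i x = xc P
  · obtain ⟨x, hx⟩ := hx
    obtain ⟨h, hh, hxh⟩ := exists_xc_eq (W := (W.map ρ).toAffine) (ρ x)
    rcases RedTo.of_xc hr hP hh hx hxh.symm with h5 | h5
    exacts [⟨_, h5⟩, ⟨_, h5⟩]
  · exact ⟨0, redTo_zero_iff.2 (.inr (by simpa using hx))⟩

lemma IsMult.exists_hasX_reduction [IsAlgClosed k] [(W.map ρ).IsElliptic] [IsAlgClosed K]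
    [(W.map i).IsElliptic] (hr : IsReduction i ρ)
    {φ : (W.map i).toAffine.Point →+ (W.map i).toAffine.Point} {α : K} {A B : K[X]}
    (hφ : IsMult φ α A B) {ψ : (W.map ρ).toAffine.Point →+ (W.map ρ).toAffine.Point}
    (hψ : ∀ P h, RedTo i ρ W P h → RedTo i ρ W (φ P) (ψ h)) (hsurj : Function.Surjective ψ) :
    ∃ d A' B', d ≠ 0 ∧ HasX ψ d A' B' ∧
      ∀ a, i a = α → ρ a = 0 → derivative A' * B' - A' * derivative B' = 0 := by
  have hne : A ≠ 0 ∨ B ≠ 0 := by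
    by_contra! h
    have := hφ.coprime
    rw [h.1, h.2] at this
    exact not_isCoprime_zero_zero this
  obtain ⟨A', B', c, hc, hA, hB, hAB⟩ := hr.exists_normalise hne
  have key : ∀ᶠ h in cofinite, (ψ h = 0 ∧ (B'.map ρ).eval (xc h) = 0) ∨ (ψ h ≠ 0 ∧
      (B'.map ρ).eval (xc h) ≠ 0 ∧ xc (ψ h) * (B'.map ρ).eval (xc h) = (A'.map ρ).eval (xc h)) := by
    filter_upwards [eventually_ne 0, eventually_ne_or hAB] with h hh h1
    obtain ⟨P, hP⟩ := exists_redTo (W := W) hr h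
    exact hφ.redTo_cases hr hc hA hB hh hP (hψ P h hP) h1
  have hB0 : B'.map ρ ≠ 0 := by
    intro h0
    simp only [h0, eval_zero, ne_eq, not_true_eq_false, false_and, and_false, or_false,
      and_true] at key
    refine Set.infinite_univ (α := (W.map ρ).toAffine.Point)
      ((((Filter.eventually_cofinite.1 key).image ψ).union (Set.finite_singleton 0)).subset ?_)
    rintro Q -
    obtain ⟨P, rfl⟩ := hsurj Q
    by_cases h1 : ψ P = 0
    · exact .inr h1
    · exact .inl ⟨P, h1, rfl⟩
  obtain ⟨d, A₁, B₁, g, hd, hg, hgA, hgB, hX⟩ := exists_hasX_of_surjective hsurj hB0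
    (N := A'.map ρ) (by
      filter_upwards [key, eventually_eval_ne hB0] with P h1 h2
      rcases h1 with h1 | h1
      · exact absurd h1.2 h2
      · exact ⟨h1.1, h1.2.2⟩)
  refine ⟨d, A₁, B₁, hd, hX, fun a ha ha0 => ?_⟩
  have e1 : (derivative A' * B' - A' * derivative B') ^ 2 *
      (C 4 * X ^ 3 + C W.b₂ * X ^ 2 + C (2 * W.b₄) * X + C W.b₆) =
    C a ^ 2 * (B' * (4 * A' ^ 3 + C W.b₂ * A' ^ 2 * B' + 2 * C W.b₄ * A' * B' ^ 2 +
      C W.b₆ * B' ^ 3)) := by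
    apply Polynomial.map_injective i hr.inj
    have h2 := hφ.deriv_sq
    simp only [psi, map_b₂, map_b₄, map_b₆] at h2
    simp only [Polynomial.map_mul, Polynomial.map_add, Polynomial.map_sub, Polynomial.map_pow,
      ← derivative_map, hA, hB, derivative_mul, derivative_C, map_C, map_X, ha,
      Polynomial.map_ofNat, _root_.map_mul, map_ofNat] at h2 ⊢
    linear_combination (C c) ^ 4 * h2
  have e2 := congrArg (Polynomial.map ρ) e1
  simp only [Polynomial.map_mul, Polynomial.map_sub, Polynomial.map_pow,
      ← derivative_map, map_C, ha0, C_0] at e2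
  rw [zero_pow two_ne_zero, zero_mul, mul_eq_zero, pow_eq_zero_iff two_ne_zero, or_iff_left, hgA, hgB,
    derivative_mul, derivative_mul] at e2
  · refine mul_left_cancel₀ (pow_ne_zero 2 hg) ?_
    linear_combination e2
  · have := psi_ne_zero (W.map ρ)
    simpa [psi, map_ofNat] using! this

/-- The reduction of a ring of complex multiplications. -/
theorem exists_reduced_hom [CharZero K] [IsAlgClosed K] [IsAlgClosed k] [(W.map ρ).IsElliptic]
    [(W.map i).IsElliptic] (hr : IsReduction i ρ) {S : Subring K}
    {ι : S →+* AddMonoid.End (W.map i).toAffine.Point} (hι : IsCM (W.map i).toAffine ι)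
    (hconj : ∀ α : S, α ≠ 0 → ∃ (α' : S) (n : ℕ), n ≠ 0 ∧ α * α' = n) :
    ∃ (κ : S →+* AddMonoid.End (W.map ρ).toAffine.Point), ∀ α : S, α ≠ 0 → ∃ d A B, d ≠ 0 ∧
      HasX (κ α : (W.map ρ).toAffine.Point →+ (W.map ρ).toAffine.Point) d A B ∧
      ∀ a, i a = α → ρ a = 0 → derivative A * B - A * derivative B = 0 := by
  have h2 := eventually_two_nsmul_ne (W.map ρ).toAffine
  have hex : ∀ α : S, ∃ ψ : (W.map ρ).toAffine.Point →+ (W.map ρ).toAffine.Point,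
      ∀ P h, RedTo i ρ W P h → RedTo i ρ W (ι α P) (ψ h) := by
    intro α
    by_cases hα : α = 0
    · refine ⟨0, fun P h _ => ?_⟩
      rw [hα, _root_.map_zero]
      exact .zero
    · obtain ⟨A, B, hAB⟩ := hι α (by simpa using hα)
      exact exists_induced hr h2 (φ := ι α) (fun P h _ => exists_redTo_of_isElliptic hr _)
        fun P hP => hAB.redTo_zero hr h2 (fun P h _ => exists_redTo_of_isElliptic hr _) hP
  choose κ hκ using hex
  have key : ∀ (α : S) h P, RedTo i ρ W P h → ∀ h', RedTo i ρ W (ι α P) h' → κ α h = h' :=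
    fun α h P hP h' hh' => RedTo.unique hr (hκ α P h hP) hh'
  have hone : ∀ h, κ 1 h = h := fun h => by
    obtain ⟨P, hP⟩ := exists_redTo (W := W) hr h
    refine key 1 h P hP h ?_
    rw [_root_.map_one]
    exact hP
  have hmul : ∀ α β h, κ (α * β) h = κ α (κ β h) := fun α β h => by
    obtain ⟨P, hP⟩ := exists_redTo (W := W) hr h
    refine key _ h P hP _ ?_
    rw [_root_.map_mul]
    exact hκ α _ _ (hκ β _ _ hP)
  have hadd : ∀ α β h, κ (α + β) h = κ α h + κ β h := fun α β h => by
    obtain ⟨P, hP⟩ := exists_redTo (W := W) hr h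
    refine key _ h P hP _ ?_
    rw [_root_.map_add]
    exact RedTo.add hr h2 (hκ α _ _ hP) (hκ β _ _ hP)
  let κ' : S →+* AddMonoid.End (W.map ρ).toAffine.Point := RingHom.mk' ⟨⟨κ, AddMonoidHom.ext hone⟩,
    fun α β => AddMonoidHom.ext (hmul α β)⟩ fun α β => AddMonoidHom.ext (hadd α β)
  refine ⟨κ', fun α hα => ?_⟩
  obtain ⟨A, B, hAB⟩ := hι α (by simpa using hα)
  refine hAB.exists_hasX_reduction hr (hκ α) fun P => ?_
  obtain ⟨α', n, hn, hα'⟩ := hconj α hα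
  obtain ⟨Q, hQ⟩ := nsmul_surjective (W.map ρ).toAffine hn P
  refine ⟨κ α' Q, ?_⟩
  refine (hmul α α' Q).symm.trans ?_
  rw [hα', ← hQ]
  change κ' n Q = _
  rw [map_natCast]
  rfl

end WeierstrassCurve.Affine.Point

end

section

open Polynomial Filter

namespace WeierstrassCurve.Affine.Point

variable {k : Type*} [Field k] [DecidableEq k] [IsAlgClosed k] {p : ℕ} [Fact p.Prime] [CharP k p]
  {W : WeierstrassCurve.Affine k} [W.IsElliptic]

/-- An inseparable map has few elements in its kernel. -/
lemma HasX.card_ker_mul_le {φ : W.Point →+ W.Point} {d : ℕ} {A B : k[X]} (h : HasX φ d A B)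
    (hd : d ≠ 0) (hs : derivative A * B - A * derivative B = 0) : p * Nat.card φ.ker ≤ d := by
  have hp : p.Prime := Fact.out
  have hcop : IsCoprime A B := by
    by_contra hc
    obtain ⟨z, h1, h2⟩ := (not_forall.1 (mt (isCoprime_iff_aeval_ne_zero_of_isAlgClosed k k A B).2
      hc)).imp fun z hz => not_or.1 hz
    obtain ⟨j, hj⟩ := h.prim.eval_ne z
    fin_cases j
    · exact hj (by simpa using h1)
    · exact hj (by simpa using h2)
  have hdv : ∀ {f g : k[X]}, IsCoprime f g → f ∣ derivative f * g → derivative f = 0 := by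
    intro f g hfg hf
    have h1 := hfg.dvd_of_dvd_mul_right hf
    by_contra h0
    have h2 := natDegree_le_of_dvd h1 h0
    by_cases hf0 : f.natDegree = 0
    · rw [eq_C_of_natDegree_eq_zero hf0] at h0
      simp at h0
    · have := natDegree_derivative_lt hf0
      omega
  have hA : derivative A = 0 := hdv hcop ⟨derivative B, by linear_combination hs⟩
  have hB : derivative B = 0 := hdv hcop.symm ⟨derivative A, by linear_combination -hs⟩
  obtain ⟨c, h1, h2⟩ := (h.eventually_coeff_ne.and (h.card_ker hd)).exists
  have hdeg : (A - C c * B).natDegree = d := by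
    refine le_antisymm ?_ (le_natDegree_of_ne_zero (by simpa using h1))
    refine (natDegree_sub_le_of_le h.natDegree_left_le
      ((natDegree_C_mul_le _ _).trans h.natDegree_right_le)).trans (by simp)
  obtain ⟨g, hg⟩ : ∃ g, A - C c * B = expand k p g := by
    refine ⟨contract p (A - C c * B), (expand_contract p ?_ hp.ne_zero).symm⟩
    rw [derivative_sub, derivative_mul, hA, hB]
    simp
  rw [h2, ← hdeg, hg, natDegree_expand, mul_comm]
  refine Nat.mul_le_mul_right p ?_
  rw [roots_expand, Multiset.toFinset_nsmul _ _ hp.ne_zero]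
  exact ((Multiset.toFinset_card_le _).trans_eq (Multiset.card_map _ _)).trans (card_roots' g)

variable {S : Type*} [CommRing S]

/-- A ring of endomorphisms with degrees `d`, inseparable on the prime ideal `𝔭` above `p`. -/
structure IsCMReduction (p : ℕ) (κ : S →+* AddMonoid.End W.Point) (d : S → ℕ) (𝔭 : Ideal S) :
    Prop where
  hasDeg : ∀ α, HasDeg (κ α) (d α)
  degForm : DegForm fun α => (d α : ℤ)
  isPrime : 𝔭.IsPrime
  natCast_mem : (p : S) ∈ 𝔭
  card_ker : ∀ α ∈ 𝔭, α ≠ 0 → p * Nat.card (κ α : W.Point →+ W.Point).ker ≤ d α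

namespace IsCMReduction

variable {κ : S →+* AddMonoid.End W.Point} {d : S → ℕ} {𝔭 : Ideal S} {α β : S}

lemma mul_conj (h : IsCMReduction p κ d 𝔭) (α : S) :
    α * (h.degForm.tr α • 1 - α) = d α • 1 := by
  have := h.degForm.sq_eq α
  rw [mul_sub, this, mul_smul_comm, mul_one, sub_sub_cancel, natCast_zsmul]

lemma ne_zero_of_deg (h : IsCMReduction p κ d 𝔭) (hα : d α ≠ 0) : α ≠ 0 := by
  rintro rfl
  exact hα (by exact_mod_cast h.degForm.zero)

lemma finite_ker (h : IsCMReduction p κ d 𝔭) (hα : d α ≠ 0) :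
    Finite (κ α : W.Point →+ W.Point).ker := by
  obtain ⟨A, B, hX⟩ := (h.hasDeg α).exists_hasX hα
  exact hX.finite_ker

lemma deg_natCast (h : IsCMReduction p κ d 𝔭) : d (p : S) = p ^ 2 := by
  have := h.degForm.zsmul p 1
  rw [h.degForm.one, mul_one] at this
  simp only [natCast_zsmul, nsmul_eq_mul, mul_one] at this
  exact_mod_cast this

lemma injective_of_card_ker_le (h : IsCMReduction p κ d 𝔭) (hα : d α ≠ 0)
    (hc : Nat.card (κ α : W.Point →+ W.Point).ker ≤ 1) : Function.Injective (κ α) := by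
  have := h.finite_ker hα
  have h1 := Finite.card_le_one_iff_subsingleton.1 hc
  refine (injective_iff_map_eq_zero (κ α : W.Point →+ W.Point)).2 fun P hP => ?_
  exact congrArg Subtype.val (Subsingleton.elim
    (⟨P, hP⟩ : (κ α : W.Point →+ W.Point).ker) 0)

lemma injective_of_deg_eq (h : IsCMReduction p κ d 𝔭) (hα : α ∈ 𝔭) (hd : d α = p) :
    Function.Injective (κ α) := by
  have hp : p.Prime := Fact.out
  have hd0 : d α ≠ 0 := hd ▸ hp.ne_zero
  refine h.injective_of_card_ker_le hd0 ?_
  have := h.card_ker α hα (h.ne_zero_of_deg hd0)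
  rw [hd] at this
  exact Nat.le_of_mul_le_mul_left (by omega) hp.pos

lemma map_natCast_apply (κ : S →+* AddMonoid.End W.Point) (n : ℕ) (P : W.Point) :
    κ n P = n • P := by
  rw [map_natCast]
  rfl

lemma map_intCast_apply (κ : S →+* AddMonoid.End W.Point) (n : ℤ) (P : W.Point) :
    κ n P = n • P := by
  rw [map_intCast]
  rfl

lemma map_mul_apply (κ : S →+* AddMonoid.End W.Point) (α β : S) (P : W.Point) :
    κ (α * β) P = κ α (κ β P) := by
  rw [_root_.map_mul]
  rfl

lemma map_add_apply (κ : S →+* AddMonoid.End W.Point) (α β : S) (P : W.Point) :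
    κ (α + β) P = κ α P + κ β P := by
  rw [_root_.map_add]
  rfl

lemma map_zsmul_apply (κ : S →+* AddMonoid.End W.Point) (α : S) (n : ℤ) (P : W.Point) :
    κ α (n • P) = n • κ α P :=
  AddMonoidHom.map_zsmul _ _ _

lemma map_nsmul_apply (κ : S →+* AddMonoid.End W.Point) (α : S) (n : ℕ) (P : W.Point) :
    κ α (n • P) = n • κ α P :=
  AddMonoidHom.map_nsmul _ _ _

lemma map_zero_apply (κ : S →+* AddMonoid.End W.Point) (α : S) : κ α 0 = 0 :=
  AddMonoidHom.map_zero _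

lemma torsion (h : IsCMReduction p κ d 𝔭) :
    {P : W.Point | p • P = 0}.Finite ∧ {P : W.Point | p • P = 0}.ncard < p ^ 2 := by
  have hp : p.Prime := Fact.out
  have hd0 : d (p : S) ≠ 0 := h.deg_natCast ▸ pow_ne_zero 2 hp.ne_zero
  have heq : {P : W.Point | p • P = 0} = ((κ p : W.Point →+ W.Point).ker : Set W.Point) := by
    ext P
    change p • P = 0 ↔ κ p P = 0
    rw [map_natCast_apply]
  have hf := h.finite_ker hd0
  have h1 := h.card_ker p h.natCast_mem (h.ne_zero_of_deg hd0)
  rw [h.deg_natCast, pow_two] at h1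
  rw [heq]
  refine ⟨hf, ?_⟩
  refine lt_of_le_of_lt (Nat.le_of_mul_le_mul_left h1 hp.pos) ?_
  have := hp.one_lt
  nlinarith

lemma exists_eq_zsmul (h : IsCMReduction p κ d 𝔭) {P Q : W.Point} (hP : P ≠ 0) (hpP : p • P = 0)
    (hpQ : p • Q = 0) : ∃ c : ℤ, Q = c • P :=
  exists_zsmul_of_card_torsion_lt Fact.out h.torsion.1 h.torsion.2 hP hpP hpQ

lemma injective_comp (hα : Function.Injective (κ α)) (hβ : Function.Injective (κ β)) :
    Function.Injective (κ (α * β)) := by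
  rw [_root_.map_mul]
  exact hα.comp hβ

lemma injective_of_mul (h : Function.Injective (κ (α * β))) : Function.Injective (κ β) := by
  rw [_root_.map_mul] at h
  exact Function.Injective.of_comp (f := κ α) h

/-- An element of degree prime to its trace or its conjugate is injective. -/
lemma injective_or (h : IsCMReduction p κ d 𝔭) {r : ℕ} (hd : d α = p ^ r)
    (ht : ¬ (p : ℤ) ∣ h.degForm.tr α) :
    Function.Injective (κ α) ∨ Function.Injective (κ (h.degForm.tr α • 1 - α)) := by
  have hp : p.Prime := Fact.out
  set β := h.degForm.tr α • 1 - α with hβ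
  have hαβ : α * β = ((p ^ r : ℕ) : S) := by rw [h.mul_conj, hd, nsmul_one]
  have key : ∀ γ δ : S, δ * γ = ((p ^ r : ℕ) : S) → ¬ Function.Injective (κ γ) →
      ∃ P : W.Point, P ≠ 0 ∧ p • P = 0 ∧ κ γ P = 0 := by
    intro γ δ hγ hi
    have hi' := mt (injective_iff_map_eq_zero (κ γ : W.Point →+ W.Point)).2 hi
    push Not at hi'
    obtain ⟨P, hP, hP0⟩ := hi'
    have hex : ∃ n, p ^ n • P = 0 := ⟨r, by
      rw [← map_natCast_apply κ, ← hγ, map_mul_apply]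
      exact (congrArg (κ δ) hP).trans (map_zero_apply κ δ)⟩
    classical
    have h1 := Nat.find_spec hex
    have h2 : Nat.find hex ≠ 0 := fun h0 => hP0 (by simpa [h0] using h1)
    refine ⟨p ^ (Nat.find hex - 1) • P, Nat.find_min hex (by omega), ?_, ?_⟩
    · rwa [smul_smul, ← pow_succ', Nat.sub_add_cancel (by omega)]
    · have hP' : κ γ P = 0 := hP
      rw [map_nsmul_apply, hP', smul_zero]
  by_contra! hcon
  obtain ⟨P, hP, hpP, hαP⟩ := key α β (by rw [mul_comm, hαβ]) hcon.1
  obtain ⟨Q, hQ, hpQ, hβQ⟩ := key β α hαβ hcon.2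
  obtain ⟨c, rfl⟩ := h.exists_eq_zsmul hP hpP hpQ
  have hαQ : κ α (c • P) = 0 := by rw [map_zsmul_apply, hαP, smul_zero]
  have hsum : h.degForm.tr α • (c • P) = 0 := by
    rw [← map_intCast_apply κ, show ((h.degForm.tr α : ℤ) : S) = α + β by rw [hβ]; simp,
      map_add_apply, hαQ, hβQ, add_zero]
  refine ht ?_
  have := addOrderOf_dvd_iff_zsmul_eq_zero.2 hsum
  rwa [addOrderOf_eq_prime hpQ hQ] at this

/-- Multiplication by `p` is injective when an element without eigenvalues modulo `p` acts. -/
lemma injective_natCast (h : IsCMReduction p κ d 𝔭) {s n : ℤ} (hα : α * α = s • α - n • 1)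
    (hs : ∀ c : ℤ, ¬ (p : ℤ) ∣ c * c - s * c + n) : Function.Injective (κ p) := by
  refine (injective_iff_map_eq_zero (κ p : W.Point →+ W.Point)).2 fun P hP => ?_
  by_contra hP0
  have hp : p • P = 0 := (map_natCast_apply κ p P).symm.trans hP
  obtain ⟨c, hc⟩ := h.exists_eq_zsmul (Q := κ α P) hP0 hp
    (by rw [← map_nsmul_apply, hp, map_zero_apply])
  have h1 : κ (α * α + (n : S)) P = κ ((s : S) * α) P := by
    rw [hα]
    congr 2
    simp
  rw [map_add_apply, map_mul_apply, map_mul_apply, map_intCast_apply, map_intCast_apply, hc,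
    map_zsmul_apply, hc] at h1
  refine hs c ?_
  rw [← addOrderOf_eq_prime hp hP0]
  refine addOrderOf_dvd_iff_zsmul_eq_zero.2 ?_
  rw [add_smul, sub_smul, mul_smul, mul_smul, ← h1]
  abel

/-- Injectivity in the ramified case. -/
lemma injective_of_ramified (h : IsCMReduction p κ d 𝔭) {s : ℤ}
    (hα : α * α = (p : S) * (s • α - 1)) (hd : d α = p) :
    Function.Injective (κ α) ∧ Function.Injective (κ p) := by
  have hmem : α ∈ 𝔭 := by
    have : α * α ∈ 𝔭 := hα ▸ 𝔭.mul_mem_right _ h.natCast_mem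
    exact (h.isPrime.mem_or_mem this).elim id id
  have h1 := h.injective_of_deg_eq hmem hd
  refine ⟨h1, injective_of_mul (α := s • α - 1) ?_⟩
  rw [mul_comm, ← hα]
  exact injective_comp h1 h1

end IsCMReduction

end WeierstrassCurve.Affine.Point

end

section

open Polynomial Filter

namespace WeierstrassCurve.Affine.Point.IsCMReduction

variable {k : Type*} [Field k] [DecidableEq k] [IsAlgClosed k] {p : ℕ} [Fact p.Prime] [CharP k p]
  {W : WeierstrassCurve.Affine k} [W.IsElliptic] {S : Type*} [CommRing S]
  {κ : S →+* AddMonoid.End W.Point} {d : S → ℕ} {𝔭 : Ideal S} {α : S}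

/-- An injective endomorphism of degree `p ^ r` is the Frobenius of a curve over a finite field. -/
theorem exists_card (h : IsCMReduction p κ d 𝔭) {F : Type*} [Field F] [Fintype F] {r : ℕ}
    (hF : Fintype.card F = p ^ r) (hd : d α = p ^ r) (hα : Function.Injective (κ α)) :
    ∃ W₀ : WeierstrassCurve F, W₀.Δ ≠ 0 ∧
      (Nat.card W₀.toAffine.Point : ℤ) = (p : ℤ) ^ r + 1 - h.degForm.tr α := by
  classical
  have : CharP F p := charP_of_card_eq_prime_pow hF
  let _ : Algebra (ZMod p) F := ZMod.algebra F p
  let _ : Algebra (ZMod p) k := ZMod.algebra k p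
  let _ : Algebra F k := (IsAlgClosed.lift (R := ZMod p) (S := F) (M := k)).toRingHom.toAlgebra
  have hd0 : d α ≠ 0 := hd ▸ pow_ne_zero _ (Fact.out : p.Prime).ne_zero
  obtain ⟨A, B, hX⟩ := (h.hasDeg α).exists_hasX hd0
  rw [hd] at hX
  have hσ : ∀ x, iterateFrobenius k p r x = x ^ p ^ r := fun x => iterateFrobenius_def p r x
  obtain ⟨u, a, b, c, hC, hα'⟩ := hX.exists_chg_of_injective hα hσ
  have h1 : HasDeg (AddMonoidHom.id _ - frobHom (iterateFrobenius k p r) hC) (d (1 - α)) := by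
    have := h.hasDeg (1 - α)
    rw [_root_.map_sub, _root_.map_one] at this
    exact (congrArg (fun f : W.Point →+ W.Point => HasDeg (AddMonoidHom.id _ - f) (d (1 - α)))
      hα').mp this
  obtain ⟨W₀, hΔ, hc⟩ := exists_card_eq (F := F) (fun x => by rw [hF, hσ]) hC h1
  refine ⟨W₀, hΔ, ?_⟩
  have h2 := h.degForm.one_sub α
  rw [hd] at h2
  rw [hc, h2]
  push_cast
  ring

lemma deg_of_sq_eq (h : IsCMReduction p κ d 𝔭) {s n : ℤ} (hα : α * α = s • α - n • 1)
    (hn : s ^ 2 < 4 * n) : (d α : ℤ) = n ∧ h.degForm.tr α = s := by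
  have h1 := h.degForm.sq_eq α
  rw [hα] at h1
  set t := h.degForm.tr α
  set e : ℤ := (d α : ℤ)
  have h2 : ((t - s : ℤ) : S) * α = ((e - n : ℤ) : S) := by
    simp only [zsmul_eq_mul, mul_one] at h1
    push_cast
    linear_combination -h1
  have h3 : (((e - n) ^ 2 - s * ((t - s) * (e - n)) + n * (t - s) ^ 2 : ℤ) : S) = 0 := by
    simp only [zsmul_eq_mul, mul_one] at hα
    push_cast at h2 ⊢
    linear_combination ((t : S) - s) ^ 2 * hα - (((t : S) - s) * α + (e - n) - s * (t - s)) * h2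
  have h4 := h.degForm.zsmul ((e - n) ^ 2 - s * ((t - s) * (e - n)) + n * (t - s) ^ 2) 1
  rw [zsmul_one, h3, h.degForm.zero, h.degForm.one, mul_one, eq_comm, pow_eq_zero_iff two_ne_zero]
    at h4
  have h5 : (2 * (e - n) - s * (t - s)) ^ 2 + (4 * n - s ^ 2) * (t - s) ^ 2 = 0 := by
    linear_combination 4 * h4
  have h6 : t - s = 0 := by
    by_contra hc
    have := mul_pos (sub_pos.2 hn) (pow_pos (abs_pos.2 hc) 2)
    rw [sq_abs] at this
    nlinarith [sq_nonneg (2 * (e - n) - s * (t - s))]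
  rw [h6] at h4
  refine ⟨?_, by linarith⟩
  have : (e - n) ^ 2 = 0 := by linear_combination h4
  have := pow_eq_zero_iff two_ne_zero |>.1 this
  linarith

end WeierstrassCurve.Affine.Point.IsCMReduction

end

section

open Polynomial Filter

lemma Complex.exists_quadratic_root {s n : ℤ} (h : s ^ 2 < 4 * n) :
    ∃ τ : ℂ, τ.im ≠ 0 ∧ τ * τ = s * τ - n := by
  refine ⟨⟨s / 2, √(4 * n - s ^ 2 : ℝ) / 2⟩, ?_, ?_⟩
  · have : (0 : ℝ) < 4 * n - s ^ 2 := sub_pos.2 (by exact_mod_cast h)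
    have := Real.sqrt_pos.2 this
    simp only
    positivity
  · have : (0 : ℝ) ≤ 4 * n - s ^ 2 := (sub_pos.2 (by exact_mod_cast h)).le
    have h1 := Real.mul_self_sqrt this
    apply Complex.ext
    · simp
      linarith
    · simp
      ring

namespace PeriodPair

/-- The lattice `ℤ + ℤ τ`. -/
noncomputable def ofIm (τ : ℂ) (h : τ.im ≠ 0) : PeriodPair where
  ω₁ := 1
  ω₂ := τ
  indep := by
    rw [LinearIndependent.pair_iff]
    intro a b hab
    have h1 := congrArg Complex.im hab
    have h2 := congrArg Complex.re hab
    simp [h] at h1 h2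
    subst h1
    simpa using h2

variable {τ : ℂ} {s n : ℤ}

lemma multiplies_closure (h : τ.im ≠ 0) (hτ : τ * τ = s * τ - n) :
    ∀ α ∈ Subring.closure {τ}, (ofIm τ h).Multiplies α := by
  intro α hα
  induction hα using Subring.closure_induction with
  | mem x hx =>
    rw [Set.mem_singleton_iff] at hx
    subst hx
    intro l hl
    obtain ⟨a, b, rfl⟩ := mem_lattice.1 hl
    refine mem_lattice.2 ⟨-n * b, a + s * b, ?_⟩
    simp only [ofIm]
    push_cast
    linear_combination -b * hτ
  | zero => intro l _; rw [zero_mul]; exact zero_mem _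
  | one => intro l hl; rwa [one_mul]
  | add x y _ _ hx hy => intro l hl; rw [add_mul]; exact add_mem (hx l hl) (hy l hl)
  | neg x _ hx => intro l hl; rw [neg_mul]; exact neg_mem (hx l hl)
  | mul x y _ _ hx hy => intro l hl; rw [mul_assoc]; exact hx _ (hy l hl)

end PeriodPair

lemma exists_eq_of_mem_closure {τ : ℂ} {s n : ℤ} (hτ : τ * τ = s * τ - n) {α : ℂ}
    (hα : α ∈ Subring.closure {τ}) : ∃ a b : ℤ, α = a + b * τ := by
  induction hα using Subring.closure_induction with
  | mem x hx => exact ⟨0, 1, by simpa using hx⟩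
  | zero => exact ⟨0, 0, by simp⟩
  | one => exact ⟨1, 0, by simp⟩
  | add x y _ _ hx hy =>
    obtain ⟨a, b, rfl⟩ := hx
    obtain ⟨c, e, rfl⟩ := hy
    exact ⟨a + c, b + e, by push_cast; ring⟩
  | neg x _ hx =>
    obtain ⟨a, b, rfl⟩ := hx
    exact ⟨-a, -b, by push_cast; ring⟩
  | mul x y _ _ hx hy =>
    obtain ⟨a, b, rfl⟩ := hx
    obtain ⟨c, e, rfl⟩ := hy
    exact ⟨a * c - n * (b * e), a * e + b * c + s * (b * e), by
      push_cast; linear_combination (b : ℂ) * e * hτ⟩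

lemma exists_mul_eq_natCast {τ : ℂ} {s n : ℤ} (hn : s ^ 2 < 4 * n)
    (hτ : τ * τ = s * τ - n) (α : Subring.closure {τ}) (hα : α ≠ 0) :
    ∃ (α' : Subring.closure {τ}) (m : ℕ), m ≠ 0 ∧ α * α' = m := by
  obtain ⟨α, hmem⟩ := α
  obtain ⟨a, b, rfl⟩ := exists_eq_of_mem_closure hτ hmem
  have hτm : τ ∈ Subring.closure {τ} := Subring.subset_closure rfl
  have hN : 4 * (a ^ 2 + s * a * b + n * b ^ 2) =
      (2 * a + s * b) ^ 2 + (4 * n - s ^ 2) * b ^ 2 := by ring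
  have hN0 : 0 ≤ a ^ 2 + s * a * b + n * b ^ 2 := by
    have := mul_nonneg (sub_pos.2 hn).le (sq_nonneg b)
    nlinarith [sq_nonneg (2 * a + s * b)]
  have hN1 : a ^ 2 + s * a * b + n * b ^ 2 ≠ 0 := by
    intro h0
    have hb : b = 0 := by
      by_contra hb
      have := mul_pos (sub_pos.2 hn) (pow_pos (abs_pos.2 hb) 2)
      rw [sq_abs] at this
      nlinarith [sq_nonneg (2 * a + s * b)]
    subst hb
    have ha : a = 0 := by simpa using h0
    subst ha
    exact hα (Subtype.ext (by simp))
  refine ⟨⟨(a + s * b : ℤ) - b * τ, sub_mem (intCast_mem _ _) (mul_mem (intCast_mem _ _) hτm)⟩,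
    (a ^ 2 + s * a * b + n * b ^ 2).natAbs, by simpa using hN1, Subtype.ext ?_⟩
  change (a + b * τ) * ((a + s * b : ℤ) - b * τ) = ((a ^ 2 + s * a * b + n * b ^ 2).natAbs : ℂ)
  rw [Nat.cast_natAbs, abs_of_nonneg hN0]
  push_cast
  linear_combination -(b : ℂ) ^ 2 * hτ

open WeierstrassCurve WeierstrassCurve.Affine.Point

/-- Every imaginary quadratic order acts on an elliptic curve in characteristic `p`. -/
theorem exists_isCMReduction (p : ℕ) [Fact p.Prime] {s n : ℤ} (hn : s ^ 2 < 4 * n) :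
    ∃ (k : Type) (_ : Field k) (_ : DecidableEq k) (_ : IsAlgClosed k) (_ : CharP k p)
      (W : WeierstrassCurve.Affine k) (_ : W.IsElliptic) (S : Type) (_ : CommRing S)
      (κ : S →+* AddMonoid.End W.Point) (d : S → ℕ) (𝔭 : Ideal S) (τ : S),
      IsCMReduction p κ d 𝔭 ∧ τ * τ = s • τ - n • 1 := by
  classical
  obtain ⟨τ, him, hτ⟩ := Complex.exists_quadratic_root hn
  let L := PeriodPair.ofIm τ him
  let S := Subring.closure {τ}
  let τS : S := ⟨τ, Subring.subset_closure rfl⟩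
  have hτS : τS * τS = s • τS - n • 1 := Subtype.ext (by simpa [τS] using hτ)
  obtain ⟨ι₀, hι₀⟩ := L.exists_isCM S (PeriodPair.multiplies_closure him hτ)
  have hp : p.Prime := Fact.out
  obtain ⟨V, hV⟩ := IsReduction.exists_valuationSubring (K := ℂ) hp
  have hr := IsReduction.of_valuationSubring V
  have : IsAlgClosed (IsLocalRing.ResidueField V) := hr.isAlgClosed
  obtain ⟨W, hW1, hW2, ι, hι⟩ := exists_good_model hr hp L.curve hι₀
    (D := (4 * n - s ^ 2).natAbs) (β := 2 * τS - s) (by omega) (by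
      rw [Nat.cast_natAbs, abs_of_nonneg (by omega)]
      push_cast
      simp only [zsmul_eq_mul, mul_one] at hτS
      linear_combination 4 * hτS)
  obtain ⟨κ, hκ⟩ := exists_reduced_hom hr hι (exists_mul_eq_natCast hn hτ)
  have hSV : S ≤ V.toSubring := by
    refine Subring.closure_le.2 (Set.singleton_subset_iff.2 ?_)
    obtain ⟨a, ha⟩ := hr.exists_of_monic (F := X ^ 2 - C (s : V) * X + C (n : V))
      (by monicity!) (z := τ) (by
        simp only [eval₂_add, eval₂_sub, eval₂_mul, eval₂_pow, eval₂_X, eval₂_C]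
        simp only [map_intCast]
        linear_combination hτ)
    rw [← ha]
    exact a.2
  let j : S →+* V := Subring.inclusion hSV
  have hd : ∀ α : S, ∃ d, HasDeg (κ α) d ∧ (α ≠ 0 → d ≠ 0) := by
    intro α
    by_cases hα : α = 0
    · exact ⟨0, .inl ⟨by rw [hα, _root_.map_zero]; rfl, rfl⟩, fun h => absurd hα h⟩
    · obtain ⟨d, A, B, hd, hX, -⟩ := hκ α hα
      exact ⟨d, hX.hasDeg hd, fun _ => hd⟩
  choose d hd hd0 using hd
  have hinj : Function.Injective κ := by
    refine (injective_iff_map_eq_zero κ).2 fun α hα => ?_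
    by_contra h0
    obtain ⟨A, B, hX⟩ := (hd α).exists_hasX (hd0 α h0)
    obtain ⟨P, hP, -⟩ := hX.ev.exists
    exact hP (congrArg (fun f : AddMonoid.End (W.map (IsLocalRing.residue V)).toAffine.Point => f P)
      hα)
  refine ⟨IsLocalRing.ResidueField V, inferInstance, inferInstance, this, hV,
    (W.map (IsLocalRing.residue V)).toAffine, hW1, S, inferInstance, κ, d,
    RingHom.ker ((IsLocalRing.residue V).comp j), τS,
    ⟨hd, degForm_of_hasDeg κ hinj d hd, RingHom.ker_isPrime _, ?_, fun α hα h0 => ?_⟩, hτS⟩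
  · rw [RingHom.mem_ker, map_natCast, CharP.cast_eq_zero]
  · obtain ⟨e, A, B, he, hX, hs⟩ := hκ α h0
    rw [(hd α).unique (hX.hasDeg he)]
    exact hX.card_ker_mul_le he (hs (j α) rfl hα)

end

section

open Polynomial Filter

namespace DegForm

variable {R : Type*} [Ring R] {d : R → ℤ}

lemma tr_zsmul (h : DegForm d) (n : ℤ) (x : R) : h.tr (n • x) = n * h.tr x := by
  rw [← bil_one, bil_zsmul_left, bil_one]

lemma tr_one (h : DegForm d) : h.tr 1 = 2 := by
  rw [← bil_one, bil_self, h.one, mul_one]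

end DegForm

namespace WeierstrassCurve.Affine.Point.IsCMReduction

variable {k : Type*} [Field k] [DecidableEq k] [IsAlgClosed k] {p : ℕ} [Fact p.Prime] [CharP k p]
  {W : WeierstrassCurve.Affine k} [W.IsElliptic] {S : Type*} [CommRing S]
  {κ : S →+* AddMonoid.End W.Point} {d : S → ℕ} {𝔭 : Ideal S} {γ : S}

lemma injective_one (κ : S →+* AddMonoid.End W.Point) : Function.Injective (κ 1) := by
  rw [_root_.map_one]
  exact Function.injective_id

lemma injective_zsmul (hp : Function.Injective (κ p)) (hγ : Function.Injective (κ γ)) {m : ℤ}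
    {j : ℕ} (hm : m = p ^ j ∨ m = -p ^ j) : Function.Injective (κ (m • γ)) := by
  have h1 : ∀ j : ℕ, Function.Injective (κ ((p : S) ^ j * γ)) := by
    intro j
    induction j with
    | zero => simpa using hγ
    | succ j ih =>
      rw [pow_succ', mul_assoc]
      exact injective_comp hp ih
  rcases hm with rfl | rfl
  · simpa using h1 j
  · refine injective_of_mul (α := -1) ?_
    simpa using h1 j

lemma exists_card_zsmul (h : IsCMReduction p κ d 𝔭) {F : Type*} [Field F] [Fintype F] {r : ℕ}
    (hF : Fintype.card F = p ^ r) (hp : Function.Injective (κ p)) (hγ : Function.Injective (κ γ))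
    {m : ℤ} {j e : ℕ} (hm : m = p ^ j ∨ m = -p ^ j) (hd : (d γ : ℤ) = p ^ e) (hr : r = 2 * j + e) :
    ∃ W₀ : WeierstrassCurve F, W₀.Δ ≠ 0 ∧
      (Nat.card W₀.toAffine.Point : ℤ) = (p : ℤ) ^ r + 1 - m * h.degForm.tr γ := by
  rw [← h.degForm.tr_zsmul]
  refine h.exists_card hF ?_ (injective_zsmul hp hγ hm)
  have h1 := h.degForm.zsmul m γ
  have h2 : m ^ 2 = p ^ (2 * j) := by rcases hm with rfl | rfl <;> ring
  rw [hd, h2, ← pow_add, ← hr] at h1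
  exact_mod_cast h1

lemma exists_card_of_unit (h : IsCMReduction p κ d 𝔭) {F : Type*} [Field F] [Fintype F] {r : ℕ}
    (hF : Fintype.card F = p ^ r) (hp : Function.Injective (κ p)) {s : ℤ}
    (hγ : γ * γ = s • γ - (1 : ℤ) • 1) (hs : s ^ 2 < 4) {m : ℤ} {j : ℕ}
    (hm : m = p ^ j ∨ m = -p ^ j) (hr : r = 2 * j) :
    ∃ W₀ : WeierstrassCurve F, W₀.Δ ≠ 0 ∧
      (Nat.card W₀.toAffine.Point : ℤ) = (p : ℤ) ^ r + 1 - m * s := by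
  obtain ⟨h1, h2⟩ := h.deg_of_sq_eq hγ (by omega)
  have h3 : Function.Injective (κ γ) := by
    refine injective_of_mul (α := s • 1 - γ) ?_
    have : (s • 1 - γ) * γ = 1 := by
      simp only [zsmul_eq_mul, mul_one, Int.cast_one] at hγ ⊢
      linear_combination -hγ
    rw [this]
    exact injective_one κ
  have := h.exists_card_zsmul hF hp h3 (e := 0) hm (by simpa using h1) (by omega)
  rwa [h2] at this

end WeierstrassCurve.Affine.Point.IsCMReduction

lemma not_dvd_sq_sub_add_one {p : ℕ} (hp : p.Prime) (h3 : p % 3 = 2) (c : ℤ) :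
    ¬ (p : ℤ) ∣ c * c - 1 * c + 1 := by
  have := Fact.mk hp
  rw [← ZMod.intCast_zmod_eq_zero_iff_dvd]
  push_cast
  generalize (c : ZMod p) = x
  intro hx
  have hx0 : x ≠ 0 := by rintro rfl; simp at hx
  have h1 := ZMod.pow_card_sub_one_eq_one hx0
  have hx3 : x ^ 3 = -1 := by linear_combination (x + 1) * hx
  rw [show p - 1 = 3 * (p / 3) + 1 by omega, pow_succ, pow_mul, hx3] at h1
  rcases neg_one_pow_eq_or (ZMod p) (p / 3) with h | h <;> rw [h] at h1
  · have : x = 1 := by simpa using h1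
    subst this
    simp at hx
  · have : x = -1 := by linear_combination -h1
    subst this
    have h4 : ((3 : ℕ) : ZMod p) = 0 := by push_cast; linear_combination hx
    rw [ZMod.natCast_eq_zero_iff, Nat.prime_dvd_prime_iff_eq hp Nat.prime_three] at h4
    omega

lemma not_dvd_sq_add_one {p : ℕ} (hp : p.Prime) (h4 : p % 4 = 3) (c : ℤ) :
    ¬ (p : ℤ) ∣ c * c - 0 * c + 1 := by
  have := Fact.mk hp
  rw [← ZMod.intCast_zmod_eq_zero_iff_dvd]
  push_cast
  intro hx
  exact ZMod.mod_four_ne_three_of_sq_eq_neg_one (y := (c : ZMod p)) (by linear_combination hx) h4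

open WeierstrassCurve.Affine.Point WeierstrassCurve.Affine.Point.IsCMReduction

section Existence

variable {p r : ℕ} {F : Type} [Field F] [Fintype F] {t : ℤ}

lemma exists_card_of_gcd (hp : p.Prime) (hF : Fintype.card F = p ^ r) (ht : t ^ 2 ≤ 4 * (p : ℤ) ^ r)
    (hr : 1 ≤ r) (hg : Int.gcd p t = 1) : ∃ W : WeierstrassCurve F, W.Δ ≠ 0 ∧
      (Nat.card W.toAffine.Point : ℤ) = (p : ℤ) ^ r + 1 + t := by
  have := Fact.mk hp
  have hpt : ¬ (p : ℤ) ∣ t := fun h => by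
    have h1 := Int.gcd_eq_natAbs_left h
    have := hp.one_lt
    simp at h1
    omega
  have hlt : (-t) ^ 2 < 4 * (p : ℤ) ^ r := by
    rw [neg_sq]
    refine lt_of_le_of_ne ht fun h => hpt ?_
    refine (Nat.prime_iff_prime_int.1 hp).dvd_of_dvd_pow (n := 2) ?_
    rw [h]
    exact (dvd_pow_self _ (by omega)).mul_left _
  obtain ⟨k, _, _, _, _, W, _, S, _, κ, d, 𝔭, τ, h, hτ⟩ := exists_isCMReduction p hlt
  have key : ∀ α : S, α * α = (-t) • α - ((p : ℤ) ^ r) • 1 → Function.Injective (κ α) →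
      ∃ W : WeierstrassCurve F, W.Δ ≠ 0 ∧
      (Nat.card W.toAffine.Point : ℤ) = (p : ℤ) ^ r + 1 + t := by
    intro α hα hi
    obtain ⟨h1, h2⟩ := h.deg_of_sq_eq hα hlt
    have := h.exists_card hF (by exact_mod_cast h1) hi
    rwa [h2, sub_neg_eq_add] at this
  obtain ⟨h1, h2⟩ := h.deg_of_sq_eq hτ hlt
  rcases h.injective_or (α := τ) (r := r) (by exact_mod_cast h1) (by rw [h2, dvd_neg]; exact hpt)
    with hi | hi
  · exact key _ hτ hi
  · refine key _ ?_ hi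
    rw [h2]
    simp only [zsmul_eq_mul, mul_one] at hτ ⊢
    push_cast at hτ ⊢
    linear_combination hτ

lemma exists_ramified (hp : p.Prime) {s : ℤ} (hs : (p * s) ^ 2 < 4 * (p : ℤ)) :
    ∃ (k : Type) (_ : Field k) (_ : DecidableEq k) (_ : IsAlgClosed k) (_ : CharP k p)
      (W : WeierstrassCurve.Affine k) (_ : W.IsElliptic) (S : Type) (_ : CommRing S)
      (κ : S →+* AddMonoid.End W.Point) (d : S → ℕ) (𝔭 : Ideal S) (τ : S)
      (h : IsCMReduction p κ d 𝔭), τ * τ = ((p : ℤ) * s) • τ - (p : ℤ) • 1 ∧ (d τ : ℤ) = p ∧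
      h.degForm.tr τ = p * s ∧ Function.Injective (κ τ) ∧ Function.Injective (κ p) := by
  have := Fact.mk hp
  obtain ⟨k, _, _, _, _, W, _, S, _, κ, d, 𝔭, τ, h, hτ⟩ := exists_isCMReduction p hs
  obtain ⟨h1, h2⟩ := h.deg_of_sq_eq hτ hs
  refine ⟨k, _, _, ‹_›, ‹_›, W, ‹_›, S, _, κ, d, 𝔭, τ, h, hτ, h1, h2, ?_⟩
  refine h.injective_of_ramified (s := s) ?_ (by exact_mod_cast h1)
  rw [hτ]
  simp
  ring

lemma exists_card_of_sq_eq_four_mul (hp : p.Prime) (hF : Fintype.card F = p ^ r) (hr : Even r)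
    (ht : t ^ 2 = 4 * (p : ℤ) ^ r) : ∃ W : WeierstrassCurve F, W.Δ ≠ 0 ∧
      (Nat.card W.toAffine.Point : ℤ) = (p : ℤ) ^ r + 1 + t := by
  have := Fact.mk hp
  obtain ⟨k, _, _, _, _, W, _, S, _, κ, d, 𝔭, τ, h, -, -, -, -, hi⟩ :=
    exists_ramified hp (s := 0) (by have := hp.pos; simpa)
  obtain ⟨j, rfl⟩ := hr
  have h1 : t = 2 * p ^ j ∨ t = -(2 * p ^ j) := sq_eq_sq_iff_eq_or_eq_neg.1 (by rw [ht]; ring)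
  obtain ⟨m, hm, rfl⟩ : ∃ m : ℤ, (m = p ^ j ∨ m = -p ^ j) ∧ t = -(m * 2) := by
    rcases h1 with rfl | rfl
    · exact ⟨_, .inr rfl, by ring⟩
    · exact ⟨_, .inl rfl, by ring⟩
  have := h.exists_card_zsmul hF hi (injective_one κ) (e := 0) hm
    (by simpa using h.degForm.one) (by omega)
  rwa [h.degForm.tr_one, sub_eq_add_neg] at this

lemma exists_card_of_odd (hp : p.Prime) (hF : Fintype.card F = p ^ r) (hr : Odd r)
    (ht : ((p = 2 ∨ p = 3) ∧ t ^ 2 = (p : ℤ) * (p : ℤ) ^ r) ∨ t = 0) :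
    ∃ W : WeierstrassCurve F, W.Δ ≠ 0 ∧
      (Nat.card W.toAffine.Point : ℤ) = (p : ℤ) ^ r + 1 + t := by
  have := Fact.mk hp
  obtain ⟨j, rfl⟩ := hr
  obtain ⟨s, m, hs, hm, rfl⟩ : ∃ s m : ℤ, (p * s) ^ 2 < 4 * (p : ℤ) ∧
      (m = p ^ j ∨ m = -p ^ j) ∧ t = -(m * (p * s)) := by
    rcases ht with ⟨h2, ht⟩ | rfl
    · have h1 : t = p * p ^ j ∨ t = -(p * p ^ j) :=
        sq_eq_sq_iff_eq_or_eq_neg.1 (by rw [ht]; ring)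
      refine ⟨1, ?_⟩
      have h3 : ((p : ℤ) * 1) ^ 2 < 4 * p := by rcases h2 with rfl | rfl <;> norm_num
      rcases h1 with rfl | rfl
      · exact ⟨_, h3, .inr rfl, by ring⟩
      · exact ⟨_, h3, .inl rfl, by ring⟩
    · exact ⟨0, _, by have := hp.pos; simpa, .inl rfl, by ring⟩
  obtain ⟨k, _, _, _, _, W, _, S, _, κ, d, 𝔭, τ, h, -, hd, htr, hi', hi⟩ := exists_ramified hp hs
  have := h.exists_card_zsmul hF hi hi' (e := 1) hm (by simpa using hd) rfl
  rwa [htr, sub_eq_add_neg] at this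

lemma exists_unit (hp : p.Prime) {s : ℤ} (h : (s = 1 ∧ ¬ p ≡ 1 [MOD 3]) ∨ (s = 0 ∧ ¬ p ≡ 1 [MOD 4])) :
    ∃ (k : Type) (_ : Field k) (_ : DecidableEq k) (_ : IsAlgClosed k) (_ : CharP k p)
      (W : WeierstrassCurve.Affine k) (_ : W.IsElliptic) (S : Type) (_ : CommRing S)
      (κ : S →+* AddMonoid.End W.Point) (d : S → ℕ) (𝔭 : Ideal S) (γ : S),
      IsCMReduction p κ d 𝔭 ∧ γ * γ = s • γ - (1 : ℤ) • 1 ∧ Function.Injective (κ p) := by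
  have := Fact.mk hp
  have hs2 : s ^ 2 < 4 * 1 := by rcases h with ⟨rfl, -⟩ | ⟨rfl, -⟩ <;> norm_num
  by_cases hram : p = s + 2
  · obtain ⟨k, _, _, _, _, W, _, S, _, κ, d, 𝔭, τ, h', hτ, -, -, -, hi⟩ :=
      exists_ramified hp (s := 1) (by rcases h with ⟨rfl, -⟩ | ⟨rfl, -⟩ <;> rw [hram] <;> norm_num)
    refine ⟨k, _, _, ‹_›, ‹_›, W, ‹_›, S, _, κ, d, 𝔭, τ - 1, h', ?_, hi⟩
    rw [hram] at hτ
    simp only [zsmul_eq_mul, mul_one] at hτ ⊢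
    push_cast at hτ ⊢
    linear_combination hτ
  · obtain ⟨k, _, _, _, _, W, _, S, _, κ, d, 𝔭, τ, h', hτ⟩ := exists_isCMReduction p hs2
    refine ⟨k, _, _, ‹_›, ‹_›, W, ‹_›, S, _, κ, d, 𝔭, τ, h', hτ, h'.injective_natCast hτ ?_⟩
    rcases h with ⟨rfl, h⟩ | ⟨rfl, h⟩
    · refine not_dvd_sq_sub_add_one hp ?_
      have h0 : p % 3 ≠ 0 := fun h0 => by
        rw [← Nat.dvd_iff_mod_eq_zero, Nat.prime_dvd_prime_iff_eq Nat.prime_three hp] at h0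
        omega
      unfold Nat.ModEq at h
      omega
    · refine not_dvd_sq_add_one hp ?_
      have h0 : p % 2 ≠ 0 := fun h0 => by
        rw [← Nat.dvd_iff_mod_eq_zero, Nat.prime_dvd_prime_iff_eq Nat.prime_two hp] at h0
        omega
      unfold Nat.ModEq at h
      omega

lemma exists_card_of_even (hp : p.Prime) (hF : Fintype.card F = p ^ r) (hr : Even r)
    (ht : (¬ p ≡ 1 [MOD 3] ∧ t ^ 2 = (p : ℤ) ^ r) ∨ (¬ p ≡ 1 [MOD 4] ∧ t = 0)) :
    ∃ W : WeierstrassCurve F, W.Δ ≠ 0 ∧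
      (Nat.card W.toAffine.Point : ℤ) = (p : ℤ) ^ r + 1 + t := by
  have := Fact.mk hp
  obtain ⟨j, rfl⟩ := hr
  obtain ⟨s, m, hs, hm, rfl⟩ : ∃ s m : ℤ,
      ((s = 1 ∧ ¬ p ≡ 1 [MOD 3]) ∨ (s = 0 ∧ ¬ p ≡ 1 [MOD 4])) ∧
      (m = p ^ j ∨ m = -p ^ j) ∧ t = -(m * s) := by
    rcases ht with ⟨h2, ht⟩ | ⟨h2, rfl⟩
    · have h1 : t = p ^ j ∨ t = -p ^ j := sq_eq_sq_iff_eq_or_eq_neg.1 (by rw [ht]; ring)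
      rcases h1 with rfl | rfl
      · exact ⟨1, _, .inl ⟨rfl, h2⟩, .inr rfl, by ring⟩
      · exact ⟨1, _, .inl ⟨rfl, h2⟩, .inl rfl, by ring⟩
    · exact ⟨0, _, .inr ⟨rfl, h2⟩, .inl rfl, by ring⟩
  obtain ⟨k, _, _, _, _, W, _, S, _, κ, d, 𝔭, γ, h, hγ, hi⟩ := exists_unit hp hs
  exact h.exists_card_of_unit hF hi hγ
    (by rcases hs with ⟨rfl, -⟩ | ⟨rfl, -⟩ <;> norm_num) hm (by omega)

end Existence

end

theorem stmt0 (p r : ℕ) (hp : p.Prime) (hr : 1 ≤ r)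
    (F : Type) [Field F] [Fintype F] (hF : Fintype.card F = p ^ r)
    (t : ℤ) (ht : t ^ 2 ≤ 4 * (p : ℤ) ^ r) :
    (∃ W : WeierstrassCurve F, W.Δ ≠ 0 ∧
        (Nat.card W.toAffine.Point : ℤ) = (p : ℤ) ^ r + 1 + t) ↔
      (Int.gcd p t = 1 ∨
        (Even r ∧ t ^ 2 = 4 * (p : ℤ) ^ r) ∨
        (Even r ∧ ¬ p ≡ 1 [MOD 3] ∧ t ^ 2 = (p : ℤ) ^ r) ∨
        (Odd r ∧ (p = 2 ∨ p = 3) ∧ t ^ 2 = (p : ℤ) * (p : ℤ) ^ r) ∨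
        (Odd r ∧ t = 0) ∨
        (Even r ∧ ¬ p ≡ 1 [MOD 4] ∧ t = 0)) := by
  refine ⟨fun ⟨W₀, hΔ, hcard⟩ =>
    WeierstrassCurve.Affine.Point.card_condition hp hr hF W₀ hΔ hcard, ?_⟩
  rintro (h | ⟨h, h1⟩ | ⟨h, h1⟩ | ⟨h, h1⟩ | ⟨h, h1⟩ | ⟨h, h1⟩)
  · exact exists_card_of_gcd hp hF ht hr h
  · exact exists_card_of_sq_eq_four_mul hp hF h h1
  · exact exists_card_of_even hp hF h (.inl h1)
  · exact exists_card_of_odd hp hF h (.inl h1)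
  · exact exists_card_of_odd hp hF h (.inr h1)
  · exact exists_card_of_even hp hF h (.inr h1)
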